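/- Bourgain's slicing conjecture holds: sup_{n ≥ 1} Lₙ < +∞, i.e., there is a universal constant C such that L_K ≤ C for every n ≥ 1 and every convex body K ⊂ ℝⁿ in convex isotropic position. -/

import Mathlib

open MeasureTheory

noncomputable section

/-- A convex body in `ℝⁿ`: a compact convex set with nonempty interior. -/
def IsConvexBody {n : ℕ} (K : Set (EuclideanSpace ℝ (Fin n))) : Prop :=
  IsCompact K ∧ Convex ℝ K ∧ (interior K).Nonempty

/-- A convex body `K ⊂ ℝⁿ` is in convex isotropic position with constant `L = L_K > 0`
if `Vol(K) = 1`, `∫_K x dx = 0` and `∫_K x xᵀ dx = L_K² Iₙ`. -/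
def IsConvexIsotropic {n : ℕ} (K : Set (EuclideanSpace ℝ (Fin n))) (L : ℝ) : Prop :=
  IsConvexBody K ∧ volume K = 1 ∧ 0 < L ∧
  (∀ i, ∫ x in K, x i = 0) ∧
  (∀ i j, ∫ x in K, x i * x j = if i = j then L ^ 2 else 0)

/-- One-dimensional Brunn–Minkowski inequality for midpoints. -/
theorem volume_add_volume_le_of_midpoint_mem {A B C : Set ℝ} (hA : IsCompact A) (hB : IsCompact B)
    (hA' : A.Nonempty) (hB' : B.Nonempty) (h : ∀ a ∈ A, ∀ b ∈ B, (a + b) / 2 ∈ C) :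
    volume A + volume B ≤ 2 * volume C := by
  obtain ⟨a1, ha1, hmax⟩ := hA.exists_isGreatest hA'
  obtain ⟨b0, hb0, hmin⟩ := hB.exists_isLeast hB'
  set C' : Set ℝ := (fun x => (1/2 : ℝ) * x) ⁻¹' C with hC'
  have hvol : volume C' = 2 * volume C := by
    rw [hC', Real.volume_preimage_mul_left (by norm_num)]
    norm_num
  rw [← hvol, ← measure_inter_add_sdiff C' (measurableSet_Iic (a := a1 + b0))]
  gcongr ?_ + ?_
  · rw [← measure_preimage_add_right volume (-b0) A]
    apply measure_mono
    intro x hx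
    simp only [Set.mem_preimage] at hx
    refine ⟨?_, ?_⟩
    · have := h _ hx _ hb0
      simp only [hC', Set.mem_preimage]
      convert this using 1; ring
    · have := hmax hx
      simp only [Set.mem_Iic]; linarith
  · rw [← measure_preimage_add_right volume (-a1) B]
    calc volume ((fun x => x + -a1) ⁻¹' B) ≤ volume ((C' \ Set.Iic (a1 + b0)) ∪ {a1 + b0}) := by
          apply measure_mono
          intro x hx
          simp only [Set.mem_preimage] at hx
          have h1 := h _ ha1 _ hx
          have h2 := hmin hx
          by_cases hx' : x = a1 + b0
          · right; exact hx'
          · left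
            refine ⟨?_, ?_⟩
            · simp only [hC', Set.mem_preimage]
              convert h1 using 1; ring
            · simp only [Set.mem_Iic, not_le]
              rcases lt_or_eq_of_le (show a1 + b0 ≤ x by linarith) with h3 | h3
              · exact h3
              · exact absurd h3.symm hx'
      _ ≤ volume (C' \ Set.Iic (a1 + b0)) + volume {a1 + b0} := measure_union_le _ _
      _ = _ := by simp

theorem volume_add_volume_le_of_midpoint_mem' {A B C : Set ℝ} (hA : MeasurableSet A)
    (hB : MeasurableSet B)
    (hA' : A.Nonempty) (hB' : B.Nonempty) (h : ∀ a ∈ A, ∀ b ∈ B, (a + b) / 2 ∈ C) :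
    volume A + volume B ≤ 2 * volume C := by
  obtain ⟨a, ha⟩ := hA'
  obtain ⟨b, hb⟩ := hB'
  refine le_of_forall_lt fun r hr => ?_
  obtain ⟨u, hu, v, hv, huv⟩ : ∃ u, (∃ K ⊆ A, IsCompact K ∧ u = volume K) ∧
      ∃ v, (∃ L ⊆ B, IsCompact L ∧ v = volume L) ∧ r < u + v := by
    by_contra hcon
    push Not at hcon
    refine absurd hr (not_lt.2 ?_)
    rw [hA.measure_eq_iSup_isCompact, hB.measure_eq_iSup_isCompact]
    have hs : ∀ S : Set ℝ, (⨆ (K : Set ℝ) (_ : K ⊆ S) (_ : IsCompact K), volume K) =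
        ⨆ K : {K : Set ℝ // K ⊆ S ∧ IsCompact K}, volume K.1 := by
      intro S
      rw [iSup_subtype]
      simp only [iSup_and]
    have : ∀ S : Set ℝ, Nonempty {K : Set ℝ // K ⊆ S ∧ IsCompact K} :=
      fun S => ⟨⟨∅, Set.empty_subset _, isCompact_empty⟩⟩
    rw [hs, hs]
    exact ENNReal.iSup_add_iSup_le fun K L =>
      hcon _ ⟨K.1, K.2.1, K.2.2, rfl⟩ _ ⟨L.1, L.2.1, L.2.2, rfl⟩
  obtain ⟨K, hKA, hK, rfl⟩ := hu
  obtain ⟨L, hLB, hL, rfl⟩ := hv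
  refine huv.trans_le ?_
  calc volume K + volume L ≤ volume (K ∪ {a}) + volume (L ∪ {b}) := by
        gcongr <;> exact Set.subset_union_left
    _ ≤ _ := volume_add_volume_le_of_midpoint_mem (hK.union isCompact_singleton)
        (hL.union isCompact_singleton) ⟨a, by simp⟩ ⟨b, by simp⟩ (by
          rintro x (hx | hx) y (hy | hy)
          · exact h _ (hKA hx) _ (hLB hy)
          · simp only [Set.mem_singleton_iff] at hy; subst hy; exact h _ (hKA hx) _ hb
          · simp only [Set.mem_singleton_iff] at hx; subst hx; exact h _ ha _ (hLB hy)
          · simp only [Set.mem_singleton_iff] at hx hy; subst hx; subst hy; exact h _ ha _ hb)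

theorem lintegral_add_le_of_midpoint_normalized {f g h : ℝ → ℝ} (hf : Measurable f)
    (hg : Measurable g) (hh : Measurable h) (hf0 : 0 ≤ f) (hg0 : 0 ≤ g) (hh0 : 0 ≤ h)
    (hf1 : ∀ x, f x ≤ 1) (hg1 : ∀ x, g x ≤ 1) (hfs : ∀ t < 1, ∃ x, t < f x)
    (hgs : ∀ t < 1, ∃ x, t < g x) (H : ∀ x y, f x * g y ≤ h ((x + y) / 2) ^ 2) :
    (∫⁻ x, ENNReal.ofReal (f x)) + ∫⁻ x, ENNReal.ofReal (g x) ≤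
      2 * ∫⁻ x, ENNReal.ofReal (h x) := by
  rw [lintegral_eq_lintegral_meas_lt _ (Filter.Eventually.of_forall hf0) hf.aemeasurable,
    lintegral_eq_lintegral_meas_lt _ (Filter.Eventually.of_forall hg0) hg.aemeasurable,
    lintegral_eq_lintegral_meas_lt _ (Filter.Eventually.of_forall hh0) hh.aemeasurable,
    ← lintegral_const_mul' _ _ (by simp)]
  refine (le_lintegral_add _ _).trans ?_
  refine setLIntegral_mono' measurableSet_Ioi fun t ht => ?_
  rcases lt_or_ge t 1 with h1 | h1
  · refine volume_add_volume_le_of_midpoint_mem' (hf measurableSet_Ioi) (hg measurableSet_Ioi)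
      (hfs t h1) (hgs t h1) fun a ha b hb => ?_
    simp only [Set.mem_ofPred_eq, Set.mem_Ioi] at ha hb ht ⊢
    have := H a b
    by_contra hcon
    push Not at hcon
    have h2 : h ((a + b) / 2) ^ 2 ≤ t ^ 2 := by
      have := hh0 ((a + b) / 2)
      simp only [Pi.zero_apply] at this
      gcongr
    nlinarith [mul_lt_mul'' ha hb ht.le ht.le]
  · have e1 : {a | t < f a} = ∅ := by
      ext a; simpa using (hf1 a).trans h1
    have e2 : {a | t < g a} = ∅ := by
      ext a; simpa using (hg1 a).trans h1
    simp [e1, e2]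

theorem ENNReal.mul_le_sq_of_add_le {a b c : ENNReal} (h : a + b ≤ 2 * c) : a * b ≤ c ^ 2 := by
  by_cases hc : c = ⊤
  · subst hc; simp
  have h2 : (2 * c) ≠ ⊤ := ENNReal.mul_ne_top (by simp) hc
  have hab := ne_top_of_le_ne_top h2 h
  have ha : a ≠ ⊤ := fun h => hab (by simp [h])
  have hb : b ≠ ⊤ := fun h => hab (by simp [h])
  lift a to NNReal using ha
  lift b to NNReal using hb
  lift c to NNReal using hc
  norm_cast at h ⊢
  rw [← NNReal.coe_le_coe] at h ⊢
  push_cast at h ⊢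
  nlinarith [sq_nonneg ((a:ℝ) - b), a.2, b.2, c.2]

theorem prekopaLeindler_real_of_bounded {f g h : ℝ → ENNReal} (hf : Measurable f)
    (hg : Measurable g) (hh : Measurable h) {M : NNReal} (hfM : ∀ x, f x ≤ M) (hgM : ∀ x, g x ≤ M)
    (H : ∀ x y, f x * g y ≤ h ((x + y) / 2) ^ 2) :
    (∫⁻ x, f x) * ∫⁻ x, g x ≤ (∫⁻ x, h x) ^ 2 := by
  by_cases hF : ∀ x, f x = 0
  · simp [hF]
  by_cases hG : ∀ x, g x = 0
  · simp [hG]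
  push Not at hF hG
  obtain ⟨x0, hx0⟩ := hF
  obtain ⟨y0, hy0⟩ := hG
  have hft : ∀ x, f x ≠ ⊤ := fun x => ne_top_of_le_ne_top (by simp) (hfM x)
  have hgt : ∀ x, g x ≠ ⊤ := fun x => ne_top_of_le_ne_top (by simp) (hgM x)
  have hfb : BddAbove (Set.range fun x => (f x).toReal) :=
    ⟨M, by rintro _ ⟨x, rfl⟩; exact ENNReal.toReal_mono (by simp) (hfM x)⟩
  have hgb : BddAbove (Set.range fun x => (g x).toReal) :=
    ⟨M, by rintro _ ⟨x, rfl⟩; exact ENNReal.toReal_mono (by simp) (hgM x)⟩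
  set F := ⨆ x, (f x).toReal with hFd
  set G := ⨆ x, (g x).toReal with hGd
  have hFp : 0 < F := (ENNReal.toReal_pos hx0 (hft x0)).trans_le (le_ciSup hfb x0)
  have hGp : 0 < G := (ENNReal.toReal_pos hy0 (hgt y0)).trans_le (le_ciSup hgb y0)
  set c := Real.sqrt (F * G) with hc
  have hcp : 0 < c := Real.sqrt_pos.2 (mul_pos hFp hGp)
  have hc2 : c ^ 2 = F * G := Real.sq_sqrt (mul_pos hFp hGp).le
  have key := lintegral_add_le_of_midpoint_normalized
    (f := fun x => (f x).toReal / F) (g := fun x => (g x).toReal / G)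
    (h := fun x => (min (h x) (ENNReal.ofReal c)).toReal / c)
    (hf.ennreal_toReal.div_const _) (hg.ennreal_toReal.div_const _)
    ((hh.min measurable_const).ennreal_toReal.div_const _)
    (fun x => by positivity) (fun x => by positivity) (fun x => by positivity)
    (fun x => by rw [div_le_one hFp]; exact le_ciSup hfb x)
    (fun x => by rw [div_le_one hGp]; exact le_ciSup hgb x)
    (fun t ht => by
      obtain ⟨x, hx⟩ := exists_lt_of_lt_ciSup (show t * F < F by nlinarith)
      exact ⟨x, by rwa [lt_div_iff₀ hFp]⟩)
    (fun t ht => by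
      obtain ⟨x, hx⟩ := exists_lt_of_lt_ciSup (show t * G < G by nlinarith)
      exact ⟨x, by rwa [lt_div_iff₀ hGp]⟩)
    (fun x y => by
      have h1 : f x * g y ≤ (min (h ((x + y) / 2)) (ENNReal.ofReal c)) ^ 2 := by
        rcases min_choice (h ((x + y) / 2)) (ENNReal.ofReal c) with h2 | h2
        · rw [h2]; exact H x y
        · rw [h2, ← ENNReal.ofReal_pow hcp.le, hc2, ENNReal.ofReal_mul hFp.le]
          gcongr
          · exact (ENNReal.le_ofReal_iff_toReal_le (hft x) hFp.le).2 (le_ciSup hfb x)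
          · exact (ENNReal.le_ofReal_iff_toReal_le (hgt y) hGp.le).2 (le_ciSup hgb y)
      have h2 := ENNReal.toReal_mono (ENNReal.pow_ne_top (ne_top_of_le_ne_top ENNReal.ofReal_ne_top (min_le_right _ _))) h1
      rw [ENNReal.toReal_mul, ENNReal.toReal_pow] at h2
      rw [div_mul_div_comm, div_pow, hc2]
      gcongr)
  have key2 := ENNReal.mul_le_sq_of_add_le key
  have e1 : ∫⁻ x, f x = ENNReal.ofReal F * ∫⁻ x, ENNReal.ofReal ((f x).toReal / F) := by
    rw [← lintegral_const_mul' _ _ (by simp)]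
    refine lintegral_congr fun x => ?_
    rw [← ENNReal.ofReal_mul hFp.le, mul_div_cancel₀ _ hFp.ne', ENNReal.ofReal_toReal (hft x)]
  have e2 : ∫⁻ x, g x = ENNReal.ofReal G * ∫⁻ x, ENNReal.ofReal ((g x).toReal / G) := by
    rw [← lintegral_const_mul' _ _ (by simp)]
    refine lintegral_congr fun x => ?_
    rw [← ENNReal.ofReal_mul hGp.le, mul_div_cancel₀ _ hGp.ne', ENNReal.ofReal_toReal (hgt x)]
  have e3 : ENNReal.ofReal c * (∫⁻ x, ENNReal.ofReal ((min (h x) (ENNReal.ofReal c)).toReal / c))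
      ≤ ∫⁻ x, h x := by
    rw [← lintegral_const_mul' _ _ (by simp)]
    refine lintegral_mono fun x => ?_
    rw [← ENNReal.ofReal_mul hcp.le, mul_div_cancel₀ _ hcp.ne', ENNReal.ofReal_toReal (by simp)]
    exact min_le_left _ _
  calc (∫⁻ x, f x) * ∫⁻ x, g x = (ENNReal.ofReal F * ENNReal.ofReal G) *
        ((∫⁻ x, ENNReal.ofReal ((f x).toReal / F)) * ∫⁻ x, ENNReal.ofReal ((g x).toReal / G)) := by
        rw [e1, e2, mul_mul_mul_comm]
    _ ≤ (ENNReal.ofReal F * ENNReal.ofReal G) * (∫⁻ x, ENNReal.ofReal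
          ((min (h x) (ENNReal.ofReal c)).toReal / c)) ^ 2 := by gcongr
    _ = (ENNReal.ofReal c * (∫⁻ x, ENNReal.ofReal
          ((min (h x) (ENNReal.ofReal c)).toReal / c))) ^ 2 := by
        rw [mul_pow, ← ENNReal.ofReal_pow hcp.le, hc2, ENNReal.ofReal_mul hFp.le]
    _ ≤ _ := by gcongr

theorem prekopaLeindler_real {f g h : ℝ → ENNReal} (hf : Measurable f)
    (hg : Measurable g) (hh : Measurable h) (H : ∀ x y, f x * g y ≤ h ((x + y) / 2) ^ 2) :
    (∫⁻ x, f x) * ∫⁻ x, g x ≤ (∫⁻ x, h x) ^ 2 := by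
  have key : ∀ {f : ℝ → ENNReal}, Measurable f →
      ∫⁻ x, f x = ⨆ m : ℕ, ∫⁻ x, min (f x) (m : ENNReal) := by
    intro f hf
    rw [← lintegral_iSup (fun m => hf.min measurable_const)]
    · refine lintegral_congr fun x => ?_
      rw [← inf_iSup_eq, ENNReal.iSup_natCast, min_eq_left le_top]
    · intro m k hmk x
      exact min_le_min le_rfl (by exact_mod_cast hmk)
  have hmono : ∀ {f : ℝ → ENNReal}, Monotone fun m : ℕ => ∫⁻ x, min (f x) (m : ENNReal) := by
    intro f m k hmk
    exact lintegral_mono fun x => min_le_min le_rfl (by exact_mod_cast hmk)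
  rw [key hf, key hg, ENNReal.iSup_mul]
  simp only [ENNReal.mul_iSup]
  refine iSup_le fun m1 => iSup_le fun m2 => ?_
  refine (mul_le_mul' (hmono (le_max_left m1 m2)) (hmono (le_max_right m1 m2))).trans ?_
  generalize max m1 m2 = m
  refine prekopaLeindler_real_of_bounded (M := m) (hf.min measurable_const)
    (hg.min measurable_const) hh (fun x => by simp) (fun x => by simp) fun x y => ?_
  exact (mul_le_mul' (min_le_left _ _) (min_le_left _ _)).trans (H x y)

/-- The Prékopa–Leindler inequality for midpoints. -/
theorem prekopaLeindler {n : ℕ} {f g h : (Fin n → ℝ) → ENNReal} (hf : Measurable f)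
    (hg : Measurable g) (hh : Measurable h)
    (H : ∀ x y, f x * g y ≤ h ((1 / 2 : ℝ) • (x + y)) ^ 2) :
    (∫⁻ x, f x) * ∫⁻ x, g x ≤ (∫⁻ x, h x) ^ 2 := by
  induction n with
  | zero =>
    have e : ∀ φ : (Fin 0 → ℝ) → ENNReal, ∫⁻ x, φ x = φ 0 := by
      intro φ
      rw [lintegral_unique, volume_pi, Measure.pi_of_empty]
      simp
      exact congrArg φ (Subsingleton.elim _ _)
    rw [e, e, e]
    simpa using H 0 0
  | succ n ih =>
    have e0 : ∀ p : ℝ × (Fin n → ℝ), (MeasurableEquiv.piFinSuccAbove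
        (fun _ : Fin (n + 1) => ℝ) 0).symm p = Fin.cons p.1 p.2 := by
      intro p
      ext i
      refine Fin.cases ?_ (fun j => ?_) i <;> simp [MeasurableEquiv.piFinSuccAbove]
    have e : ∀ {φ : (Fin (n + 1) → ℝ) → ENNReal}, Measurable φ →
        ∫⁻ x, φ x = ∫⁻ a : ℝ, ∫⁻ z : Fin n → ℝ, φ (Fin.cons a z) := by
      intro φ hφ
      have hmp := (volume_preserving_piFinSuccAbove (fun _ : Fin (n + 1) => ℝ) 0).symm
      rw [← hmp.lintegral_comp hφ, Measure.volume_eq_prod, lintegral_prod]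
      · simp only [e0]
      · exact (hφ.comp (MeasurableEquiv.measurable _)).aemeasurable
    have hc0 :=
      (MeasurableEquiv.piFinSuccAbove (fun _ : Fin (n + 1) => ℝ) 0).symm.measurable
    have hc : Measurable fun p : ℝ × (Fin n → ℝ) => (Fin.cons p.1 p.2 : Fin (n + 1) → ℝ) := by
      simpa only [← e0] using hc0
    rw [e hf, e hg, e hh]
    refine prekopaLeindler_real (hf.comp hc).lintegral_prod_right' (hg.comp hc).lintegral_prod_right'
      (hh.comp hc).lintegral_prod_right' fun a b => ?_
    refine ih (hf.comp (hc.comp (measurable_const.prodMk measurable_id)))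
      (hg.comp (hc.comp (measurable_const.prodMk measurable_id)))
      (hh.comp (hc.comp (measurable_const.prodMk measurable_id))) fun x y => ?_
    refine (H (Fin.cons a x) (Fin.cons b y)).trans_eq ?_
    congr 2
    ext i
    refine Fin.cases ?_ (fun j => ?_) i
    · simp; ring
    · simp; ring

/-- `f` has the second-order expansion `a + b t + c t² + o(t²)` at `0`. -/
def HasExpansion (f : ℝ → ℝ) (a b c : ℝ) : Prop :=
  (fun t => f t - (a + b * t + c * t ^ 2)) =o[nhds 0] (fun t : ℝ => t ^ 2)

namespace HasExpansion

open Filter Topology Asymptotics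

variable {f g : ℝ → ℝ} {a b c a' b' c' : ℝ}

theorem congr_coeff (h : HasExpansion f a b c) (ha : a = a') (hb : b = b') (hc : c = c') :
    HasExpansion f a' b' c' := by subst ha hb hc; exact h

theorem congr' (h : HasExpansion f a b c) (hfg : f =ᶠ[𝓝 0] g) : HasExpansion g a b c := by
  refine IsLittleO.congr' h ?_ EventuallyEq.rfl
  filter_upwards [hfg] with t ht
  rw [ht]

theorem const (a : ℝ) : HasExpansion (fun _ => a) a 0 0 := by
  simp only [HasExpansion]
  refine (isLittleO_zero _ _).congr_left fun t => by ring

theorem poly (a b c : ℝ) : HasExpansion (fun t => a + b * t + c * t ^ 2) a b c := by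
  simp only [HasExpansion]
  refine (isLittleO_zero _ _).congr_left fun t => by ring

theorem add (h : HasExpansion f a b c) (h' : HasExpansion g a' b' c') :
    HasExpansion (fun t => f t + g t) (a + a') (b + b') (c + c') :=
  (IsLittleO.add h h').congr_left fun t => by ring

theorem const_mul (k : ℝ) (h : HasExpansion f a b c) :
    HasExpansion (fun t => k * f t) (k * a) (k * b) (k * c) :=
  (IsLittleO.const_mul_left h k).congr_left fun t => by ring

theorem neg (h : HasExpansion f a b c) :
    HasExpansion (fun t => - f t) (-a) (-b) (-c) :=
  (IsLittleO.const_mul_left h (-1)).congr_left fun t => by ring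

theorem sub (h : HasExpansion f a b c) (h' : HasExpansion g a' b' c') :
    HasExpansion (fun t => f t - g t) (a - a') (b - b') (c - c') :=
  (IsLittleO.sub h h').congr_left fun t => by ring

theorem sum {ι : Type*} (s : Finset ι) {f : ι → ℝ → ℝ} {a b c : ι → ℝ}
    (h : ∀ i ∈ s, HasExpansion (f i) (a i) (b i) (c i)) :
    HasExpansion (fun t => ∑ i ∈ s, f i t) (∑ i ∈ s, a i) (∑ i ∈ s, b i) (∑ i ∈ s, c i) := by
  refine (IsLittleO.sum h).congr_left fun t => ?_
  rw [Finset.sum_apply, Finset.sum_sub_distrib, Finset.sum_add_distrib, Finset.sum_add_distrib, Finset.sum_mul,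
    Finset.sum_mul]

theorem tendsto (h : HasExpansion f a b c) : Tendsto f (𝓝 0) (𝓝 a) := by
  have h1 : Tendsto (fun t : ℝ => t ^ 2) (𝓝 0) (𝓝 0) := by
    simpa using (continuous_pow 2).tendsto (0 : ℝ)
  have h2 := h.trans_tendsto h1
  have h3 : Tendsto (fun t : ℝ => a + b * t + c * t ^ 2) (𝓝 0) (𝓝 a) := by
    have : Continuous fun t : ℝ => a + b * t + c * t ^ 2 := by fun_prop
    simpa using this.tendsto 0
  simpa using h2.add h3

theorem isBigO_sub (h : HasExpansion f a b c) : (fun t => f t - a) =O[𝓝 0] (fun t : ℝ => t) := by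
  have h1 : (fun t : ℝ => t ^ 2) =O[𝓝 0] (fun t : ℝ => t) := by
    have : (fun t : ℝ => t) =O[𝓝 0] (fun _ : ℝ => (1 : ℝ)) :=
      (continuous_id.tendsto (0 : ℝ)).isBigO_one ℝ
    refine ((isBigO_refl (fun t : ℝ => t) _).mul this).congr (fun t => by ring) (fun t => by ring)
  have h2 : (fun t : ℝ => b * t) =O[𝓝 0] (fun t : ℝ => t) :=
    (isBigO_refl (fun t : ℝ => t) _).const_mul_left b
  refine (((IsLittleO.isBigO h).trans h1).add (h2.add (h1.const_mul_left c))).congr_left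
    fun t => by ring

theorem mul (h : HasExpansion f a b c) (h' : HasExpansion g a' b' c') :
    HasExpansion (fun t => f t * g t) (a * a') (a * b' + b * a') (a * c' + b * b' + c * a') := by
  have h1 := IsLittleO.mul_isBigO h (h'.tendsto.isBigO_one ℝ)
  have h2 := IsBigO.mul_isLittleO (((poly a b c).tendsto).isBigO_one ℝ) h'
  have h3 : (fun t : ℝ => t ^ 3 * (b * c' + c * b' + c * c' * t)) =o[𝓝 0] (fun t : ℝ => t ^ 2) := by
    have e1 : (fun t : ℝ => t * (b * c' + c * b' + c * c' * t)) =o[𝓝 0] (fun _ : ℝ => (1 : ℝ)) := by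
      rw [isLittleO_one_iff]
      have : Continuous fun t : ℝ => t * (b * c' + c * b' + c * c' * t) := by fun_prop
      simpa using this.tendsto 0
    exact ((isBigO_refl (fun t : ℝ => t ^ 2) (𝓝 0)).mul_isLittleO e1).congr (fun t => by ring)
      (fun t => by ring)
  simp only [mul_one, one_mul] at h1 h2
  exact ((h1.add h2).add h3).congr_left fun t => by ring

/-- Composition with a function that has a second-order Taylor expansion at `a`. -/
theorem comp {φ : ℝ → ℝ} {p q r : ℝ} (hφ : HasExpansion (fun t => φ (a + t)) p q r)
    (h : HasExpansion f a b c) :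
    HasExpansion (fun t => φ (f t)) p (q * b) (q * c + r * b ^ 2) := by
  have h0 : Tendsto (fun t => f t - a) (𝓝 0) (𝓝 0) := by
    simpa using h.tendsto.sub_const a
  have h1 := (IsLittleO.comp_tendsto hφ h0).trans_isBigO (h.isBigO_sub.pow 2)
  have hg : HasExpansion (fun t => f t - a) 0 b c := by
    simpa using h.sub (const a)
  have h2 := ((const p).add (hg.const_mul q)).add ((hg.mul hg).const_mul r)
  refine (h1.add h2).congr_left fun t => ?_
  simp only [Function.comp]
  rw [add_sub_cancel]
  ring

theorem of_le_cube {C : ℝ} (h : ∀ᶠ t in 𝓝 0, |f t - (a + b * t + c * t ^ 2)| ≤ C * |t| ^ 3) :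
    HasExpansion f a b c := by
  have h1 : (fun t => f t - (a + b * t + c * t ^ 2)) =O[𝓝 0] (fun t : ℝ => t ^ 3) := by
    refine IsBigO.of_bound C ?_
    filter_upwards [h] with t ht
    simpa using ht
  have h2 : (fun t : ℝ => t ^ 3) =o[𝓝 0] (fun t : ℝ => t ^ 2) :=
    isLittleO_pow_pow (by norm_num)
  exact h1.trans_isLittleO h2

theorem log_one : HasExpansion (fun t => Real.log (1 + t)) 0 1 (-1 / 2) := by
  refine of_le_cube (C := 2) ?_
  have : ∀ᶠ t : ℝ in 𝓝 0, |t| < 1 / 2 := by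
    have := Metric.ball_mem_nhds (0 : ℝ) (show (0 : ℝ) < 1 / 2 by norm_num)
    filter_upwards [this] with t ht
    simpa using ht
  filter_upwards [this] with t ht
  have h1 := Real.abs_log_sub_add_sum_range_le (x := -t) (by simpa using ht.trans (by norm_num)) 2
  simp only [Finset.sum_range_succ, Finset.sum_range_zero, abs_neg] at h1
  norm_num at h1
  calc _ = |-t + t ^ 2 / 2 + Real.log (1 + t)| := by congr 1; ring
    _ ≤ _ := h1
    _ ≤ 2 * |t| ^ 3 := by
      rw [div_le_iff₀ (by linarith)]
      nlinarith [pow_nonneg (abs_nonneg t) 3]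

theorem log (h : HasExpansion f 1 b c) : HasExpansion (fun t => Real.log (f t)) 0 b (c - b ^ 2 / 2) :=
  (comp log_one h).congr_coeff rfl (by ring) (by ring)

theorem inv_aux (ha : 0 < a) : HasExpansion (fun t => (a + t)⁻¹) a⁻¹ (-(a⁻¹) ^ 2) (a⁻¹ ^ 3) := by
  refine of_le_cube (C := 2 * (a⁻¹) ^ 4) ?_
  have : ∀ᶠ t : ℝ in 𝓝 0, |t| < a / 2 := by
    have := Metric.ball_mem_nhds (0 : ℝ) (show (0 : ℝ) < a / 2 by linarith)
    filter_upwards [this] with t ht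
    simpa using ht
  filter_upwards [this] with t ht
  have h2 := abs_lt.1 ht
  have h3 : 0 < a + t := by linarith
  have e : (a + t)⁻¹ - (a⁻¹ + -(a⁻¹) ^ 2 * t + a⁻¹ ^ 3 * t ^ 2) = - (t ^ 3 * a⁻¹ ^ 3 * (a + t)⁻¹) := by
    field_simp; ring
  rw [e, abs_neg, abs_mul, abs_mul, abs_pow, abs_of_pos (by positivity : 0 < a⁻¹ ^ 3),
    abs_of_pos (by positivity : 0 < (a + t)⁻¹)]
  have : (a + t)⁻¹ ≤ 2 * a⁻¹ := by
    rw [inv_le_comm₀ h3 (by positivity)]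
    field_simp; linarith
  calc |t| ^ 3 * a⁻¹ ^ 3 * (a + t)⁻¹ ≤ |t| ^ 3 * a⁻¹ ^ 3 * (2 * a⁻¹) := by gcongr
    _ = _ := by ring

theorem inv (ha : 0 < a) (h : HasExpansion f a b c) :
    HasExpansion (fun t => (f t)⁻¹) a⁻¹ (-(a⁻¹) ^ 2 * b) (-(a⁻¹) ^ 2 * c + a⁻¹ ^ 3 * b ^ 2) :=
  comp (inv_aux ha) h

theorem coeff_nonpos (h : HasExpansion f 0 0 c) (hf : ∀ᶠ t in 𝓝[>] 0, f t ≤ 0) : c ≤ 0 := by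
  by_contra hc
  push Not at hc
  have h1 := (h.def (show (0 : ℝ) < c / 2 by linarith)).filter_mono
    (nhdsWithin_le_nhds (s := Set.Ioi 0))
  obtain ⟨t, ⟨h2, h3⟩, h4⟩ := ((h1.and hf).and self_mem_nhdsWithin).exists
  replace h4 : 0 < t := h4
  simp only [zero_add, zero_mul, Real.norm_eq_abs, abs_of_nonneg (sq_nonneg t)] at h2
  have := (abs_le.1 h2).1
  nlinarith [pow_pos h4 2]

/-- Expansion of exponential integrals. -/
theorem integral_exp {α : Type*} [MeasurableSpace α] {μ : Measure α} [IsFiniteMeasure μ]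
    {φ u v : α → ℝ} (hφ : Measurable φ) (hu : Measurable u) (hv : Measurable v) {M : ℝ}
    (hφM : ∀ᵐ x ∂μ, |φ x| ≤ M) (huM : ∀ᵐ x ∂μ, |u x| ≤ M) (hvM : ∀ᵐ x ∂μ, |v x| ≤ M) :
    HasExpansion (fun t => ∫ x, φ x * Real.exp (t * u x + t ^ 2 * v x) ∂μ) (∫ x, φ x ∂μ)
      (∫ x, φ x * u x ∂μ) (∫ x, φ x * (v x + u x ^ 2 / 2) ∂μ) := by
  have hM' : ∃ M : ℝ, 0 ≤ M ∧ (∀ᵐ x ∂μ, |φ x| ≤ M) ∧ (∀ᵐ x ∂μ, |u x| ≤ M) ∧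
      (∀ᵐ x ∂μ, |v x| ≤ M) := by
    refine ⟨|M|, abs_nonneg _, ?_, ?_, ?_⟩
    · filter_upwards [hφM] with x hx using hx.trans (le_abs_self M)
    · filter_upwards [huM] with x hx using hx.trans (le_abs_self M)
    · filter_upwards [hvM] with x hx using hx.trans (le_abs_self M)
  clear hφM huM hvM
  obtain ⟨M, hM, hφM, huM, hvM⟩ := hM'
  refine of_le_cube (C := M * (8 * M ^ 3 + 2 * M ^ 2) * μ.real Set.univ) ?_
  have : ∀ᶠ t : ℝ in 𝓝 0, |t| < 1 / (2 * M + 1) := by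
    have := Metric.ball_mem_nhds (0 : ℝ) (show (0 : ℝ) < 1 / (2 * M + 1) by positivity)
    filter_upwards [this] with t ht
    simpa using ht
  filter_upwards [this] with t ht
  rw [lt_div_iff₀ (by positivity)] at ht
  have ht1 : |t| ≤ 1 := by nlinarith [abs_nonneg t]
  have h_intg : ∀ {w : α → ℝ}, Measurable w → (∃ C, ∀ᵐ x ∂μ, |w x| ≤ C) → Integrable w μ := by
    rintro w hw ⟨C, hC⟩
    exact Integrable.of_bound hw.aestronglyMeasurable C hC
  have i1 : Integrable φ μ := h_intg hφ ⟨M, hφM⟩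
  have i2 : Integrable (fun x => φ x * u x) μ := h_intg (hφ.mul hu) ⟨M * M, by
    filter_upwards [hφM, huM] with x h1 h2
    rw [abs_mul]; gcongr⟩
  have i3 : Integrable (fun x => φ x * (v x + u x ^ 2 / 2)) μ :=
    h_intg (hφ.mul (hv.add ((hu.pow_const 2).div_const 2))) ⟨M * (M + M ^ 2 / 2), by
      filter_upwards [hφM, huM, hvM] with x h1 h2 h3
      rw [abs_mul]; gcongr
      refine (abs_add_le _ _).trans ?_
      rw [abs_div, abs_pow, abs_two]; gcongr⟩
  have i4 : Integrable (fun x => φ x * Real.exp (t * u x + t ^ 2 * v x)) μ :=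
    h_intg (hφ.mul (((hu.const_mul t).add (hv.const_mul (t ^ 2))).exp)) ⟨M * Real.exp (|t| * M + t ^ 2 * M), by
      filter_upwards [hφM, huM, hvM] with x h1 h2 h3
      rw [abs_mul, Real.abs_exp]
      have e1 : t * u x ≤ |t| * M := by
        refine (le_abs_self _).trans ?_
        rw [abs_mul]; gcongr
      have e2 : v x ≤ M := (le_abs_self _).trans h3
      gcongr⟩
  have e : (∫ x, φ x * Real.exp (t * u x + t ^ 2 * v x) ∂μ) - ((∫ x, φ x ∂μ) +
      (∫ x, φ x * u x ∂μ) * t + (∫ x, φ x * (v x + u x ^ 2 / 2) ∂μ) * t ^ 2) =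
      ∫ x, (φ x * Real.exp (t * u x + t ^ 2 * v x) - (φ x + φ x * u x * t +
        φ x * (v x + u x ^ 2 / 2) * t ^ 2)) ∂μ := by
    have i5 : Integrable (fun x => φ x + φ x * u x * t) μ := i1.add (i2.mul_const t)
    have i6 : Integrable (fun x => φ x + φ x * u x * t + φ x * (v x + u x ^ 2 / 2) * t ^ 2) μ :=
      i5.add (i3.mul_const _)
    rw [integral_sub i4 i6, integral_add i5 (i3.mul_const _), integral_add i1 (i2.mul_const t),
      integral_mul_const, integral_mul_const]
  rw [e]
  have key : ∀ᵐ x ∂μ, ‖φ x * Real.exp (t * u x + t ^ 2 * v x) - (φ x + φ x * u x * t +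
        φ x * (v x + u x ^ 2 / 2) * t ^ 2)‖ ≤ M * (8 * M ^ 3 + 2 * M ^ 2) * |t| ^ 3 := by
    filter_upwards [hφM, huM, hvM] with x h1 h2 h3
    set z := t * u x + t ^ 2 * v x with hz
    have hz1 : |z| ≤ 2 * M * |t| := by
      calc |z| ≤ |t| * |u x| + |t| ^ 2 * |v x| := by
            rw [hz]; refine (abs_add_le _ _).trans ?_; rw [abs_mul, abs_mul, abs_pow]
        _ ≤ |t| * M + |t| * M := by
            gcongr
            nlinarith [abs_nonneg t]
        _ = _ := by ring
    have hz2 : |z| ≤ 1 := by linarith [abs_nonneg t]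
    have h4 := Real.exp_bound hz2 (n := 3) (by norm_num)
    simp only [Finset.sum_range_succ, Finset.sum_range_zero] at h4
    norm_num [Nat.factorial] at h4
    have h5 : |Real.exp z - (1 + z + z ^ 2 / 2)| ≤ 8 * M ^ 3 * |t| ^ 3 := by
      refine h4.trans ?_
      calc |z| ^ 3 * (2 / 9) ≤ (2 * M * |t|) ^ 3 * 1 := by gcongr; norm_num
        _ = _ := by ring
    have h6 : |t ^ 3 * (u x * v x) + t ^ 4 * v x ^ 2 / 2| ≤ 2 * M ^ 2 * |t| ^ 3 := by
      calc _ ≤ |t| ^ 3 * (|u x| * |v x|) + |t| ^ 3 * |t| * |v x| ^ 2 / 2 := by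
            refine (abs_add_le _ _).trans ?_
            rw [abs_div, abs_mul, abs_mul, abs_mul, abs_pow, abs_pow, abs_pow, abs_two]
            apply le_of_eq; ring
        _ ≤ |t| ^ 3 * (M * M) + |t| ^ 3 * 1 * M ^ 2 / 2 := by gcongr
        _ ≤ _ := by nlinarith [mul_nonneg (pow_nonneg (abs_nonneg t) 3) (sq_nonneg M)]
    have e2 : φ x * Real.exp z - (φ x + φ x * u x * t + φ x * (v x + u x ^ 2 / 2) * t ^ 2) =
        φ x * ((Real.exp z - (1 + z + z ^ 2 / 2)) +
          (t ^ 3 * (u x * v x) + t ^ 4 * v x ^ 2 / 2)) := by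
      rw [hz]; ring
    rw [e2, norm_mul, Real.norm_eq_abs, Real.norm_eq_abs, mul_assoc]
    gcongr
    refine (abs_add_le _ _).trans ?_
    linarith
  refine (norm_integral_le_of_norm_le_const key).trans ?_
  apply le_of_eq; ring

end HasExpansion

open Matrix in
/-- The concave quadratic potential `θ·x - ½ x·Gx`. -/
noncomputable def quadPot {n : ℕ} (G : Matrix (Fin n) (Fin n) ℝ) (θ x : Fin n → ℝ) : ℝ :=
  θ ⬝ᵥ x - (1 / 2) * (x ⬝ᵥ G *ᵥ x)

/-- Compact convex sets with nonempty interior in coordinate space. -/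
structure IsBody {n : ℕ} (K : Set (Fin n → ℝ)) : Prop where
  isCompact : IsCompact K
  convex : Convex ℝ K
  interior_nonempty : (interior K).Nonempty

/-- The probability measure on `K` with density proportional to `exp (θ·x - ½ x·Gx)`. -/
noncomputable def quadTilt {n : ℕ} (K : Set (Fin n → ℝ)) (G : Matrix (Fin n) (Fin n) ℝ)
    (θ : Fin n → ℝ) : Measure (Fin n → ℝ) :=
  (volume.restrict K).tilted (quadPot G θ)

section Basic

open Matrix

variable {n : ℕ} {K : Set (Fin n → ℝ)} {G : Matrix (Fin n) (Fin n) ℝ} {θ : Fin n → ℝ}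

@[fun_prop]
theorem continuous_quadPot {X : Type*} [TopologicalSpace X] {G : X → Matrix (Fin n) (Fin n) ℝ}
    {θ x : X → Fin n → ℝ} (hG : Continuous G) (hθ : Continuous θ) (hx : Continuous x) :
    Continuous fun p => quadPot (G p) (θ p) (x p) := by
  unfold quadPot
  exact (hθ.dotProduct hx).sub (continuous_const.mul (hx.dotProduct (hG.matrix_mulVec hx)))

theorem quadPot_add (G N : Matrix (Fin n) (Fin n) ℝ) (θ η x : Fin n → ℝ) :
    quadPot (G + N) (θ + η) x = quadPot G θ x + quadPot N η x := by
  simp only [quadPot, add_mulVec, dotProduct_add, add_dotProduct]; ring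

theorem quadPot_midpoint (hG : G.IsSymm) (x y : Fin n → ℝ) :
    quadPot G θ x + quadPot G θ y =
      2 * quadPot G θ ((1 / 2 : ℝ) • (x + y)) - (1 / 4) * ((x - y) ⬝ᵥ G *ᵥ (x - y)) := by
  have h : y ⬝ᵥ G *ᵥ x = x ⬝ᵥ G *ᵥ y := by
    rw [dotProduct_comm, dotProduct_mulVec x, ← mulVec_transpose, hG.eq]
  simp only [quadPot, mulVec_smul, mulVec_add, mulVec_sub, dotProduct_add, dotProduct_smul,
    smul_dotProduct, add_dotProduct, sub_dotProduct, dotProduct_sub, smul_eq_mul, h]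
  ring

theorem IsBody.measurableSet (hK : IsBody K) : MeasurableSet K := hK.isCompact.isClosed.measurableSet

theorem IsBody.integrable_exp (hK : IsBody K) :
    Integrable (fun x => Real.exp (quadPot G θ x)) (volume.restrict K) := by
  have : Continuous fun x => Real.exp (quadPot G θ x) := by fun_prop
  exact this.continuousOn.integrableOn_compact hK.isCompact

theorem IsBody.restrict_ne_zero (hK : IsBody K) : NeZero (volume.restrict K) := by
  refine ⟨fun h => ?_⟩
  rw [Measure.restrict_eq_zero] at h
  have := (isOpen_interior (s := K)).measure_pos volume hK.interior_nonempty
  exact this.ne' (measure_mono_null interior_subset h)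

theorem IsBody.isProbabilityMeasure (hK : IsBody K) (G : Matrix (Fin n) (Fin n) ℝ)
    (θ : Fin n → ℝ) : IsProbabilityMeasure (quadTilt K G θ) := by
  have := hK.restrict_ne_zero
  exact isProbabilityMeasure_tilted hK.integrable_exp

theorem IsBody.ae_mem (hK : IsBody K) (G : Matrix (Fin n) (Fin n) ℝ)
    (θ : Fin n → ℝ) : ∀ᵐ x ∂(quadTilt K G θ), x ∈ K :=
  (tilted_absolutelyContinuous _ _).ae_le (ae_restrict_mem hK.measurableSet)

theorem IsBody.exists_bound (hK : IsBody K) {φ : (Fin n → ℝ) → ℝ} (hφ : Continuous φ) :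
    ∃ C, ∀ x ∈ K, |φ x| ≤ C := by
  obtain ⟨C, hC⟩ := hK.isCompact.exists_bound_of_continuousOn hφ.continuousOn
  exact ⟨C, hC⟩

theorem IsBody.integrable (hK : IsBody K) {φ : (Fin n → ℝ) → ℝ} (hφ : Continuous φ) :
    Integrable φ (quadTilt K G θ) := by
  have := hK.isProbabilityMeasure G θ
  obtain ⟨C, hC⟩ := hK.exists_bound hφ
  refine Integrable.of_bound hφ.aestronglyMeasurable C ?_
  filter_upwards [hK.ae_mem G θ] with x hx using hC x hx

theorem IsBody.tilted_quadPot (hK : IsBody K) (G N : Matrix (Fin n) (Fin n) ℝ)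
    (θ η : Fin n → ℝ) :
    (quadTilt K G θ).tilted (quadPot N η) = quadTilt K (G + N) (θ + η) := by
  unfold quadTilt
  rw [tilted_tilted hK.integrable_exp]
  congr 1
  ext x
  simp [quadPot_add]

theorem IsBody.lintegral_mul_lintegral_le (hK : IsBody K) (hG : G.IsSymm)
    {φ₁ φ₂ φ₃ : (Fin n → ℝ) → ENNReal} (h₁ : Measurable φ₁) (h₂ : Measurable φ₂)
    (h₃ : Measurable φ₃)
    (H : ∀ x ∈ K, ∀ y ∈ K, ENNReal.ofReal (Real.exp (-(1 / 4) * ((x - y) ⬝ᵥ G *ᵥ (x - y)))) *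
      (φ₁ x * φ₂ y) ≤ φ₃ ((1 / 2 : ℝ) • (x + y)) ^ 2) :
    (∫⁻ x, φ₁ x ∂(quadTilt K G θ)) * ∫⁻ x, φ₂ x ∂(quadTilt K G θ) ≤
      (∫⁻ x, φ₃ x ∂(quadTilt K G θ)) ^ 2 := by
  set c := ∫ x in K, Real.exp (quadPot G θ x) with hc
  have hcm : Measurable fun x => ENNReal.ofReal (Real.exp (quadPot G θ x) / c) := by
    have : Continuous fun x => Real.exp (quadPot G θ x) / c := by fun_prop
    exact this.measurable.ennreal_ofReal
  have e : ∀ φ : (Fin n → ℝ) → ENNReal, ∫⁻ x, φ x ∂(quadTilt K G θ) =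
      ∫⁻ x, K.indicator (fun x => ENNReal.ofReal (Real.exp (quadPot G θ x) / c) * φ x) x := by
    intro φ
    rw [quadTilt, lintegral_tilted, lintegral_indicator hK.measurableSet]
  rw [e, e, e]
  have hc0 : 0 ≤ c := integral_nonneg fun x => (Real.exp_pos _).le
  refine prekopaLeindler ((hcm.mul h₁).indicator hK.measurableSet)
    ((hcm.mul h₂).indicator hK.measurableSet) ((hcm.mul h₃).indicator hK.measurableSet)
    fun x y => ?_
  by_cases hx : x ∈ K
  swap
  · simp [hx]
  by_cases hy : y ∈ K
  swap
  · simp [hy]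
  have hm : (1 / 2 : ℝ) • (x + y) ∈ K := by
    rw [smul_add]
    exact hK.convex hx hy (by norm_num) (by norm_num) (by norm_num)
  rw [Set.indicator_of_mem hx, Set.indicator_of_mem hy, Set.indicator_of_mem hm, mul_pow]
  have e2 : ENNReal.ofReal (Real.exp (quadPot G θ x) / c) *
      ENNReal.ofReal (Real.exp (quadPot G θ y) / c) =
      ENNReal.ofReal (Real.exp (quadPot G θ ((1 / 2 : ℝ) • (x + y))) / c) ^ 2 *
      ENNReal.ofReal (Real.exp (-(1 / 4) * ((x - y) ⬝ᵥ G *ᵥ (x - y)))) := by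
    rw [← ENNReal.ofReal_pow (by positivity), ← ENNReal.ofReal_mul (by positivity),
      ← ENNReal.ofReal_mul (by positivity)]
    congr 1
    rw [div_mul_div_comm, ← Real.exp_add, quadPot_midpoint hG, sub_eq_add_neg, Real.exp_add,
      div_pow, ← Real.exp_nat_mul, neg_mul]
    push_cast
    ring
  calc _ = (ENNReal.ofReal (Real.exp (quadPot G θ x) / c) *
      ENNReal.ofReal (Real.exp (quadPot G θ y) / c)) * (φ₁ x * φ₂ y) := mul_mul_mul_comm _ _ _ _
    _ ≤ _ := by rw [e2, mul_assoc]; gcongr; exact H x hx y hy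

/-- A log-concavity estimate on exponential moments gives a variance bound. -/
theorem variance_le_of_exp_moments {α : Type*} [MeasurableSpace α] {μ : Measure α}
    [IsProbabilityMeasure μ] {u : α → ℝ} (hu : Measurable u) {M : ℝ} (huM : ∀ᵐ x ∂μ, |u x| ≤ M)
    {e : ℝ → ℝ} {c : ℝ} (he : HasExpansion e 1 0 c)
    (H : ∀ᶠ t in nhdsWithin 0 (Set.Ioi 0),
      (∫ x, Real.exp (t * u x) ∂μ) * (∫ x, Real.exp (t * (- u x)) ∂μ) ≤ e t) :
    (∫ x, u x ^ 2 ∂μ) - (∫ x, u x ∂μ) ^ 2 ≤ c := by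
  have h1 := HasExpansion.integral_exp (μ := μ) (φ := fun _ => 1) (u := u) (v := fun _ => 0)
    (M := max M 1) measurable_const hu measurable_const (by simp)
    (by filter_upwards [huM] with x hx using hx.trans (le_max_left _ _)) (by simp)
  have h2 := HasExpansion.integral_exp (μ := μ) (φ := fun _ => 1) (u := fun x => - u x)
    (v := fun _ => 0)
    (M := max M 1) measurable_const hu.neg measurable_const (by simp)
    (by filter_upwards [huM] with x hx; rw [abs_neg]; exact hx.trans (le_max_left _ _)) (by simp)
  simp only [one_mul, mul_zero, add_zero, zero_add, neg_sq, integral_const, probReal_univ,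
    smul_eq_mul, mul_one, integral_neg, integral_div] at h1 h2
  have h3 := ((h1.mul h2).sub he).congr_coeff (a' := 0) (b' := 0)
    (c' := (∫ x, u x ^ 2 ∂μ) - (∫ x, u x ∂μ) ^ 2 - c) (by ring) (by ring) (by ring)
  have := h3.coeff_nonpos (by filter_upwards [H] with t ht; linarith)
  linarith

/-- The covariance form of the Brascamp–Lieb inequality. -/
theorem IsBody.variance_mulVec_le (hK : IsBody K) (hG : G.PosSemidef) (u : Fin n → ℝ) :
    (∫ x, ((G *ᵥ u) ⬝ᵥ x) ^ 2 ∂(quadTilt K G θ)) - (∫ x, (G *ᵥ u) ⬝ᵥ x ∂(quadTilt K G θ)) ^ 2 ≤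
      u ⬝ᵥ G *ᵥ u := by
  have := hK.isProbabilityMeasure G θ
  have hGs : G.IsSymm := isHermitian_iff_isSymm.1 hG.1
  have hcont : Continuous fun x : Fin n → ℝ => (G *ᵥ u) ⬝ᵥ x :=
    continuous_const.dotProduct continuous_id
  obtain ⟨C, hC⟩ := hK.exists_bound hcont
  have he : HasExpansion (fun t => Real.exp (t ^ 2 * (u ⬝ᵥ G *ᵥ u))) 1 0 (u ⬝ᵥ G *ᵥ u) := by
    have := HasExpansion.integral_exp (μ := Measure.dirac (0 : ℝ)) (φ := fun _ => 1)
      (u := fun _ => 0) (v := fun _ => u ⬝ᵥ G *ᵥ u) (M := max 1 |u ⬝ᵥ G *ᵥ u|) measurable_const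
      measurable_const measurable_const (by simp) (by simp) (by simp)
    simpa using this
  refine variance_le_of_exp_moments hcont.measurable
    (by filter_upwards [hK.ae_mem G θ] with x hx using hC x hx) he (Filter.Eventually.of_forall
      fun t => ?_)
  have hm : ∀ s : ℝ, Continuous fun x : Fin n → ℝ => Real.exp (s * ((G *ᵥ u) ⬝ᵥ x)) := fun s =>
    Real.continuous_exp.comp (continuous_const.mul hcont)
  have key := hK.lintegral_mul_lintegral_le (θ := θ) hGs
    (φ₁ := fun x => ENNReal.ofReal (Real.exp (t * ((G *ᵥ u) ⬝ᵥ x))))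
    (φ₂ := fun x => ENNReal.ofReal (Real.exp (-t * ((G *ᵥ u) ⬝ᵥ x))))
    (φ₃ := fun _ => ENNReal.ofReal (Real.exp (t ^ 2 * (u ⬝ᵥ G *ᵥ u) / 2)))
    (hm t).measurable.ennreal_ofReal (hm (-t)).measurable.ennreal_ofReal measurable_const
    (fun x _ y _ => by
      rw [← ENNReal.ofReal_pow (Real.exp_pos _).le, ← ENNReal.ofReal_mul (Real.exp_pos _).le,
        ← ENNReal.ofReal_mul (Real.exp_pos _).le, ← Real.exp_add, ← Real.exp_add,
        ← Real.exp_nat_mul]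
      refine ENNReal.ofReal_le_ofReal (Real.exp_le_exp.2 ?_)
      have h1 := hG.dotProduct_mulVec_nonneg ((1 / 2 : ℝ) • (x - y) - t • u)
      have h2 : ∀ z w : Fin n → ℝ, z ⬝ᵥ G *ᵥ w = w ⬝ᵥ G *ᵥ z := fun z w => by
        rw [dotProduct_comm, dotProduct_mulVec w, ← mulVec_transpose, hGs.eq]
      have h3 : (G *ᵥ u) ⬝ᵥ x - (G *ᵥ u) ⬝ᵥ y = (x - y) ⬝ᵥ G *ᵥ u := by
        rw [← dotProduct_sub, dotProduct_comm]
      simp only [star_trivial, mulVec_sub (A := G) ((1 / 2 : ℝ) • (x - y)), mulVec_smul,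
        sub_dotProduct ((1 / 2 : ℝ) • (x - y)), smul_dotProduct,
        dotProduct_sub _ ((1 / 2 : ℝ) • G *ᵥ (x - y)), dotProduct_smul, smul_eq_mul] at h1
      rw [h2 u (x - y), ← h3] at h1
      push_cast
      nlinarith)
  rw [lintegral_const, measure_univ, mul_one, ← ENNReal.ofReal_pow (Real.exp_pos _).le,
    ← ofReal_integral_eq_lintegral_ofReal (hK.integrable (hm t))
      (Filter.Eventually.of_forall fun x => (Real.exp_pos _).le),
    ← ofReal_integral_eq_lintegral_ofReal (hK.integrable (hm (-t)))
      (Filter.Eventually.of_forall fun x => (Real.exp_pos _).le),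
    ← ENNReal.ofReal_mul (integral_nonneg fun x => (Real.exp_pos _).le), 
    ENNReal.ofReal_le_ofReal_iff (by positivity), ← Real.exp_nat_mul] at key
  refine (le_of_eq ?_).trans (key.trans (le_of_eq ?_))
  · simp
  · push_cast; congr 1; ring

theorem IsBody.integral_sq_le_of_nonneg (hK : IsBody K) (hG : G.PosSemidef) (r : ℝ)
    (v : Fin n → ℝ) (h0 : ∀ x ∈ K, 0 ≤ r + v ⬝ᵥ x) :
    ∫ x, (r + v ⬝ᵥ x) ^ 2 ∂(quadTilt K G θ) ≤ 8 * (∫ x, (r + v ⬝ᵥ x) ∂(quadTilt K G θ)) ^ 2 := by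
  have := hK.isProbabilityMeasure G θ
  have hGs : G.IsSymm := isHermitian_iff_isSymm.1 hG.1
  set s : (Fin n → ℝ) → ℝ := fun x => r + v ⬝ᵥ x with hs
  have hcont : Continuous s := continuous_const.add (continuous_const.dotProduct continuous_id)
  have hnn : 0 ≤ᵐ[quadTilt K G θ] s := by
    filter_upwards [hK.ae_mem G θ] with x hx using h0 x hx
  have hm : ∀ u, MeasurableSet {x | u ≤ s x} := fun u =>
    (isClosed_le continuous_const hcont).measurableSet
  have key : ∀ u : ℝ, quadTilt K G θ {x | u ≤ s x / 2} ≤ (quadTilt K G θ {x | u ≤ s x}) ^ 2 := by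
    intro u
    have := hK.lintegral_mul_lintegral_le (θ := θ) hGs
      (φ₁ := {x | u ≤ s x / 2}.indicator 1) (φ₂ := K.indicator 1)
      (φ₃ := {x | u ≤ s x}.indicator 1)
      (measurable_one.indicator (isClosed_le continuous_const (hcont.div_const 2)).measurableSet)
      (measurable_one.indicator hK.measurableSet) (measurable_one.indicator (hm u))
      (fun x hx y hy => by
        rw [Set.indicator_of_mem hy]
        by_cases hxu : u ≤ s x / 2
        · have hu : u ≤ s ((1 / 2 : ℝ) • (x + y)) := by
            have := h0 y hy
            simp only [hs, dotProduct_smul, dotProduct_add, smul_eq_mul] at hxu ⊢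
            linarith
          rw [Set.indicator_of_mem (show x ∈ {x | u ≤ s x / 2} from hxu),
            Set.indicator_of_mem (show _ ∈ {x | u ≤ s x} from hu)]
          simp only [Pi.one_apply, mul_one, one_pow]
          rw [ENNReal.ofReal_le_one, Real.exp_le_one_iff]
          have := hG.dotProduct_mulVec_nonneg (x - y)
          simp only [star_trivial] at this
          linarith
        · rw [Set.indicator_of_notMem (show x ∉ {x | u ≤ s x / 2} from hxu)]
          simp)
    rw [lintegral_indicator_one (hm u), lintegral_indicator_one hK.measurableSet,
      lintegral_indicator_one (isClosed_le continuous_const (hcont.div_const 2)).measurableSet,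
      (prob_compl_eq_zero_iff hK.measurableSet).1 (hK.ae_mem G θ), mul_one] at this
    exact this
  have e1 : ENNReal.ofReal (∫ x, s x ∂(quadTilt K G θ)) =
      ∫⁻ t in Set.Ioi 0, quadTilt K G θ {x | t ≤ s x} := by
    rw [ofReal_integral_eq_lintegral_ofReal (hK.integrable hcont) hnn,
      lintegral_eq_lintegral_meas_le _ hnn hcont.aemeasurable]
  have hmarkov : ∀ u : ℝ, quadTilt K G θ {x | u ≤ s x} * ENNReal.ofReal u ≤
      ENNReal.ofReal (∫ x, s x ∂(quadTilt K G θ)) := by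
    intro u
    rw [ofReal_integral_eq_lintegral_ofReal (hK.integrable hcont) hnn, mul_comm]
    refine le_trans ?_ (mul_meas_ge_le_lintegral hcont.measurable.ennreal_ofReal (ENNReal.ofReal u))
    gcongr with x
    exact fun h => ENNReal.ofReal_le_ofReal h
  have e2 : ENNReal.ofReal (∫ x, (s x / 2) ^ 2 ∂(quadTilt K G θ)) ≤
      2 * (ENNReal.ofReal (∫ x, s x ∂(quadTilt K G θ))) ^ 2 := by
    rw [ofReal_integral_eq_lintegral_ofReal (hK.integrable (by fun_prop))
      (Filter.Eventually.of_forall fun x => sq_nonneg _)]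
    have h2 := lintegral_rpow_eq_lintegral_meas_le_mul (quadTilt K G θ) (f := fun x => s x / 2)
      (by filter_upwards [hnn] with x hx; exact div_nonneg hx (by norm_num))
      (hcont.div_const 2).aemeasurable (p := 2) (by norm_num)
    have h3 : ∀ x, ENNReal.ofReal ((s x / 2) ^ (2 : ℝ)) = ENNReal.ofReal ((s x / 2) ^ 2) := by
      intro x; norm_num
    simp only [h3] at h2
    rw [h2]
    norm_num
    gcongr
    calc ∫⁻ t in Set.Ioi (0 : ℝ), quadTilt K G θ {x | t ≤ s x / 2} * ENNReal.ofReal t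
        ≤ ∫⁻ t in Set.Ioi (0 : ℝ), ENNReal.ofReal (∫ x, s x ∂(quadTilt K G θ)) *
          quadTilt K G θ {x | t ≤ s x} := by
          refine lintegral_mono fun t => ?_
          calc _ ≤ (quadTilt K G θ {x | t ≤ s x}) ^ 2 * ENNReal.ofReal t := by
                gcongr; exact key t
            _ = (quadTilt K G θ {x | t ≤ s x} * ENNReal.ofReal t) *
                quadTilt K G θ {x | t ≤ s x} := by ring
            _ ≤ _ := by gcongr; exact hmarkov t
      _ = _ := by
          rw [lintegral_const_mul' _ _ ENNReal.ofReal_ne_top, ← e1, pow_two]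
  rw [← ENNReal.ofReal_pow (integral_nonneg_of_ae hnn), show (2 : ENNReal) = ENNReal.ofReal 2 by
    simp, ← ENNReal.ofReal_mul (by norm_num), ENNReal.ofReal_le_ofReal_iff (by positivity)] at e2
  simp only [div_pow, integral_div] at e2
  linarith

theorem lintegral_comp_inv_smul (f : (Fin n → ℝ) → ENNReal) {r : ℝ} (hr : 0 < r) :
    ∫⁻ x, f (r⁻¹ • x) = ENNReal.ofReal (r ^ n) * ∫⁻ x, f x := by
  have h := Measure.map_addHaar_smul (volume : Measure (Fin n → ℝ)) (inv_ne_zero hr.ne')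
  have h2 : ∫⁻ x, f (r⁻¹ • x) = ∫⁻ x, f x ∂(Measure.map (r⁻¹ • ·) volume) :=
    ((Homeomorph.smulOfNeZero r⁻¹ (inv_ne_zero hr.ne')).toMeasurableEquiv.measurableEmbedding.lintegral_map
      f).symm
  rw [h2, h, lintegral_smul_measure, smul_eq_mul]
  congr 2
  simp [abs_of_pos hr]

theorem HasExpansion.pow_one {f : ℝ → ℝ} {c : ℝ} (h : HasExpansion f 1 0 c) (m : ℕ) :
    HasExpansion (fun t => f t ^ m) 1 0 (m * c) := by
  induction m with
  | zero => simpa using HasExpansion.const 1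
  | succ m ih =>
    simp only [pow_succ]
    exact (ih.mul h).congr_coeff (by ring) (by ring) (by push_cast; ring)

/-- The varentropy bound. -/
theorem IsBody.variance_quadPot_le (hK : IsBody K) (hG : G.PosSemidef) :
    (∫ x, quadPot G θ x ^ 2 ∂(quadTilt K G θ)) - (∫ x, quadPot G θ x ∂(quadTilt K G θ)) ^ 2 ≤ n := by
  have := hK.isProbabilityMeasure G θ
  have hGs : G.IsSymm := isHermitian_iff_isSymm.1 hG.1
  have hcont : Continuous (quadPot G θ) := by
    have : Continuous fun x => quadPot G θ x := by fun_prop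
    exact this
  obtain ⟨C, hC⟩ := hK.exists_bound hcont
  have he : HasExpansion (fun t : ℝ => ((1 + 0 * t + (-1) * t ^ 2)⁻¹) ^ n) 1 0 n := by
    have := ((HasExpansion.poly 1 0 (-1)).inv one_pos).congr_coeff (a' := 1) (b' := 0) (c' := 1)
      (by norm_num) (by norm_num) (by norm_num)
    simpa using this.pow_one n
  refine variance_le_of_exp_moments hcont.measurable
    (by filter_upwards [hK.ae_mem G θ] with x hx using hC x hx) he ?_
  filter_upwards [Ioo_mem_nhdsGT (show (0 : ℝ) < 1 by norm_num)] with t ht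
  set Z := ∫ x in K, Real.exp (quadPot G θ x) with hZ
  have hZ0 : 0 < Z := by
    have := hK.restrict_ne_zero
    exact integral_exp_pos hK.integrable_exp
  set I : ℝ → ℝ := fun τ => ∫ x in K, Real.exp (τ * quadPot G θ x) with hI
  have hIint : ∀ τ, Integrable (fun x => Real.exp (τ * quadPot G θ x)) (volume.restrict K) := by
    intro τ
    have : Continuous fun x => Real.exp (τ * quadPot G θ x) := by fun_prop
    exact this.continuousOn.integrableOn_compact hK.isCompact
  have hI0 : ∀ τ, 0 ≤ I τ := fun τ => integral_nonneg fun x => (Real.exp_pos _).le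
  have hR : ∀ τ, ∫ x, Real.exp (τ * quadPot G θ x) ∂(quadTilt K G θ) = I (1 + τ) / Z := by
    intro τ
    rw [quadTilt, integral_tilted, hI, ← integral_div]
    congr 1; ext x
    rw [smul_eq_mul, div_mul_eq_mul_div, ← Real.exp_add, ← hZ]
    ring_nf
  have hF : ∀ r : ℝ, 0 < r → ∫⁻ x, K.indicator
      (fun x => ENNReal.ofReal (Real.exp (r * quadPot G θ x))) (r⁻¹ • x) =
      ENNReal.ofReal (r ^ n * I r) := by
    intro r hr
    rw [lintegral_comp_inv_smul _ hr, lintegral_indicator hK.measurableSet,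
      ENNReal.ofReal_mul (by positivity), hI,
      ofReal_integral_eq_lintegral_ofReal (hIint r)
        (Filter.Eventually.of_forall fun x => (Real.exp_pos _).le)]
  have hmeas : ∀ r : ℝ, Measurable fun x => K.indicator
      (fun x => ENNReal.ofReal (Real.exp (r * quadPot G θ x))) (r⁻¹ • x) := by
    intro r
    have h1 : Continuous fun x => Real.exp (r * quadPot G θ x) := by fun_prop
    exact (h1.measurable.ennreal_ofReal.indicator hK.measurableSet).comp
      (measurable_const_smul r⁻¹)
  have hp : 0 < 1 + t := by linarith [ht.1]
  have hq : 0 < 1 - t := by linarith [ht.2]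
  have key := prekopaLeindler (hmeas (1 + t)) (hmeas (1 - t)) (hmeas 1) (fun x y => by
    obtain ⟨a, rfl⟩ : ∃ a, x = (1 + t) • a := ⟨(1 + t)⁻¹ • x, (smul_inv_smul₀ hp.ne' x).symm⟩
    obtain ⟨b, rfl⟩ : ∃ b, y = (1 - t) • b := ⟨(1 - t)⁻¹ • y, (smul_inv_smul₀ hq.ne' y).symm⟩
    rw [inv_smul_smul₀ hp.ne', inv_smul_smul₀ hq.ne', inv_one, one_smul]
    by_cases ha : a ∈ K
    swap
    · simp [ha]
    by_cases hb : b ∈ K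
    swap
    · simp [hb]
    have hm : (1 / 2 : ℝ) • ((1 + t) • a + (1 - t) • b) ∈ K := by
      rw [smul_add, smul_smul, smul_smul]
      exact hK.convex ha hb (by positivity) (by positivity) (by ring)
    rw [Set.indicator_of_mem ha, Set.indicator_of_mem hb, Set.indicator_of_mem hm,
      ← ENNReal.ofReal_mul (Real.exp_pos _).le, ← ENNReal.ofReal_pow (Real.exp_pos _).le,
      ← Real.exp_add, ← Real.exp_nat_mul]
    refine ENNReal.ofReal_le_ofReal (Real.exp_le_exp.2 ?_)
    have h1 := hG.dotProduct_mulVec_nonneg (a - b)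
    have h2 : b ⬝ᵥ G *ᵥ a = a ⬝ᵥ G *ᵥ b := by
      rw [dotProduct_comm, dotProduct_mulVec a, ← mulVec_transpose, hGs.eq]
    simp only [star_trivial, quadPot, mulVec_smul, mulVec_add, mulVec_sub, dotProduct_add,
      dotProduct_smul, smul_dotProduct, add_dotProduct, sub_dotProduct, dotProduct_sub,
      smul_eq_mul, h2] at h1 ⊢
    push_cast
    nlinarith [mul_nonneg (mul_pos hp hq).le h1])
  rw [hF _ hp, hF _ hq, hF _ one_pos, ← ENNReal.ofReal_mul (mul_nonneg (by positivity) (hI0 _)),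
    ← ENNReal.ofReal_pow (mul_nonneg (by positivity) (hI0 _)), ENNReal.ofReal_le_ofReal_iff
    (by positivity)] at key
  have hI1 : I 1 = Z := by simp [hI, hZ]
  simp only [mul_neg, ← neg_mul]
  rw [hR, hR, ← sub_eq_add_neg, div_mul_div_comm, div_le_iff₀ (by positivity)]
  rw [hI1, one_pow, one_mul] at key
  have h3 : 1 + 0 * t + (-1) * t ^ 2 = (1 + t) * (1 - t) := by ring
  rw [h3, inv_pow, mul_pow, inv_mul_eq_div, le_div_iff₀ (by positivity)]
  nlinarith [key]

end Basic

open MvPolynomial in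
/-- The structure of polynomials in the `L²` space of a probability measure on coordinate space,
together with the weighted Laplacians `Lop d`, a Bochner inequality with curvature `g`, and
centered, isotropic (with variance `τ`) coordinates. -/
structure PolyModel (n : ℕ) (H : Type*) [NormedAddCommGroup H] [InnerProductSpace ℝ H]
    (g : Fin n → ℝ) (τ : ℝ) where
  emb : MvPolynomial (Fin n) ℝ →ₗ[ℝ] H
  mean : MvPolynomial (Fin n) ℝ →ₗ[ℝ] ℝ
  lap : (Fin n → ℝ) → MvPolynomial (Fin n) ℝ → H
  mean_one : mean 1 = 1
  inner_emb : ∀ p q, inner ℝ (emb p) (emb q) = mean (p * q)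
  inner_lap : ∀ d : Fin n → ℝ, (∀ k, 0 < d k) → ∀ u p,
    inner ℝ (lap d u) (emb p) = ∑ k, d k * mean (pderiv k u * pderiv k p)
  bochner : ∀ d : Fin n → ℝ, (∀ k, 0 < d k) → ∀ u,
    ∑ k, d k * (∑ l, d l * mean (pderiv l (pderiv k u) * pderiv l (pderiv k u))) +
      ∑ k, g k * d k ^ 2 * mean (pderiv k u * pderiv k u) ≤ ‖lap d u‖ ^ 2
  mem_closure : ∀ d : Fin n → ℝ, (∀ k, 0 < d k) → ∀ f, mean f = 0 →
    emb f ∈ closure (Set.range (lap d))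
  mean_X : ∀ k, mean (X k) = 0
  mean_X_mul_X : ∀ k l, mean (X k * X l) = if k = l then τ else 0

namespace PolyModel

open MvPolynomial

variable {n : ℕ} {H : Type*} [NormedAddCommGroup H] [InnerProductSpace ℝ H] {g : Fin n → ℝ}
  {τ : ℝ} (M : PolyModel n H g τ)

/-- The Dirichlet form with diffusion coefficients `d`. -/
noncomputable def dir (d : Fin n → ℝ) (p q : MvPolynomial (Fin n) ℝ) : ℝ :=
  ∑ k, d k * M.mean (pderiv k p * pderiv k q)

theorem mean_mul_self_nonneg (p : MvPolynomial (Fin n) ℝ) : 0 ≤ M.mean (p * p) := by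
  rw [← M.inner_emb]; exact real_inner_self_nonneg

theorem norm_emb_sq (p : MvPolynomial (Fin n) ℝ) : ‖M.emb p‖ ^ 2 = M.mean (p * p) := by
  rw [← M.inner_emb, real_inner_self_eq_norm_sq]

theorem dir_nonneg {d : Fin n → ℝ} (hd : ∀ k, 0 < d k) (p : MvPolynomial (Fin n) ℝ) :
    0 ≤ M.dir d p p :=
  Finset.sum_nonneg fun k _ => mul_nonneg (hd k).le (M.mean_mul_self_nonneg _)

theorem two_mul_mean_le {C : ℝ} (hC : 0 < C) (p q : MvPolynomial (Fin n) ℝ) :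
    2 * M.mean (p * q) ≤ C⁻¹ * M.mean (p * p) + C * M.mean (q * q) := by
  have h := M.mean_mul_self_nonneg (p - C • q)
  have e : (p - C • q) * (p - C • q) = p * p - (2 * C) • (p * q) + (C * C) • (q * q) := by
    simp only [smul_eq_C_mul, map_mul]
    rw [map_ofNat]
    ring
  rw [e, map_add, map_sub, map_smul, map_smul, smul_eq_mul, smul_eq_mul] at h
  have h2 := mul_nonneg (inv_pos.2 hC).le h
  have h3 : C⁻¹ * C = 1 := inv_mul_cancel₀ hC.ne'
  have h4 : C⁻¹ * (M.mean (p * p) - 2 * C * M.mean (p * q) + C * C * M.mean (q * q)) =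
    C⁻¹ * M.mean (p * p) - 2 * (C⁻¹ * C) * M.mean (p * q) + (C⁻¹ * C) * (C * M.mean (q * q)) := by
    ring
  rw [h4, h3] at h2
  linarith

theorem two_mul_dir_le {d : Fin n → ℝ} (hd : ∀ k, 0 < d k) {C : ℝ} (hC : 0 < C)
    (p q : MvPolynomial (Fin n) ℝ) :
    2 * M.dir d p q ≤ C⁻¹ * M.dir d p p + C * M.dir d q q := by
  simp only [dir, Finset.mul_sum, ← Finset.sum_add_distrib]
  refine Finset.sum_le_sum fun k _ => ?_
  have := mul_le_mul_of_nonneg_left (M.two_mul_mean_le hC (pderiv k p) (pderiv k q)) (hd k).le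
  linarith

/-- Duality between lower bounds for the Laplacian and Poincaré inequalities. -/
theorem poincare_of_dir_le {d : Fin n → ℝ} (hd : ∀ k, 0 < d k) {C : ℝ} (hC : 0 < C)
    (h : ∀ u, M.dir d u u ≤ C * ‖M.lap d u‖ ^ 2) {f : MvPolynomial (Fin n) ℝ}
    (hf : M.mean f = 0) : M.mean (f * f) ≤ C * M.dir d f f := by
  have key : Set.range (M.lap d) ⊆
      {h : H | M.mean (f * f) - C * M.dir d f f ≤ ‖h - M.emb f‖ ^ 2} := by
    rintro _ ⟨u, rfl⟩
    show M.mean (f * f) - C * M.dir d f f ≤ ‖M.lap d u - M.emb f‖ ^ 2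
    rw [norm_sub_sq_real, M.inner_lap d hd, M.norm_emb_sq]
    have h1 := M.two_mul_dir_le hd hC u f
    have h2 := mul_le_mul_of_nonneg_left (h u) (inv_pos.2 hC).le
    rw [← mul_assoc, inv_mul_cancel₀ hC.ne', one_mul] at h2
    unfold dir at *
    linarith
  have := closure_minimal key (isClosed_le continuous_const (by fun_prop)) (M.mem_closure d hd f hf)
  simp only [Set.mem_ofPred_eq, sub_self, norm_zero] at this
  norm_num at this
  linarith

theorem mean_centered (p : MvPolynomial (Fin n) ℝ) : M.mean (p - C (M.mean p)) = 0 := by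
  have : (C (M.mean p) : MvPolynomial (Fin n) ℝ) = M.mean p • 1 := by rw [smul_eq_C_mul, mul_one]
  rw [map_sub, this, map_smul, M.mean_one, smul_eq_mul, mul_one, sub_self]

theorem mean_centered_mul (p q : MvPolynomial (Fin n) ℝ) :
    M.mean ((p - C (M.mean p)) * q) = M.mean (p * q) - M.mean p * M.mean q := by
  rw [sub_mul, ← smul_eq_C_mul, map_sub, map_smul, smul_eq_mul]

theorem mean_centered_sq (p : MvPolynomial (Fin n) ℝ) :
    M.mean ((p - C (M.mean p)) * (p - C (M.mean p))) = M.mean (p * p) - M.mean p ^ 2 := by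
  rw [mean_centered_mul, M.mean_centered, mul_zero, sub_zero, mul_comm, mean_centered_mul]
  ring

theorem dir_centered (d : Fin n → ℝ) (p : MvPolynomial (Fin n) ℝ) :
    M.dir d (p - C (M.mean p)) (p - C (M.mean p)) = M.dir d p p := by
  simp [dir]

/-- The Brascamp–Lieb inequality. -/
theorem brascampLieb (hg : ∀ k, 0 < g k) {f : MvPolynomial (Fin n) ℝ} (hf : M.mean f = 0) :
    M.mean (f * f) ≤ M.dir (fun k => (g k)⁻¹) f f := by
  have hd : ∀ k, 0 < (g k)⁻¹ := fun k => inv_pos.2 (hg k)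
  have := M.poincare_of_dir_le hd one_pos (fun u => ?_) hf
  · simpa using this
  have h := M.bochner (fun k => (g k)⁻¹) hd u
  have h1 : 0 ≤ ∑ k, (g k)⁻¹ * (∑ l, (g l)⁻¹ *
      M.mean (pderiv l (pderiv k u) * pderiv l (pderiv k u))) :=
    Finset.sum_nonneg fun k _ => mul_nonneg (hd k).le
      (Finset.sum_nonneg fun l _ => mul_nonneg (hd l).le (M.mean_mul_self_nonneg _))
  have h2 : ∑ k, g k * (g k)⁻¹ ^ 2 * M.mean (pderiv k u * pderiv k u) =
      M.dir (fun k => (g k)⁻¹) u u := by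
    refine Finset.sum_congr rfl fun k _ => ?_
    have := (hg k).ne'
    field_simp
  linarith

theorem bessel (hτ : 0 < τ) (h : H) : ∑ k, inner ℝ h (M.emb (X k)) ^ 2 ≤ τ * ‖h‖ ^ 2 := by
  set a : Fin n → ℝ := fun k => inner ℝ h (M.emb (X k)) with ha
  set v : H := ∑ k, a k • M.emb (X k) with hv
  have h1 : inner ℝ h v = ∑ k, a k ^ 2 := by
    rw [hv, inner_sum]
    refine Finset.sum_congr rfl fun k _ => ?_
    rw [inner_smul_right, pow_two]
  have h2 : ‖v‖ ^ 2 = τ * ∑ k, a k ^ 2 := by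
    rw [← real_inner_self_eq_norm_sq, hv, sum_inner, Finset.mul_sum]
    refine Finset.sum_congr rfl fun k _ => ?_
    rw [inner_sum, Finset.sum_eq_single k]
    · rw [inner_smul_left, inner_smul_right, M.inner_emb, M.mean_X_mul_X, if_pos rfl]
      simp; ring
    · intro l _ hl
      rw [inner_smul_left, inner_smul_right, M.inner_emb, M.mean_X_mul_X, if_neg hl.symm]
      simp
    · simp
  have h3 : 0 ≤ ‖τ • h - v‖ ^ 2 := sq_nonneg _
  rw [norm_sub_sq_real, norm_smul, inner_smul_left, h1, h2, Real.norm_of_nonneg hτ.le] at h3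
  simp only [conj_trivial] at h3
  have h4 : 0 ≤ τ * (τ * ‖h‖ ^ 2 - ∑ k, a k ^ 2) := by nlinarith
  have := nonneg_of_mul_nonneg_right h4 hτ
  linarith

theorem inner_lap_X {d : Fin n → ℝ} (hd : ∀ k, 0 < d k) (u : MvPolynomial (Fin n) ℝ) (k : Fin n) :
    inner ℝ (M.lap d u) (M.emb (X k)) = d k * M.mean (pderiv k u) := by
  rw [M.inner_lap d hd, Finset.sum_eq_single k]
  · simp
  · intro l _ hl
    simp [pderiv_X_of_ne hl.symm]
  · simp

/-- The improved Poincaré inequality: the constant is `√(τ / g₀)` rather than `1 / g₀`. -/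
theorem poincare_sqrt (hτ : 0 < τ) {d : Fin n → ℝ} (hd : ∀ k, 1 ≤ d k) {g₀ : ℝ} (hg₀ : 0 < g₀)
    (hgd : ∀ k, g₀ ≤ g k * d k) {f : MvPolynomial (Fin n) ℝ} (hf : M.mean f = 0) :
    M.mean (f * f) ≤ √(τ / g₀) * M.dir d f f := by
  have hd0 : ∀ k, 0 < d k := fun k => one_pos.trans_le (hd k)
  set S : Set ℝ := {C | 0 ≤ C ∧ ∀ f, M.mean f = 0 → M.mean (f * f) ≤ C * M.dir d f f} with hS
  have hcurv : ∀ u, ∑ k, d k * M.dir d (pderiv k u) (pderiv k u) + g₀ * M.dir d u u ≤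
      ‖M.lap d u‖ ^ 2 := by
    intro u
    refine le_trans (add_le_add le_rfl ?_) (M.bochner d hd0 u)
    rw [dir, Finset.mul_sum]
    refine Finset.sum_le_sum fun k _ => ?_
    have := mul_le_mul_of_nonneg_right (hgd k)
      (mul_nonneg (hd0 k).le (M.mean_mul_self_nonneg (pderiv k u)))
    linarith
  have hdd : ∀ u, 0 ≤ ∑ k, d k * M.dir d (pderiv k u) (pderiv k u) := fun u =>
    Finset.sum_nonneg fun k _ => mul_nonneg (hd0 k).le (M.dir_nonneg hd0 _)
  have hne : S.Nonempty := by
    refine ⟨g₀⁻¹, (inv_pos.2 hg₀).le, fun f hf => M.poincare_of_dir_le hd0 (inv_pos.2 hg₀)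
      (fun u => ?_) hf⟩
    rw [inv_mul_eq_div, le_div_iff₀ hg₀]
    linarith [hcurv u, hdd u]
  have hstep : ∀ C ∈ S, (C + τ) / (1 + g₀ * C) ∈ S := by
    rintro C ⟨hC0, hC⟩
    have hpos : 0 < (C + τ) / (1 + g₀ * C) := by positivity
    refine ⟨hpos.le, fun f hf => M.poincare_of_dir_le hd0 hpos (fun u => ?_) hf⟩
    have h1 : M.dir d u u ≤ τ * ‖M.lap d u‖ ^ 2 +
        C * ∑ k, d k * M.dir d (pderiv k u) (pderiv k u) := by
      refine le_trans ?_ (add_le_add (M.bessel hτ (M.lap d u)) le_rfl)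
      rw [dir, Finset.mul_sum, ← Finset.sum_add_distrib]
      refine Finset.sum_le_sum fun k _ => ?_
      rw [M.inner_lap_X hd0]
      have h2 := hC _ (M.mean_centered (pderiv k u))
      rw [M.mean_centered_sq, M.dir_centered] at h2
      have h3 := mul_le_mul_of_nonneg_left h2 (hd0 k).le
      have h4 : 0 ≤ d k * (d k - 1) * M.mean (pderiv k u) ^ 2 :=
        mul_nonneg (mul_nonneg (hd0 k).le (by linarith [hd k])) (sq_nonneg _)
      nlinarith
    rw [div_mul_eq_mul_div, le_div_iff₀ (by positivity)]
    nlinarith [mul_le_mul_of_nonneg_left (hcurv u) hC0]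
  have hbdd : BddBelow S := ⟨0, fun C hC => hC.1⟩
  have h0 : 0 ≤ sInf S := le_csInf hne fun C hC => hC.1
  have hinf : sInf S ∈ S := by
    refine ⟨h0, fun f hf => ?_⟩
    rcases (M.dir_nonneg hd0 f).eq_or_lt with h | h
    · obtain ⟨C, hC⟩ := hne
      have := hC.2 f hf
      rw [← h] at this ⊢
      simpa using this
    · rw [← div_le_iff₀ h]
      refine le_csInf hne fun C hC => ?_
      rw [div_le_iff₀ h]
      exact hC.2 f hf
  have h1 := csInf_le hbdd (hstep _ hinf)
  rw [le_div_iff₀ (by positivity)] at h1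
  have h2 : sInf S ≤ √(τ / g₀) := by
    refine Real.le_sqrt_of_sq_le ?_
    rw [le_div_iff₀ hg₀]
    nlinarith
  exact (hinf.2 f hf).trans (mul_le_mul_of_nonneg_right h2 (M.dir_nonneg hd0 f))

theorem mean_linear_sq (s : Finset (Fin n)) (c : Fin n → ℝ) :
    M.mean ((∑ j ∈ s, c j • X j) * (∑ j ∈ s, c j • X j)) = τ * ∑ j ∈ s, c j ^ 2 := by
  rw [Finset.sum_mul_sum, map_sum, Finset.mul_sum]
  refine Finset.sum_congr rfl fun j hj => ?_
  rw [map_sum, Finset.sum_eq_single_of_mem j hj]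
  · rw [smul_mul_smul_comm, map_smul, M.mean_X_mul_X, if_pos rfl, smul_eq_mul]; ring
  · intro l _ hl
    rw [smul_mul_smul_comm, map_smul, M.mean_X_mul_X, if_neg hl.symm, smul_zero]

/-- The third moments in the directions of large curvature. -/
theorem sum_third_moment_sq_le (hτ : 0 < τ) (hg : ∀ k, 0 < g k) (i : Fin n) (s : Finset (Fin n))
    (hs : ∀ k ∈ s, g i ≤ g k) :
    ∑ j ∈ s, ∑ k ∈ s, M.mean (X i * X j * X k) ^ 2 ≤ 4 * τ ^ 2 * √(τ / g i) := by
  set c : Fin n → Fin n → ℝ := fun j k => M.mean (X i * X j * X k) with hc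
  have hcs : ∀ j k, c j k = c k j := fun j k => by simp only [hc]; congr 1; ring
  set S := ∑ j ∈ s, ∑ k ∈ s, c j k ^ 2 with hS
  set f₀ : MvPolynomial (Fin n) ℝ := ∑ j ∈ s, ∑ k ∈ s, c j k • (X j * X k) with hf₀
  set d : Fin n → ℝ := fun k => max 1 (g i / g k) with hd
  have hd1 : ∀ k, 1 ≤ d k := fun k => le_max_left _ _
  have hgd : ∀ k, g i ≤ g k * d k := fun k => by
    have : g k * (g i / g k) = g i := mul_div_cancel₀ _ (hg k).ne'
    calc g i = g k * (g i / g k) := this.symm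
      _ ≤ _ := mul_le_mul_of_nonneg_left (le_max_right _ _) (hg k).le
  have h1 := M.poincare_sqrt hτ hd1 (hg i) hgd (M.mean_centered f₀)
  rw [M.dir_centered] at h1
  have hder : ∀ k, pderiv k f₀ = if k ∈ s then (2 : ℝ) • ∑ j ∈ s, c k j • X j else 0 := by
    intro k
    have hX : ∀ j, pderiv k (X j : MvPolynomial (Fin n) ℝ) = if j = k then 1 else 0 := by
      intro j
      rw [pderiv_X]
      simp [Pi.single_apply, eq_comm]
    have hterm : ∀ j l, pderiv k (c j l • (X j * X l : MvPolynomial (Fin n) ℝ)) =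
        (if l = k then c j l • X j else 0) + if j = k then c j l • X l else 0 := by
      intro j l
      rw [Derivation.map_smul, Derivation.leibniz, hX, hX]
      split_ifs <;> simp
    simp only [hf₀, map_sum, hterm, Finset.sum_add_distrib]
    rw [Finset.sum_comm (f := fun j l => if j = k then c j l • X l else 0)]
    simp only [Finset.sum_ite_eq']
    split_ifs with hk
    · rw [two_smul]
      congr 1
      exact Finset.sum_congr rfl fun j _ => by rw [hcs]
    · simp
  have h2 : M.dir d f₀ f₀ = 4 * τ * S := by
    simp only [dir, hder]
    rw [hS, Finset.mul_sum, ← Finset.sum_subset (Finset.subset_univ s)]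
    · refine Finset.sum_congr rfl fun k hk => ?_
      have hdk : d k = 1 := by
        rw [hd]
        refine max_eq_left ?_
        rw [div_le_one (hg k)]
        exact hs k hk
      rw [if_pos hk, smul_mul_smul_comm, map_smul, M.mean_linear_sq, hdk, smul_eq_mul]
      ring
    · intro k _ hk
      simp [hk]
  have h3 := M.bessel hτ (M.emb (f₀ - C (M.mean f₀)))
  rw [M.norm_emb_sq] at h3
  have h4 := (Finset.single_le_sum (f := fun k => inner ℝ (M.emb (f₀ - C (M.mean f₀)))
    (M.emb (X k)) ^ 2) (fun k _ => sq_nonneg _) (Finset.mem_univ i)).trans h3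
  have h5 : M.mean (f₀ * X i) = S := by
    simp only [hf₀, Finset.sum_mul, map_sum, hS]
    refine Finset.sum_congr rfl fun j _ => Finset.sum_congr rfl fun k _ => ?_
    rw [smul_mul_assoc, map_smul, smul_eq_mul, pow_two]
    congr 1
    simp only [hc]; congr 1; ring
  simp only [M.inner_emb, M.mean_centered_mul f₀ (X i), M.mean_X, mul_zero, sub_zero, h5] at h4
  rw [h2] at h1
  have hS0 : 0 ≤ S := Finset.sum_nonneg fun _ _ => Finset.sum_nonneg fun _ _ => sq_nonneg _
  have h6 : S * S ≤ 4 * τ ^ 2 * √(τ / g i) * S := by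
    nlinarith [mul_le_mul_of_nonneg_left h1 hτ.le]
  rcases hS0.eq_or_lt with h | h
  · rw [← h]; positivity
  · exact le_of_mul_le_mul_right h6 h

theorem three_halves_mul_mean_le (hg : ∀ k, 0 < g k) {f : MvPolynomial (Fin n) ℝ}
    (hf : M.mean f = 0) :
    (3 / 2) * M.mean (f * f) - (1 / 2) * ∑ k, g k * M.mean (f * X k) ^ 2 ≤
      M.dir (fun k => (g k)⁻¹) f f := by
  set d : Fin n → ℝ := fun k => (g k)⁻¹ with hd
  have hd0 : ∀ k, 0 < d k := fun k => inv_pos.2 (hg k)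
  have key : Set.range (M.lap d) ⊆ {h : H | 2 * inner ℝ h (M.emb f) - (1 / 2) * ‖h‖ ^ 2 -
      (1 / 2) * ∑ k, g k * inner ℝ h (M.emb (X k)) ^ 2 ≤ M.dir d f f} := by
    rintro _ ⟨u, rfl⟩
    show 2 * inner ℝ (M.lap d u) (M.emb f) - (1 / 2) * ‖M.lap d u‖ ^ 2 -
      (1 / 2) * ∑ k, g k * inner ℝ (M.lap d u) (M.emb (X k)) ^ 2 ≤ M.dir d f f
    have h1 := M.two_mul_dir_le hd0 one_pos u f
    have h2 := M.bochner d hd0 u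
    have h3 : ∑ k, d k * M.mean (pderiv k u * pderiv k u) -
        ∑ k, g k * inner ℝ (M.lap d u) (M.emb (X k)) ^ 2 ≤
        ∑ k, d k * (∑ l, d l * M.mean (pderiv l (pderiv k u) * pderiv l (pderiv k u))) := by
      rw [← Finset.sum_sub_distrib]
      refine Finset.sum_le_sum fun k _ => ?_
      have h4 := M.brascampLieb hg (M.mean_centered (pderiv k u))
      rw [M.mean_centered_sq, M.dir_centered] at h4
      have h5 := mul_le_mul_of_nonneg_left h4 (hd0 k).le
      rw [M.inner_lap_X hd0]
      have h6 : g k * (d k * M.mean (pderiv k u)) ^ 2 = d k * M.mean (pderiv k u) ^ 2 := by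
        have := (hg k).ne'
        simp only [hd]; field_simp
      rw [h6]
      unfold dir at h5
      linarith
    have h7 : ∑ k, g k * d k ^ 2 * M.mean (pderiv k u * pderiv k u) = M.dir d u u := by
      refine Finset.sum_congr rfl fun k _ => ?_
      have := (hg k).ne'
      simp only [hd]; field_simp
    rw [M.inner_lap d hd0 u f]
    unfold dir at *
    linarith
  have := closure_minimal key (isClosed_le (by fun_prop) continuous_const)
    (M.mem_closure d hd0 f hf)
  simp only [Set.mem_ofPred_eq, M.norm_emb_sq, M.inner_emb] at this
  linarith

/-- The sharp third moment estimate. -/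
theorem sum_third_moment_sq_div_le (hτ : 0 < τ) (hτ' : τ < 5) (hg : ∀ k, 0 < g k)
    (hg1 : ∀ k, g k ≤ 1) (i : Fin n) :
    (1 / 2) * ∑ k, ∑ l, M.mean (X i * X k * X l) ^ 2 /
      ((g k)⁻¹ * (5 / (2 * τ) - g l / 2)⁻¹ + (g l)⁻¹ * (5 / (2 * τ) - g k / 2)⁻¹) ≤
      τ - g i * τ ^ 2 := by
  set d : Fin n → ℝ := fun k => (g k)⁻¹ with hd
  have hd0 : ∀ k, 0 < d k := fun k => inv_pos.2 (hg k)
  set q : Fin n → ℝ := fun k => 5 / (2 * τ) - g k / 2 with hq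
  have hq0 : ∀ k, 0 < q k := fun k => by
    have : 1 / 2 < 5 / (2 * τ) := by
      rw [div_lt_div_iff₀ (by norm_num) (by positivity)]; linarith
    simp only [hq]; linarith [hg1 k]
  have key : Set.range (M.lap d) ⊆ {h : H | (1 / 2) * ∑ k, ∑ l,
      inner ℝ h (M.emb (X k * X l)) ^ 2 / (d k * (q l)⁻¹ + d l * (q k)⁻¹) ≤
      ‖h‖ ^ 2 - g i * inner ℝ h (M.emb (X i)) ^ 2} := by
    rintro _ ⟨u, rfl⟩
    show (1 / 2) * ∑ k, ∑ l,
      inner ℝ (M.lap d u) (M.emb (X k * X l)) ^ 2 / (d k * (q l)⁻¹ + d l * (q k)⁻¹) ≤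
      ‖M.lap d u‖ ^ 2 - g i * inner ℝ (M.lap d u) (M.emb (X i)) ^ 2
    set c : Fin n → Fin n → ℝ := fun k l => M.mean (pderiv k u * X l) with hc
    have hinner : ∀ k l, inner ℝ (M.lap d u) (M.emb (X k * X l)) = d k * c k l + d l * c l k := by
      intro k l
      rw [M.inner_lap d hd0]
      simp only [Derivation.leibniz, smul_eq_mul, mul_add, map_add, Finset.sum_add_distrib]
      rw [add_comm]
      congr 1
      · rw [Finset.sum_eq_single k]
        · rw [pderiv_X_self, mul_one]
        · intro j _ hj
          rw [pderiv_X_of_ne hj.symm, mul_zero, mul_zero, map_zero, mul_zero]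
        · simp
      · rw [Finset.sum_eq_single l]
        · rw [pderiv_X_self, mul_one]
        · intro j _ hj
          rw [pderiv_X_of_ne hj.symm, mul_zero, mul_zero, map_zero, mul_zero]
        · simp
    have h1 : ∑ k, ∑ l, inner ℝ (M.lap d u) (M.emb (X k * X l)) ^ 2 /
        (d k * (q l)⁻¹ + d l * (q k)⁻¹) ≤ ∑ k, ∑ l, (d k * q l * c k l ^ 2 + d l * q k * c l k ^ 2) := by
      refine Finset.sum_le_sum fun k _ => Finset.sum_le_sum fun l _ => ?_
      have hk := hd0 k
      have hl := hd0 l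
      have hqk := hq0 k
      have hql := hq0 l
      rw [hinner, div_le_iff₀ (by positivity)]
      have e : (d k * q l * c k l ^ 2 + d l * q k * c l k ^ 2) *
          (d k * (q l)⁻¹ + d l * (q k)⁻¹) - (d k * c k l + d l * c l k) ^ 2 =
          d k * d l * (q l * c k l - q k * c l k) ^ 2 / (q k * q l) := by
        field_simp
        ring
      have : 0 ≤ d k * d l * (q l * c k l - q k * c l k) ^ 2 / (q k * q l) := by positivity
      linarith
    have h2 : ∑ k, ∑ l, (d k * q l * c k l ^ 2 + d l * q k * c l k ^ 2) =
        2 * ∑ k, d k * ∑ l, q l * c k l ^ 2 := by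
      simp only [Finset.sum_add_distrib]
      rw [Finset.sum_comm (f := fun k l => d l * q k * c l k ^ 2), ← two_mul]
      simp only [Finset.mul_sum, mul_assoc]
    have h3 : ∀ k, ∑ l, q l * c k l ^ 2 ≤ M.dir d (pderiv k u) (pderiv k u) +
        (M.mean (pderiv k u * pderiv k u) - M.mean (pderiv k u) ^ 2) := by
      intro k
      have h4 := M.three_halves_mul_mean_le hg (M.mean_centered (pderiv k u))
      have h5 := M.bessel hτ (M.emb (pderiv k u - C (M.mean (pderiv k u))))
      have h8 : ∀ l, M.mean ((pderiv k u - C (M.mean (pderiv k u))) * X l) = c k l := fun l => by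
        rw [M.mean_centered_mul, M.mean_X, mul_zero, sub_zero]
      simp only [M.norm_emb_sq, M.inner_emb, M.mean_centered_sq, h8, M.dir_centered] at h4 h5
      have h6 : ∑ l, q l * c k l ^ 2 = 5 / (2 * τ) * ∑ l, c k l ^ 2 -
          (1 / 2) * ∑ l, g l * c k l ^ 2 := by
        rw [Finset.mul_sum, Finset.mul_sum, ← Finset.sum_sub_distrib]
        exact Finset.sum_congr rfl fun l _ => by simp only [hq]; ring
      have h7 : 5 / (2 * τ) * ∑ l, c k l ^ 2 ≤
          5 / 2 * (M.mean (pderiv k u * pderiv k u) - M.mean (pderiv k u) ^ 2) := by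
        rw [div_mul_eq_mul_div, div_le_iff₀ (by positivity)]
        linarith
      linarith
    have h9 : ∑ k, d k * ∑ l, q l * c k l ^ 2 ≤ ∑ k, d k * M.dir d (pderiv k u) (pderiv k u) +
        M.dir d u u - ∑ k, d k * M.mean (pderiv k u) ^ 2 := by
      rw [dir, ← Finset.sum_add_distrib, ← Finset.sum_sub_distrib]
      refine Finset.sum_le_sum fun k _ => ?_
      linarith [mul_le_mul_of_nonneg_left (h3 k) (hd0 k).le]
    have h10 := M.bochner d hd0 u
    have h11 : ∑ k, g k * d k ^ 2 * M.mean (pderiv k u * pderiv k u) = M.dir d u u := by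
      refine Finset.sum_congr rfl fun k _ => ?_
      have := (hg k).ne'
      simp only [hd]; field_simp
    have h12 : g i * inner ℝ (M.lap d u) (M.emb (X i)) ^ 2 ≤ ∑ k, d k * M.mean (pderiv k u) ^ 2 := by
      refine le_trans (le_of_eq ?_) (Finset.single_le_sum
        (f := fun k => d k * M.mean (pderiv k u) ^ 2)
        (fun k _ => mul_nonneg (hd0 k).le (sq_nonneg _)) (Finset.mem_univ i))
      rw [M.inner_lap_X hd0]
      have := (hg i).ne'
      simp only [hd]; field_simp
    rw [h11] at h10
    unfold dir at *
    linarith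
  have := closure_minimal key (isClosed_le (by fun_prop) (by fun_prop))
    (M.mem_closure d hd0 (X i) (M.mean_X i))
  simp only [Set.mem_ofPred_eq, M.norm_emb_sq, M.inner_emb, M.mean_X_mul_X, if_true] at this
  simpa only [mul_assoc] using this

end PolyModel

section GaussianAlgebra

open MvPolynomial

theorem MvPolynomial.pderiv_pderiv_comm {σ : Type*} {A : Type*} [CommRing A] (i j : σ)
    (p : MvPolynomial σ A) : pderiv i (pderiv j p) = pderiv j (pderiv i p) := by
  classical
  have h : ⁅(pderiv i : Derivation A (MvPolynomial σ A) (MvPolynomial σ A)),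
      (pderiv j : Derivation A (MvPolynomial σ A) (MvPolynomial σ A))⁆ = 0 := by
    refine MvPolynomial.derivation_ext fun k => ?_
    rw [Derivation.commutator_apply, pderiv_X, pderiv_X, Derivation.coe_zero, Pi.zero_apply]
    simp only [Pi.single_apply]
    split_ifs <;> simp
  have h2 := congrArg (fun D => D p) h
  simp only [Derivation.commutator_apply, Derivation.coe_zero, Pi.zero_apply] at h2
  exact sub_eq_zero.1 h2

variable {n : ℕ}

/-- The Ornstein–Uhlenbeck operator centered at `y`. -/
noncomputable def ouPoly (s : ℝ) (y d : Fin n → ℝ) (u : MvPolynomial (Fin n) ℝ) :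
    MvPolynomial (Fin n) ℝ :=
  ∑ k, C (d k) * (C s * ((X k - C (y k)) * pderiv k u) - pderiv k (pderiv k u))

variable {s : ℝ} {y : Fin n → ℝ} {ℓ : MvPolynomial (Fin n) ℝ →ₗ[ℝ] ℝ}

theorem mean_ouPoly_mul
    (h : ∀ k p, ℓ (pderiv k p) = s * ℓ ((X k - C (y k)) * p)) (d : Fin n → ℝ)
    (u p : MvPolynomial (Fin n) ℝ) :
    ℓ (ouPoly s y d u * p) = ∑ k, d k * ℓ (pderiv k u * pderiv k p) := by
  rw [ouPoly, Finset.sum_mul, map_sum]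
  refine Finset.sum_congr rfl fun k _ => ?_
  have h1 := h k (pderiv k u * p)
  rw [Derivation.leibniz, smul_eq_mul, smul_eq_mul, map_add] at h1
  have e : C (d k) * (C s * ((X k - C (y k)) * pderiv k u) - pderiv k (pderiv k u)) * p =
      d k • (s • ((X k - C (y k)) * (pderiv k u * p)) - p * pderiv k (pderiv k u)) := by
    rw [smul_eq_C_mul, smul_eq_C_mul]; ring
  rw [e, map_smul, map_sub, map_smul, smul_eq_mul, smul_eq_mul, ← h1]
  ring

theorem pderiv_ouPoly (d : Fin n → ℝ) (u : MvPolynomial (Fin n) ℝ) (k : Fin n) :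
    pderiv k (ouPoly s y d u) = ouPoly s y d (pderiv k u) + (s * d k) • pderiv k u := by
  have hX : ∀ j, pderiv k (X j : MvPolynomial (Fin n) ℝ) = if j = k then 1 else 0 := by
    intro j
    rw [pderiv_X]
    simp [Pi.single_apply, eq_comm]
  have e : ∀ j, pderiv k (C (d j) * (C s * ((X j - C (y j)) * pderiv j u) -
      pderiv j (pderiv j u))) = C (d j) * (C s * ((X j - C (y j)) * pderiv j (pderiv k u)) -
      pderiv j (pderiv j (pderiv k u))) + if j = k then (s * d j) • pderiv j u else 0 := by
    intro j
    rw [pderiv_C_mul, map_sub, pderiv_C_mul, Derivation.leibniz, map_sub, pderiv_C, hX,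
      pderiv_pderiv_comm k j (pderiv j u), pderiv_pderiv_comm k j u, sub_zero]
    simp only [smul_eq_C_mul, smul_eq_mul, map_mul]
    split_ifs <;> ring
  rw [ouPoly, map_sum, ouPoly]
  simp only [e, Finset.sum_add_distrib, Finset.sum_ite_eq', Finset.mem_univ, if_true]

theorem mean_ouPoly_sq
    (h : ∀ k p, ℓ (pderiv k p) = s * ℓ ((X k - C (y k)) * p)) (d : Fin n → ℝ)
    (u : MvPolynomial (Fin n) ℝ) :
    ℓ (ouPoly s y d u * ouPoly s y d u) =
      ∑ k, d k * (∑ l, d l * ℓ (pderiv l (pderiv k u) * pderiv l (pderiv k u))) +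
      s * ∑ k, d k ^ 2 * ℓ (pderiv k u * pderiv k u) := by
  rw [mean_ouPoly_mul h, Finset.mul_sum, ← Finset.sum_add_distrib]
  refine Finset.sum_congr rfl fun k _ => ?_
  rw [pderiv_ouPoly, mul_add, map_add, mul_comm (pderiv k u) (ouPoly s y d (pderiv k u)),
    mean_ouPoly_mul h, mul_smul_comm, map_smul, smul_eq_mul]
  ring

end GaussianAlgebra

section Growth

variable {n : ℕ} {R : ℝ}

/-- Exponential growth in the first variable, uniformly for the second variable in a box. -/
def ExpGrowth (R : ℝ) (Φ : (Fin n → ℝ) → (Fin n → ℝ) → ℝ) : Prop :=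
  Measurable (fun z : (Fin n → ℝ) × (Fin n → ℝ) => Φ z.1 z.2) ∧
  ∃ c a : ℝ, 0 ≤ c ∧ 0 ≤ a ∧ ∀ x y, (∀ k, |y k| ≤ R) → |Φ x y| ≤ c * Real.exp (a * ∑ k, |x k|)

namespace ExpGrowth

variable {Φ Ψ : (Fin n → ℝ) → (Fin n → ℝ) → ℝ}

theorem const (c : ℝ) : ExpGrowth (n := n) R fun _ _ => c :=
  ⟨measurable_const, |c|, 0, abs_nonneg c, le_rfl, fun x y _ => by simp⟩

theorem add (h : ExpGrowth R Φ) (h' : ExpGrowth R Ψ) : ExpGrowth R fun x y => Φ x y + Ψ x y := by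
  obtain ⟨m, c, a, hc, ha, H⟩ := h
  obtain ⟨m', c', a', hc', ha', H'⟩ := h'
  refine ⟨m.add m', c + c', a + a', by positivity, by positivity, fun x y hy => ?_⟩
  have hS : 0 ≤ ∑ k, |x k| := Finset.sum_nonneg fun _ _ => abs_nonneg _
  calc |Φ x y + Ψ x y| ≤ |Φ x y| + |Ψ x y| := abs_add_le _ _
    _ ≤ c * Real.exp (a * ∑ k, |x k|) + c' * Real.exp (a' * ∑ k, |x k|) :=
        add_le_add (H x y hy) (H' x y hy)
    _ ≤ c * Real.exp ((a + a') * ∑ k, |x k|) + c' * Real.exp ((a + a') * ∑ k, |x k|) := by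
        gcongr <;> linarith
    _ = _ := by ring

theorem mul (h : ExpGrowth R Φ) (h' : ExpGrowth R Ψ) : ExpGrowth R fun x y => Φ x y * Ψ x y := by
  obtain ⟨m, c, a, hc, ha, H⟩ := h
  obtain ⟨m', c', a', hc', ha', H'⟩ := h'
  refine ⟨m.mul m', c * c', a + a', by positivity, by positivity, fun x y hy => ?_⟩
  rw [abs_mul, add_mul, Real.exp_add]
  calc _ ≤ (c * Real.exp (a * ∑ k, |x k|)) * (c' * Real.exp (a' * ∑ k, |x k|)) :=
        mul_le_mul (H x y hy) (H' x y hy) (abs_nonneg _) (by positivity)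
    _ = _ := by ring

theorem const_mul (c : ℝ) (h : ExpGrowth R Φ) : ExpGrowth R fun x y => c * Φ x y :=
  (const c).mul h

theorem neg (h : ExpGrowth R Φ) : ExpGrowth R fun x y => - Φ x y := by
  simpa using h.const_mul (-1)

theorem sub (h : ExpGrowth R Φ) (h' : ExpGrowth R Ψ) : ExpGrowth R fun x y => Φ x y - Ψ x y := by
  simpa [sub_eq_add_neg] using h.add h'.neg

theorem sum {ι : Type*} (t : Finset ι) {Φ : ι → (Fin n → ℝ) → (Fin n → ℝ) → ℝ}
    (h : ∀ i ∈ t, ExpGrowth R (Φ i)) : ExpGrowth R fun x y => ∑ i ∈ t, Φ i x y := by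
  classical
  induction t using Finset.induction_on with
  | empty => simpa using const 0
  | insert i t hi ih =>
    simp only [Finset.sum_insert hi]
    exact (h i (Finset.mem_insert_self i t)).add
      (ih fun j hj => h j (Finset.mem_insert_of_mem hj))

theorem exp_linear (θ : Fin n → ℝ) : ExpGrowth R fun x _ => Real.exp (∑ k, θ k * x k) := by
  refine ⟨by fun_prop, 1, ∑ k, |θ k|, zero_le_one, Finset.sum_nonneg fun _ _ => abs_nonneg _,
    fun x y _ => ?_⟩
  rw [abs_of_pos (Real.exp_pos _), one_mul, Finset.sum_mul]
  refine Real.exp_le_exp.2 (Finset.sum_le_sum fun k _ => ?_)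
  calc θ k * x k ≤ |θ k * x k| := le_abs_self _
    _ = |θ k| * |x k| := abs_mul _ _
    _ ≤ _ := by
      gcongr
      exact Finset.single_le_sum (f := fun k => |x k|) (fun _ _ => abs_nonneg _) (Finset.mem_univ k)

theorem fst (k : Fin n) : ExpGrowth R fun x _ => x k := by
  refine ⟨by fun_prop, 1, 1, zero_le_one, zero_le_one, fun x y _ => ?_⟩
  rw [one_mul, one_mul]
  have h1 : |x k| ≤ ∑ k, |x k| :=
    Finset.single_le_sum (f := fun k => |x k|) (fun _ _ => abs_nonneg _) (Finset.mem_univ k)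
  have h2 := Real.add_one_le_exp (∑ k, |x k|)
  linarith

theorem snd (hR : 0 ≤ R) (k : Fin n) : ExpGrowth R fun _ y => y k :=
  ⟨by fun_prop, R, 0, hR, le_rfl, fun x y hy => by simpa using hy k⟩

theorem poly (p : MvPolynomial (Fin n) ℝ) : ExpGrowth R fun x _ => MvPolynomial.eval x p := by
  induction p using MvPolynomial.induction_on with
  | C a => simpa using const a
  | add p q hp hq => simpa using hp.add hq
  | mul_X p k hp => simpa using hp.mul (fst k)

end ExpGrowth

theorem integrable_exp_abs_sub_sq (a : ℝ) {b : ℝ} (hb : 0 < b) :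
    Integrable fun x : Fin n → ℝ => Real.exp (a * ∑ k, |x k| - b * ∑ k, x k ^ 2) := by
  have h1 : Integrable fun t : ℝ => Real.exp (a * |t| - b * t ^ 2) := by
    have h2 := (integrable_exp_neg_mul_sq (half_pos hb)).const_mul (Real.exp (a ^ 2 / (2 * b)))
    refine h2.mono' (by fun_prop) (Filter.Eventually.of_forall fun t => ?_)
    rw [Real.norm_of_nonneg (Real.exp_pos _).le, ← Real.exp_add]
    refine Real.exp_le_exp.2 ?_
    have h3 : 0 ≤ (b * |t| - a) ^ 2 / (2 * b) := by positivity
    have h4 : (b * |t| - a) ^ 2 / (2 * b) = b / 2 * t ^ 2 - a * |t| + a ^ 2 / (2 * b) := by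
      rw [← sq_abs t]; field_simp; ring
    linarith
  have h5 := Integrable.fintype_prod (μ := fun _ : Fin n => (volume : Measure ℝ))
    (f := fun _ t => Real.exp (a * |t| - b * t ^ 2)) fun _ => h1
  rw [← volume_pi] at h5
  refine h5.congr (Filter.Eventually.of_forall fun x => ?_)
  simp only [← Real.exp_sum, Finset.sum_sub_distrib, Finset.mul_sum]

end Growth

section Smoothing

variable {n : ℕ} {R s : ℝ} {μ : Measure (Fin n → ℝ)}

/-- The normalizing constant of the Gaussian density with precision `s`. -/
noncomputable def gaussConst (n : ℕ) (s : ℝ) : ℝ :=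
  (∫ z : Fin n → ℝ, Real.exp (-(s / 2) * ∑ k, z k ^ 2))⁻¹

/-- The Gaussian density of precision `s` centered at `y`. -/
noncomputable def gaussKer (s : ℝ) (x y : Fin n → ℝ) : ℝ :=
  gaussConst n s * Real.exp (-(s / 2) * ∑ k, (x k - y k) ^ 2)

/-- The density of the convolution of `μ` with a Gaussian. -/
noncomputable def smoothDensity (s : ℝ) (μ : Measure (Fin n → ℝ)) (x : Fin n → ℝ) : ℝ :=
  ∫ y, gaussKer s x y ∂μ

/-- The convolution of `μ` with a Gaussian of precision `s`. -/
noncomputable def smoothing (s : ℝ) (μ : Measure (Fin n → ℝ)) : Measure (Fin n → ℝ) :=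
  volume.withDensity fun x => ENNReal.ofReal (smoothDensity s μ x)

/-- The posterior law of `y` given the noisy observation `x`. -/
noncomputable def posterior (s : ℝ) (μ : Measure (Fin n → ℝ)) (x : Fin n → ℝ) :
    Measure (Fin n → ℝ) :=
  μ.tilted (quadPot (s • (1 : Matrix (Fin n) (Fin n) ℝ)) (s • x))

/-- The posterior average of a function. -/
noncomputable def posteriorAvg (s : ℝ) (μ : Measure (Fin n → ℝ))
    (Φ : (Fin n → ℝ) → (Fin n → ℝ) → ℝ) (x : Fin n → ℝ) : ℝ :=
  ∫ y, Φ x y ∂(posterior s μ x)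

theorem quadPot_smul_one (s : ℝ) (x y : Fin n → ℝ) :
    quadPot (s • (1 : Matrix (Fin n) (Fin n) ℝ)) (s • x) y =
      s / 2 * ∑ k, x k ^ 2 - s / 2 * ∑ k, (x k - y k) ^ 2 := by
  simp only [quadPot, Matrix.smul_mulVec, Matrix.one_mulVec, dotProduct, Pi.smul_apply,
    smul_eq_mul, Finset.mul_sum, ← Finset.sum_sub_distrib]
  exact Finset.sum_congr rfl fun k _ => by ring

theorem integrable_exp_neg_sum_sq (hs : 0 < s) :
    Integrable fun z : Fin n → ℝ => Real.exp (-(s / 2) * ∑ k, z k ^ 2) := by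
  simpa [neg_mul, zero_sub] using integrable_exp_abs_sub_sq (n := n) 0 (half_pos hs)

theorem gaussConst_pos (hs : 0 < s) : 0 < gaussConst n s :=
  inv_pos.2 (integral_exp_pos (integrable_exp_neg_sum_sq hs))

theorem gaussKer_pos (hs : 0 < s) (x y : Fin n → ℝ) : 0 < gaussKer s x y :=
  mul_pos (gaussConst_pos hs) (Real.exp_pos _)

@[fun_prop]
theorem continuous_gaussKer {X : Type*} [TopologicalSpace X] {x y : X → Fin n → ℝ}
    (hx : Continuous x) (hy : Continuous y) : Continuous fun p => gaussKer s (x p) (y p) := by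
  unfold gaussKer
  fun_prop

theorem integral_gaussKer (hs : 0 < s) (y : Fin n → ℝ) : ∫ x, gaussKer s x y = 1 := by
  have h := integral_sub_right_eq_self (μ := (volume : Measure (Fin n → ℝ)))
    (fun z : Fin n → ℝ => Real.exp (-(s / 2) * ∑ k, z k ^ 2)) y
  simp only [Pi.sub_apply] at h
  simp only [gaussKer]
  rw [integral_const_mul, h, gaussConst, inv_mul_cancel₀]
  exact (integral_exp_pos (integrable_exp_neg_sum_sq hs)).ne'

theorem gaussKer_le (hs : 0 < s) {x y : Fin n → ℝ} (hy : ∀ k, |y k| ≤ R) :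
    gaussKer s x y ≤ gaussConst n s * Real.exp (s / 2 * (n * R ^ 2)) *
      Real.exp (-(s / 4 * ∑ k, x k ^ 2)) := by
  rw [gaussKer, mul_assoc, ← Real.exp_add]
  refine mul_le_mul_of_nonneg_left (Real.exp_le_exp.2 ?_) (gaussConst_pos hs).le
  have h : ∑ k, x k ^ 2 / 2 ≤ ∑ k, ((x k - y k) ^ 2 + R ^ 2) := by
    refine Finset.sum_le_sum fun k _ => ?_
    have := sq_le_sq' (abs_le.1 (hy k)).1 (abs_le.1 (hy k)).2
    nlinarith [sq_nonneg (x k - 2 * y k)]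
  rw [Finset.sum_add_distrib, ← Finset.sum_div, Finset.sum_const, Finset.card_univ,
    Fintype.card_fin, nsmul_eq_mul] at h
  nlinarith

theorem ExpGrowth.integrable_gaussKer {Φ : (Fin n → ℝ) → (Fin n → ℝ) → ℝ}
    (h : ExpGrowth R Φ) (hs : 0 < s) {y : Fin n → ℝ} (hy : ∀ k, |y k| ≤ R) :
    Integrable fun x => Φ x y * gaussKer s x y := by
  obtain ⟨m, c, a, hc, ha, H⟩ := h
  have hm : Measurable fun x => Φ x y := m.comp (measurable_id.prodMk measurable_const)
  refine ((integrable_exp_abs_sub_sq (n := n) a (b := s / 4) (by positivity)).const_mul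
    (c * (gaussConst n s * Real.exp (s / 2 * (n * R ^ 2))))).mono'
    (hm.mul (by fun_prop)).aestronglyMeasurable (Filter.Eventually.of_forall fun x => ?_)
  rw [norm_mul, Real.norm_of_nonneg (gaussKer_pos hs _ _).le, Real.norm_eq_abs, sub_eq_add_neg,
    Real.exp_add]
  calc _ ≤ (c * Real.exp (a * ∑ k, |x k|)) * (gaussConst n s * Real.exp (s / 2 * (n * R ^ 2)) *
      Real.exp (-(s / 4 * ∑ k, x k ^ 2))) := mul_le_mul (H x y hy) (gaussKer_le hs hy)
        (gaussKer_pos hs _ _).le (by positivity)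
    _ = _ := by ring

theorem ExpGrowth.integrable_prod {Φ : (Fin n → ℝ) → (Fin n → ℝ) → ℝ} [IsFiniteMeasure μ]
    (h : ExpGrowth R Φ) (hs : 0 < s) (hμ : ∀ᵐ y ∂μ, ∀ k, |y k| ≤ R) :
    Integrable (fun z : (Fin n → ℝ) × (Fin n → ℝ) => Φ z.1 z.2 * gaussKer s z.1 z.2)
      (volume.prod μ) := by
  obtain ⟨m, c, a, hc, ha, H⟩ := h
  have h1 := ((integrable_exp_abs_sub_sq (n := n) a (b := s / 4) (by positivity)).const_mul
    (c * (gaussConst n s * Real.exp (s / 2 * (n * R ^ 2))))).comp_fst μ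
  refine h1.mono' (m.mul (by fun_prop)).aestronglyMeasurable ?_
  filter_upwards [Measure.quasiMeasurePreserving_snd.ae hμ] with z hz
  rw [norm_mul, Real.norm_of_nonneg (gaussKer_pos hs _ _).le, Real.norm_eq_abs, sub_eq_add_neg,
    Real.exp_add]
  calc _ ≤ (c * Real.exp (a * ∑ k, |z.1 k|)) * (gaussConst n s * Real.exp (s / 2 * (n * R ^ 2)) *
      Real.exp (-(s / 4 * ∑ k, z.1 k ^ 2))) := mul_le_mul (H z.1 z.2 hz) (gaussKer_le hs hz)
        (gaussKer_pos hs _ _).le (by positivity)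
    _ = _ := by ring

theorem ExpGrowth.integrable_right {Φ : (Fin n → ℝ) → (Fin n → ℝ) → ℝ} [IsFiniteMeasure μ]
    (h : ExpGrowth R Φ) (hμ : ∀ᵐ y ∂μ, ∀ k, |y k| ≤ R) (x : Fin n → ℝ) :
    Integrable (Φ x) μ := by
  obtain ⟨m, c, a, hc, ha, H⟩ := h
  have hm : Measurable (Φ x) := m.comp (measurable_const.prodMk measurable_id)
  refine Integrable.of_bound hm.aestronglyMeasurable (c * Real.exp (a * ∑ k, |x k|)) ?_
  filter_upwards [hμ] with y hy using H x y hy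

theorem integrable_exp_quadPot [IsFiniteMeasure μ] (hs : 0 ≤ s) (x : Fin n → ℝ) :
    Integrable (fun y => Real.exp
      (quadPot (s • (1 : Matrix (Fin n) (Fin n) ℝ)) (s • x) y)) μ := by
  refine Integrable.of_bound (by fun_prop) (Real.exp (s / 2 * ∑ k, x k ^ 2))
    (Filter.Eventually.of_forall fun y => ?_)
  rw [Real.norm_of_nonneg (Real.exp_pos _).le, quadPot_smul_one]
  refine Real.exp_le_exp.2 ?_
  have : 0 ≤ ∑ k, (x k - y k) ^ 2 := Finset.sum_nonneg fun _ _ => sq_nonneg _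
  nlinarith

theorem gaussKer_eq (s : ℝ) (x y : Fin n → ℝ) :
    gaussKer s x y = gaussConst n s * Real.exp (-(s / 2 * ∑ k, x k ^ 2)) *
      Real.exp (quadPot (s • (1 : Matrix (Fin n) (Fin n) ℝ)) (s • x) y) := by
  rw [gaussKer, quadPot_smul_one, mul_assoc, ← Real.exp_add]
  ring_nf

theorem smoothDensity_eq (s : ℝ) (μ : Measure (Fin n → ℝ)) (x : Fin n → ℝ) :
    smoothDensity s μ x = gaussConst n s * Real.exp (-(s / 2 * ∑ k, x k ^ 2)) *
      ∫ y, Real.exp (quadPot (s • (1 : Matrix (Fin n) (Fin n) ℝ)) (s • x) y) ∂μ := by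
  rw [smoothDensity]
  simp only [gaussKer_eq, integral_const_mul]

theorem smoothDensity_pos [IsProbabilityMeasure μ] (hs : 0 < s) (x : Fin n → ℝ) :
    0 < smoothDensity s μ x := by
  rw [smoothDensity_eq]
  exact mul_pos (mul_pos (gaussConst_pos hs) (Real.exp_pos _))
    (integral_exp_pos (integrable_exp_quadPot hs.le x))

theorem posteriorAvg_mul_smoothDensity [IsProbabilityMeasure μ] (hs : 0 < s)
    (Φ : (Fin n → ℝ) → (Fin n → ℝ) → ℝ) (x : Fin n → ℝ) :
    posteriorAvg s μ Φ x * smoothDensity s μ x = ∫ y, Φ x y * gaussKer s x y ∂μ := by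
  have hZ := (integral_exp_pos (integrable_exp_quadPot (μ := μ) hs.le x)).ne'
  rw [posteriorAvg, posterior, integral_tilted, smoothDensity_eq, ← integral_mul_const]
  refine integral_congr_ae (Filter.Eventually.of_forall fun y => ?_)
  simp only [smul_eq_mul]
  rw [gaussKer_eq]
  field_simp

theorem isProbabilityMeasure_posterior [IsProbabilityMeasure μ] (hs : 0 < s) (x : Fin n → ℝ) :
    IsProbabilityMeasure (posterior s μ x) :=
  isProbabilityMeasure_tilted (integrable_exp_quadPot hs.le x)

theorem ae_posterior {p : (Fin n → ℝ) → Prop} (hμ : ∀ᵐ y ∂μ, p y) (x : Fin n → ℝ) :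
    ∀ᵐ y ∂(posterior s μ x), p y :=
  (tilted_absolutelyContinuous _ _).ae_le hμ

theorem measurable_smoothDensity [IsProbabilityMeasure μ] :
    Measurable (smoothDensity s μ) := by
  have : StronglyMeasurable fun z : (Fin n → ℝ) × (Fin n → ℝ) => gaussKer s z.1 z.2 :=
    Continuous.stronglyMeasurable (by fun_prop)
  exact (this.integral_prod_right (ν := μ)).measurable

theorem ExpGrowth.posteriorAvg {Φ : (Fin n → ℝ) → (Fin n → ℝ) → ℝ} [IsProbabilityMeasure μ]
    (h : ExpGrowth R Φ) (hs : 0 < s) (hμ : ∀ᵐ y ∂μ, ∀ k, |y k| ≤ R) :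
    ExpGrowth R fun x _ => posteriorAvg s μ Φ x := by
  have e : _root_.posteriorAvg s μ Φ =
      fun x => (∫ y, Φ x y * gaussKer s x y ∂μ) / smoothDensity s μ x := by
    ext x
    rw [eq_div_iff (smoothDensity_pos hs x).ne', posteriorAvg_mul_smoothDensity hs]
  obtain ⟨m, c, a, hc, ha, H⟩ := h
  refine ⟨?_, c, a, hc, ha, fun x y _ => ?_⟩
  · have h1 : StronglyMeasurable fun z : (Fin n → ℝ) × (Fin n → ℝ) =>
        Φ z.1 z.2 * gaussKer s z.1 z.2 := by
      have h2 : StronglyMeasurable fun z : (Fin n → ℝ) × (Fin n → ℝ) => gaussKer s z.1 z.2 :=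
        Continuous.stronglyMeasurable (by fun_prop)
      exact m.stronglyMeasurable.mul h2
    rw [e]
    exact ((h1.integral_prod_right' (ν := μ)).measurable.div measurable_smoothDensity).comp
      measurable_fst
  · have := isProbabilityMeasure_posterior (μ := μ) hs x
    have h3 : ∀ᵐ y ∂(posterior s μ x), ‖Φ x y‖ ≤ c * Real.exp (a * ∑ k, |x k|) := by
      filter_upwards [ae_posterior hμ x] with y hy using H x y hy
    simpa [_root_.posteriorAvg] using norm_integral_le_of_norm_le_const h3

theorem integrable_smoothing_iff [IsProbabilityMeasure μ] (hs : 0 < s) (f : (Fin n → ℝ) → ℝ) :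
    Integrable f (smoothing s μ) ↔ Integrable fun x => f x * smoothDensity s μ x := by
  rw [smoothing, integrable_withDensity_iff (by exact measurable_smoothDensity.ennreal_ofReal)
    (Filter.Eventually.of_forall fun _ => ENNReal.ofReal_lt_top)]
  simp only [ENNReal.toReal_ofReal (smoothDensity_pos hs _).le]

theorem integral_smoothing [IsProbabilityMeasure μ] (hs : 0 < s) (f : (Fin n → ℝ) → ℝ) :
    ∫ x, f x ∂(smoothing s μ) = ∫ x, f x * smoothDensity s μ x := by
  rw [smoothing, integral_withDensity_eq_integral_toReal_smul
    (by exact measurable_smoothDensity.ennreal_ofReal)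
    (Filter.Eventually.of_forall fun _ => ENNReal.ofReal_lt_top)]
  simp only [ENNReal.toReal_ofReal (smoothDensity_pos hs _).le, smul_eq_mul, mul_comm]

theorem ExpGrowth.integrable_posteriorAvg {Φ : (Fin n → ℝ) → (Fin n → ℝ) → ℝ}
    [IsProbabilityMeasure μ] (h : ExpGrowth R Φ) (hs : 0 < s) (hμ : ∀ᵐ y ∂μ, ∀ k, |y k| ≤ R) :
    Integrable (fun x => _root_.posteriorAvg s μ Φ x) (smoothing s μ) := by
  rw [integrable_smoothing_iff hs]
  simp only [posteriorAvg_mul_smoothDensity hs]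
  exact (h.integrable_prod hs hμ).integral_prod_left

theorem ExpGrowth.integral_posteriorAvg {Φ : (Fin n → ℝ) → (Fin n → ℝ) → ℝ}
    [IsProbabilityMeasure μ] (h : ExpGrowth R Φ) (hs : 0 < s) (hμ : ∀ᵐ y ∂μ, ∀ k, |y k| ≤ R) :
    ∫ x, _root_.posteriorAvg s μ Φ x ∂(smoothing s μ) =
      ∫ y, (∫ x, Φ x y * gaussKer s x y) ∂μ := by
  rw [integral_smoothing hs]
  simp only [posteriorAvg_mul_smoothDensity hs]
  exact integral_integral_swap (h.integrable_prod hs hμ)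

theorem ExpGrowth.integrable_left {Φ : (Fin n → ℝ) → (Fin n → ℝ) → ℝ}
    [IsProbabilityMeasure μ] (h : ExpGrowth R Φ) (hs : 0 < s) (hμ : ∀ᵐ y ∂μ, ∀ k, |y k| ≤ R) :
    Integrable (fun y => ∫ x, Φ x y * gaussKer s x y) μ :=
  (h.integrable_prod hs hμ).integral_prod_right

theorem posteriorAvg_fst [IsProbabilityMeasure μ] (hs : 0 < s) (f : (Fin n → ℝ) → ℝ) :
    posteriorAvg s μ (fun x _ => f x) = f := by
  ext x
  have := isProbabilityMeasure_posterior (μ := μ) hs x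
  simp [posteriorAvg]

theorem ExpGrowth.integrable_smoothing {f : (Fin n → ℝ) → ℝ}
    [IsProbabilityMeasure μ] (h : ExpGrowth R fun x _ => f x) (hs : 0 < s)
    (hμ : ∀ᵐ y ∂μ, ∀ k, |y k| ≤ R) : Integrable f (smoothing s μ) := by
  have := h.integrable_posteriorAvg hs hμ
  rwa [posteriorAvg_fst hs] at this

theorem ExpGrowth.integral_smoothing {f : (Fin n → ℝ) → ℝ}
    [IsProbabilityMeasure μ] (h : ExpGrowth R fun x _ => f x) (hs : 0 < s)
    (hμ : ∀ᵐ y ∂μ, ∀ k, |y k| ≤ R) :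
    ∫ x, f x ∂(smoothing s μ) = ∫ y, (∫ x, f x * gaussKer s x y) ∂μ := by
  have := h.integral_posteriorAvg hs hμ
  rwa [posteriorAvg_fst hs] at this

theorem ExpGrowth.memLp_smoothing {f : (Fin n → ℝ) → ℝ}
    [IsProbabilityMeasure μ] (h : ExpGrowth R fun x _ => f x) (hs : 0 < s)
    (hμ : ∀ᵐ y ∂μ, ∀ k, |y k| ≤ R) : MemLp f 2 (smoothing s μ) := by
  have hm : Measurable f := h.1.comp (measurable_id.prodMk (measurable_const (a := (0 : Fin n → ℝ))))
  rw [memLp_two_iff_integrable_sq hm.aestronglyMeasurable]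
  simpa [sq] using (h.mul h).integrable_smoothing hs hμ

theorem isProbabilityMeasure_smoothing [IsProbabilityMeasure μ] (hs : 0 < s)
    (hμ : ∀ᵐ y ∂μ, ∀ k, |y k| ≤ R) : IsProbabilityMeasure (smoothing s μ) := by
  have h1 := (ExpGrowth.const (n := n) (R := R) 1).integrable_smoothing hs hμ
  have h2 := (ExpGrowth.const (n := n) (R := R) 1).integral_smoothing hs hμ
  simp only [one_mul, integral_gaussKer hs, integral_const, smul_eq_mul, mul_one,
    probReal_univ] at h2
  have h3 : IsFiniteMeasure (smoothing s μ) := (integrable_const_iff_isFiniteMeasure one_ne_zero).1 h1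
  exact ⟨(ENNReal.toReal_eq_one_iff _).1 h2⟩

end Smoothing

section GaussianMean

open MvPolynomial

variable {n : ℕ} {R s : ℝ} {μ : Measure (Fin n → ℝ)}

theorem MvPolynomial.induction_on_degree {P : MvPolynomial (Fin n) ℝ → Prop}
    (add : ∀ p q, P p → P q → P (p + q))
    (mon : ∀ (e : Fin n →₀ ℕ) (a : ℝ),
      (∀ (e' : Fin n →₀ ℕ) (b : ℝ), e'.degree < e.degree → P (monomial e' b)) →
      P (monomial e a)) (p : MvPolynomial (Fin n) ℝ) : P p := by
  have h : ∀ N (e : Fin n →₀ ℕ) (a : ℝ), e.degree ≤ N → P (monomial e a) := by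
    intro N
    induction N with
    | zero => exact fun e a he => mon e a fun e' b h => by omega
    | succ N ih => exact fun e a he => mon e a fun e' b h => ih e' b (by omega)
  induction p using MvPolynomial.monomial_add_induction_on with
  | C a => exact h _ 0 a le_rfl
  | monomial_add e a p _ _ hp => exact add _ _ (h _ e a le_rfl) hp

theorem MvPolynomial.degree_sub_single_lt (e : Fin n →₀ ℕ) {k : Fin n} (hk : e k ≠ 0) :
    (e - Finsupp.single k 1).degree + 1 = e.degree := by
  have h : e - Finsupp.single k 1 + Finsupp.single k 1 = e := by
    refine tsub_add_cancel_of_le ?_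
    rw [Finsupp.single_le_iff]; omega
  conv_rhs => rw [← h]
  simp [map_add, Finsupp.degree_single]

theorem MvPolynomial.hasLineDerivAt_eval (p : MvPolynomial (Fin n) ℝ) (x : Fin n → ℝ) (k : Fin n) :
    HasLineDerivAt ℝ (fun x => eval x p) (eval x (pderiv k p)) x (Pi.single k 1) := by
  induction p using MvPolynomial.induction_on with
  | C a =>
    simp only [eval_C, pderiv_C, map_zero]
    exact hasDerivAt_const _ _
  | add p q hp hq =>
    simp only [map_add]
    exact HasDerivAt.fun_add hp hq
  | mul_X p j hp =>
    have hX : HasLineDerivAt ℝ (fun x : Fin n → ℝ => x j) ((Pi.single k (1 : ℝ) : Fin n → ℝ) j) x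
        (Pi.single k 1) := by
      have : HasFDerivAt (fun x : Fin n → ℝ => x j)
          (ContinuousLinearMap.proj (R := ℝ) (φ := fun _ : Fin n => ℝ) j) x :=
        (ContinuousLinearMap.proj (R := ℝ) (φ := fun _ : Fin n => ℝ) j).hasFDerivAt
      simpa using this.hasLineDerivAt (Pi.single k 1)
    have h := HasDerivAt.fun_mul hp hX
    unfold HasLineDerivAt
    simp only [map_mul, eval_X, Derivation.leibniz, smul_eq_mul, map_add, pderiv_X]
    refine h.congr_deriv ?_
    simp only [Pi.single_apply, zero_smul, add_zero]
    split_ifs <;> simp_all [mul_comm, add_comm]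

theorem hasLineDerivAt_gaussKer (s : ℝ) (x y : Fin n → ℝ) (k : Fin n) :
    HasLineDerivAt ℝ (fun x => gaussKer s x y) (-(s * ((x k - y k) * gaussKer s x y))) x
      (Pi.single k 1) := by
  unfold HasLineDerivAt
  have h1 : HasDerivAt (fun t : ℝ => ∑ j, ((x + t • (Pi.single k 1 : Fin n → ℝ)) j - y j) ^ 2)
      (∑ j, 2 * (x j - y j) * (Pi.single k (1 : ℝ) : Fin n → ℝ) j) 0 := by
    refine HasDerivAt.fun_sum fun j _ => ?_
    have h2 : HasDerivAt (fun t : ℝ => (x + t • (Pi.single k 1 : Fin n → ℝ)) j - y j)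
        ((Pi.single k (1 : ℝ) : Fin n → ℝ) j) 0 := by
      simp only [Pi.add_apply, Pi.smul_apply, smul_eq_mul]
      simpa using (((hasDerivAt_id (0 : ℝ)).mul_const
        ((Pi.single k (1 : ℝ) : Fin n → ℝ) j)).const_add (x j)).sub_const (y j)
    simpa using h2.fun_pow 2
  have h3 := ((h1.const_mul (-(s / 2))).exp).const_mul (gaussConst n s)
  unfold gaussKer
  refine h3.congr_deriv ?_
  simp only [Pi.single_apply, zero_smul, add_zero, mul_ite, mul_one, mul_zero, Finset.sum_ite_eq',
    Finset.mem_univ, if_true]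
  ring

theorem abs_le_sum_abs (y : Fin n → ℝ) (k : Fin n) : |y k| ≤ ∑ j, |y j| :=
  Finset.single_le_sum (f := fun k => |y k|) (fun _ _ => abs_nonneg _) (Finset.mem_univ k)

/-- Integration of polynomials against a Gaussian. -/
noncomputable def gaussMean (hs : 0 < s) (y : Fin n → ℝ) : MvPolynomial (Fin n) ℝ →ₗ[ℝ] ℝ where
  toFun p := ∫ x, eval x p * gaussKer s x y
  map_add' p q := by
    rw [← integral_add ((ExpGrowth.poly p).integrable_gaussKer hs (abs_le_sum_abs y))
      ((ExpGrowth.poly q).integrable_gaussKer hs (abs_le_sum_abs y))]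
    simp only [map_add, add_mul]
  map_smul' c p := by
    rw [RingHom.id_apply, smul_eq_mul, ← integral_const_mul]
    simp only [smul_eval, mul_assoc]

theorem gaussMean_apply (hs : 0 < s) (y : Fin n → ℝ) (p : MvPolynomial (Fin n) ℝ) :
    gaussMean hs y p = ∫ x, eval x p * gaussKer s x y := rfl

theorem gaussMean_one (hs : 0 < s) (y : Fin n → ℝ) : gaussMean hs y 1 = 1 := by
  simp [gaussMean_apply, integral_gaussKer hs]

theorem integral_mul_gaussKer_lineDeriv (hs : 0 < s) (y : Fin n → ℝ) (k : Fin n)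
    (p : MvPolynomial (Fin n) ℝ) :
    gaussMean hs y (pderiv k p) = s * gaussMean hs y ((X k - C (y k)) * p) := by
  have i1 := (ExpGrowth.poly (pderiv k p)).integrable_gaussKer hs (abs_le_sum_abs y)
  have i2 := (ExpGrowth.poly p).integrable_gaussKer hs (abs_le_sum_abs y)
  have i3 := (ExpGrowth.poly (C s * ((X k - C (y k)) * p))).integrable_gaussKer hs
    (abs_le_sum_abs y)
  have h := integral_bilinear_hasLineDerivAt_right_eq_neg_left_of_integrable
    (μ := (volume : Measure (Fin n → ℝ))) (B := ContinuousLinearMap.mul ℝ ℝ)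
    (f := fun x => eval x p) (f' := fun x => eval x (pderiv k p))
    (g := fun x => gaussKer s x y) (g' := fun x => -(s * ((x k - y k) * gaussKer s x y)))
    (v := Pi.single k 1) (by simpa using i1)
    (by
      refine i3.neg.congr (Filter.Eventually.of_forall fun x => ?_)
      simp; ring) (by simpa using i2)
    (fun x _ => hasLineDerivAt_eval p x k) (fun x _ => hasLineDerivAt_gaussKer s x y k)
  simp only [ContinuousLinearMap.mul_apply', mul_neg, integral_neg, neg_inj] at h
  rw [gaussMean_apply, gaussMean_apply, ← h, ← integral_const_mul]
  refine integral_congr_ae (Filter.Eventually.of_forall fun x => ?_)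
  simp; ring

theorem gaussMean_X_mul (hs : 0 < s) (y : Fin n → ℝ) (k : Fin n) (p : MvPolynomial (Fin n) ℝ) :
    gaussMean hs y (X k * p) = y k * gaussMean hs y p + s⁻¹ * gaussMean hs y (pderiv k p) := by
  rw [integral_mul_gaussKer_lineDeriv, ← mul_assoc, inv_mul_cancel₀ hs.ne', one_mul, sub_mul,
    map_sub, ← smul_eq_C_mul, map_smul, smul_eq_mul]
  ring

theorem gaussMean_sub_le (hR : 0 ≤ R) (p : MvPolynomial (Fin n) ℝ) :
    ∃ c : ℝ, 0 ≤ c ∧ ∀ s (hs : 0 < s), 1 ≤ s → ∀ y : Fin n → ℝ, (∀ k, |y k| ≤ R) →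
      |gaussMean hs y p - eval y p| ≤ c * s⁻¹ := by
  have hb : ∀ p : MvPolynomial (Fin n) ℝ, ∃ c : ℝ, 0 ≤ c ∧ ∀ y : Fin n → ℝ, (∀ k, |y k| ≤ R) →
      |eval y p| ≤ c := by
    intro p
    obtain ⟨_, c, a, hc, ha, H⟩ := ExpGrowth.poly (R := R) p
    refine ⟨c * Real.exp (a * ∑ k : Fin n, R), by positivity, fun y hy => (H y y hy).trans ?_⟩
    gcongr with k
    exact hy k
  induction p using MvPolynomial.induction_on_degree with
  | add p q hp hq =>
    obtain ⟨c, hc, hp⟩ := hp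
    obtain ⟨c', hc', hq⟩ := hq
    refine ⟨c + c', by positivity, fun s hs h1 y hy => ?_⟩
    rw [map_add, map_add, add_sub_add_comm, add_mul]
    exact (abs_add_le _ _).trans (add_le_add (hp s hs h1 y hy) (hq s hs h1 y hy))
  | mon e a ih =>
    rcases eq_or_ne e 0 with rfl | he
    · refine ⟨0, le_rfl, fun s hs h1 y hy => ?_⟩
      have : monomial (0 : Fin n →₀ ℕ) a = a • (1 : MvPolynomial (Fin n) ℝ) := by
        rw [smul_eq_C_mul, mul_one]; rfl
      rw [this, map_smul, gaussMean_one]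
      simp
    · obtain ⟨k, hk⟩ := Finsupp.ne_iff.1 he
      rw [Finsupp.coe_zero, Pi.zero_apply] at hk
      have hd := degree_sub_single_lt e hk
      have e1 : monomial e a = X k * monomial (e - Finsupp.single k 1) a := by
        rw [X, monomial_mul, one_mul, add_tsub_cancel_of_le]
        rw [Finsupp.single_le_iff]; omega
      obtain ⟨c1, hc1, h1⟩ := ih (e - Finsupp.single k 1) a (by omega)
      have h2 : ∃ c : ℝ, 0 ≤ c ∧ ∀ s (hs : 0 < s), 1 ≤ s → ∀ y : Fin n → ℝ, (∀ k, |y k| ≤ R) →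
          |gaussMean hs y (pderiv k (monomial (e - Finsupp.single k 1) a))| ≤ c := by
        obtain ⟨b, hb'⟩ : ∃ b, pderiv k (monomial (e - Finsupp.single k 1) a) =
            monomial (e - Finsupp.single k 1 - Finsupp.single k 1) b := ⟨_, pderiv_monomial⟩
        rw [hb']
        have hd2 : (e - Finsupp.single k 1 - Finsupp.single k 1).degree ≤
          (e - Finsupp.single k 1).degree := Finsupp.degree_mono tsub_le_self
        obtain ⟨c2, hc2, h2⟩ := ih (e - Finsupp.single k 1 - Finsupp.single k 1) b (by omega)
        obtain ⟨c3, hc3, h3⟩ := hb (monomial (e - Finsupp.single k 1 - Finsupp.single k 1) b)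
        refine ⟨c2 + c3, by positivity, fun s hs hs1 y hy => ?_⟩
        have h4 := h2 s hs hs1 y hy
        have h5 := h3 y hy
        have h6 : c2 * s⁻¹ ≤ c2 := mul_le_of_le_one_right hc2 (inv_le_one_of_one_le₀ hs1)
        exact (abs_sub_abs_le_abs_sub _ _ |>.trans h4 |> fun h => by linarith)
      obtain ⟨c2, hc2, h2⟩ := h2
      refine ⟨R * c1 + c2, by positivity, fun s hs hs1 y hy => ?_⟩
      rw [e1, gaussMean_X_mul, map_mul, eval_X]
      set A := gaussMean hs y (monomial (e - Finsupp.single k 1) a)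
      set B := eval y (monomial (e - Finsupp.single k 1) a)
      set D := gaussMean hs y (pderiv k (monomial (e - Finsupp.single k 1) a))
      have e2 : y k * A + s⁻¹ * D - y k * B = y k * (A - B) + s⁻¹ * D := by ring
      have h3 : |y k| * |A - B| ≤ R * (c1 * s⁻¹) :=
        mul_le_mul (hy k) (h1 s hs hs1 y hy) (abs_nonneg _) hR
      have h4 : s⁻¹ * |D| ≤ s⁻¹ * c2 :=
        mul_le_mul_of_nonneg_left (h2 s hs hs1 y hy) (inv_pos.2 hs).le
      rw [e2]
      refine (abs_add_le _ _).trans ?_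
      rw [abs_mul, abs_mul, abs_of_pos (inv_pos.2 hs)]
      linarith

end GaussianMean

section SmoothModel

open MvPolynomial

variable {n : ℕ} {R s : ℝ} {μ : Measure (Fin n → ℝ)} [IsProbabilityMeasure μ]

/-- Integration of polynomials against a smoothing of a compactly supported measure. -/
noncomputable def smoothMean (hs : 0 < s) (hμ : ∀ᵐ y ∂μ, ∀ k, |y k| ≤ R) :
    MvPolynomial (Fin n) ℝ →ₗ[ℝ] ℝ where
  toFun p := ∫ x, eval x p ∂(smoothing s μ)
  map_add' p q := by
    rw [← integral_add ((ExpGrowth.poly p).integrable_smoothing hs hμ)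
      ((ExpGrowth.poly q).integrable_smoothing hs hμ)]
    simp only [map_add]
  map_smul' c p := by
    rw [RingHom.id_apply, smul_eq_mul, ← integral_const_mul]
    simp only [smul_eval]

theorem smoothMean_apply (hs : 0 < s) (hμ : ∀ᵐ y ∂μ, ∀ k, |y k| ≤ R)
    (p : MvPolynomial (Fin n) ℝ) : smoothMean hs hμ p = ∫ x, eval x p ∂(smoothing s μ) := rfl

theorem smoothMean_eq (hs : 0 < s) (hμ : ∀ᵐ y ∂μ, ∀ k, |y k| ≤ R)
    (p : MvPolynomial (Fin n) ℝ) : smoothMean hs hμ p = ∫ y, gaussMean hs y p ∂μ :=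
  (ExpGrowth.poly p).integral_smoothing hs hμ

theorem integrable_gaussMean (hs : 0 < s) (hμ : ∀ᵐ y ∂μ, ∀ k, |y k| ≤ R)
    (p : MvPolynomial (Fin n) ℝ) : Integrable (fun y => gaussMean hs y p) μ :=
  (ExpGrowth.poly p).integrable_left hs hμ

theorem smoothMean_one (hs : 0 < s) (hμ : ∀ᵐ y ∂μ, ∀ k, |y k| ≤ R) :
    smoothMean hs hμ 1 = 1 := by
  simp [smoothMean_eq, gaussMean_one]

/-- The embedding of polynomials in `L²` of the smoothing. -/
noncomputable def smoothEmb (hs : 0 < s) (hμ : ∀ᵐ y ∂μ, ∀ k, |y k| ≤ R) :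
    MvPolynomial (Fin n) ℝ →ₗ[ℝ] Lp ℝ 2 (smoothing s μ) where
  toFun p := ((ExpGrowth.poly p).memLp_smoothing hs hμ).toLp _
  map_add' p q := by
    rw [← MemLp.toLp_add]
    congr 1
    ext x
    simp
  map_smul' c p := by
    rw [RingHom.id_apply, ← MemLp.toLp_const_smul]
    congr 1
    ext x
    simp

theorem inner_toLp {α : Type*} [MeasurableSpace α] {ν : Measure α} {f g : α → ℝ}
    (hf : MemLp f 2 ν) (hg : MemLp g 2 ν) :
    inner ℝ (hf.toLp f) (hg.toLp g) = ∫ x, f x * g x ∂ν := by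
  rw [L2.inner_def]
  refine integral_congr_ae ?_
  filter_upwards [hf.coeFn_toLp, hg.coeFn_toLp] with x h1 h2
  rw [h1, h2]
  simp [mul_comm]

theorem inner_smoothEmb (hs : 0 < s) (hμ : ∀ᵐ y ∂μ, ∀ k, |y k| ≤ R)
    (p q : MvPolynomial (Fin n) ℝ) :
    inner ℝ (smoothEmb hs hμ p) (smoothEmb hs hμ q) = smoothMean hs hμ (p * q) := by
  rw [smoothMean_apply]
  simp only [map_mul]
  exact inner_toLp ((ExpGrowth.poly p).memLp_smoothing hs hμ)
    ((ExpGrowth.poly q).memLp_smoothing hs hμ)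

theorem eval_ouPoly (s : ℝ) (x y d : Fin n → ℝ) (u : MvPolynomial (Fin n) ℝ) :
    eval x (ouPoly s y d u) = (∑ k, d k * (s * (x k * eval x (pderiv k u)) -
      eval x (pderiv k (pderiv k u)))) - ∑ k, (s * d k * eval x (pderiv k u)) * y k := by
  simp only [ouPoly, map_sum, map_mul, map_sub, eval_C, eval_X]
  rw [← Finset.sum_sub_distrib]
  exact Finset.sum_congr rfl fun k _ => by ring

theorem ExpGrowth.ouPoly (hR : 0 ≤ R) (s : ℝ) (d : Fin n → ℝ) (u : MvPolynomial (Fin n) ℝ) :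
    ExpGrowth R fun x y => eval x (ouPoly s y d u) := by
  simp only [eval_ouPoly]
  refine .sub (.sum _ fun k _ => .const_mul _ (.sub (.const_mul _ ((fst k).mul (poly _))) (poly _)))
    (.sum _ fun k _ => .mul (.const_mul _ (poly _)) (snd hR k))

/-- The weighted Laplacian associated with the smoothing. -/
noncomputable def smoothLapFun (s : ℝ) (μ : Measure (Fin n → ℝ)) (d : Fin n → ℝ)
    (u : MvPolynomial (Fin n) ℝ) : (Fin n → ℝ) → ℝ :=
  posteriorAvg s μ fun x y => eval x (ouPoly s y d u)

theorem memLp_smoothLapFun (hs : 0 < s) (hR : 0 ≤ R) (hμ : ∀ᵐ y ∂μ, ∀ k, |y k| ≤ R)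
    (d : Fin n → ℝ) (u : MvPolynomial (Fin n) ℝ) :
    MemLp (smoothLapFun s μ d u) 2 (smoothing s μ) :=
  ((ExpGrowth.ouPoly hR s d u).posteriorAvg hs hμ).memLp_smoothing hs hμ

/-- The weighted Laplacian associated with the smoothing, as an element of `L²`. -/
noncomputable def smoothLap (hs : 0 < s) (hR : 0 ≤ R) (hμ : ∀ᵐ y ∂μ, ∀ k, |y k| ≤ R)
    (d : Fin n → ℝ) (u : MvPolynomial (Fin n) ℝ) : Lp ℝ 2 (smoothing s μ) :=
  (memLp_smoothLapFun hs hR hμ d u).toLp _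

omit [IsProbabilityMeasure μ] in
theorem posteriorAvg_mul (Φ : (Fin n → ℝ) → (Fin n → ℝ) → ℝ) (f : (Fin n → ℝ) → ℝ)
    (x : Fin n → ℝ) :
    posteriorAvg s μ Φ x * f x = posteriorAvg s μ (fun x y => Φ x y * f x) x := by
  rw [posteriorAvg, posteriorAvg, integral_mul_const]

theorem inner_smoothLap (hs : 0 < s) (hR : 0 ≤ R) (hμ : ∀ᵐ y ∂μ, ∀ k, |y k| ≤ R)
    (d : Fin n → ℝ) (u p : MvPolynomial (Fin n) ℝ) :
    inner ℝ (smoothLap hs hR hμ d u) (smoothEmb hs hμ p) =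
      ∑ k, d k * smoothMean hs hμ (pderiv k u * pderiv k p) := by
  refine (inner_toLp (memLp_smoothLapFun hs hR hμ d u)
    ((ExpGrowth.poly p).memLp_smoothing hs hμ)).trans ?_
  have e0 : ∀ x, smoothLapFun s μ d u x * eval x p = posteriorAvg s μ
      (fun x y => eval x (ouPoly s y d u) * eval x p) x :=
    fun x => posteriorAvg_mul _ (fun x => eval x p) x
  simp only [e0]
  rw [((ExpGrowth.ouPoly hR s d u).mul (ExpGrowth.poly p)).integral_posteriorAvg hs hμ]
  have e : ∀ y, ∫ x, eval x (ouPoly s y d u) * eval x p * gaussKer s x y =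
      ∑ k, d k * gaussMean hs y (pderiv k u * pderiv k p) := by
    intro y
    rw [← mean_ouPoly_mul (integral_mul_gaussKer_lineDeriv hs y), gaussMean_apply]
    simp only [map_mul]
  simp only [e]
  rw [integral_finsetSum _ fun k _ => (integrable_gaussMean hs hμ _).const_mul _]
  simp only [integral_const_mul, smoothMean_eq]

theorem sq_integral_const_sub {α : Type*} [MeasurableSpace α] {P : Measure α}
    [IsProbabilityMeasure P] (A : ℝ) {f : α → ℝ} (hf : Integrable f P)
    (hf2 : Integrable (fun x => f x ^ 2) P) :
    (∫ x, (A - f x) ∂P) ^ 2 = ∫ x, (A - f x) ^ 2 ∂P -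
      (∫ x, f x ^ 2 ∂P - (∫ x, f x ∂P) ^ 2) := by
  have e : ∀ x, (A - f x) ^ 2 = A ^ 2 - 2 * A * f x + f x ^ 2 := fun x => by ring
  simp only [e]
  rw [integral_sub (integrable_const _) hf, integral_add (by fun_prop) hf2,
    integral_sub (integrable_const _) (hf.const_mul _), integral_const_mul]
  simp
  ring

theorem bochner_smoothLap (hs : 0 < s) (hR : 0 ≤ R) (hμ : ∀ᵐ y ∂μ, ∀ k, |y k| ≤ R)
    {γ : Fin n → ℝ} (hγ : ∀ k, 0 < γ k)
    (hcov : ∀ x v : Fin n → ℝ, ∫ y, (∑ k, v k * y k) ^ 2 ∂(posterior s μ x) -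
      (∫ y, ∑ k, v k * y k ∂(posterior s μ x)) ^ 2 ≤ ∑ k, v k ^ 2 / (γ k + s))
    (d : Fin n → ℝ) (u : MvPolynomial (Fin n) ℝ) :
    ∑ k, d k * (∑ l, d l * smoothMean hs hμ (pderiv l (pderiv k u) * pderiv l (pderiv k u))) +
      ∑ k, (s * γ k / (γ k + s)) * d k ^ 2 * smoothMean hs hμ (pderiv k u * pderiv k u) ≤
      ‖smoothLap hs hR hμ d u‖ ^ 2 := by
  have hEG := ExpGrowth.ouPoly hR s d u
  have hlow : ∀ x, posteriorAvg s μ (fun x y => eval x (ouPoly s y d u) *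
      eval x (ouPoly s y d u)) x - ∑ k, s ^ 2 * d k ^ 2 / (γ k + s) *
      eval x (pderiv k u * pderiv k u) ≤ smoothLapFun s μ d u x * smoothLapFun s μ d u x := by
    intro x
    have := isProbabilityMeasure_posterior (μ := μ) hs x
    have hp := ae_posterior (s := s) hμ x
    have hl : ExpGrowth (n := n) R fun x y => ∑ k, (s * d k * eval x (pderiv k u)) * y k :=
      .sum _ fun k _ => .mul (.const_mul _ (.poly _)) (.snd hR k)
    have h1 := hl.integrable_right hp x
    have h2 : Integrable (fun y => (∑ k, (s * d k * eval x (pderiv k u)) * y k) ^ 2)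
        (posterior s μ x) := by simpa only [sq] using (hl.mul hl).integrable_right hp x
    have h3 := hcov x fun k => s * d k * eval x (pderiv k u)
    have h4 := sq_integral_const_sub (P := posterior s μ x) (∑ k, d k * (s * (x k * eval x (pderiv k u)) -
      eval x (pderiv k (pderiv k u)))) h1 h2
    have h5 : ∑ k, (s * d k * eval x (pderiv k u)) ^ 2 / (γ k + s) =
        ∑ k, s ^ 2 * d k ^ 2 / (γ k + s) * eval x (pderiv k u * pderiv k u) := by
      refine Finset.sum_congr rfl fun k _ => ?_
      rw [map_mul]; ring
    rw [h5] at h3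
    simp only [smoothLapFun, posteriorAvg, eval_ouPoly, ← sq] at h3 ⊢
    rw [h4]
    linarith
  have hL2 : ‖smoothLap hs hR hμ d u‖ ^ 2 =
      ∫ x, smoothLapFun s μ d u x * smoothLapFun s μ d u x ∂(smoothing s μ) := by
    rw [← real_inner_self_eq_norm_sq]; exact inner_toLp _ _
  have hA := (hEG.mul hEG).integrable_posteriorAvg hs hμ
  have hB : ∀ k ∈ Finset.univ, Integrable (fun x => s ^ 2 * d k ^ 2 / (γ k + s) *
      eval x (pderiv k u * pderiv k u)) (smoothing s μ) := fun k _ =>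
    ((ExpGrowth.poly (pderiv k u * pderiv k u)).integrable_smoothing hs hμ).const_mul _
  have hC : Integrable (fun x => smoothLapFun s μ d u x * smoothLapFun s μ d u x)
      (smoothing s μ) := by
    have h := hEG.posteriorAvg hs hμ
    exact (h.mul h).integrable_smoothing hs hμ
  have h := integral_mono (hA.sub (integrable_finsetSum _ hB)) hC hlow
  rw [← hL2] at h
  simp only [Pi.sub_apply] at h
  rw [integral_sub hA (integrable_finsetSum _ hB), integral_finsetSum _ hB,
    (hEG.mul hEG).integral_posteriorAvg hs hμ] at h
  have e : ∀ y, ∫ x, eval x (ouPoly s y d u) * eval x (ouPoly s y d u) * gaussKer s x y =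
      ∑ k, d k * (∑ l, d l * gaussMean hs y (pderiv l (pderiv k u) * pderiv l (pderiv k u))) +
      s * ∑ k, d k ^ 2 * gaussMean hs y (pderiv k u * pderiv k u) := by
    intro y
    rw [← mean_ouPoly_sq (integral_mul_gaussKer_lineDeriv hs y), gaussMean_apply]
    simp only [map_mul]
  have i1 := integrable_gaussMean (μ := μ) hs hμ
  have e2 : ∫ y, (∑ k, d k * (∑ l, d l * gaussMean hs y (pderiv l (pderiv k u) *
      pderiv l (pderiv k u))) + s * ∑ k, d k ^ 2 * gaussMean hs y (pderiv k u * pderiv k u)) ∂μ =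
      ∑ k, d k * (∑ l, d l * smoothMean hs hμ (pderiv l (pderiv k u) * pderiv l (pderiv k u))) +
      s * ∑ k, d k ^ 2 * smoothMean hs hμ (pderiv k u * pderiv k u) := by
    have j1 : ∀ k, Integrable (fun y => ∑ l, d l * gaussMean hs y (pderiv l (pderiv k u) *
        pderiv l (pderiv k u))) μ := fun k =>
      integrable_finsetSum _ fun l _ => (i1 _).const_mul _
    have j2 : ∀ k, Integrable (fun y => d k * ∑ l, d l * gaussMean hs y (pderiv l (pderiv k u) *
        pderiv l (pderiv k u))) μ := fun k => (j1 k).const_mul _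
    have j3 : ∀ k, Integrable (fun y => d k ^ 2 * gaussMean hs y (pderiv k u * pderiv k u)) μ :=
      fun k => (i1 _).const_mul _
    rw [integral_add (integrable_finsetSum _ fun k _ => j2 k)
      ((integrable_finsetSum _ fun k _ => j3 k).const_mul _), integral_const_mul,
      integral_finsetSum _ fun k _ => j2 k, integral_finsetSum _ fun k _ => j3 k]
    simp only [integral_const_mul, smoothMean_eq]
    congr 1
    refine Finset.sum_congr rfl fun k _ => ?_
    rw [integral_finsetSum _ fun l _ => (i1 _).const_mul _]
    simp only [integral_const_mul]
  simp only [e] at h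
  rw [e2] at h
  simp only [integral_const_mul, ← smoothMean_apply hs hμ] at h
  have e3 : ∑ k, (s * γ k / (γ k + s)) * d k ^ 2 * smoothMean hs hμ (pderiv k u * pderiv k u) =
      s * ∑ k, d k ^ 2 * smoothMean hs hμ (pderiv k u * pderiv k u) -
      ∑ k, s ^ 2 * d k ^ 2 / (γ k + s) * smoothMean hs hμ (pderiv k u * pderiv k u) := by
    rw [Finset.mul_sum, ← Finset.sum_sub_distrib]
    refine Finset.sum_congr rfl fun k _ => ?_
    have := hγ k
    field_simp
    ring
  rw [e3]
  linarith

end SmoothModel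

section Density

open MvPolynomial

variable {n : ℕ}

theorem integral_mul_cexp_eq_zero {ν : Measure (Fin n → ℝ)}
    (hexp : ∀ θ : Fin n → ℝ, MemLp (fun x => Real.exp (∑ k, θ k * x k)) 2 ν)
    {g : (Fin n → ℝ) → ℝ} (hg : MemLp g 2 ν) (h0 : ∀ p, ∫ x, g x * eval x p ∂ν = 0)
    (θ : Fin n → ℝ) :
    ∫ x, (g x : ℂ) * Complex.exp ((∑ k, θ k * x k : ℝ) * Complex.I) ∂ν = 0 := by
  set t : (Fin n → ℝ) → ℝ := fun x => ∑ k, θ k * x k with ht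
  have htc : Continuous t := by fun_prop
  set B : (Fin n → ℝ) → ℝ := fun x => |g x| * (Real.exp (t x) + Real.exp (-t x)) with hB
  have hBi : Integrable B ν := by
    have h1 := hexp θ
    have h2 := hexp (-θ)
    have e : ∀ x : Fin n → ℝ, ∑ k, (-θ) k * x k = - t x := fun x => by
      simp [ht, Finset.sum_neg_distrib]
    simp only [e] at h2
    have h3 := hg.abs.integrable_mul (h1.add h2)
    exact h3.congr (Filter.Eventually.of_forall fun x => rfl)
  have hle : ∀ x, Real.exp |t x| ≤ Real.exp (t x) + Real.exp (-t x) := by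
    intro x
    rcases abs_cases (t x) with h | h <;> rw [h.1] <;>
      linarith [Real.exp_pos (t x), Real.exp_pos (-t x)]
  have hpow : ∀ k : ℕ, Integrable (fun x => g x * t x ^ k) ν := by
    intro k
    refine (hBi.const_mul (k.factorial : ℝ)).mono' (hg.1.mul (by fun_prop)) ?_
    refine Filter.Eventually.of_forall fun x => ?_
    rw [norm_mul, norm_pow, Real.norm_eq_abs, Real.norm_eq_abs]
    have h1 := Real.pow_div_factorial_le_exp |t x| (abs_nonneg _) k
    rw [div_le_iff₀ (by positivity)] at h1
    calc |g x| * |t x| ^ k ≤ |g x| * ((Real.exp (t x) + Real.exp (-t x)) * k.factorial) := by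
          gcongr
          exact h1.trans (by gcongr; exact hle x)
      _ = _ := by simp only [hB]; ring
  have hzero : ∀ k : ℕ, ∫ x, g x * t x ^ k ∂ν = 0 := by
    intro k
    have h1 := h0 ((∑ j, C (θ j) * X j) ^ k)
    simpa [ht] using h1
  set F : ℕ → (Fin n → ℝ) → ℂ := fun N x =>
    ∑ k ∈ Finset.range N, ((g x * t x ^ k : ℝ) : ℂ) * (Complex.I ^ k / k.factorial) with hF
  have hF0 : ∀ N, ∫ x, F N x ∂ν = 0 := by
    intro N
    simp only [hF]
    rw [integral_finsetSum _ fun k _ => (hpow k).ofReal.mul_const _]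
    refine Finset.sum_eq_zero fun k _ => ?_
    have h2 : ∫ x, ((g x * t x ^ k : ℝ) : ℂ) ∂ν = 0 := by
      refine (integral_ofReal (𝕜 := ℂ) (f := fun x => g x * t x ^ k)).trans ?_
      rw [hzero]; rfl
    rw [integral_mul_const, h2, zero_mul]
  have hlim := tendsto_integral_of_dominated_convergence (μ := ν) (F := F)
    (f := fun x => (g x : ℂ) * Complex.exp ((t x : ℝ) * Complex.I)) B
    (fun N => by
      refine Finset.aestronglyMeasurable_fun_sum _ fun k _ => ?_
      exact ((hpow k).ofReal.mul_const _).1)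
    hBi
    (fun N => Filter.Eventually.of_forall fun x => by
      calc ‖F N x‖ ≤ ∑ k ∈ Finset.range N, |g x| * (|t x| ^ k / k.factorial) := by
            refine norm_sum_le_of_le _ fun k _ => ?_
            rw [norm_mul, Complex.norm_real, norm_mul, norm_pow, norm_div, norm_pow,
              Complex.norm_I, one_pow, Complex.norm_natCast, Real.norm_eq_abs, Real.norm_eq_abs]
            rw [mul_assoc, mul_one_div]
        _ ≤ B x := by
            rw [← Finset.mul_sum]
            exact mul_le_mul_of_nonneg_left ((Real.sum_le_exp_of_nonneg (abs_nonneg _) N).trans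
              (hle x)) (abs_nonneg _))
    (Filter.Eventually.of_forall fun x => by
      have h1 := (NormedSpace.expSeries_div_hasSum_exp ((t x : ℝ) * Complex.I)).tendsto_sum_nat
      rw [← Complex.exp_eq_exp_ℂ] at h1
      refine (h1.const_mul (g x : ℂ)).congr fun N => ?_
      simp only [hF, Finset.mul_sum]
      refine Finset.sum_congr rfl fun k _ => ?_
      push_cast
      ring)
  simp only [hF0] at hlim
  exact tendsto_nhds_unique hlim tendsto_const_nhds |>.symm ▸ rfl

theorem ae_eq_zero_of_forall_integral_mul_eval {ν : Measure (Fin n → ℝ)} [IsFiniteMeasure ν]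
    (hexp : ∀ θ : Fin n → ℝ, MemLp (fun x => Real.exp (∑ k, θ k * x k)) 2 ν)
    {g : (Fin n → ℝ) → ℝ} (hg : MemLp g 2 ν) (h0 : ∀ p, ∫ x, g x * eval x p ∂ν = 0) :
    g =ᵐ[ν] 0 := by
  have hgi : Integrable g ν := hg.integrable one_le_two
  have hfin : ∀ f : (Fin n → ℝ) → ℝ, Integrable f ν →
      IsFiniteMeasure (ν.withDensity fun x => ENNReal.ofReal (f x)) := fun f hf =>
    isFiniteMeasure_withDensity_ofReal hf.2
  have := hfin g hgi
  have := hfin (fun x => -g x) hgi.neg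
  have hm : AEMeasurable (fun x => ENNReal.ofReal (g x)) ν := hgi.1.aemeasurable.ennreal_ofReal
  have hm' : AEMeasurable (fun x => ENNReal.ofReal (-g x)) ν :=
    hgi.neg.1.aemeasurable.ennreal_ofReal
  have key : (ν.withDensity fun x => ENNReal.ofReal (g x)) =
      ν.withDensity fun x => ENNReal.ofReal (-g x) := by
    refine Measure.ext_of_charFunDual (funext fun L => ?_)
    rw [charFunDual_apply, charFunDual_apply,
      integral_withDensity_eq_integral_toReal_smul₀ hm (Filter.Eventually.of_forall fun _ =>
        ENNReal.ofReal_lt_top),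
      integral_withDensity_eq_integral_toReal_smul₀ hm' (Filter.Eventually.of_forall fun _ =>
        ENNReal.ofReal_lt_top), ← sub_eq_zero]
    have hL : Continuous fun x => Complex.exp (L x * Complex.I) := by fun_prop
    have h_intg : ∀ f : (Fin n → ℝ) → ℝ, Integrable f ν → Integrable (fun x =>
        (ENNReal.ofReal (f x)).toReal • Complex.exp (L x * Complex.I)) ν := by
      intro f hf
      refine hf.norm.mono' ?_ (Filter.Eventually.of_forall fun x => ?_)
      · exact (hf.1.aemeasurable.ennreal_ofReal.ennreal_toReal.aestronglyMeasurable).smul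
          hL.aestronglyMeasurable
      · rw [norm_smul, Complex.norm_exp_ofReal_mul_I, mul_one, Real.norm_of_nonneg
          ENNReal.toReal_nonneg, ENNReal.toReal_ofReal']
        exact max_le (le_abs_self _) (abs_nonneg _)
    rw [← integral_sub (h_intg g hgi) (h_intg (fun x => -g x) hgi.neg)]
    refine (integral_congr_ae (Filter.Eventually.of_forall fun x => ?_)).trans
      (integral_mul_cexp_eq_zero hexp hg h0 fun k => L (Pi.single k 1))
    have hLx : L x = ∑ k, L (Pi.single k 1) * x k := by
      conv_lhs => rw [← Finset.univ_sum_single x, map_sum]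
      refine Finset.sum_congr rfl fun k _ => ?_
      have : (Pi.single k (x k) : Fin n → ℝ) = x k • Pi.single k 1 := by
        rw [← Pi.single_smul, smul_eq_mul, mul_one]
      rw [this, map_smul, smul_eq_mul, mul_comm]
    simp only [← hLx]
    rw [← sub_smul, ENNReal.toReal_ofReal', ENNReal.toReal_ofReal', 
      max_zero_sub_eq_self, Complex.real_smul]
  rw [withDensity_eq_iff_of_sigmaFinite hm hm'] at key
  filter_upwards [key] with x hx
  have h1 := congrArg ENNReal.toReal hx
  rw [ENNReal.toReal_ofReal', ENNReal.toReal_ofReal'] at h1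
  rw [Pi.zero_apply]
  rcases le_total (g x) 0 with h | h
  · rw [max_eq_right h, max_eq_left (by linarith)] at h1; linarith
  · rw [max_eq_left h, max_eq_right (by linarith)] at h1; linarith

end Density

section Closure

open MvPolynomial

variable {n : ℕ} {R s : ℝ} {μ : Measure (Fin n → ℝ)} [IsProbabilityMeasure μ]

theorem eq_zero_of_forall_inner_smoothEmb (hs : 0 < s) (hμ : ∀ᵐ y ∂μ, ∀ k, |y k| ≤ R)
    (g : Lp ℝ 2 (smoothing s μ)) (h : ∀ p, inner ℝ g (smoothEmb hs hμ p) = 0) : g = 0 := by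
  have := isProbabilityMeasure_smoothing hs hμ
  have h1 : (g : (Fin n → ℝ) → ℝ) =ᵐ[smoothing s μ] 0 := by
    refine ae_eq_zero_of_forall_integral_mul_eval
      (fun θ => (ExpGrowth.exp_linear θ).memLp_smoothing hs hμ) (Lp.memLp g) fun p => ?_
    rw [← h p, ← inner_toLp (Lp.memLp g) ((ExpGrowth.poly p).memLp_smoothing hs hμ),
      Lp.toLp_coeFn]
    rfl
  exact (Lp.eq_zero_iff_ae_eq_zero).2 h1

theorem dense_range_smoothEmb (hs : 0 < s) (hμ : ∀ᵐ y ∂μ, ∀ k, |y k| ≤ R)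
    (g : Lp ℝ 2 (smoothing s μ)) {ε : ℝ} (hε : 0 < ε) : ∃ p, ‖g - smoothEmb hs hμ p‖ < ε := by
  have h1 : (LinearMap.range (smoothEmb hs hμ)).topologicalClosure = ⊤ := by
    rw [Submodule.topologicalClosure_eq_top_iff, Submodule.eq_bot_iff]
    intro g hg
    refine eq_zero_of_forall_inner_smoothEmb hs hμ g fun p => ?_
    rw [real_inner_comm]
    exact hg _ ⟨p, rfl⟩
  have h2 : g ∈ closure (Set.range (smoothEmb hs hμ)) := by
    have : g ∈ (LinearMap.range (smoothEmb hs hμ)).topologicalClosure := by rw [h1]; trivial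
    rwa [← SetLike.mem_coe, Submodule.topologicalClosure_coe, LinearMap.coe_range] at this
  obtain ⟨_, ⟨p, rfl⟩, hp⟩ := Metric.mem_closure_iff.1 h2 ε hε
  exact ⟨p, by rwa [dist_eq_norm] at hp⟩

/-- The weighted Laplacian of the smoothing as a linear map. -/
noncomputable def smoothLapLin (hs : 0 < s) (hR : 0 ≤ R) (hμ : ∀ᵐ y ∂μ, ∀ k, |y k| ≤ R)
    (d : Fin n → ℝ) : MvPolynomial (Fin n) ℝ →ₗ[ℝ] Lp ℝ 2 (smoothing s μ) where
  toFun := smoothLap hs hR hμ d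
  map_add' u v := by
    rw [← sub_eq_zero]
    refine eq_zero_of_forall_inner_smoothEmb hs hμ _ fun p => ?_
    rw [inner_sub_left, inner_add_left, inner_smoothLap, inner_smoothLap, inner_smoothLap,
      ← Finset.sum_add_distrib, ← Finset.sum_sub_distrib]
    refine Finset.sum_eq_zero fun k _ => ?_
    rw [map_add, add_mul, map_add]
    ring
  map_smul' c u := by
    rw [← sub_eq_zero]
    refine eq_zero_of_forall_inner_smoothEmb hs hμ _ fun p => ?_
    rw [inner_sub_left, RingHom.id_apply, real_inner_smul_left, inner_smoothLap, inner_smoothLap,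
      Finset.mul_sum, ← Finset.sum_sub_distrib]
    refine Finset.sum_eq_zero fun k _ => ?_
    rw [Derivation.map_smul, smul_mul_assoc, map_smul, smul_eq_mul]
    ring

theorem smoothLapLin_apply (hs : 0 < s) (hR : 0 ≤ R) (hμ : ∀ᵐ y ∂μ, ∀ k, |y k| ≤ R)
    (d : Fin n → ℝ) (u : MvPolynomial (Fin n) ℝ) :
    smoothLapLin hs hR hμ d u = smoothLap hs hR hμ d u := rfl

omit [IsProbabilityMeasure μ] in
theorem ouPoly_add (s : ℝ) (y d : Fin n → ℝ) (u v : MvPolynomial (Fin n) ℝ) :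
    ouPoly s y d (u + v) = ouPoly s y d u + ouPoly s y d v := by
  rw [ouPoly, ouPoly, ouPoly, ← Finset.sum_add_distrib]
  refine Finset.sum_congr rfl fun k _ => ?_
  simp only [map_add]
  ring

omit [IsProbabilityMeasure μ] in
theorem exists_add_ouPoly_eq {s₀ : ℝ} (hs₀ : 0 < s₀) (hs : 0 < s) {d : Fin n → ℝ}
    (hd : ∀ k, 0 < d k) (p : MvPolynomial (Fin n) ℝ) : ∃ u, s₀ • u + ouPoly s 0 d u = p := by
  induction p using MvPolynomial.induction_on_degree with
  | add p q hp hq =>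
    obtain ⟨u, rfl⟩ := hp
    obtain ⟨v, rfl⟩ := hq
    exact ⟨u + v, by rw [ouPoly_add, smul_add]; ring⟩
  | mon e a ih =>
    set c := s₀ + s * ∑ k, d k * e k with hc
    have hc0 : 0 < c := by
      have : 0 ≤ ∑ k, d k * (e k : ℝ) :=
        Finset.sum_nonneg fun k _ => mul_nonneg (hd k).le (Nat.cast_nonneg _)
      positivity
    set u₀ := monomial e (a / c) with hu₀
    have hX : ∀ k, X k * pderiv k u₀ = (e k : ℝ) • u₀ := by
      intro k
      rw [hu₀, X_mul_pderiv_monomial, Nat.cast_smul_eq_nsmul]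
    have h1 : s₀ • u₀ + ouPoly s 0 d u₀ = monomial e a - ∑ k, d k • pderiv k (pderiv k u₀) := by
      have h2 : ouPoly s 0 d u₀ = (s * ∑ k, d k * (e k : ℝ)) • u₀ -
          ∑ k, d k • pderiv k (pderiv k u₀) := by
        rw [ouPoly, Finset.mul_sum, Finset.sum_smul, ← Finset.sum_sub_distrib]
        refine Finset.sum_congr rfl fun k _ => ?_
        rw [Pi.zero_apply, map_zero, sub_zero, hX]
        simp only [smul_eq_C_mul, map_mul]
        ring
      rw [h2, ← add_sub_assoc, ← add_smul, ← hc, hu₀, smul_monomial, smul_eq_mul,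
        mul_div_cancel₀ _ hc0.ne']
    have h3 : ∀ t : Finset (Fin n), ∃ v, s₀ • v + ouPoly s 0 d v =
        ∑ k ∈ t, d k • pderiv k (pderiv k u₀) := by
      intro t
      induction t using Finset.induction_on with
      | empty => exact ⟨0, by simp [ouPoly]⟩
      | insert k t hk iht =>
        obtain ⟨v, hv⟩ := iht
        obtain ⟨w, hw⟩ : ∃ w, s₀ • w + ouPoly s 0 d w = d k • pderiv k (pderiv k u₀) := by
          by_cases hek : e k = 0
          · refine ⟨0, ?_⟩
            rw [hu₀, pderiv_monomial, hek]
            simp [ouPoly]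
          · obtain ⟨b, hb⟩ : ∃ b, d k • pderiv k (pderiv k u₀) =
                monomial (e - Finsupp.single k 1 - Finsupp.single k 1) b := by
              rw [hu₀, pderiv_monomial, pderiv_monomial, smul_monomial]
              exact ⟨_, rfl⟩
            rw [hb]
            refine ih _ _ ?_
            have h4 := degree_sub_single_lt e hek
            have h5 : (e - Finsupp.single k 1 - Finsupp.single k 1).degree ≤
              (e - Finsupp.single k 1).degree := Finsupp.degree_mono tsub_le_self
            omega
        refine ⟨w + v, ?_⟩
        rw [Finset.sum_insert hk, ← hv, ← hw, ouPoly_add, smul_add]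
        ring
    obtain ⟨v, hv⟩ := h3 Finset.univ
    refine ⟨u₀ + v, ?_⟩
    rw [ouPoly_add, smul_add, add_add_add_comm, h1, hv, sub_add_cancel]

theorem norm_smoothEmb_ouPoly_sub_sq_le (hs : 0 < s) (hR : 0 ≤ R)
    (hμ : ∀ᵐ y ∂μ, ∀ k, |y k| ≤ R) {d : Fin n → ℝ} (hd : ∀ k, 0 < d k)
    (u : MvPolynomial (Fin n) ℝ) :
    ‖smoothEmb hs hμ (ouPoly s 0 d u) - smoothLap hs hR hμ d u‖ ^ 2 ≤
      (s * R) ^ 2 * (∑ k, d k) * ∑ k, d k * smoothMean hs hμ (pderiv k u * pderiv k u) := by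
  have m1 := (ExpGrowth.poly (R := R) (ouPoly s 0 d u)).memLp_smoothing hs hμ
  have m2 := memLp_smoothLapFun hs hR hμ d u
  have e1 : smoothEmb hs hμ (ouPoly s 0 d u) - smoothLap hs hR hμ d u =
      (m1.sub m2).toLp _ := (MemLp.toLp_sub m1 m2).symm
  rw [e1, ← real_inner_self_eq_norm_sq, inner_toLp]
  have hpt : ∀ x, ((fun x => eval x (ouPoly s 0 d u)) - smoothLapFun s μ d u) x *
      ((fun x => eval x (ouPoly s 0 d u)) - smoothLapFun s μ d u) x ≤
      (s * R) ^ 2 * (∑ k, d k) * ∑ k, d k * eval x (pderiv k u * pderiv k u) := by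
    intro x
    have := isProbabilityMeasure_posterior (μ := μ) hs x
    have hp := ae_posterior (s := s) hμ x
    have i1 := (ExpGrowth.ouPoly hR s d u).integrable_right hp x
    have e2 : ((fun x => eval x (ouPoly s 0 d u)) - smoothLapFun s μ d u) x =
        ∫ y, (eval x (ouPoly s 0 d u) - eval x (ouPoly s y d u)) ∂(posterior s μ x) := by
      rw [integral_sub (integrable_const _) i1]
      simp [smoothLapFun, posteriorAvg]
    have h1 : |((fun x => eval x (ouPoly s 0 d u)) - smoothLapFun s μ d u) x| ≤
        s * R * ∑ k, d k * |eval x (pderiv k u)| := by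
      rw [e2]
      have h2 : ∀ᵐ y ∂(posterior s μ x), ‖eval x (ouPoly s 0 d u) - eval x (ouPoly s y d u)‖ ≤
          s * R * ∑ k, d k * |eval x (pderiv k u)| := by
        filter_upwards [hp] with y hy
        rw [eval_ouPoly, eval_ouPoly, Finset.mul_sum]
        simp only [Pi.zero_apply, mul_zero, Finset.sum_const_zero, sub_zero, sub_sub_cancel]
        refine norm_sum_le_of_le _ fun k _ => ?_
        rw [norm_mul, norm_mul, norm_mul, Real.norm_of_nonneg hs.le, Real.norm_of_nonneg (hd k).le,
          Real.norm_eq_abs, Real.norm_eq_abs]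
        have h3 : 0 ≤ s * d k * |eval x (pderiv k u)| :=
          mul_nonneg (mul_nonneg hs.le (hd k).le) (abs_nonneg _)
        nlinarith [mul_le_mul_of_nonneg_left (hy k) h3]
      simpa using norm_integral_le_of_norm_le_const h2
    have h4 : (∑ k, d k * |eval x (pderiv k u)|) ^ 2 ≤
        (∑ k, d k) * ∑ k, d k * eval x (pderiv k u * pderiv k u) := by
      refine Finset.sum_sq_le_sum_mul_sum_of_sq_le_mul _ (fun k _ => (hd k).le)
        (fun k _ => ?_) fun k _ => ?_
      · rw [map_mul]; exact mul_nonneg (hd k).le (mul_self_nonneg _)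
      · rw [map_mul, mul_pow, sq_abs]; exact (by ring : _ = _).le
    have h5 := mul_self_le_mul_self (abs_nonneg _) h1
    rw [abs_mul_abs_self] at h5
    refine h5.trans ?_
    calc _ = (s * R) ^ 2 * (∑ k, d k * |eval x (pderiv k u)|) ^ 2 := by ring
      _ ≤ (s * R) ^ 2 * ((∑ k, d k) * ∑ k, d k * eval x (pderiv k u * pderiv k u)) := by gcongr
      _ = _ := by ring
  have i2 : ∀ k ∈ Finset.univ, Integrable (fun x => d k * eval x (pderiv k u * pderiv k u))
      (smoothing s μ) := fun k _ =>
    ((ExpGrowth.poly (pderiv k u * pderiv k u)).integrable_smoothing hs hμ).const_mul _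
  have h6 := integral_mono ((m1.sub m2).integrable_mul (m1.sub m2))
    ((integrable_finsetSum _ i2).const_mul ((s * R) ^ 2 * (∑ k, d k))) hpt
  rw [integral_const_mul, integral_finsetSum _ i2] at h6
  simp only [integral_const_mul, ← smoothMean_apply hs hμ] at h6
  exact h6

theorem dense_range_add_smoothLap (hs : 0 < s) (hR : 0 ≤ R)
    (hμ : ∀ᵐ y ∂μ, ∀ k, |y k| ≤ R) {d : Fin n → ℝ} (hd : ∀ k, 0 < d k) :
    ∃ s₀ : ℝ, 0 < s₀ ∧ ∀ (g : Lp ℝ 2 (smoothing s μ)) (ε : ℝ), 0 < ε → ∃ u,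
      ‖g - (s₀ • smoothEmb hs hμ u + smoothLap hs hR hμ d u)‖ < ε := by
  set B := (s * R) ^ 2 * ∑ k, d k with hB
  have hB0 : 0 ≤ B := mul_nonneg (sq_nonneg _) (Finset.sum_nonneg fun k _ => (hd k).le)
  set s₀ := 5 / 2 * B + 1 with hs₀
  have hs₀0 : 0 < s₀ := by positivity
  refine ⟨s₀, hs₀0, ?_⟩
  set T : MvPolynomial (Fin n) ℝ →ₗ[ℝ] Lp ℝ 2 (smoothing s μ) :=
    s₀ • smoothEmb hs hμ + smoothLapLin hs hR hμ d with hT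
  have hTu : ∀ u, T u = s₀ • smoothEmb hs hμ u + smoothLap hs hR hμ d u := fun u => rfl
  have hhalf : ∀ u, ‖smoothEmb hs hμ (ouPoly s 0 d u) - smoothLap hs hR hμ d u‖ ≤
      1 / 2 * ‖smoothEmb hs hμ (s₀ • u + ouPoly s 0 d u)‖ := by
    intro u
    set Q := ∑ k, d k * smoothMean hs hμ (pderiv k u * pderiv k u) with hQ
    set D := smoothEmb hs hμ (ouPoly s 0 d u) - smoothLap hs hR hμ d u with hD
    have h1 : ‖D‖ ^ 2 ≤ B * Q := norm_smoothEmb_ouPoly_sub_sq_le hs hR hμ hd u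
    set N := ‖smoothEmb hs hμ u‖ with hN
    set P := ‖smoothEmb hs hμ (s₀ • u + ouPoly s 0 d u)‖ with hP
    have h2 : inner ℝ (smoothEmb hs hμ (s₀ • u + ouPoly s 0 d u)) (smoothEmb hs hμ u) =
        s₀ * N ^ 2 + Q + inner ℝ D (smoothEmb hs hμ u) := by
      have e : smoothEmb hs hμ (s₀ • u + ouPoly s 0 d u) =
          s₀ • smoothEmb hs hμ u + smoothLap hs hR hμ d u + D := by
        rw [hD, map_add, map_smul]; abel
      rw [e, inner_add_left, inner_add_left, real_inner_smul_left, real_inner_self_eq_norm_sq,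
        inner_smoothLap]
    have h3 := real_inner_le_norm (smoothEmb hs hμ (s₀ • u + ouPoly s 0 d u)) (smoothEmb hs hμ u)
    have h4 := neg_le_of_abs_le (abs_real_inner_le_norm D (smoothEmb hs hμ u))
    rw [h2] at h3
    have hN0 : 0 ≤ N := norm_nonneg _
    have hP0 : 0 ≤ P := norm_nonneg _
    have hD0 : 0 ≤ ‖D‖ := norm_nonneg _
    have h5 : (2 * ‖D‖) ^ 2 ≤ P ^ 2 := by
      have h6 : s₀ * N ^ 2 + Q ≤ P * N + ‖D‖ * N := by linarith
      have h7 := mul_le_mul_of_nonneg_left h6 hB0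
      rw [hs₀] at h7
      nlinarith [sq_nonneg (P - 4 * B * N), sq_nonneg (‖D‖ - B * N), sq_nonneg N, mul_nonneg hB0 (sq_nonneg N)]
    have h6 := abs_le_of_sq_le_sq h5 hP0
    linarith [(le_abs_self _).trans h6]
  have hclos : (LinearMap.range T).topologicalClosure = ⊤ := by
    rw [Submodule.topologicalClosure_eq_top_iff, Submodule.eq_bot_iff]
    intro g hg
    have h1 : ∀ p, inner ℝ g (smoothEmb hs hμ p) ≤ 1 / 2 * (‖g‖ * ‖smoothEmb hs hμ p‖) := by
      intro p
      obtain ⟨u, hu⟩ := exists_add_ouPoly_eq hs₀0 hs hd p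
      have h2 : inner ℝ g (T u) = 0 := by rw [real_inner_comm]; exact hg _ ⟨u, rfl⟩
      have h3 : smoothEmb hs hμ p = T u +
          (smoothEmb hs hμ (ouPoly s 0 d u) - smoothLap hs hR hμ d u) := by
        rw [hTu, ← hu, map_add, map_smul]; abel
      have h4 := hhalf u
      rw [hu] at h4
      rw [h3, inner_add_right, h2, zero_add, ← h3]
      refine (real_inner_le_norm _ _).trans ?_
      nlinarith [norm_nonneg g]
    by_contra hne
    have hg0 : 0 < ‖g‖ := norm_pos_iff.2 hne
    obtain ⟨p, hp⟩ := dense_range_smoothEmb hs hμ g (ε := ‖g‖ / 4) (by positivity)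
    have h2 := h1 p
    have h3 : inner ℝ g (smoothEmb hs hμ p) = ‖g‖ ^ 2 - inner ℝ g (g - smoothEmb hs hμ p) := by
      rw [inner_sub_right, real_inner_self_eq_norm_sq]; ring
    have h4 := real_inner_le_norm g (g - smoothEmb hs hμ p)
    have h5 : ‖smoothEmb hs hμ p‖ ≤ ‖g‖ + ‖g - smoothEmb hs hμ p‖ := by
      have := norm_sub_le g (g - smoothEmb hs hμ p)
      rwa [sub_sub_cancel] at this
    nlinarith
  intro g ε hε
  have h2 : g ∈ closure (Set.range T) := by
    have : g ∈ (LinearMap.range T).topologicalClosure := by rw [hclos]; trivial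
    rwa [← SetLike.mem_coe, Submodule.topologicalClosure_coe, LinearMap.coe_range] at this
  obtain ⟨_, ⟨u, rfl⟩, hu⟩ := Metric.mem_closure_iff.1 h2 ε hε
  exact ⟨u, by rwa [dist_eq_norm] at hu⟩

theorem exists_approx_of_orthogonal (hs : 0 < s) (hR : 0 ≤ R)
    (hμ : ∀ᵐ y ∂μ, ∀ k, |y k| ≤ R) {d : Fin n → ℝ} (hd : ∀ k, 0 < d k)
    {g : Lp ℝ 2 (smoothing s μ)} (hg : ∀ u, inner ℝ (smoothLap hs hR hμ d u) g = 0) :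
    ∃ c : ℝ, 0 ≤ c ∧ ∀ ε : ℝ, 0 < ε → ∃ w, ‖g - smoothEmb hs hμ w‖ ≤ ε ∧
      ∑ k, d k * smoothMean hs hμ (pderiv k w * pderiv k w) ≤ c * ε ^ 2 := by
  obtain ⟨s₀, hs₀, h⟩ := dense_range_add_smoothLap hs hR hμ hd
  refine ⟨s₀, hs₀.le, fun ε hε => ?_⟩
  obtain ⟨u, hu⟩ := h g ε hε
  set z := s₀ • smoothEmb hs hμ u - g with hz
  set Q := ∑ k, d k * smoothMean hs hμ (pderiv k u * pderiv k u) with hQ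
  have hQ0 : 0 ≤ Q := Finset.sum_nonneg fun k _ => mul_nonneg (hd k).le (by
    rw [← inner_smoothEmb]; exact real_inner_self_nonneg)
  have h1 : inner ℝ (z + smoothLap hs hR hμ d u) z = ‖z‖ ^ 2 + s₀ * Q := by
    have h2 : inner ℝ (smoothLap hs hR hμ d u) z = s₀ * Q := by
      rw [hz, inner_sub_right, hg, sub_zero, real_inner_smul_right, inner_smoothLap]
    rw [inner_add_left, real_inner_self_eq_norm_sq, h2]
  have h2 := real_inner_le_norm (z + smoothLap hs hR hμ d u) z
  have h3 : ‖z + smoothLap hs hR hμ d u‖ < ε := by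
    have e : z + smoothLap hs hR hμ d u =
        -(g - (s₀ • smoothEmb hs hμ u + smoothLap hs hR hμ d u)) := by
      rw [hz]; abel
    rw [e, norm_neg]
    exact hu
  rw [h1] at h2
  have hz0 := norm_nonneg z
  have h4 : ‖z‖ ^ 2 + s₀ * Q ≤ ε * ‖z‖ := h2.trans (mul_le_mul_of_nonneg_right h3.le hz0)
  have h5 : ‖z‖ ≤ ε := by
    by_contra hlt
    push Not at hlt
    nlinarith [mul_nonneg hs₀.le hQ0]
  refine ⟨s₀ • u, ?_, ?_⟩
  · rw [map_smul, ← norm_neg, neg_sub]; exact h5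
  · have e : ∑ k, d k * smoothMean hs hμ (pderiv k (s₀ • u) * pderiv k (s₀ • u)) = s₀ ^ 2 * Q := by
      rw [hQ, Finset.mul_sum]
      refine Finset.sum_congr rfl fun k _ => ?_
      rw [Derivation.map_smul, smul_mul_smul_comm, map_smul, smul_eq_mul]
      ring
    have h6 : s₀ * Q ≤ ε ^ 2 := by nlinarith
    rw [e]
    nlinarith

end Closure

section ClosureModel

open MvPolynomial

variable {n : ℕ} {R s : ℝ} {μ : Measure (Fin n → ℝ)} [IsProbabilityMeasure μ]

/-- The density of a centered Gaussian with respect to the smoothing. -/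
noncomputable def gaussWeight (s : ℝ) (μ : Measure (Fin n → ℝ)) (x : Fin n → ℝ) : ℝ :=
  gaussKer (2 * s) x 0 / smoothDensity s μ x

theorem gaussWeight_pos (hs : 0 < s) (x : Fin n → ℝ) : 0 < gaussWeight s μ x :=
  div_pos (gaussKer_pos (by positivity) _ _) (smoothDensity_pos hs x)

theorem measurable_gaussWeight : Measurable (gaussWeight s μ) := by
  refine Measurable.div ?_ measurable_smoothDensity
  exact (by fun_prop : Continuous fun x : Fin n → ℝ => gaussKer (2 * s) x 0).measurable

theorem gaussWeight_le (hs : 0 < s) (hμ : ∀ᵐ y ∂μ, ∀ k, |y k| ≤ R) (x : Fin n → ℝ) :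
    gaussWeight s μ x ≤ gaussConst n (2 * s) / (gaussConst n s * Real.exp (-(s * (n * R ^ 2)))) := by
  have c1 : 0 < gaussConst n (2 * s) := gaussConst_pos (by positivity)
  have c2 : 0 < gaussConst n s := gaussConst_pos hs
  have h1 : gaussConst n s * Real.exp (-(s * (n * R ^ 2))) * Real.exp (-(s * ∑ k, x k ^ 2)) ≤
      smoothDensity s μ x := by
    have h2 : ∀ᵐ y ∂μ, gaussConst n s * Real.exp (-(s * (n * R ^ 2))) *
        Real.exp (-(s * ∑ k, x k ^ 2)) ≤ gaussKer s x y := by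
      filter_upwards [hμ] with y hy
      rw [gaussKer, mul_assoc, ← Real.exp_add]
      gcongr
      have h3 : ∑ k, (x k - y k) ^ 2 ≤ 2 * ∑ k, x k ^ 2 + 2 * (n * R ^ 2) := by
        calc _ ≤ ∑ k, (2 * x k ^ 2 + 2 * R ^ 2) := by
              gcongr with k
              nlinarith [sq_nonneg (x k + y k), abs_le.1 (hy k), sq_abs (y k),
                mul_self_le_mul_self (abs_nonneg _) (hy k)]
          _ = _ := by
              rw [Finset.sum_add_distrib, ← Finset.mul_sum]; simp; ring
      nlinarith
    have h3 : Integrable (gaussKer s x) μ := by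
      simp only [funext (gaussKer_eq s x)]
      exact (integrable_exp_quadPot hs.le x).const_mul _
    have h4 := integral_mono_ae (integrable_const _) h3 h2
    simpa [smoothDensity] using h4
  rw [gaussWeight, div_le_div_iff₀ (smoothDensity_pos hs x) (by positivity)]
  have h5 : gaussKer (2 * s) x 0 = gaussConst n (2 * s) * Real.exp (-(s * ∑ k, x k ^ 2)) := by
    rw [gaussKer]; congr 2; simp
  rw [h5]
  calc _ = gaussConst n (2 * s) * (gaussConst n s * Real.exp (-(s * (n * R ^ 2))) *
        Real.exp (-(s * ∑ k, x k ^ 2))) := by ring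
    _ ≤ _ := by gcongr

theorem memLp_gaussWeight_mul (hs : 0 < s) (hμ : ∀ᵐ y ∂μ, ∀ k, |y k| ≤ R)
    {f : (Fin n → ℝ) → ℝ} (hf : MemLp f 2 (smoothing s μ)) :
    MemLp (fun x => gaussWeight s μ x * f x) 2 (smoothing s μ) := by
  refine hf.of_le_mul (c := gaussConst n (2 * s) /
    (gaussConst n s * Real.exp (-(s * (n * R ^ 2)))))
    (measurable_gaussWeight.aestronglyMeasurable.mul hf.1) (Filter.Eventually.of_forall fun x => ?_)
  rw [norm_mul, Real.norm_of_nonneg (gaussWeight_pos hs x).le]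
  exact mul_le_mul_of_nonneg_right (gaussWeight_le hs hμ x) (norm_nonneg _)

/-- Polynomials times the Gaussian weight, as elements of `L²` of the smoothing. -/
noncomputable def weightEmb (hs : 0 < s) (hμ : ∀ᵐ y ∂μ, ∀ k, |y k| ≤ R) :
    MvPolynomial (Fin n) ℝ →ₗ[ℝ] Lp ℝ 2 (smoothing s μ) where
  toFun p := (memLp_gaussWeight_mul hs hμ ((ExpGrowth.poly p).memLp_smoothing hs hμ)).toLp _
  map_add' p q := by
    rw [← MemLp.toLp_add]
    congr 1
    ext x
    simp [mul_add]
  map_smul' c p := by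
    rw [RingHom.id_apply, ← MemLp.toLp_const_smul]
    congr 1
    ext x
    simp
    ring

theorem inner_smoothEmb_weightEmb (hs : 0 < s) (hμ : ∀ᵐ y ∂μ, ∀ k, |y k| ≤ R)
    (p q : MvPolynomial (Fin n) ℝ) :
    inner ℝ (smoothEmb hs hμ p) (weightEmb hs hμ q) =
      gaussMean (by positivity : 0 < 2 * s) 0 (p * q) := by
  refine (inner_toLp ((ExpGrowth.poly p).memLp_smoothing hs hμ)
    (memLp_gaussWeight_mul hs hμ ((ExpGrowth.poly q).memLp_smoothing hs hμ))).trans ?_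
  rw [integral_smoothing hs, gaussMean_apply]
  refine integral_congr_ae (Filter.Eventually.of_forall fun x => ?_)
  have := (smoothDensity_pos (μ := μ) hs x).ne'
  simp only [gaussWeight, map_mul]
  field_simp

theorem inner_weightEmb_eq_zero (hs : 0 < s) (hR : 0 ≤ R)
    (hμ : ∀ᵐ y ∂μ, ∀ k, |y k| ≤ R) {d : Fin n → ℝ} (hd : ∀ k, 0 < d k)
    {g : Lp ℝ 2 (smoothing s μ)} (hg : ∀ u, inner ℝ (smoothLap hs hR hμ d u) g = 0)
    (k : Fin n) (p : MvPolynomial (Fin n) ℝ) :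
    inner ℝ g (weightEmb hs hμ (C (2 * s) * (X k * p) - pderiv k p)) = 0 := by
  obtain ⟨c, hc, h⟩ := exists_approx_of_orthogonal hs hR hμ hd hg
  set r := C (2 * s) * (X k * p) - pderiv k p with hr
  have h2s : 0 < 2 * s := by positivity
  by_contra hne
  set A := |inner ℝ g (weightEmb hs hμ r)| with hA
  have hA0 : 0 < A := abs_pos.2 hne
  set M := ‖weightEmb hs hμ r‖ + √(c / d k) * ‖weightEmb hs hμ p‖ with hM
  have hM0 : 0 ≤ M := by positivity
  have key : ∀ ε : ℝ, 0 < ε → A ≤ ε * M := by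
    intro ε hε
    obtain ⟨w, hw, hw2⟩ := h ε hε
    have e1 : inner ℝ g (weightEmb hs hμ r) =
        inner ℝ (g - smoothEmb hs hμ w) (weightEmb hs hμ r) +
          inner ℝ (smoothEmb hs hμ (pderiv k w)) (weightEmb hs hμ p) := by
      have e2 : inner ℝ (smoothEmb hs hμ w) (weightEmb hs hμ r) =
          inner ℝ (smoothEmb hs hμ (pderiv k w)) (weightEmb hs hμ p) := by
        rw [inner_smoothEmb_weightEmb, inner_smoothEmb_weightEmb]
        have e3 := gaussMean_X_mul h2s 0 k (w * p)
        rw [Pi.zero_apply, zero_mul, zero_add, Derivation.leibniz, map_add, smul_eq_mul,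
          smul_eq_mul] at e3
        have e4 : w * r = (2 * s) • (X k * (w * p)) - w * pderiv k p := by
          rw [hr, smul_eq_C_mul]; ring
        rw [e4, map_sub, map_smul, e3, smul_eq_mul, mul_comm p]
        field_simp
        ring
      rw [inner_sub_left, e2]; ring
    have h3 : ‖smoothEmb hs hμ (pderiv k w)‖ ≤ √(c / d k) * ε := by
      refine abs_le_of_sq_le_sq' ?_ (by positivity) |>.2
      rw [mul_pow, Real.sq_sqrt (div_nonneg hc (hd k).le), ← real_inner_self_eq_norm_sq,
        inner_smoothEmb, div_mul_eq_mul_div, le_div_iff₀ (hd k)]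
      refine le_trans ?_ hw2
      rw [mul_comm]
      exact Finset.single_le_sum (f := fun k => d k * smoothMean hs hμ (pderiv k w * pderiv k w))
        (fun j _ => mul_nonneg (hd j).le (by
          rw [← inner_smoothEmb]; exact real_inner_self_nonneg)) (Finset.mem_univ k)
    have h4 := abs_real_inner_le_norm (g - smoothEmb hs hμ w) (weightEmb hs hμ r)
    have h5 := abs_real_inner_le_norm (smoothEmb hs hμ (pderiv k w)) (weightEmb hs hμ p)
    rw [hA, e1]
    refine (abs_add_le _ _).trans ?_
    have h6 := mul_le_mul_of_nonneg_right hw (norm_nonneg (weightEmb hs hμ r))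
    have h7 := mul_le_mul_of_nonneg_right h3 (norm_nonneg (weightEmb hs hμ p))
    rw [hM]
    linarith
  have h8 := key (A / (2 * (M + 1))) (by positivity)
  rw [div_mul_eq_mul_div, le_div_iff₀ (by positivity)] at h8
  nlinarith

theorem eq_const_of_orthogonal (hs : 0 < s) (hR : 0 ≤ R)
    (hμ : ∀ᵐ y ∂μ, ∀ k, |y k| ≤ R) {d : Fin n → ℝ} (hd : ∀ k, 0 < d k)
    {g : Lp ℝ 2 (smoothing s μ)} (hg : ∀ u, inner ℝ (smoothLap hs hR hμ d u) g = 0) :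
    ∃ c : ℝ, g = c • smoothEmb hs hμ 1 := by
  have := isProbabilityMeasure_smoothing hs hμ
  have h2s : 0 < 2 * s := by positivity
  set c := inner ℝ g (weightEmb hs hμ 1) with hc
  refine ⟨c, sub_eq_zero.1 ?_⟩
  set g' := g - c • smoothEmb hs hμ 1 with hg'
  have hX : ∀ k p, inner ℝ g' (weightEmb hs hμ (X k * p)) =
      (2 * s)⁻¹ * inner ℝ g' (weightEmb hs hμ (pderiv k p)) := by
    intro k p
    have h1 := inner_weightEmb_eq_zero hs hR hμ hd hg k p
    rw [map_sub, ← smul_eq_C_mul, map_smul, inner_sub_right, real_inner_smul_right] at h1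
    have h2 := gaussMean_X_mul h2s 0 k p
    rw [Pi.zero_apply, zero_mul, zero_add] at h2
    rw [hg', inner_sub_left, inner_sub_left, real_inner_smul_left, real_inner_smul_left,
      inner_smoothEmb_weightEmb, inner_smoothEmb_weightEmb, one_mul, one_mul, h2]
    have h3 : inner ℝ g (weightEmb hs hμ (X k * p)) =
        (2 * s)⁻¹ * inner ℝ g (weightEmb hs hμ (pderiv k p)) := by
      field_simp
      linarith
    rw [h3]; ring
  have h1 : inner ℝ g' (weightEmb hs hμ 1) = 0 := by
    rw [hg', inner_sub_left, real_inner_smul_left, inner_smoothEmb_weightEmb, one_mul,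
      gaussMean_one, ← hc]
    ring
  have hall : ∀ p, inner ℝ g' (weightEmb hs hμ p) = 0 := by
    intro p
    induction p using MvPolynomial.induction_on_degree with
    | add p q hp hq => rw [map_add, inner_add_right, hp, hq, add_zero]
    | mon e a ih =>
      by_cases he : e = 0
      · subst he
        rw [← C_apply, ← mul_one (C a), ← smul_eq_C_mul, map_smul, real_inner_smul_right, h1,
          mul_zero]
      · obtain ⟨k, hk⟩ := Finsupp.ne_iff.1 he
        have hk' : e k ≠ 0 := hk
        have e1 : monomial e a = X k * monomial (e - Finsupp.single k 1) a := by
          rw [X, monomial_mul, one_mul, add_tsub_cancel_of_le]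
          exact Finsupp.single_le_iff.2 (Nat.one_le_iff_ne_zero.2 hk')
        have hd1 := MvPolynomial.degree_sub_single_lt e hk'
        rw [e1, hX, pderiv_monomial, ih, mul_zero]
        have := Finsupp.degree_mono (tsub_le_self : e - Finsupp.single k 1 - Finsupp.single k 1 ≤
          e - Finsupp.single k 1)
        omega
  have h2 : (fun x => gaussWeight s μ x * g' x) =ᵐ[smoothing s μ] 0 := by
    refine ae_eq_zero_of_forall_integral_mul_eval
      (fun θ => (ExpGrowth.exp_linear θ).memLp_smoothing hs hμ)
      (memLp_gaussWeight_mul hs hμ (Lp.memLp g')) fun p => ?_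
    have h3 := inner_toLp (Lp.memLp g')
      (memLp_gaussWeight_mul hs hμ ((ExpGrowth.poly p).memLp_smoothing hs hμ))
    rw [Lp.toLp_coeFn] at h3
    rw [← hall p]
    refine Eq.trans ?_ h3.symm
    refine integral_congr_ae (Filter.Eventually.of_forall fun x => ?_)
    simp only
    ring
  refine (Lp.eq_zero_iff_ae_eq_zero).2 ?_
  filter_upwards [h2] with x hx
  exact (mul_eq_zero.1 hx).resolve_left (gaussWeight_pos hs x).ne'

theorem smoothEmb_mem_closure (hs : 0 < s) (hR : 0 ≤ R)
    (hμ : ∀ᵐ y ∂μ, ∀ k, |y k| ≤ R) {d : Fin n → ℝ} (hd : ∀ k, 0 < d k)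
    (f : MvPolynomial (Fin n) ℝ) (hf : smoothMean hs hμ f = 0) :
    smoothEmb hs hμ f ∈ closure (Set.range (smoothLap hs hR hμ d)) := by
  have h1 : smoothEmb hs hμ f ∈ (LinearMap.range (smoothLapLin hs hR hμ d)).topologicalClosure := by
    rw [← Submodule.orthogonal_orthogonal_eq_closure, Submodule.mem_orthogonal]
    intro g hg
    obtain ⟨c, rfl⟩ := eq_const_of_orthogonal hs hR hμ hd (g := g) fun u => hg _ ⟨u, rfl⟩
    rw [real_inner_smul_left, inner_smoothEmb, one_mul, hf, mul_zero]
  rwa [← SetLike.mem_coe, Submodule.topologicalClosure_coe, LinearMap.coe_range] at h1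

/-- The model attached to the Gaussian smoothing of an isotropic measure. -/
noncomputable def smoothModel (hs : 0 < s) (hR : 0 ≤ R) (hμ : ∀ᵐ y ∂μ, ∀ k, |y k| ≤ R)
    {γ : Fin n → ℝ} (hγ : ∀ k, 0 < γ k)
    (hcov : ∀ x v : Fin n → ℝ, ∫ y, (∑ k, v k * y k) ^ 2 ∂(posterior s μ x) -
      (∫ y, ∑ k, v k * y k ∂(posterior s μ x)) ^ 2 ≤ ∑ k, v k ^ 2 / (γ k + s))
    (hmean : ∀ k, ∫ y, y k ∂μ = 0)
    (hiso : ∀ k l, ∫ y, y k * y l ∂μ = if k = l then 1 else 0) :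
    PolyModel n (Lp ℝ 2 (smoothing s μ)) (fun k => s * γ k / (γ k + s)) (1 + s⁻¹) where
  emb := smoothEmb hs hμ
  mean := smoothMean hs hμ
  lap := smoothLap hs hR hμ
  mean_one := smoothMean_one hs hμ
  inner_emb := inner_smoothEmb hs hμ
  inner_lap d _ := inner_smoothLap hs hR hμ d
  bochner d _ u := bochner_smoothLap hs hR hμ hγ hcov d u
  mem_closure d hd := smoothEmb_mem_closure hs hR hμ hd
  mean_X k := by
    rw [smoothMean_eq, ← hmean k]
    congr 1
    ext y
    have := gaussMean_X_mul hs y k 1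
    rw [mul_one, gaussMean_one, pderiv_one, map_zero] at this
    rw [this]; ring
  mean_X_mul_X k l := by
    rw [smoothMean_eq]
    have h1 : ∀ y, gaussMean hs y (X k * X l) = y k * y l + s⁻¹ * if k = l then 1 else 0 := by
      intro y
      have h2 := gaussMean_X_mul hs y l 1
      rw [mul_one, gaussMean_one, pderiv_one, map_zero] at h2
      rw [gaussMean_X_mul, h2, pderiv_X]
      by_cases h : k = l
      · subst h
        simp [gaussMean_one]
      · have h' : l ≠ k := fun e => h e.symm
        simp [h, h']
    simp only [h1]
    have h3 : Integrable (fun y : Fin n → ℝ => y k * y l) μ :=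
      ((ExpGrowth.snd hR k).mul (ExpGrowth.snd hR l)).integrable_right hμ 0
    rw [integral_add h3 (integrable_const _), hiso]
    by_cases h : k = l <;> simp [h]

end ClosureModel

section

open Filter Topology

section Whitened

open MvPolynomial

variable {n : ℕ} {R : ℝ} {μ : Measure (Fin n → ℝ)}

theorem integrable_of_ae_abs_le [IsFiniteMeasure μ] (hμ : ∀ᵐ y ∂μ, ∀ k, |y k| ≤ R)
    {f : (Fin n → ℝ) → ℝ} (hf : Continuous f) : Integrable f μ := by
  obtain ⟨b, hb⟩ := (isCompact_univ_pi fun _ : Fin n =>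
    isCompact_Icc (a := -R) (b := R)).exists_bound_of_continuousOn hf.continuousOn
  refine Integrable.of_bound hf.aestronglyMeasurable b ?_
  filter_upwards [hμ] with y hy
  exact hb y fun k _ => abs_le.1 (hy k)

theorem tendsto_smoothMean [IsProbabilityMeasure μ] (hR : 0 ≤ R) (hμ : ∀ᵐ y ∂μ, ∀ k, |y k| ≤ R)
    (p : MvPolynomial (Fin n) ℝ) :
    Tendsto (fun N : ℕ => smoothMean (Nat.cast_add_one_pos N : (0 : ℝ) < N + 1) hμ p) atTop
      (𝓝 (∫ y, eval y p ∂μ)) := by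
  obtain ⟨c, hc, h⟩ := gaussMean_sub_le hR p
  have hp : Integrable (fun y => eval y p) μ :=
    integrable_of_ae_abs_le hμ (MvPolynomial.continuous_eval p)
  rw [tendsto_iff_norm_sub_tendsto_zero]
  have hlim : Tendsto (fun N : ℕ => c * ((N : ℝ) + 1)⁻¹) atTop (𝓝 0) := by
    simpa using (tendsto_one_div_add_atTop_nhds_zero_nat (𝕜 := ℝ)).const_mul c
  refine squeeze_zero (fun _ => norm_nonneg _) (fun N => ?_) hlim
  have hs : (0 : ℝ) < N + 1 := Nat.cast_add_one_pos N
  rw [smoothMean_eq, ← integral_sub (integrable_gaussMean hs hμ p) hp]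
  have h2 : ∀ᵐ y ∂μ, ‖gaussMean hs y p - eval y p‖ ≤ c * ((N : ℝ) + 1)⁻¹ := by
    filter_upwards [hμ] with y hy using h _ hs (by simp) y hy
  simpa using norm_integral_le_of_norm_le_const h2

/-- A compactly supported isotropic probability measure whose Gaussian tilts have covariances
bounded by those of the diagonal precision `γ`. -/
structure IsWhitened (γ : Fin n → ℝ) (μ : Measure (Fin n → ℝ)) : Prop where
  isProbabilityMeasure : IsProbabilityMeasure μ
  exists_bound : ∃ R : ℝ, 0 ≤ R ∧ ∀ᵐ y ∂μ, ∀ k, |y k| ≤ R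
  pos : ∀ k, 0 < γ k
  mean : ∀ k, ∫ y, y k ∂μ = 0
  cov : ∀ k l, ∫ y, y k * y l ∂μ = if k = l then 1 else 0
  cov_posterior : ∀ s : ℝ, 0 < s → ∀ x v : Fin n → ℝ,
    ∫ y, (∑ k, v k * y k) ^ 2 ∂(posterior s μ x) -
      (∫ y, ∑ k, v k * y k ∂(posterior s μ x)) ^ 2 ≤ ∑ k, v k ^ 2 / (γ k + s)

namespace IsWhitened

variable {γ : Fin n → ℝ} (h : IsWhitened γ μ)
include h

theorem integrable {f : (Fin n → ℝ) → ℝ} (hf : Continuous f) : Integrable f μ := by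
  have := h.isProbabilityMeasure
  obtain ⟨R, -, hμ⟩ := h.exists_bound
  exact integrable_of_ae_abs_le hμ hf

theorem exists_model : ∃ (H : ℕ → Type) (_ : ∀ N, NormedAddCommGroup (H N))
    (_ : ∀ N, InnerProductSpace ℝ (H N))
    (M : ∀ N : ℕ, PolyModel n (H N) (fun k => ((N : ℝ) + 1) * γ k / (γ k + (N + 1)))
      (1 + ((N : ℝ) + 1)⁻¹)),
    ∀ p, Tendsto (fun N => (M N).mean p) atTop (𝓝 (∫ y, eval y p ∂μ)) := by
  have := h.isProbabilityMeasure
  obtain ⟨R, hR, hμ⟩ := h.exists_bound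
  exact ⟨_, inferInstance, inferInstance,
    fun N => smoothModel (Nat.cast_add_one_pos N : (0 : ℝ) < N + 1) hR hμ h.pos
      (h.cov_posterior _ (Nat.cast_add_one_pos N)) h.mean h.cov,
    tendsto_smoothMean hR hμ⟩

omit h in
theorem tendsto_weight (hγ : ∀ k, 0 < γ k) (k : Fin n) :
    Tendsto (fun N : ℕ => ((N : ℝ) + 1) * γ k / (γ k + (N + 1))) atTop (𝓝 (γ k)) := by
  have h1 : Tendsto (fun N : ℕ => γ k / (γ k * ((N : ℝ) + 1)⁻¹ + 1)) atTop (𝓝 (γ k)) := by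
    have h2 := tendsto_one_div_add_atTop_nhds_zero_nat (𝕜 := ℝ)
    simp only [one_div] at h2
    have h3 := (tendsto_const_nhds (x := γ k)).div ((h2.const_mul (γ k)).add_const 1) (by simp)
    rw [mul_zero, zero_add, div_one] at h3
    exact h3
  refine h1.congr fun N => ?_
  have := hγ k
  field_simp

theorem brascampLieb (p : MvPolynomial (Fin n) ℝ) :
    ∫ y, eval y p ^ 2 ∂μ - (∫ y, eval y p ∂μ) ^ 2 ≤
      ∑ k, (γ k)⁻¹ * ∫ y, eval y (pderiv k p) ^ 2 ∂μ := by
  obtain ⟨H, i1, i2, M, hM⟩ := h.exists_model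
  have hb : ∀ N : ℕ, (M N).mean (p * p) - (M N).mean p ^ 2 ≤
      ∑ k, (((N : ℝ) + 1) * γ k / (γ k + (N + 1)))⁻¹ * (M N).mean (pderiv k p * pderiv k p) := by
    intro N
    have h0 : (M N).mean (p - C ((M N).mean p)) = 0 := by
      rw [map_sub, ← mul_one (C _), ← smul_eq_C_mul, map_smul, (M N).mean_one]; simp
    have h1 := (M N).brascampLieb (fun k => by have := h.pos k; positivity) h0
    have h2 : (p - C ((M N).mean p)) * (p - C ((M N).mean p)) =
        p * p - (2 * (M N).mean p) • p + ((M N).mean p ^ 2) • 1 := by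
      simp only [smul_eq_C_mul, map_mul, map_pow]
      rw [map_ofNat]; ring
    rw [h2, map_add, map_sub, map_smul, map_smul, (M N).mean_one] at h1
    simp only [PolyModel.dir, map_sub, pderiv_C, sub_zero, smul_eq_mul] at h1
    linarith
  have hl := ((hM (p * p)).sub ((hM p).pow 2))
  have hr := tendsto_finsetSum (Finset.univ : Finset (Fin n)) fun k _ =>
    ((tendsto_weight h.pos k).inv₀ (h.pos k).ne').mul (hM (pderiv k p * pderiv k p))
  have := le_of_tendsto_of_tendsto' hl hr hb
  simpa only [map_mul, pow_two] using this

theorem le_one (i : Fin n) : γ i ≤ 1 := by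
  have h1 := h.brascampLieb (X i)
  have := h.isProbabilityMeasure
  have h2 : ∫ y : Fin n → ℝ, y i ^ 2 ∂μ = 1 := by
    simpa [pow_two] using h.cov i i
  simp only [eval_X, h2, h.mean i] at h1
  rw [Finset.sum_eq_single i] at h1
  · simp at h1
    exact (one_le_inv₀ (h.pos i)).1 h1
  · intro k _ hk
    rw [pderiv_X_of_ne hk.symm]; simp
  · simp

theorem sum_third_moment_sq_le (i : Fin n) (S : Finset (Fin n)) (hS : ∀ k ∈ S, γ i ≤ γ k) :
    ∑ j ∈ S, ∑ k ∈ S, (∫ y, y i * y j * y k ∂μ) ^ 2 ≤ 4 * √(1 / γ i) := by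
  obtain ⟨H, i1, i2, M, hM⟩ := h.exists_model
  have hb : ∀ N : ℕ, ∑ j ∈ S, ∑ k ∈ S, (M N).mean (X i * X j * X k) ^ 2 ≤
      4 * (1 + ((N : ℝ) + 1)⁻¹) ^ 2 *
        √((1 + ((N : ℝ) + 1)⁻¹) / (((N : ℝ) + 1) * γ i / (γ i + (N + 1)))) := by
    intro N
    refine (M N).sum_third_moment_sq_le (by positivity)
      (fun k => by have := h.pos k; positivity) i S fun k hk => ?_
    have h1 := h.pos i
    have h2 := h.pos k
    have h3 := hS k hk
    rw [div_le_div_iff₀ (by positivity) (by positivity)]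
    have : (0 : ℝ) < N + 1 := Nat.cast_add_one_pos N
    nlinarith [mul_le_mul_of_nonneg_left h3 (mul_pos this this).le]
  have hl := tendsto_finsetSum S fun j _ => tendsto_finsetSum S fun k _ =>
    (hM (X i * X j * X k)).pow 2
  have h2 := tendsto_one_div_add_atTop_nhds_zero_nat (𝕜 := ℝ)
  simp only [one_div] at h2
  have hτ := h2.const_add 1
  rw [add_zero] at hτ
  have hr := ((hτ.pow 2).const_mul 4).mul
    ((hτ.div (tendsto_weight h.pos i) (h.pos i).ne').sqrt)
  have := le_of_tendsto_of_tendsto' hl hr hb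
  simpa only [map_mul, eval_X, one_pow, mul_one] using this

theorem sum_third_moment_sq_div_le (i : Fin n) :
    (1 / 2) * ∑ k, ∑ l, (∫ y, y i * y k * y l ∂μ) ^ 2 /
      ((γ k)⁻¹ * (5 / 2 - γ l / 2)⁻¹ + (γ l)⁻¹ * (5 / 2 - γ k / 2)⁻¹) ≤ 1 - γ i := by
  obtain ⟨H, i1, i2, M, hM⟩ := h.exists_model
  set g : ℕ → Fin n → ℝ := fun N k => ((N : ℝ) + 1) * γ k / (γ k + (N + 1)) with hg
  set τ : ℕ → ℝ := fun N => 1 + ((N : ℝ) + 1)⁻¹ with hτ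
  have hb : ∀ N : ℕ, (1 / 2) * ∑ k, ∑ l, (M N).mean (X i * X k * X l) ^ 2 /
      ((g N k)⁻¹ * (5 / (2 * τ N) - g N l / 2)⁻¹ + (g N l)⁻¹ * (5 / (2 * τ N) - g N k / 2)⁻¹) ≤
      τ N - g N i * τ N ^ 2 := by
    intro N
    have h1 : ((N : ℝ) + 1)⁻¹ ≤ 1 := inv_le_one_of_one_le₀ (by simp)
    refine (M N).sum_third_moment_sq_div_le (by positivity) (by linarith)
      (fun k => by have := h.pos k; positivity) (fun k => ?_) i
    have h2 := h.pos k
    have h3 := h.le_one k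
    rw [div_le_one (by positivity)]
    have : (0 : ℝ) < N + 1 := Nat.cast_add_one_pos N
    nlinarith
  have h2 := tendsto_one_div_add_atTop_nhds_zero_nat (𝕜 := ℝ)
  simp only [one_div] at h2
  have hτl : Tendsto τ atTop (𝓝 1) := by
    have := h2.const_add 1
    rwa [add_zero] at this
  have hgl : ∀ k, Tendsto (fun N => g N k) atTop (𝓝 (γ k)) := fun k => tendsto_weight h.pos k
  have hp : ∀ k, 0 < 5 / (2 * (1 : ℝ)) - γ k / 2 := fun k => by
    have := h.le_one k; linarith
  have hpl : ∀ k, Tendsto (fun N => (5 / (2 * τ N) - g N k / 2)⁻¹) atTop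
      (𝓝 (5 / (2 * 1) - γ k / 2)⁻¹) := fun k =>
    (((tendsto_const_nhds (x := (5 : ℝ))).div (hτl.const_mul 2) (by norm_num)).sub
      ((hgl k).div_const 2)).inv₀ (hp k).ne'
  have hl := (tendsto_finsetSum (Finset.univ : Finset (Fin n)) fun k _ =>
    tendsto_finsetSum (Finset.univ : Finset (Fin n)) fun l _ =>
      ((hM (X i * X k * X l)).pow 2).div
        ((((hgl k).inv₀ (h.pos k).ne').mul (hpl l)).add (((hgl l).inv₀ (h.pos l).ne').mul (hpl k)))
        (by have := h.pos k; have := h.pos l; have := hp k; have := hp l; positivity)).const_mul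
          (1 / 2 : ℝ)
  have hr := hτl.sub ((hgl i).mul (hτl.pow 2))
  have := le_of_tendsto_of_tendsto' hl hr hb
  simpa only [map_mul, eval_X, one_pow, mul_one] using this

end IsWhitened

end Whitened

end

section

open Filter Topology

section CubicInequality

theorem cubic_ordered {x y z : ℝ} (hx : 0 ≤ x) (hy : 0 ≤ y) (hz : 0 ≤ z) :
    let c := 1 + z
    let b := c + y
    let a := b + x
    18 * ((1 + 5 * a) * a * (4 * ((b + c) * (b * c)) + (b * b + c * c)) +
      (1 + 5 * b) * b * (4 * ((c + a) * (c * a)) + (c * c + a * a)) +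
      (1 + 5 * c) * c * (4 * ((a + b) * (a * b)) + (a * a + b * b))) ≤
    10 * (3 + 5 * (a + b + c)) ^ 2 * (a * b * c) := by
  intro c b a
  rw [← sub_nonneg]
  simp only [a, b, c]
  ring_nf
  positivity

theorem cubic_inequality {a b c : ℝ} (ha : 1 ≤ a) (hb : 1 ≤ b) (hc : 1 ≤ c) :
    18 * ((1 + 5 * a) * a * (4 * ((b + c) * (b * c)) + (b * b + c * c)) +
      (1 + 5 * b) * b * (4 * ((c + a) * (c * a)) + (c * c + a * a)) +
      (1 + 5 * c) * c * (4 * ((a + b) * (a * b)) + (a * a + b * b))) ≤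
    10 * (3 + 5 * (a + b + c)) ^ 2 * (a * b * c) := by
  have H : ∀ {a b c : ℝ}, 1 ≤ c → c ≤ b → b ≤ a →
      18 * ((1 + 5 * a) * a * (4 * ((b + c) * (b * c)) + (b * b + c * c)) +
      (1 + 5 * b) * b * (4 * ((c + a) * (c * a)) + (c * c + a * a)) +
      (1 + 5 * c) * c * (4 * ((a + b) * (a * b)) + (a * a + b * b))) ≤
      10 * (3 + 5 * (a + b + c)) ^ 2 * (a * b * c) := by
    intro a b c h1 h2 h3
    have := cubic_ordered (sub_nonneg.2 h3) (sub_nonneg.2 h2) (sub_nonneg.2 h1)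
    simpa only [add_sub_cancel] using this
  rcases le_total a b with h1 | h1 <;> rcases le_total b c with h2 | h2 <;>
    rcases le_total a c with h3 | h3
  · linarith [H ha h1 h2]
  · linarith [H ha h1 h2]
  · linarith [H ha h3 h2]
  · linarith [H hc h3 h1]
  · linarith [H hb h1 h3]
  · linarith [H hb h2 h3]
  · linarith [H hc h2 h1]
  · linarith [H hc h2 h1]

/-- The weight attached to a pair of eigenvalues. -/
noncomputable def pairWeight (b c : ℝ) : ℝ := 4 / 5 * (b + c) + 1 / 5 * (b / c + c / b)

theorem pairWeight_pos {b c : ℝ} (hb : 0 < b) (hc : 0 < c) : 0 < pairWeight b c := by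
  unfold pairWeight; positivity

theorem three_le_sum_div_pairWeight {a b c : ℝ} (ha : 1 ≤ a) (hb : 1 ≤ b) (hc : 1 ≤ c) :
    9 ≤ (1 + 5 * a) / pairWeight b c + (1 + 5 * b) / pairWeight c a +
      (1 + 5 * c) / pairWeight a b := by
  have ha0 : 0 < a := by linarith
  have hb0 : 0 < b := by linarith
  have hc0 : 0 < c := by linarith
  have d1 := pairWeight_pos hb0 hc0
  have d2 := pairWeight_pos hc0 ha0
  have d3 := pairWeight_pos ha0 hb0
  set W := 3 + 5 * (a + b + c) with hW
  set D := (1 + 5 * a) * pairWeight b c + (1 + 5 * b) * pairWeight c a +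
    (1 + 5 * c) * pairWeight a b with hD
  have hD0 : 0 < D := by positivity
  have hW0 : 0 < W := by positivity
  have key : 9 * D ≤ W ^ 2 := by
    have h1 := cubic_inequality ha hb hc
    have e : D * (5 * (a * b * c)) =
        (1 + 5 * a) * a * (4 * ((b + c) * (b * c)) + (b * b + c * c)) +
        (1 + 5 * b) * b * (4 * ((c + a) * (c * a)) + (c * c + a * a)) +
        (1 + 5 * c) * c * (4 * ((a + b) * (a * b)) + (a * a + b * b)) := by
      simp only [hD, pairWeight]
      field_simp
    rw [← e] at h1
    have h0 : 0 < a * b * c := by positivity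
    refine le_of_mul_le_mul_right ?_ h0
    linarith
  have ht : ∀ w d : ℝ, 0 < w → 0 < d → w * (2 * (W / D) - (W / D) ^ 2 * d) ≤ w / d := by
    intro w d hw hd
    rw [div_eq_mul_inv w d]
    refine mul_le_mul_of_nonneg_left ?_ hw.le
    rw [← sub_nonneg]
    have : d⁻¹ - (2 * (W / D) - (W / D) ^ 2 * d) = d⁻¹ * (1 - W / D * d) ^ 2 := by
      field_simp
      ring
    rw [this]; positivity
  have t1 := ht (1 + 5 * a) _ (by positivity) d1
  have t2 := ht (1 + 5 * b) _ (by positivity) d2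
  have t3 := ht (1 + 5 * c) _ (by positivity) d3
  have e : W ^ 2 / D = 2 * (W / D) * W - (W / D) ^ 2 * D := by field_simp; ring
  have h9 : 9 ≤ W ^ 2 / D := by rw [le_div_iff₀ hD0]; exact key
  rw [e] at h9
  simp only [hD, hW] at h9 ⊢
  simp only [hD, hW] at t1 t2 t3
  linarith

end CubicInequality

section ThirdMoments

variable {n : ℕ} {μ : Measure (Fin n → ℝ)} {γ : Fin n → ℝ}

theorem sum_cyclic (F : Fin n → Fin n → Fin n → ℝ) :
    ∑ i, ∑ j, ∑ k, F i j k = ∑ i, ∑ j, ∑ k, F j k i := by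
  conv_rhs => rw [Finset.sum_comm]
  refine Finset.sum_congr rfl fun i _ => ?_
  rw [Finset.sum_comm]

/-- The squared third moments of a measure. -/
noncomputable def thirdSq (μ : Measure (Fin n → ℝ)) (i j k : Fin n) : ℝ :=
  (∫ y, y i * y j * y k ∂μ) ^ 2

theorem thirdSq_nonneg (i j k : Fin n) : 0 ≤ thirdSq μ i j k := sq_nonneg _

theorem thirdSq_rotate (i j k : Fin n) : thirdSq μ j k i = thirdSq μ i j k := by
  unfold thirdSq; congr 2; ext y; ring

theorem thirdSq_swap (i j k : Fin n) : thirdSq μ i k j = thirdSq μ i j k := by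
  unfold thirdSq; congr 2; ext y; ring

theorem IsWhitened.sum_mul_thirdSq_le (h : IsWhitened γ μ) (φ : Fin n → ℝ) (hφ : ∀ i, 0 ≤ φ i)
    (hmono : ∀ i j, γ i ≤ γ j → φ j ≤ φ i) :
    ∑ i, ∑ j, ∑ k, φ i * thirdSq μ i j k ≤ 12 * ∑ i, φ i * √(1 / γ i) := by
  classical
  set F : Fin n → Fin n → Fin n → ℝ := fun i j k =>
    if γ i ≤ γ j ∧ γ i ≤ γ k then φ i * thirdSq μ i j k else 0 with hF
  have hF0 : ∀ i j k, 0 ≤ F i j k := fun i j k => by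
    simp only [hF]; split_ifs
    · exact mul_nonneg (hφ i) (thirdSq_nonneg _ _ _)
    · exact le_rfl
  have h1 : ∀ i j k, φ i * thirdSq μ i j k ≤ F i j k + F j k i + F k i j := by
    intro i j k
    have t0 := thirdSq_nonneg (μ := μ) i j k
    have r1 := thirdSq_rotate (μ := μ) i j k
    have r2 : thirdSq μ k i j = thirdSq μ i j k := by rw [← thirdSq_rotate, ← thirdSq_rotate]
    rcases le_total (γ i) (γ j) with a | a <;> rcases le_total (γ j) (γ k) with b | b <;>
      rcases le_total (γ i) (γ k) with c | c
    · have : F i j k = φ i * thirdSq μ i j k := if_pos ⟨a, c⟩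
      linarith [hF0 j k i, hF0 k i j]
    · have : F i j k = φ i * thirdSq μ i j k := if_pos ⟨a, a.trans b⟩
      linarith [hF0 j k i, hF0 k i j]
    · have : F i j k = φ i * thirdSq μ i j k := if_pos ⟨a, c⟩
      linarith [hF0 j k i, hF0 k i j]
    · have : F k i j = φ k * thirdSq μ k i j := if_pos ⟨c, b⟩
      rw [r2] at this
      linarith [hF0 j k i, hF0 i j k, mul_le_mul_of_nonneg_right (hmono k i c) t0]
    · have : F j k i = φ j * thirdSq μ j k i := if_pos ⟨b, a⟩
      rw [r1] at this
      linarith [hF0 i j k, hF0 k i j, mul_le_mul_of_nonneg_right (hmono j i a) t0]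
    · have : F j k i = φ j * thirdSq μ j k i := if_pos ⟨b, a⟩
      rw [r1] at this
      linarith [hF0 i j k, hF0 k i j, mul_le_mul_of_nonneg_right (hmono j i a) t0]
    · have : F k i j = φ k * thirdSq μ k i j := if_pos ⟨b.trans a, b⟩
      rw [r2] at this
      linarith [hF0 j k i, hF0 i j k,
        mul_le_mul_of_nonneg_right (hmono k i (b.trans a)) t0]
    · have : F k i j = φ k * thirdSq μ k i j := if_pos ⟨c, b⟩
      rw [r2] at this
      linarith [hF0 j k i, hF0 i j k, mul_le_mul_of_nonneg_right (hmono k i c) t0]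
  have h2 : ∑ i, ∑ j, ∑ k, F i j k ≤ 4 * ∑ i, φ i * √(1 / γ i) := by
    rw [Finset.mul_sum]
    refine Finset.sum_le_sum fun i _ => ?_
    have h3 := h.sum_third_moment_sq_le i (Finset.univ.filter fun k => γ i ≤ γ k) (by simp)
    have h4 : ∑ j, ∑ k, F i j k = φ i * ∑ j ∈ Finset.univ.filter fun k => γ i ≤ γ k,
        ∑ k ∈ Finset.univ.filter fun k => γ i ≤ γ k, thirdSq μ i j k := by
      rw [Finset.mul_sum, Finset.sum_filter]
      refine Finset.sum_congr rfl fun j _ => ?_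
      by_cases hj : γ i ≤ γ j
      · simp only [hF, hj, true_and, if_true, Finset.mul_sum, Finset.sum_filter, mul_ite, mul_zero]
      · simp [hF, hj]
    rw [h4]
    calc _ ≤ φ i * (4 * √(1 / γ i)) := mul_le_mul_of_nonneg_left h3 (hφ i)
      _ = _ := by ring
  have h5 : ∑ i, ∑ j, ∑ k, φ i * thirdSq μ i j k ≤
      ∑ i, ∑ j, ∑ k, (F i j k + F j k i + F k i j) :=
    Finset.sum_le_sum fun i _ => Finset.sum_le_sum fun j _ => Finset.sum_le_sum fun k _ => h1 i j k
  simp only [Finset.sum_add_distrib] at h5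
  have e1 := sum_cyclic F
  have e2 := sum_cyclic fun i j k => F j k i
  linarith

theorem IsWhitened.sum_thirdSq_le (h : IsWhitened γ μ) :
    6 * ((1 / 2) * ∑ i, ∑ j, ∑ k, thirdSq μ i j k) ≤
      ∑ i, (1 - γ i) + 5 * ∑ i, ((γ i)⁻¹ - 1) := by
  have hγ := h.pos
  have h1 : ∀ i, ∑ k, ∑ l, thirdSq μ i k l / pairWeight (γ k)⁻¹ (γ l)⁻¹ ≤ 1 - γ i := by
    intro i
    refine le_trans ?_ (h.sum_third_moment_sq_div_le i)
    rw [Finset.mul_sum]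
    refine Finset.sum_le_sum fun k _ => ?_
    rw [Finset.mul_sum]
    refine Finset.sum_le_sum fun l _ => ?_
    have hk := hγ k
    have hl := hγ l
    have hk1 := h.le_one k
    have hl1 := h.le_one l
    have hp : ∀ t : ℝ, 0 < t → t ≤ 1 → (5 / 2 - t / 2)⁻¹ ≤ 1 / 2 * (4 / 5 + 1 / 5 * t) := by
      intro t h0 h1
      rw [inv_le_iff_one_le_mul₀ (by linarith)]
      nlinarith
    have pk : 0 < (5 / 2 - γ k / 2)⁻¹ := inv_pos.2 (by linarith)
    have pl : 0 < (5 / 2 - γ l / 2)⁻¹ := inv_pos.2 (by linarith)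
    have hd : (γ k)⁻¹ * (5 / 2 - γ l / 2)⁻¹ + (γ l)⁻¹ * (5 / 2 - γ k / 2)⁻¹ ≤
        1 / 2 * pairWeight (γ k)⁻¹ (γ l)⁻¹ := by
      have a1 := mul_le_mul_of_nonneg_left (hp _ hl hl1) (inv_pos.2 hk).le
      have a2 := mul_le_mul_of_nonneg_left (hp _ hk hk1) (inv_pos.2 hl).le
      refine (add_le_add a1 a2).trans (le_of_eq ?_)
      unfold pairWeight
      field_simp
      ring
    have hpw := pairWeight_pos (inv_pos.2 hk) (inv_pos.2 hl)
    calc thirdSq μ i k l / pairWeight (γ k)⁻¹ (γ l)⁻¹ =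
        1 / 2 * (thirdSq μ i k l / (1 / 2 * pairWeight (γ k)⁻¹ (γ l)⁻¹)) := by field_simp
      _ ≤ _ := by
        refine mul_le_mul_of_nonneg_left ?_ (by norm_num)
        exact div_le_div_of_nonneg_left (thirdSq_nonneg _ _ _) (by positivity) hd
  set E : Fin n → Fin n → Fin n → ℝ := fun i k l =>
    (1 + 5 * (γ i)⁻¹) * (thirdSq μ i k l / pairWeight (γ k)⁻¹ (γ l)⁻¹) with hE
  have h2 : ∑ i, ∑ k, ∑ l, E i k l ≤ ∑ i, (1 - γ i) + 5 * ∑ i, ((γ i)⁻¹ - 1) := by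
    rw [Finset.mul_sum, ← Finset.sum_add_distrib]
    refine Finset.sum_le_sum fun i _ => ?_
    have hi := hγ i
    calc ∑ k, ∑ l, E i k l = (1 + 5 * (γ i)⁻¹) *
        ∑ k, ∑ l, thirdSq μ i k l / pairWeight (γ k)⁻¹ (γ l)⁻¹ := by
          simp only [hE, Finset.mul_sum]
      _ ≤ (1 + 5 * (γ i)⁻¹) * (1 - γ i) := mul_le_mul_of_nonneg_left (h1 i) (by positivity)
      _ = _ := by field_simp
  have h3 : ∀ i k l, 9 * thirdSq μ i k l ≤ E i k l + E k l i + E l i k := by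
    intro i k l
    have r1 := thirdSq_rotate (μ := μ) i k l
    have r2 : thirdSq μ l i k = thirdSq μ i k l := by rw [← thirdSq_rotate, ← thirdSq_rotate]
    have h4 := three_le_sum_div_pairWeight ((one_le_inv₀ (hγ i)).2 (h.le_one i))
      ((one_le_inv₀ (hγ k)).2 (h.le_one k)) ((one_le_inv₀ (hγ l)).2 (h.le_one l))
    have h5 := mul_le_mul_of_nonneg_right h4 (thirdSq_nonneg (μ := μ) i k l)
    simp only [hE, r1, r2]
    refine h5.trans (le_of_eq ?_)
    ring
  have h5 : ∑ i, ∑ j, ∑ k, 9 * thirdSq μ i j k ≤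
      ∑ i, ∑ j, ∑ k, (E i j k + E j k i + E k i j) :=
    Finset.sum_le_sum fun i _ => Finset.sum_le_sum fun j _ => Finset.sum_le_sum fun k _ => h3 i j k
  simp only [Finset.sum_add_distrib, ← Finset.mul_sum] at h5
  have e1 := sum_cyclic E
  have e2 := sum_cyclic fun i j k => E j k i
  linarith

end ThirdMoments

end

section LinearAlgebra

open Matrix

variable {n : ℕ}

theorem exists_orthogonal_diagonal {A : Matrix (Fin n) (Fin n) ℝ} (hA : A.IsSymm) :
    ∃ (O : Matrix (Fin n) (Fin n) ℝ) (d : Fin n → ℝ),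
      Oᵀ * O = 1 ∧ O * Oᵀ = 1 ∧ Oᵀ * A * O = diagonal d := by
  have hH : A.IsHermitian := isHermitian_iff_isSymm.2 hA
  refine ⟨hH.eigenvectorUnitary, hH.eigenvalues, ?_, ?_, ?_⟩
  · have := Unitary.coe_star_mul_self hH.eigenvectorUnitary
    rwa [star_eq_conjTranspose, conjTranspose_eq_transpose_of_trivial] at this
  · have := Unitary.coe_mul_star_self hH.eigenvectorUnitary
    rwa [Unitary.coe_star, star_eq_conjTranspose, conjTranspose_eq_transpose_of_trivial] at this
  · have := hH.conjStarAlgAut_star_eigenvectorUnitary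
    rwa [Unitary.conjStarAlgAut_star_apply, star_eq_conjTranspose,
      conjTranspose_eq_transpose_of_trivial] at this

/-- Two positive definite forms can be diagonalized simultaneously. -/
theorem exists_simultaneous_diagonal {A G : Matrix (Fin n) (Fin n) ℝ} (hA : A.PosDef)
    (hG : G.PosDef) : ∃ (B : Matrix (Fin n) (Fin n) ℝ) (γ : Fin n → ℝ),
      IsUnit B.det ∧ B * Bᵀ = A ∧ Bᵀ * G * B = diagonal γ ∧ ∀ k, 0 < γ k := by
  obtain ⟨O, d, h1, h2, h3⟩ := exists_orthogonal_diagonal (isHermitian_iff_isSymm.1 hA.1)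
  have hOu : IsUnit O := (isUnit_iff_isUnit_det _).2 (isUnit_det_of_right_inverse h2)
  have hd : ∀ k, 0 < d k := by
    have : (Oᵀ * A * O).PosDef := by
      have := hA.conjTranspose_mul_mul_same (B := O) (mulVec_injective_of_isUnit hOu)
      rwa [conjTranspose_eq_transpose_of_trivial] at this
    rw [h3] at this
    exact posDef_diagonal_iff.1 this
  have hA' : A = O * diagonal d * Oᵀ := by
    rw [← h3]
    calc A = (O * Oᵀ) * A * (O * Oᵀ) := by rw [h2]; simp
      _ = _ := by simp only [Matrix.mul_assoc]
  set C := O * diagonal fun k => √(d k) with hC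
  have hCC : C * Cᵀ = A := by
    rw [hC, transpose_mul, diagonal_transpose, hA']
    calc _ = O * ((diagonal fun k => √(d k)) * (diagonal fun k => √(d k))) * Oᵀ := by
          simp only [Matrix.mul_assoc]
      _ = _ := by
          rw [diagonal_mul_diagonal]
          congr 3
          ext k
          exact Real.mul_self_sqrt (hd k).le
  have hCu : IsUnit C.det := by
    have := hA.isUnit
    rw [← hCC, isUnit_iff_isUnit_det, det_mul] at this
    exact isUnit_of_mul_isUnit_left this
  have hG' : (Cᵀ * G * C).PosDef := by
    have := hG.conjTranspose_mul_mul_same (B := C)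
      (mulVec_injective_of_isUnit ((isUnit_iff_isUnit_det _).2 hCu))
    rwa [conjTranspose_eq_transpose_of_trivial] at this
  obtain ⟨P, γ, g1, g2, g3⟩ := exists_orthogonal_diagonal (isHermitian_iff_isSymm.1 hG'.1)
  have hPu : IsUnit P := (isUnit_iff_isUnit_det _).2 (isUnit_det_of_right_inverse g2)
  refine ⟨C * P, γ, ?_, ?_, ?_, ?_⟩
  · rw [det_mul]; exact hCu.mul ((isUnit_iff_isUnit_det _).1 hPu)
  · rw [transpose_mul, ← hCC]
    calc _ = C * (P * Pᵀ) * Cᵀ := by simp only [Matrix.mul_assoc]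
      _ = _ := by rw [g2, Matrix.mul_one]
  · rw [← g3, transpose_mul]; simp only [Matrix.mul_assoc]
  · have := hG'.conjTranspose_mul_mul_same (B := P) (mulVec_injective_of_isUnit hPu)
    rw [conjTranspose_eq_transpose_of_trivial, g3] at this
    exact posDef_diagonal_iff.1 this

theorem quadPot_affine {M : Matrix (Fin n) (Fin n) ℝ} (hM : M.IsSymm)
    (C : Matrix (Fin n) (Fin n) ℝ) (η d x : Fin n → ℝ) :
    quadPot M η (C *ᵥ x + d) =
      quadPot (Cᵀ * M * C) (Cᵀ *ᵥ (η - M *ᵥ d)) x + quadPot M η d := by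
  have h1 : ∀ v w : Fin n → ℝ, (Cᵀ *ᵥ v) ⬝ᵥ w = v ⬝ᵥ C *ᵥ w := fun v w => by
    rw [mulVec_transpose, ← dotProduct_mulVec]
  have h2 : d ⬝ᵥ M *ᵥ (C *ᵥ x) = (M *ᵥ d) ⬝ᵥ (C *ᵥ x) := by
    rw [dotProduct_mulVec, ← mulVec_transpose, hM.eq]
  have h3 : x ⬝ᵥ (Cᵀ * M * C) *ᵥ x = (C *ᵥ x) ⬝ᵥ M *ᵥ (C *ᵥ x) := by
    rw [← mulVec_mulVec, ← mulVec_mulVec, dotProduct_comm, h1, dotProduct_comm]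
  simp only [quadPot, mulVec_add, dotProduct_add, add_dotProduct, h1, h3, h2, sub_dotProduct,
    dotProduct_comm (C *ᵥ x) (M *ᵥ d)]
  ring

end LinearAlgebra

section Whitening

open Matrix

variable {n : ℕ} {K : Set (Fin n → ℝ)} {G : Matrix (Fin n) (Fin n) ℝ} {θ : Fin n → ℝ}

/-- The barycenter of `quadTilt K G θ`. -/
noncomputable def meanVec (K : Set (Fin n → ℝ)) (G : Matrix (Fin n) (Fin n) ℝ)
    (θ : Fin n → ℝ) : Fin n → ℝ := fun i => ∫ x, x i ∂(quadTilt K G θ)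

/-- The covariance matrix of `quadTilt K G θ`. -/
noncomputable def covMat (K : Set (Fin n → ℝ)) (G : Matrix (Fin n) (Fin n) ℝ)
    (θ : Fin n → ℝ) : Matrix (Fin n) (Fin n) ℝ :=
  of fun i j => (∫ x, x i * x j ∂(quadTilt K G θ)) - meanVec K G θ i * meanVec K G θ j

theorem IsBody.integral_dotProduct (hK : IsBody K) (u : Fin n → ℝ) :
    ∫ x, u ⬝ᵥ x ∂(quadTilt K G θ) = u ⬝ᵥ meanVec K G θ := by
  simp only [dotProduct, meanVec]
  rw [integral_finsetSum _ fun k _ => hK.integrable (by fun_prop)]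
  simp only [integral_const_mul]

theorem IsBody.integral_dotProduct_mul (hK : IsBody K) (u v : Fin n → ℝ) :
    ∫ x, (u ⬝ᵥ x) * (v ⬝ᵥ x) ∂(quadTilt K G θ) =
      u ⬝ᵥ covMat K G θ *ᵥ v + (u ⬝ᵥ meanVec K G θ) * (v ⬝ᵥ meanVec K G θ) := by
  have : ∀ x : Fin n → ℝ, (u ⬝ᵥ x) * (v ⬝ᵥ x) = ∑ i, ∑ j, u i * v j * (x i * x j) := fun x => by
    simp only [dotProduct, Finset.sum_mul_sum]
    exact Finset.sum_congr rfl fun i _ => Finset.sum_congr rfl fun j _ => by ring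
  simp only [this]
  rw [integral_finsetSum _ fun k _ => hK.integrable (by fun_prop)]
  simp only [dotProduct, mulVec, covMat, of_apply, Finset.mul_sum,
    ← Finset.sum_add_distrib]
  refine Finset.sum_congr rfl fun i _ => ?_
  rw [integral_finsetSum _ fun k _ => hK.integrable (by fun_prop)]
  refine Finset.sum_congr rfl fun j _ => ?_
  rw [integral_const_mul]
  ring

theorem covMat_isSymm : (covMat K G θ).IsSymm := by
  ext i j
  simp only [covMat, transpose_apply, of_apply, mul_comm]

theorem IsBody.covMat_posDef (hK : IsBody K) : (covMat K G θ).PosDef := by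
  have := hK.isProbabilityMeasure G θ
  refine PosDef.of_dotProduct_mulVec_pos (isHermitian_iff_isSymm.2 covMat_isSymm) fun u hu => ?_
  simp only [star_trivial]
  set a := meanVec K G θ
  have hcont : Continuous fun x : Fin n → ℝ => u ⬝ᵥ x - u ⬝ᵥ a :=
    (continuous_const.dotProduct continuous_id).sub continuous_const
  have hcont1 : Continuous fun x : Fin n → ℝ => u ⬝ᵥ x := continuous_const.dotProduct continuous_id
  have h1 : ∫ x, (u ⬝ᵥ x - u ⬝ᵥ a) ^ 2 ∂(quadTilt K G θ) = u ⬝ᵥ covMat K G θ *ᵥ u := by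
    have h2 := hK.integral_dotProduct_mul (G := G) (θ := θ) u u
    have h3 := hK.integral_dotProduct (G := G) (θ := θ) u
    have : ∀ x : Fin n → ℝ, (u ⬝ᵥ x - u ⬝ᵥ a) ^ 2 =
        (u ⬝ᵥ x) * (u ⬝ᵥ x) - 2 * (u ⬝ᵥ a) * (u ⬝ᵥ x) + (u ⬝ᵥ a) ^ 2 := fun x => by ring
    simp only [this]
    rw [integral_add (hK.integrable (by fun_prop)) (integrable_const _),
      integral_sub (hK.integrable (by fun_prop)) (hK.integrable (by fun_prop)),
      integral_const_mul, h2, h3]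
    simp
    ring
  rw [← h1]
  refine lt_of_le_of_ne (integral_nonneg fun x => sq_nonneg _) fun h0 => hu ?_
  have hae := (integral_eq_zero_iff_of_nonneg (fun x => sq_nonneg _)
    (hK.integrable (hcont.pow 2))).1 h0.symm
  have hac : volume.restrict K ≪ quadTilt K G θ := absolutelyContinuous_tilted hK.integrable_exp
  have hae2 := hac.ae_le hae
  have hopen : IsOpen (interior K ∩ {x | u ⬝ᵥ x - u ⬝ᵥ a ≠ 0}) :=
    isOpen_interior.inter (isOpen_ne.preimage hcont)
  have hnull : volume (interior K ∩ {x | u ⬝ᵥ x - u ⬝ᵥ a ≠ 0}) = 0 := by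
    have h5 : volume.restrict K {x | ¬ ((fun x => (u ⬝ᵥ x - u ⬝ᵥ a) ^ 2) x = (0 : (Fin n → ℝ) → ℝ) x)} = 0 :=
      hae2
    have h6 : MeasurableSet {x : Fin n → ℝ | ¬ ((fun x => (u ⬝ᵥ x - u ⬝ᵥ a) ^ 2) x =
        (0 : (Fin n → ℝ) → ℝ) x)} := by
      have : MeasurableSet ((fun x : Fin n → ℝ => (u ⬝ᵥ x - u ⬝ᵥ a) ^ 2) ⁻¹' {0}ᶜ) :=
        (hcont.pow 2).measurable (measurableSet_singleton _).compl
      exact this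
    rw [Measure.restrict_apply h6] at h5
    refine measure_mono_null ?_ h5
    rintro x ⟨hx1, hx2⟩
    exact ⟨by simpa using hx2, interior_subset hx1⟩
  have hempty := (hopen.measure_eq_zero_iff volume).1 hnull
  obtain ⟨x0, hx0⟩ := hK.interior_nonempty
  have hz : ∀ x ∈ interior K, u ⬝ᵥ x = u ⬝ᵥ a := fun x hx => by
    by_contra hne
    exact (Set.eq_empty_iff_forall_notMem.1 hempty x) ⟨hx, sub_ne_zero.2 hne⟩
  have hev : ∀ᶠ t : ℝ in nhds 0, x0 + t • u ∈ interior K := by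
    have : Continuous fun t : ℝ => x0 + t • u := by fun_prop
    exact this.continuousAt.eventually_mem (by simpa using isOpen_interior.mem_nhds hx0)
  obtain ⟨ε, hε, hball⟩ := Metric.eventually_nhds_iff.1 hev
  have h7 := hz _ (hball (y := ε / 2) (by rw [Real.dist_eq, sub_zero, abs_of_pos] <;> linarith))
  rw [dotProduct_add, hz x0 hx0, dotProduct_smul, smul_eq_mul, add_eq_left, mul_eq_zero] at h7
  exact dotProduct_self_eq_zero.1 (h7.resolve_left (by linarith))

/-- `B` whitens the covariance of `quadTilt K G θ` and diagonalizes `G`. -/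
structure IsWhitening (K : Set (Fin n → ℝ)) (G : Matrix (Fin n) (Fin n) ℝ) (θ : Fin n → ℝ)
    (B : Matrix (Fin n) (Fin n) ℝ) (γ : Fin n → ℝ) : Prop where
  isUnit_det : IsUnit B.det
  mul_transpose : B * Bᵀ = covMat K G θ
  diag : Bᵀ * G * B = diagonal γ
  pos : ∀ k, 0 < γ k

theorem IsBody.exists_isWhitening (hK : IsBody K) (hG : G.PosDef) :
    ∃ B γ, IsWhitening K G θ B γ := by
  obtain ⟨B, γ, h1, h2, h3, h4⟩ := exists_simultaneous_diagonal (hK.covMat_posDef (θ := θ)) hG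
  exact ⟨B, γ, h1, h2, h3, h4⟩

/-- The law of `quadTilt K G θ` in whitened coordinates. -/
noncomputable def whitenedLaw (K : Set (Fin n → ℝ)) (G : Matrix (Fin n) (Fin n) ℝ)
    (θ : Fin n → ℝ) (B : Matrix (Fin n) (Fin n) ℝ) : Measure (Fin n → ℝ) :=
  (quadTilt K G θ).map fun x => B⁻¹ *ᵥ (x - meanVec K G θ)

theorem integral_whitenedLaw {B : Matrix (Fin n) (Fin n) ℝ} {f : (Fin n → ℝ) → ℝ}
    (hf : Continuous f) : ∫ y, f y ∂(whitenedLaw K G θ B) =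
      ∫ x, f (B⁻¹ *ᵥ (x - meanVec K G θ)) ∂(quadTilt K G θ) :=
  integral_map (by
    have : Continuous fun x : Fin n → ℝ => B⁻¹ *ᵥ (x - meanVec K G θ) := by fun_prop
    exact this.aemeasurable) hf.aestronglyMeasurable

theorem IsBody.integral_tilted_whitenedLaw (hK : IsBody K) {B S : Matrix (Fin n) (Fin n) ℝ}
    (hS : S.IsSymm) {z : Fin n → ℝ} {f : (Fin n → ℝ) → ℝ} (hf : Continuous f) :
    ∫ y, f y ∂((whitenedLaw K G θ B).tilted (quadPot S z)) =
      ∫ x, f (B⁻¹ *ᵥ (x - meanVec K G θ)) ∂(quadTilt K (G + B⁻¹ᵀ * S * B⁻¹)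
        (θ + B⁻¹ᵀ *ᵥ (z - S *ᵥ -(B⁻¹ *ᵥ meanVec K G θ)))) := by
  have hYd : ∀ x, B⁻¹ *ᵥ (x - meanVec K G θ) = B⁻¹ *ᵥ x + -(B⁻¹ *ᵥ meanVec K G θ) :=
    fun x => by rw [mulVec_sub, sub_eq_add_neg]
  have hqc : Continuous fun y => quadPot S z y := by fun_prop
  rw [integral_tilted, ← hK.tilted_quadPot, integral_tilted,
    integral_whitenedLaw (f := fun y => Real.exp (quadPot S z y)) (by fun_prop),
    integral_whitenedLaw (f := fun y => (Real.exp (quadPot S z y) / _) • f y) (by fun_prop)]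
  simp only [hYd, quadPot_affine hS, Real.exp_add]
  rw [integral_mul_const]
  refine integral_congr_ae (Filter.Eventually.of_forall fun x => ?_)
  simp only
  rw [mul_div_mul_right _ _ (Real.exp_pos _).ne']

theorem IsBody.variance_le_of_mulVec_eq (hK : IsBody K) (hG : G.PosSemidef) {u w : Fin n → ℝ}
    (hw : G *ᵥ u = w) (c : ℝ) : (∫ x, (w ⬝ᵥ x + c) ^ 2 ∂(quadTilt K G θ)) -
      (∫ x, w ⬝ᵥ x + c ∂(quadTilt K G θ)) ^ 2 ≤ u ⬝ᵥ w := by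
  have := hK.isProbabilityMeasure G θ
  have h := hK.variance_mulVec_le (θ := θ) hG u
  rw [hw] at h
  have hc : Continuous fun x : Fin n → ℝ => w ⬝ᵥ x := continuous_const.dotProduct continuous_id
  have : ∀ x : Fin n → ℝ, (w ⬝ᵥ x + c) ^ 2 = (w ⬝ᵥ x) ^ 2 + 2 * c * (w ⬝ᵥ x) + c ^ 2 :=
    fun x => by ring
  simp only [this]
  rw [integral_add (hK.integrable (by fun_prop)) (integrable_const _),
    integral_add (hK.integrable (by fun_prop)) (hK.integrable (by fun_prop)),
    integral_add (hK.integrable (by fun_prop)) (integrable_const _), integral_const_mul]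
  simp
  nlinarith

theorem IsWhitening.isWhitened (hK : IsBody K) (hG : G.PosDef) {B : Matrix (Fin n) (Fin n) ℝ}
    {γ : Fin n → ℝ} (h : IsWhitening K G θ B γ) : IsWhitened γ (whitenedLaw K G θ B) := by
  have hp := hK.isProbabilityMeasure G θ
  set a := meanVec K G θ with ha
  have hY : Continuous fun x : Fin n → ℝ => B⁻¹ *ᵥ (x - a) := by fun_prop
  have hrow : ∀ k (x : Fin n → ℝ), (B⁻¹ *ᵥ (x - a)) k = B⁻¹ k ⬝ᵥ x - B⁻¹ k ⬝ᵥ a := fun k x => by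
    rw [mulVec_sub, Pi.sub_apply]; rfl
  have hrc : ∀ k, Continuous fun x : Fin n → ℝ => B⁻¹ k ⬝ᵥ x :=
    fun k => continuous_const.dotProduct continuous_id
  have hcov : B⁻¹ * covMat K G θ * B⁻¹ᵀ = 1 := by
    rw [← h.mul_transpose, ← Matrix.mul_assoc, nonsing_inv_mul _ h.isUnit_det, Matrix.one_mul,
      ← transpose_mul, nonsing_inv_mul _ h.isUnit_det, transpose_one]
  refine ⟨Measure.isProbabilityMeasure_map hY.aemeasurable, ?_, h.pos, ?_, ?_, ?_⟩
  · choose C hC using fun k => hK.exists_bound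
      ((continuous_apply k).comp hY)
    refine ⟨∑ k, |C k|, Finset.sum_nonneg fun _ _ => abs_nonneg _, ?_⟩
    have hms : MeasurableSet {y : Fin n → ℝ | ∀ k, |y k| ≤ ∑ k, |C k|} := by
      rw [show {y : Fin n → ℝ | ∀ k, |y k| ≤ ∑ k, |C k|} =
        ⋂ k, {y : Fin n → ℝ | |y k| ≤ ∑ k, |C k|} by ext; simp]
      exact MeasurableSet.iInter fun k =>
        measurableSet_le (measurable_pi_apply k).abs measurable_const
    rw [whitenedLaw, ae_map_iff hY.aemeasurable hms]
    filter_upwards [hK.ae_mem G θ] with x hx k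
    exact (hC k x hx).trans ((le_abs_self _).trans
      (Finset.single_le_sum (f := fun k => |C k|) (fun _ _ => abs_nonneg _) (Finset.mem_univ k)))
  · intro k
    rw [integral_whitenedLaw (continuous_apply k)]
    simp only [← ha, hrow]
    rw [integral_sub (hK.integrable (hrc k)) (integrable_const _), hK.integral_dotProduct]
    simp [ha]
  · intro k l
    rw [integral_whitenedLaw (f := fun y => y k * y l) (by fun_prop)]
    simp only [← ha, hrow]
    have : ∀ x : Fin n → ℝ, (B⁻¹ k ⬝ᵥ x - B⁻¹ k ⬝ᵥ a) * (B⁻¹ l ⬝ᵥ x - B⁻¹ l ⬝ᵥ a) =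
        (B⁻¹ k ⬝ᵥ x) * (B⁻¹ l ⬝ᵥ x) - (B⁻¹ l ⬝ᵥ a) * (B⁻¹ k ⬝ᵥ x) - (B⁻¹ k ⬝ᵥ a) * (B⁻¹ l ⬝ᵥ x) +
          (B⁻¹ k ⬝ᵥ a) * (B⁻¹ l ⬝ᵥ a) := fun x => by ring
    simp only [this]
    have hk := hrc k
    have hl := hrc l
    rw [integral_add (hK.integrable (by fun_prop)) (integrable_const _),
      integral_sub (hK.integrable (by fun_prop)) (hK.integrable (by fun_prop)),
      integral_sub (hK.integrable (by fun_prop)) (hK.integrable (by fun_prop)),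
      integral_const_mul, integral_const_mul, hK.integral_dotProduct, hK.integral_dotProduct,
      hK.integral_dotProduct_mul]
    have he : B⁻¹ k ⬝ᵥ covMat K G θ *ᵥ B⁻¹ l = if k = l then 1 else 0 := by
      have h1 := congrFun (congrFun hcov k) l
      rw [one_apply, Matrix.mul_assoc] at h1
      rw [← h1]
      simp only [mul_apply, dotProduct, mulVec, transpose_apply]
    rw [he]
    simp [← ha]
    ring
  · intro s hs x0 v
    have hGs : G.IsSymm := isHermitian_iff_isSymm.1 hG.1
    set C := B⁻¹ with hC
    set d : Fin n → ℝ := -(C *ᵥ a) with hd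
    have hYd : ∀ x, C *ᵥ (x - a) = C *ᵥ x + d := fun x => by rw [mulVec_sub, hd, sub_eq_add_neg]
    set S : Matrix (Fin n) (Fin n) ℝ := s • 1 with hS
    have hSs : S.IsSymm := by rw [hS]; exact (isSymm_one).smul s
    set N := Cᵀ * S * C with hN
    set η := Cᵀ *ᵥ (s • x0 - S *ᵥ d) with hη
    have key : ∀ f : (Fin n → ℝ) → ℝ, Continuous f →
        ∫ y, f y ∂(posterior s (whitenedLaw K G θ B) x0) =
          ∫ x, f (C *ᵥ x + d) ∂(quadTilt K (G + N) (θ + η)) := fun f hf => by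
      rw [posterior, hK.integral_tilted_whitenedLaw hSs hf]
      simp only [← ha, ← hC, hYd, ← hN, ← hd, ← hη]
    rw [key (fun y => (∑ k, v k * y k) ^ 2) (by fun_prop), key (fun y => ∑ k, v k * y k) (by fun_prop)]
    have hsum : ∀ x, ∑ k, v k * (C *ᵥ x + d) k = (Cᵀ *ᵥ v) ⬝ᵥ x + v ⬝ᵥ d := fun x => by
      rw [mulVec_transpose, ← dotProduct_mulVec, ← dotProduct_add]; rfl
    simp only [hsum]
    have hposN : N.PosSemidef := by
      have h1 : S.PosSemidef := PosSemidef.one.smul hs.le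
      have := h1.conjTranspose_mul_mul_same C
      rwa [conjTranspose_eq_transpose_of_trivial] at this
    have hCB : C * B = 1 := nonsing_inv_mul _ h.isUnit_det
    have hBC : B * C = 1 := mul_nonsing_inv _ h.isUnit_det
    have hsolve : (G + N) *ᵥ (B *ᵥ fun k => v k / (γ k + s)) = Cᵀ *ᵥ v := by
      rw [mulVec_mulVec]
      have : (G + N) * B = Cᵀ * (diagonal γ + S) := by
        rw [Matrix.mul_add, ← h.diag, Matrix.add_mul, hN, ← Matrix.mul_assoc, ← Matrix.mul_assoc,
          ← transpose_mul, hBC, transpose_one, Matrix.one_mul, Matrix.mul_assoc _ C B, hCB,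
          Matrix.mul_one]
      rw [this, ← mulVec_mulVec]
      congr 1
      ext k
      rw [add_mulVec, hS, smul_mulVec, one_mulVec, Pi.add_apply, mulVec_diagonal]
      have := h.pos k
      simp
      field_simp
    refine (hK.variance_le_of_mulVec_eq (hG.posSemidef.add hposN) hsolve (v ⬝ᵥ d)).trans (le_of_eq ?_)
    rw [dotProduct_comm, mulVec_transpose, ← dotProduct_mulVec, mulVec_mulVec, hCB, one_mulVec]
    simp only [dotProduct]
    exact Finset.sum_congr rfl fun k _ => by ring

end Whitening

section Functional

open Matrix

variable {n : ℕ} {K : Set (Fin n → ℝ)} {G : Matrix (Fin n) (Fin n) ℝ} {θ : Fin n → ℝ}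

/-- The normalizing constant of `quadTilt K G θ`. -/
noncomputable def partFn (K : Set (Fin n → ℝ)) (G : Matrix (Fin n) (Fin n) ℝ)
    (θ : Fin n → ℝ) : ℝ := ∫ x in K, Real.exp (quadPot G θ x)

/-- The logarithm of the density of `quadTilt K G θ` at its barycenter, disregarding `K`. -/
noncomputable def logDens (K : Set (Fin n → ℝ)) (G : Matrix (Fin n) (Fin n) ℝ)
    (θ : Fin n → ℝ) : ℝ := quadPot G θ (meanVec K G θ) - Real.log (partFn K G θ)

/-- The trace of the inverse of the product of covariance and precision. -/
noncomputable def invTrace (K : Set (Fin n → ℝ)) (G : Matrix (Fin n) (Fin n) ℝ)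
    (θ : Fin n → ℝ) : ℝ := (G⁻¹ * (covMat K G θ)⁻¹).trace

/-- The functional to be maximized over quadratic tilts. -/
noncomputable def tiltFunctional (c₁ c₂ κ : ℝ) (K : Set (Fin n → ℝ))
    (G : Matrix (Fin n) (Fin n) ℝ) (θ : Fin n → ℝ) : ℝ :=
  logDens K G θ + c₁ * Real.log (covMat K G θ).det + c₂ * Real.log G.det +
    κ * (√(invTrace K G θ))⁻¹

/-- The barycenter of a measure. -/
noncomputable def lawMean (ν : Measure (Fin n → ℝ)) : Fin n → ℝ := fun k => ∫ y, y k ∂ν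

/-- The covariance matrix of a measure. -/
noncomputable def lawCov (ν : Measure (Fin n → ℝ)) : Matrix (Fin n) (Fin n) ℝ :=
  of fun k l => (∫ y, y k * y l ∂ν) - (∫ y, y k ∂ν) * ∫ y, y l ∂ν

theorem IsBody.partFn_pos (hK : IsBody K) : 0 < partFn K G θ := by
  have := hK.restrict_ne_zero
  exact integral_exp_pos hK.integrable_exp

theorem integral_affine_mul_sub {ν : Measure (Fin n → ℝ)} [IsProbabilityMeasure ν]
    (h1 : ∀ l, Integrable (fun y => y l) ν) (h2 : ∀ l m, Integrable (fun y => y l * y m) ν)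
    (α β : ℝ) (u v : Fin n → ℝ) :
    (∫ y, (α + u ⬝ᵥ y) * (β + v ⬝ᵥ y) ∂ν) - (∫ y, (α + u ⬝ᵥ y) ∂ν) * ∫ y, (β + v ⬝ᵥ y) ∂ν =
      u ⬝ᵥ lawCov ν *ᵥ v := by
  have hi : ∀ u : Fin n → ℝ, Integrable (fun y => u ⬝ᵥ y) ν := fun u =>
    integrable_finsetSum _ fun k _ => (h1 k).const_mul _
  have h_intg : ∀ u : Fin n → ℝ, ∫ y, u ⬝ᵥ y ∂ν = u ⬝ᵥ lawMean ν := fun u => by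
    simp only [dotProduct, lawMean]
    rw [integral_finsetSum _ fun k _ => (h1 k).const_mul _]
    simp only [integral_const_mul]
  have hexp : ∀ y : Fin n → ℝ, (u ⬝ᵥ y) * (v ⬝ᵥ y) = ∑ i, ∑ j, u i * v j * (y i * y j) := fun x => by
    simp only [dotProduct, Finset.sum_mul_sum]
    exact Finset.sum_congr rfl fun i _ => Finset.sum_congr rfl fun j _ => by ring
  have hii : Integrable (fun y => (u ⬝ᵥ y) * (v ⬝ᵥ y)) ν := by
    simp only [hexp]
    exact integrable_finsetSum _ fun k _ => integrable_finsetSum _ fun l _ => (h2 k l).const_mul _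
  have hint2 : ∫ y, (u ⬝ᵥ y) * (v ⬝ᵥ y) ∂ν =
      u ⬝ᵥ lawCov ν *ᵥ v + (u ⬝ᵥ lawMean ν) * (v ⬝ᵥ lawMean ν) := by
    simp only [hexp]
    rw [integral_finsetSum _ fun k _ => integrable_finsetSum _ fun l _ => (h2 k l).const_mul _]
    have hc : ∀ k l, lawCov ν k l = (∫ y, y k * y l ∂ν) - lawMean ν k * lawMean ν l :=
      fun k l => rfl
    simp only [dotProduct, mulVec, hc, Finset.mul_sum, ← Finset.sum_add_distrib]
    refine Finset.sum_congr rfl fun i _ => ?_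
    rw [integral_finsetSum _ fun l _ => (h2 i l).const_mul _]
    refine Finset.sum_congr rfl fun j _ => ?_
    rw [integral_const_mul]
    ring
  have : ∀ y : Fin n → ℝ, (α + u ⬝ᵥ y) * (β + v ⬝ᵥ y) =
      α * β + α * (v ⬝ᵥ y) + β * (u ⬝ᵥ y) + (u ⬝ᵥ y) * (v ⬝ᵥ y) := fun y => by ring
  simp only [this]
  have i1 : Integrable (fun y => α * β + α * (v ⬝ᵥ y)) ν := (integrable_const _).add ((hi v).const_mul _)
  have i2 : Integrable (fun y => α * β + α * (v ⬝ᵥ y) + β * (u ⬝ᵥ y)) ν :=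
    i1.add ((hi u).const_mul _)
  rw [integral_add i2 hii, integral_add i1 ((hi u).const_mul _),
    integral_add (integrable_const _) ((hi v).const_mul _), integral_add (integrable_const _) (hi u),
    integral_add (integrable_const _) (hi v), hint2]
  simp only [integral_const_mul, h_intg, integral_const, probReal_univ, smul_eq_mul, one_mul]
  ring

namespace IsWhitening

variable {B S : Matrix (Fin n) (Fin n) ℝ} {γ z : Fin n → ℝ}

/-- The perturbed linear term. -/
noncomputable def shiftθ (K : Set (Fin n → ℝ)) (G : Matrix (Fin n) (Fin n) ℝ) (θ : Fin n → ℝ)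
    (B S : Matrix (Fin n) (Fin n) ℝ) (z : Fin n → ℝ) : Fin n → ℝ :=
  θ + B⁻¹ᵀ *ᵥ (z - S *ᵥ -(B⁻¹ *ᵥ meanVec K G θ))

/-- The law of the perturbation in whitened coordinates. -/
noncomputable def shiftLaw (K : Set (Fin n → ℝ)) (G : Matrix (Fin n) (Fin n) ℝ) (θ : Fin n → ℝ)
    (B S : Matrix (Fin n) (Fin n) ℝ) (z : Fin n → ℝ) : Measure (Fin n → ℝ) :=
  (whitenedLaw K G θ B).tilted (quadPot S z)

theorem isProbabilityMeasure_shiftLaw (hK : IsBody K) (hG : G.PosDef)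
    (h : IsWhitening K G θ B γ) : IsProbabilityMeasure (shiftLaw K G θ B S z) := by
  have hw := h.isWhitened hK hG
  have := hw.isProbabilityMeasure
  have hqc : Continuous fun y => Real.exp (quadPot S z y) := by fun_prop
  exact isProbabilityMeasure_tilted (hw.integrable hqc)

theorem integrable_shiftLaw (hK : IsBody K) (hG : G.PosDef)
    (h : IsWhitening K G θ B γ) {f : (Fin n → ℝ) → ℝ} (hf : Continuous f) :
    Integrable f (shiftLaw K G θ B S z) := by
  have hw := h.isWhitened hK hG
  have := isProbabilityMeasure_shiftLaw hK hG h (S := S) (z := z)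
  obtain ⟨R, -, hμ⟩ := hw.exists_bound
  exact integrable_of_ae_abs_le ((tilted_absolutelyContinuous _ _).ae_le hμ) hf

theorem integral_shift (hK : IsBody K) (h : IsWhitening K G θ B γ) (hS : S.IsSymm)
    {f : (Fin n → ℝ) → ℝ} (hf : Continuous f) :
    ∫ x, f x ∂(quadTilt K (G + B⁻¹ᵀ * S * B⁻¹) (shiftθ K G θ B S z)) =
      ∫ y, f (meanVec K G θ + B *ᵥ y) ∂(shiftLaw K G θ B S z) := by
  rw [shiftLaw, hK.integral_tilted_whitenedLaw hS (f := fun y => f (meanVec K G θ + B *ᵥ y))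
    (hf.comp (by fun_prop)), shiftθ]
  congr 1
  ext x
  rw [mulVec_mulVec, mul_nonsing_inv _ h.isUnit_det, one_mulVec, add_sub_cancel]

theorem meanVec_shift (hK : IsBody K) (hG : G.PosDef) (h : IsWhitening K G θ B γ)
    (hS : S.IsSymm) :
    meanVec K (G + B⁻¹ᵀ * S * B⁻¹) (shiftθ K G θ B S z) =
      meanVec K G θ + B *ᵥ lawMean (shiftLaw K G θ B S z) := by
  have := isProbabilityMeasure_shiftLaw hK hG h (S := S) (z := z)
  ext i
  rw [meanVec, integral_shift hK h hS (continuous_apply i)]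
  simp only [Pi.add_apply, mulVec, dotProduct, lawMean]
  rw [integral_add (integrable_const _) (integrable_shiftLaw hK hG h (by fun_prop)),
    integral_finsetSum _ fun k _ => integrable_shiftLaw hK hG h (by fun_prop)]
  simp [integral_const_mul]

theorem covMat_shift (hK : IsBody K) (hG : G.PosDef) (h : IsWhitening K G θ B γ)
    (hS : S.IsSymm) :
    covMat K (G + B⁻¹ᵀ * S * B⁻¹) (shiftθ K G θ B S z) =
      B * lawCov (shiftLaw K G θ B S z) * Bᵀ := by
  have := isProbabilityMeasure_shiftLaw hK hG h (S := S) (z := z)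
  ext i j
  simp only [covMat, of_apply, meanVec]
  rw [integral_shift hK h hS (f := fun x => x i * x j) (by fun_prop),
    integral_shift hK h hS (continuous_apply i), integral_shift hK h hS (continuous_apply j)]
  have := integral_affine_mul_sub (ν := shiftLaw K G θ B S z)
    (fun l => integrable_shiftLaw hK hG h (by fun_prop))
    (fun l m => integrable_shiftLaw hK hG h (by fun_prop))
    (meanVec K G θ i) (meanVec K G θ j) (B i) (B j)
  refine Eq.trans this ?_
  rw [Matrix.mul_assoc, mul_apply]
  simp only [dotProduct, mulVec, mul_apply, transpose_apply]

theorem logDens_shift (hK : IsBody K) (hG : G.PosDef) (h : IsWhitening K G θ B γ)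
    (hS : S.IsSymm) :
    logDens K (G + B⁻¹ᵀ * S * B⁻¹) (shiftθ K G θ B S z) =
      logDens K G θ +
        quadPot (diagonal γ) (Bᵀ *ᵥ (θ - G *ᵥ meanVec K G θ)) (lawMean (shiftLaw K G θ B S z)) +
        quadPot S z (lawMean (shiftLaw K G θ B S z)) -
        Real.log (∫ y, Real.exp (quadPot S z y) ∂(whitenedLaw K G θ B)) := by
  set a := meanVec K G θ with ha
  set d := -(B⁻¹ *ᵥ a) with hd
  set m := lawMean (shiftLaw K G θ B S z)
  have haff := quadPot_affine hS B⁻¹ z d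
  have hZ : partFn K (G + B⁻¹ᵀ * S * B⁻¹) (shiftθ K G θ B S z) * Real.exp (quadPot S z d) =
      partFn K G θ * ∫ y, Real.exp (quadPot S z y) ∂(whitenedLaw K G θ B) := by
    rw [integral_whitenedLaw (f := fun y => Real.exp (quadPot S z y)) (by fun_prop)]
    have hYd : ∀ x, B⁻¹ *ᵥ (x - meanVec K G θ) = B⁻¹ *ᵥ x + d :=
      fun x => by rw [mulVec_sub, sub_eq_add_neg]
    simp only [hYd, haff, Real.exp_add]
    rw [integral_mul_const, quadTilt, integral_exp_tilted, ← mul_assoc]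
    congr 1
    have := (hK.partFn_pos (G := G) (θ := θ)).ne'
    rw [partFn] at this
    rw [partFn, partFn, mul_div_cancel₀ _ this]
    simp only [shiftθ, quadPot_add, Pi.add_apply]
    rfl
  have hW : 0 < ∫ y, Real.exp (quadPot S z y) ∂(whitenedLaw K G θ B) := by
    have h1 := hK.partFn_pos (G := G) (θ := θ)
    have h2 := hK.partFn_pos (G := G + B⁻¹ᵀ * S * B⁻¹) (θ := shiftθ K G θ B S z)
    have h3 := mul_pos h2 (Real.exp_pos (quadPot S z d))
    rw [hZ] at h3
    exact (pos_iff_pos_of_mul_pos h3).1 h1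
  have hlog := congrArg Real.log hZ
  rw [Real.log_mul hK.partFn_pos.ne' (Real.exp_pos _).ne',
    Real.log_mul hK.partFn_pos.ne' hW.ne', Real.log_exp] at hlog
  have h1 := quadPot_affine (isHermitian_iff_isSymm.1 hG.1) B θ a m
  have h2 := haff (a + B *ᵥ m)
  have h3 : B⁻¹ *ᵥ (a + B *ᵥ m) + d = m := by
    rw [mulVec_add, mulVec_mulVec, nonsing_inv_mul _ h.isUnit_det, one_mulVec, hd]
    abel
  rw [h3] at h2
  rw [h.diag] at h1
  rw [logDens, logDens, meanVec_shift hK hG h hS, shiftθ, quadPot_add, ← ha]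
  rw [show a + B *ᵥ m = B *ᵥ m + a from add_comm _ _] at h2 ⊢
  rw [h1]
  rw [shiftθ, ← ha] at hlog
  simp only [← hd] at *
  linarith

theorem G_eq (h : IsWhitening K G θ B γ) : G = B⁻¹ᵀ * diagonal γ * B⁻¹ := by
  rw [← h.diag]
  have h1 := mul_nonsing_inv _ h.isUnit_det
  calc G = (B * B⁻¹)ᵀ * G * (B * B⁻¹) := by rw [h1]; simp
    _ = _ := by rw [transpose_mul]; simp only [Matrix.mul_assoc]

theorem shift_eq (h : IsWhitening K G θ B γ) (s : ℝ) :
    G + B⁻¹ᵀ * (s • (1 : Matrix (Fin n) (Fin n) ℝ)) * B⁻¹ =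
      B⁻¹ᵀ * (diagonal fun k => γ k + s) * B⁻¹ := by
  conv_lhs => rw [h.G_eq]
  rw [← Matrix.add_mul, ← Matrix.mul_add]
  congr 2
  rw [smul_one_eq_diagonal, diagonal_add]

theorem det_shift (h : IsWhitening K G θ B γ) {s : ℝ} (hs : 0 ≤ s) :
    Real.log (G + B⁻¹ᵀ * (s • (1 : Matrix (Fin n) (Fin n) ℝ)) * B⁻¹).det =
      Real.log G.det + ∑ k, Real.log (1 + s * (γ k)⁻¹) := by
  have hB : B⁻¹.det ≠ 0 := (isUnit_nonsing_inv_det _ h.isUnit_det).ne_zero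
  have hp : ∀ k, 0 < γ k := h.pos
  have hprod : (∏ k, γ k) ≠ 0 := (Finset.prod_pos fun k _ => hp k).ne'
  have hprod' : (∏ k, (1 + s * (γ k)⁻¹)) ≠ 0 :=
    (Finset.prod_pos fun k _ => by have := hp k; positivity).ne'
  rw [h.shift_eq]
  have hdetG : G.det = (B⁻¹ᵀ * diagonal γ * B⁻¹).det := congrArg det h.G_eq
  rw [hdetG]
  simp only [det_mul, det_transpose, det_diagonal]
  rw [← Real.log_prod (fun k _ => by have := hp k; positivity), ← Real.log_mul _ hprod']
  · congr 1
    have : ∏ k, (γ k + s) = (∏ k, γ k) * ∏ k, (1 + s * (γ k)⁻¹) := by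
      rw [← Finset.prod_mul_distrib]
      exact Finset.prod_congr rfl fun k _ => by have := (hp k).ne'; field_simp
    rw [this]; ring
  · exact mul_ne_zero (mul_ne_zero hB hprod) hB

theorem inv_transpose_conj {B V : Matrix (Fin n) (Fin n) ℝ} (hB : IsUnit B.det) (d : Fin n → ℝ)
    (hd : ∀ k, d k ≠ 0) :
    ((B⁻¹ᵀ * diagonal d * B⁻¹)⁻¹ * (B * V * Bᵀ)⁻¹).trace = ∑ k, (d k)⁻¹ * V⁻¹ k k := by
  have h1 : B * B⁻¹ = 1 := mul_nonsing_inv _ hB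
  have h2 : B⁻¹ * B = 1 := nonsing_inv_mul _ hB
  have h2t : Bᵀ * B⁻¹ᵀ = 1 := by rw [← transpose_mul, h2, transpose_one]
  have h3 : (diagonal d)⁻¹ = diagonal fun k => (d k)⁻¹ := by
    refine inv_eq_right_inv ?_
    rw [diagonal_mul_diagonal, ← diagonal_one]
    congr 1; ext k; exact mul_inv_cancel₀ (hd k)
  simp only [Matrix.mul_inv_rev, nonsing_inv_nonsing_inv _ hB, h3]
  rw [← transpose_nonsing_inv, nonsing_inv_nonsing_inv _ hB, ← transpose_nonsing_inv]
  calc _ = (B * ((diagonal fun k => (d k)⁻¹) * (Bᵀ * B⁻¹ᵀ) * (V⁻¹ * B⁻¹))).trace := by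
        simp only [Matrix.mul_assoc]
    _ = ((diagonal fun k => (d k)⁻¹) * V⁻¹ * (B⁻¹ * B)).trace := by
        rw [h2t, trace_mul_comm]; simp only [Matrix.mul_assoc, Matrix.mul_one]
    _ = _ := by
        rw [h2, Matrix.mul_one, trace]
        simp only [diag_apply, diagonal_mul]

theorem invTrace_shift (hK : IsBody K) (hG : G.PosDef) (h : IsWhitening K G θ B γ) {s : ℝ}
    (hs : 0 ≤ s) : invTrace K (G + B⁻¹ᵀ * (s • (1 : Matrix (Fin n) (Fin n) ℝ)) * B⁻¹)
      (shiftθ K G θ B (s • 1) z) =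
        ∑ k, (γ k + s)⁻¹ * (lawCov (shiftLaw K G θ B (s • 1) z))⁻¹ k k := by
  rw [invTrace, covMat_shift hK hG h (isSymm_one.smul s), h.shift_eq,
    inv_transpose_conj h.isUnit_det _ fun k => (by have := h.pos k; positivity)]

theorem invTrace_eq (h : IsWhitening K G θ B γ) : invTrace K G θ = ∑ k, (γ k)⁻¹ := by
  rw [invTrace, ← h.mul_transpose]
  nth_rw 1 [h.G_eq]
  have := inv_transpose_conj (V := 1) h.isUnit_det γ fun k => (h.pos k).ne'
  rw [Matrix.mul_one] at this
  rw [this]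
  simp

end IsWhitening

end Functional

section

open Filter Topology

section Spectral

open Matrix

variable {n : ℕ}

theorem log_one_add_ge {x : ℝ} (hx : |x| ≤ 1 / 2) :
    x - 1 / 2 * x ^ 2 - 2 * |x| ^ 3 ≤ Real.log (1 + x) := by
  have h := Real.abs_log_sub_add_sum_range_le (x := -x) (by rw [abs_neg]; linarith) 2
  rw [abs_neg, sub_neg_eq_add] at h
  have h2 : |x| ^ (2 + 1) / (1 - |x|) ≤ 2 * |x| ^ 3 := by
    rw [div_le_iff₀ (by linarith)]
    norm_num
    nlinarith [mul_nonneg (pow_nonneg (abs_nonneg x) 3) (sub_nonneg.2 hx)]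
  have h3 := (abs_le.1 (h.trans h2)).1
  simp [Finset.sum_range_succ] at h3
  linarith

theorem inv_one_add_le {x : ℝ} (hx : |x| ≤ 1 / 2) :
    (1 + x)⁻¹ ≤ 1 - x + x ^ 2 + 2 * |x| ^ 3 := by
  have h1 := abs_le.1 hx
  have hp : 0 < 1 + x := by linarith
  rw [inv_le_iff_one_le_mul₀ hp]
  have h3 : -|x| ^ 3 ≤ x ^ 3 := by
    rw [← abs_pow]; exact neg_abs_le _
  have h4 := pow_nonneg (abs_nonneg x) 3
  nlinarith [mul_nonneg h4 (show (0:ℝ) ≤ 1 / 2 + x by linarith)]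

theorem orthogonal_conj_apply (O : Matrix (Fin n) (Fin n) ℝ) (f : Fin n → ℝ) (k : Fin n) :
    (O * diagonal f * Oᵀ) k k = ∑ j, O k j ^ 2 * f j := by
  rw [mul_apply]
  refine Finset.sum_congr rfl fun j _ => ?_
  rw [mul_diagonal, transpose_apply]; ring

/-- Third order perturbation bounds for the determinant and the inverse near the identity. -/
theorem perturbation_bounds {X : Matrix (Fin n) (Fin n) ℝ} (hX : X.IsSymm) {s : ℝ}
    (hs : ∑ k, ∑ l, X k l ^ 2 = s) (hs4 : s ≤ 1 / 4) :
    (∑ k, X k k) - 1 / 2 * s - 2 * (√s * s) ≤ Real.log (1 + X).det ∧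
    0 < (1 + X).det ∧
    ∀ k, 0 < (1 + X)⁻¹ k k ∧ (1 + X)⁻¹ k k ≤ 1 - X k k + (∑ l, X k l ^ 2) + 2 * (√s * s) := by
  obtain ⟨O, d, h1, h2, h3⟩ := exists_orthogonal_diagonal hX
  have hconj : ∀ M : Matrix (Fin n) (Fin n) ℝ, O * (Oᵀ * M * O) * Oᵀ = M := fun M => by
    calc _ = (O * Oᵀ) * M * (O * Oᵀ) := by simp only [Matrix.mul_assoc]
      _ = M := by rw [h2]; simp
  have hXd : X = O * diagonal d * Oᵀ := by rw [← h3, hconj]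
  have hXX : X * X = O * diagonal (fun j => d j ^ 2) * Oᵀ := by
    rw [hXd]
    calc _ = O * (diagonal d * (Oᵀ * O) * diagonal d) * Oᵀ := by simp only [Matrix.mul_assoc]
      _ = _ := by
        rw [h1, Matrix.mul_one, diagonal_mul_diagonal]
        simp only [sq]
  have hsq : ∀ k, ∑ l, X k l ^ 2 = (X * X) k k := fun k => by
    rw [mul_apply]
    refine Finset.sum_congr rfl fun l _ => ?_
    rw [sq]; congr 1; exact (hX.apply k l).symm
  have hO : ∀ k, ∑ j, O k j ^ 2 = 1 := fun k => by
    have := congrFun (congrFun h2 k) k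
    rw [mul_apply, one_apply_eq] at this
    rw [← this]
    exact Finset.sum_congr rfl fun j _ => by rw [transpose_apply, sq]
  have htr : ∀ f : Fin n → ℝ, (O * diagonal f * Oᵀ).trace = ∑ j, f j := fun f => by
    rw [trace_mul_comm, ← Matrix.mul_assoc, h1, Matrix.one_mul, trace_diagonal]
  have hsd : ∑ j, d j ^ 2 = s := by
    rw [← htr, ← hXX, ← hs]
    simp only [trace, diag_apply, hsq]
  have hs0 : 0 ≤ s := hsd ▸ Finset.sum_nonneg fun _ _ => sq_nonneg _
  have hds : ∀ j, |d j| ≤ √s := fun j => by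
    refine Real.abs_le_sqrt ?_
    rw [← hsd]
    exact Finset.single_le_sum (f := fun j => d j ^ 2) (fun _ _ => sq_nonneg _) (Finset.mem_univ j)
  have hs2 : √s ≤ 1 / 2 := by
    rw [show (1 / 2 : ℝ) = √(1 / 4) by
      rw [show (1 / 4 : ℝ) = (1 / 2) ^ 2 by norm_num, Real.sqrt_sq (by norm_num)]]
    exact Real.sqrt_le_sqrt hs4
  have hd2 : ∀ j, |d j| ≤ 1 / 2 := fun j => (hds j).trans hs2
  have hdp : ∀ j, 0 < 1 + d j := fun j => by have := (abs_le.1 (hd2 j)).1; linarith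
  have hcube : ∀ j, |d j| ^ 3 ≤ √s * d j ^ 2 := fun j => by
    rw [← sq_abs (d j), pow_succ', ]
    exact mul_le_mul_of_nonneg_right (hds j) (sq_nonneg _)
  have h1X : 1 + X = O * diagonal (fun j => 1 + d j) * Oᵀ := by
    rw [← diagonal_add, diagonal_one, Matrix.mul_add, Matrix.add_mul, ← hXd, Matrix.mul_one, h2]
  have hdet : (1 + X).det = ∏ j, (1 + d j) := by
    rw [h1X, det_mul, det_mul, det_diagonal]
    have : O.det * Oᵀ.det = 1 := by rw [← det_mul, h2, det_one]
    linear_combination (∏ j, (1 + d j)) * this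
  have hinv : (1 + X)⁻¹ = O * diagonal (fun j => (1 + d j)⁻¹) * Oᵀ := by
    refine inv_eq_right_inv ?_
    rw [h1X]
    calc _ = O * (diagonal (fun j => 1 + d j) * (Oᵀ * O) * diagonal (fun j => (1 + d j)⁻¹)) * Oᵀ := by
          simp only [Matrix.mul_assoc]
      _ = O * 1 * Oᵀ := by
          rw [h1, Matrix.mul_one, diagonal_mul_diagonal, ← diagonal_one]
          congr 3; ext j; exact mul_inv_cancel₀ (hdp j).ne'
      _ = 1 := by rw [Matrix.mul_one, h2]
  refine ⟨?_, ?_, fun k => ⟨?_, ?_⟩⟩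
  · rw [hdet, Real.log_prod fun j _ => (hdp j).ne']
    have e1 : ∑ k, X k k = ∑ j, d j := by
      rw [← htr d, ← hXd]; rfl
    have e2 : 1 / 2 * s = ∑ j, 1 / 2 * d j ^ 2 := by rw [← Finset.mul_sum, hsd]
    have e3 : 2 * (√s * s) = ∑ j, 2 * (√s * d j ^ 2) := by
      rw [← Finset.mul_sum, ← Finset.mul_sum, hsd]
    rw [e1, e2, e3, ← Finset.sum_sub_distrib, ← Finset.sum_sub_distrib]
    refine Finset.sum_le_sum fun j _ => (le_trans ?_ (log_one_add_ge (hd2 j)))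
    linarith [hcube j]
  · rw [hdet]; exact Finset.prod_pos fun j _ => hdp j
  · rw [hinv, orthogonal_conj_apply]
    by_contra hc
    push Not at hc
    have h0 := (Finset.sum_eq_zero_iff_of_nonneg fun j _ =>
      mul_nonneg (sq_nonneg (O k j)) (inv_nonneg.2 (hdp j).le)).1
        (le_antisymm hc (Finset.sum_nonneg fun j _ =>
          mul_nonneg (sq_nonneg (O k j)) (inv_nonneg.2 (hdp j).le)))
    have h5 := hO k
    rw [Finset.sum_eq_zero fun j hj => ?_] at h5
    · exact zero_ne_one h5
    · exact (mul_eq_zero.1 (h0 j hj)).resolve_right (inv_ne_zero (hdp j).ne')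
  · have e1 : X k k = ∑ j, O k j ^ 2 * d j := by
      conv_lhs => rw [hXd]
      rw [orthogonal_conj_apply]
    have e2 : ∑ l, X k l ^ 2 = ∑ j, O k j ^ 2 * d j ^ 2 := by
      rw [hsq, hXX, orthogonal_conj_apply]
    have e3 : 2 * (√s * s) ≥ ∑ j, O k j ^ 2 * (2 * (√s * d j ^ 2)) := by
      have : ∀ j, O k j ^ 2 ≤ 1 := fun j => by
        rw [← hO k]
        exact Finset.single_le_sum (f := fun j => O k j ^ 2) (fun _ _ => sq_nonneg _)
          (Finset.mem_univ j)
      calc _ ≤ ∑ j, 2 * (√s * d j ^ 2) := Finset.sum_le_sum fun j _ =>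
            mul_le_of_le_one_left (by positivity) (this j)
        _ = _ := by rw [← Finset.mul_sum, ← Finset.mul_sum, hsd]
    rw [hinv, orthogonal_conj_apply, e1, e2]
    refine le_trans ?_ (add_le_add_right e3 _)
    have e4 := (hO k).symm
    rw [show ∀ a b c : ℝ, 1 - a + b + c = (∑ j, O k j ^ 2) - a + b + c from
      fun a b c => by rw [← e4], ← Finset.sum_sub_distrib, ← Finset.sum_add_distrib, ← Finset.sum_add_distrib]
    refine Finset.sum_le_sum fun j _ => ?_
    have := mul_le_mul_of_nonneg_left (inv_one_add_le (hd2 j)) (sq_nonneg (O k j))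
    have h6 := mul_le_mul_of_nonneg_left (hcube j) (sq_nonneg (O k j))
    linarith

end Spectral

namespace HasExpansion

variable {f : ℝ → ℝ} {b c : ℝ}

theorem coeff_nonpos_of_eventually (h : HasExpansion f 0 b c) (hf : ∀ᶠ t in 𝓝 0, f t ≤ 0) :
    c ≤ 0 := by
  have hn : HasExpansion (fun t => -t) 0 (-1) 0 :=
    (poly 0 (-1) 0).congr' (.of_forall fun t => by ring)
  have h' : HasExpansion (fun t => f (-t)) 0 (b * -1) (b * 0 + c * (-1) ^ 2) :=
    comp (a := 0) (φ := f) (by simpa using h) hn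
  have hs := (h.add h').congr_coeff (a' := 0) (b' := 0) (c' := 2 * c) (by ring) (by ring) (by ring)
  have hneg : Tendsto (fun t : ℝ => -t) (𝓝 0) (𝓝 0) := by simpa using (continuous_neg.tendsto (0 : ℝ))
  have := hs.coeff_nonpos (nhdsWithin_le_nhds (by
    filter_upwards [hf, hneg.eventually hf] with t h1 h2 using add_nonpos h1 h2))
  linarith

theorem sqrt_mul_self (h : HasExpansion f 0 0 c) : HasExpansion (fun t => √(f t) * f t) 0 0 0 := by
  have h1 : Tendsto (fun t => √(f t)) (𝓝 0) (𝓝 0) := by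
    simpa [Function.comp_def] using (Real.continuous_sqrt.tendsto 0).comp h.tendsto
  have h2 : f =O[𝓝 0] (fun t : ℝ => t ^ 2) := by
    have h3 := (Asymptotics.IsLittleO.isBigO h).add
      ((Asymptotics.isBigO_refl (fun t : ℝ => t ^ 2) (𝓝 0)).const_mul_left c)
    exact h3.congr_left fun t => by ring
  have h4 := ((Asymptotics.isLittleO_one_iff ℝ).2 h1).mul_isBigO h2
  unfold HasExpansion
  exact h4.congr (fun t => by ring) (fun t => by ring)

end HasExpansion

end

section

open Filter Topology

section LocalInequality

open Matrix

variable {n : ℕ}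

theorem inv_sqrt_tangent {U V : ℝ} (hU : 0 < U) (hV : 0 < V) :
    (√U)⁻¹ - 1 / 2 * (√U)⁻¹ ^ 3 * (V - U) ≤ (√V)⁻¹ := by
  have ha := Real.sqrt_pos.2 hV
  have hb := Real.sqrt_pos.2 hU
  have ea := Real.sq_sqrt hV.le
  have eb := Real.sq_sqrt hU.le
  set a := √V
  set b := √U
  rw [← ea, ← eb]
  have key : a⁻¹ - (b⁻¹ - 1 / 2 * b⁻¹ ^ 3 * (a ^ 2 - b ^ 2)) =
      (a - b) ^ 2 * (a + 2 * b) / (2 * a * b ^ 3) := by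
    field_simp
    ring
  have : 0 ≤ (a - b) ^ 2 * (a + 2 * b) / (2 * a * b ^ 3) := by positivity
  linarith

/-- The second order coefficient of the expectation of `f` along a Gaussian tilt. -/
noncomputable def tiltSecond (μ : Measure (Fin n → ℝ)) (i : Fin n) (β : ℝ)
    (f : (Fin n → ℝ) → ℝ) : ℝ :=
  ∫ y, f y * (-(1 / 2) * (∑ k, y k ^ 2) + (β * y i) ^ 2 / 2) ∂μ

theorem quadPot_single (t β : ℝ) (i : Fin n) (y : Fin n → ℝ) :
    quadPot ((t ^ 2) • (1 : Matrix (Fin n) (Fin n) ℝ)) (Pi.single i (t * β)) y =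
      t * (β * y i) + t ^ 2 * (-(1 / 2) * ∑ k, y k ^ 2) := by
  rw [quadPot, smul_mulVec, one_mulVec, dotProduct_smul, single_dotProduct]
  simp only [dotProduct, sq, smul_eq_mul]
  ring

namespace IsWhitened

variable {μ : Measure (Fin n → ℝ)} {γ : Fin n → ℝ} (h : IsWhitened γ μ)
include h

theorem exists_ae_abs_le {f : (Fin n → ℝ) → ℝ} (hf : Continuous f) :
    ∃ M, ∀ᵐ y ∂μ, |f y| ≤ M := by
  obtain ⟨R, hR, hμ⟩ := h.exists_bound
  obtain ⟨M, hM⟩ := (isCompact_closedBall (0 : Fin n → ℝ) R).exists_bound_of_continuousOn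
    hf.continuousOn
  refine ⟨M, ?_⟩
  filter_upwards [hμ] with y hy
  refine hM y ?_
  rw [mem_closedBall_zero_iff, pi_norm_le_iff_of_nonneg hR]
  exact hy

theorem hasExpansion_integral_exp (i : Fin n) (β : ℝ) {f : (Fin n → ℝ) → ℝ} (hf : Continuous f) :
    HasExpansion (fun t => ∫ y, f y *
      Real.exp (quadPot ((t ^ 2) • (1 : Matrix (Fin n) (Fin n) ℝ)) (Pi.single i (t * β)) y) ∂μ)
      (∫ y, f y ∂μ) (∫ y, f y * (β * y i) ∂μ) (tiltSecond μ i β f) := by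
  have := h.isProbabilityMeasure
  have hu : Continuous fun y : Fin n → ℝ => β * y i := by fun_prop
  have hv : Continuous fun y : Fin n → ℝ => -(1 / 2) * ∑ k, y k ^ 2 := by fun_prop
  obtain ⟨M₁, h1⟩ := h.exists_ae_abs_le hf
  obtain ⟨M₂, h2⟩ := h.exists_ae_abs_le hu
  obtain ⟨M₃, h3⟩ := h.exists_ae_abs_le hv
  have := HasExpansion.integral_exp (μ := μ) hf.measurable hu.measurable hv.measurable
    (M := max M₁ (max M₂ M₃)) (h1.mono fun y hy => hy.trans (le_max_left _ _))
    (h2.mono fun y hy => hy.trans ((le_max_left _ _).trans (le_max_right _ _)))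
    (h3.mono fun y hy => hy.trans ((le_max_right _ _).trans (le_max_right _ _)))
  simp only [quadPot_single]
  exact this

theorem integral_sum_sq : ∫ y, ∑ k, y k ^ 2 ∂μ = n := by
  rw [integral_finsetSum _ fun k _ => h.integrable (by fun_prop)]
  simp only [sq, h.cov, if_true]
  simp

theorem hasExpansion_partition (i : Fin n) {β : ℝ} (hβ : β ^ 2 = n) :
    HasExpansion (fun t => ∫ y,
      Real.exp (quadPot ((t ^ 2) • (1 : Matrix (Fin n) (Fin n) ℝ)) (Pi.single i (t * β)) y) ∂μ)
      1 0 0 := by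
  have := h.isProbabilityMeasure
  have h1 := h.hasExpansion_integral_exp i β (f := fun _ => 1) continuous_const
  simp only [one_mul] at h1
  refine h1.congr_coeff (by simp) ?_ ?_
  · rw [integral_const_mul, h.mean, mul_zero]
  · simp only [tiltSecond, one_mul]
    have i1 : Integrable (fun y => -(1 / 2) * ∑ k, y k ^ 2) μ := h.integrable (by fun_prop)
    have i2 : Integrable (fun y => (β * y i) ^ 2 / 2) μ := h.integrable (by fun_prop)
    rw [integral_add i1 i2, integral_const_mul, h.integral_sum_sq, integral_div]
    simp only [mul_pow]
    rw [integral_const_mul, hβ]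
    simp only [sq, h.cov, if_true]
    ring

theorem hasExpansion_tilted (i : Fin n) {β : ℝ} (hβ : β ^ 2 = n) {f : (Fin n → ℝ) → ℝ}
    (hf : Continuous f) :
    HasExpansion (fun t => ∫ y, f y ∂(μ.tilted
      (quadPot ((t ^ 2) • (1 : Matrix (Fin n) (Fin n) ℝ)) (Pi.single i (t * β)))))
      (∫ y, f y ∂μ) (∫ y, f y * (β * y i) ∂μ) (tiltSecond μ i β f) := by
  have h1 := (h.hasExpansion_integral_exp i β hf).mul ((h.hasExpansion_partition i hβ).inv one_pos)
  refine (h1.congr' (.of_forall fun t => ?_)).congr_coeff (by simp) (by simp) (by simp)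
  simp only
  rw [integral_tilted, ← integral_mul_const]
  congr 1
  ext y
  rw [smul_eq_mul, div_eq_mul_inv]
  ring

theorem sum_tiltSecond {β : ℝ} (hβ : β ^ 2 = n) {f : (Fin n → ℝ) → ℝ} (hf : Continuous f) :
    ∑ i, tiltSecond μ i β f = 0 := by
  unfold tiltSecond
  rw [← integral_finsetSum _ fun k _ => h.integrable (by fun_prop)]
  refine (integral_congr_ae (.of_forall fun y => ?_)).trans (integral_zero _ _)
  rw [← Finset.mul_sum, Finset.sum_add_distrib, ← Finset.sum_div]
  simp only [mul_pow, ← Finset.mul_sum, hβ, Finset.sum_const, Finset.card_univ, Fintype.card_fin,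
    nsmul_eq_mul]
  ring

theorem hasExpansion_lawMean (i : Fin n) {β : ℝ} (hβ : β ^ 2 = n) (k : Fin n) :
    HasExpansion (fun t => lawMean (μ.tilted
      (quadPot ((t ^ 2) • (1 : Matrix (Fin n) (Fin n) ℝ)) (Pi.single i (t * β)))) k)
      0 (if i = k then β else 0) (tiltSecond μ i β fun y => y k) := by
  refine (h.hasExpansion_tilted i hβ (continuous_apply k)).congr_coeff (h.mean k) ?_ rfl
  have : ∀ y : Fin n → ℝ, y k * (β * y i) = β * (y i * y k) := fun y => by ring
  simp only [this]
  rw [integral_const_mul, h.cov]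
  simp

theorem hasExpansion_lawCov (i : Fin n) {β : ℝ} (hβ : β ^ 2 = n) (k l : Fin n) :
    HasExpansion (fun t => lawCov (μ.tilted
      (quadPot ((t ^ 2) • (1 : Matrix (Fin n) (Fin n) ℝ)) (Pi.single i (t * β)))) k l -
        (1 : Matrix (Fin n) (Fin n) ℝ) k l)
      0 (β * ∫ y, y i * y k * y l ∂μ) ((tiltSecond μ i β fun y => y k * y l) -
        if i = k ∧ i = l then (n : ℝ) else 0) := by
  have h1 := h.hasExpansion_tilted i hβ (f := fun y => y k * y l) (by fun_prop)
  have h2 := (h.hasExpansion_lawMean i hβ k).mul (h.hasExpansion_lawMean i hβ l)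
  refine (((h1.sub h2).sub (.const ((1 : Matrix (Fin n) (Fin n) ℝ) k l))).congr'
    (.of_forall fun t => rfl)).congr_coeff ?_ ?_ ?_
  · rw [h.cov, one_apply]; ring
  · have : ∀ y : Fin n → ℝ, y k * y l * (β * y i) = β * (y i * y k * y l) := fun y => by ring
    simp only [this]
    rw [integral_const_mul]; ring
  · by_cases hk : i = k <;> by_cases hl : i = l <;> simp [hk, hl, ← hβ, sq]

theorem second_order (i : Fin n) {β : ℝ} (hβ : β ^ 2 = n) (τ : Fin n → ℝ) {c₁ c₂ κ U : ℝ}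
    (hc₁ : 0 ≤ c₁) (hκ : 0 ≤ κ) (hU : U = ∑ k, (γ k)⁻¹) (hU0 : 0 < U)
    (hmax : ∀ t : ℝ, ∀ ν, ν = μ.tilted
      (quadPot ((t ^ 2) • (1 : Matrix (Fin n) (Fin n) ℝ)) (Pi.single i (t * β))) →
      0 < (lawCov ν).det →
      quadPot (diagonal γ) τ (lawMean ν) +
        quadPot ((t ^ 2) • (1 : Matrix (Fin n) (Fin n) ℝ)) (Pi.single i (t * β)) (lawMean ν) -
        Real.log (∫ y, Real.exp (quadPot ((t ^ 2) • (1 : Matrix (Fin n) (Fin n) ℝ))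
          (Pi.single i (t * β)) y) ∂μ) + c₁ * Real.log (lawCov ν).det +
        c₂ * ∑ k, Real.log (1 + t ^ 2 * (γ k)⁻¹) +
        κ * ((√(∑ k, (γ k + t ^ 2)⁻¹ * (lawCov ν)⁻¹ k k))⁻¹ - (√U)⁻¹) ≤ 0) :
    (∑ k, τ k * tiltSecond μ i β fun y => y k) - 1 / 2 * (n * γ i) + n +
      c₁ * ((∑ k, tiltSecond μ i β fun y => y k * y k) - n -
        1 / 2 * (n * ∑ k, ∑ l, thirdSq μ i k l)) + c₂ * U -
      κ * (1 / 2 * (√U)⁻¹ ^ 3 * ∑ k, ((γ k)⁻¹ * (n * ∑ l, thirdSq μ i k l -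
        ((tiltSecond μ i β fun y => y k * y k) - if i = k then (n : ℝ) else 0)) -
          (γ k)⁻¹ ^ 2)) ≤ 0 := by
  have hγ := h.pos
  set ν : ℝ → Measure (Fin n → ℝ) := fun t => μ.tilted
    (quadPot ((t ^ 2) • (1 : Matrix (Fin n) (Fin n) ℝ)) (Pi.single i (t * β))) with hν
  set X : ℝ → Matrix (Fin n) (Fin n) ℝ := fun t => lawCov (ν t) - 1 with hX
  have eX : ∀ k l, HasExpansion (fun t => X t k l) 0 (β * ∫ y, y i * y k * y l ∂μ)
      ((tiltSecond μ i β fun y => y k * y l) - if i = k ∧ i = l then (n : ℝ) else 0) :=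
    fun k l => h.hasExpansion_lawCov i hβ k l
  have eX2 : ∀ k l, HasExpansion (fun t => X t k l ^ 2) 0 0 (n * thirdSq μ i k l) := fun k l => by
    refine (((eX k l).mul (eX k l)).congr' (.of_forall fun t => (sq _).symm)).congr_coeff
      (by ring) (by ring) ?_
    rw [thirdSq, ← hβ]; ring
  have eR : ∀ k, HasExpansion (fun t => ∑ l, X t k l ^ 2) 0 0 (n * ∑ l, thirdSq μ i k l) :=
    fun k => (HasExpansion.sum Finset.univ fun l _ => eX2 k l).congr_coeff (by simp) (by simp)
      (by rw [Finset.mul_sum])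
  have eS : HasExpansion (fun t => ∑ k, ∑ l, X t k l ^ 2) 0 0
      (n * ∑ k, ∑ l, thirdSq μ i k l) :=
    (HasExpansion.sum Finset.univ fun k _ => eR k).congr_coeff (by simp) (by simp)
      (by rw [Finset.mul_sum])
  set s : ℝ → ℝ := fun t => ∑ k, ∑ l, X t k l ^ 2 with hs
  have eSS := (eS.sqrt_mul_self).const_mul 2
  have em := h.hasExpansion_lawMean i hβ
  have eq1 : HasExpansion (fun t => quadPot (diagonal γ) τ (lawMean (ν t))) 0 (τ i * β)
      ((∑ k, τ k * tiltSecond μ i β fun y => y k) - 1 / 2 * (n * γ i)) := by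
    have e1 := HasExpansion.sum Finset.univ fun k _ => (em k).const_mul (τ k)
    have e2 := HasExpansion.sum Finset.univ fun k _ => ((em k).mul ((em k).const_mul (γ k)))
    refine ((e1.sub (e2.const_mul (1 / 2))).congr' (.of_forall fun t => ?_)).congr_coeff
      (by simp) (by simp) ?_
    · simp only [quadPot, dotProduct, mulVec_diagonal, hν]
    · simp [← hβ]; ring
  have eq2 : HasExpansion (fun t => quadPot ((t ^ 2) • (1 : Matrix (Fin n) (Fin n) ℝ))
      (Pi.single i (t * β)) (lawMean (ν t))) 0 0 n := by
    have e1 := ((HasExpansion.poly 0 β 0).mul (em i))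
    have e2 := HasExpansion.sum Finset.univ fun k _ => ((em k).mul (em k))
    have e3 := (HasExpansion.poly 0 0 1).mul (e2.const_mul (-(1 / 2)))
    refine ((e1.add e3).congr' (.of_forall fun t => ?_)).congr_coeff
      (by simp) (by simp) (by simp [← hβ, sq])
    rw [quadPot_single]
    simp only [hν, sq]
    ring
  have eW := (h.hasExpansion_partition i hβ).log
  have eT : HasExpansion (fun t => ∑ k, X t k k) 0 (β * ∑ k, ∫ y, y i * y k * y k ∂μ)
      ((∑ k, tiltSecond μ i β fun y => y k * y k) - n) := by
    refine (HasExpansion.sum Finset.univ fun k _ => eX k k).congr_coeff (by simp)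
      (by rw [Finset.mul_sum]) ?_
    rw [Finset.sum_sub_distrib]; simp
  have eD := ((eT.sub (eS.const_mul (1 / 2))).sub eSS).const_mul c₁
  have eL : HasExpansion (fun t => ∑ k, Real.log (1 + t ^ 2 * (γ k)⁻¹)) 0 0 U := by
    rw [hU]
    refine (HasExpansion.sum Finset.univ fun k _ => (((HasExpansion.poly 1 0 (γ k)⁻¹).congr'
      (g := fun t => 1 + t ^ 2 * (γ k)⁻¹) (.of_forall fun t => ?_)).log)).congr_coeff
      (by simp) (by simp) (by simp)
    ring
  have eU : HasExpansion (fun t => ∑ k, (γ k + t ^ 2)⁻¹ *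
      (1 - X t k k + (∑ l, X t k l ^ 2) + 2 * (√(s t) * s t))) U
      (∑ k, (γ k)⁻¹ * -(β * ∫ y, y i * y k * y k ∂μ))
      (∑ k, ((γ k)⁻¹ * (n * ∑ l, thirdSq μ i k l -
        ((tiltSecond μ i β fun y => y k * y k) - if i = k then (n : ℝ) else 0)) -
          (γ k)⁻¹ ^ 2)) := by
    have e1 : ∀ k, HasExpansion (fun t => (γ k + t ^ 2)⁻¹) (γ k)⁻¹ 0 (-(γ k)⁻¹ ^ 2) := fun k => by
      refine (((HasExpansion.poly (γ k) 0 1).congr' (g := fun t => γ k + t ^ 2)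
        (.of_forall fun t => by ring)).inv (hγ k)).congr_coeff rfl (by simp) (by simp)
    have e2 := fun k => (((HasExpansion.const 1).sub (eX k k)).add (eR k)).add eSS
    refine (HasExpansion.sum Finset.univ fun k _ => (e1 k).mul (e2 k)).congr_coeff ?_ ?_ ?_
    · rw [hU]; simp
    · refine Finset.sum_congr rfl fun k _ => by ring
    · refine Finset.sum_congr rfl fun k _ => ?_
      simp only [and_self]; ring
  have eF := (((((eq1.add eq2).sub eW).add eD).add (eL.const_mul c₂)).add
    (((eU.sub (.const U)).const_mul (-(1 / 2 * (√U)⁻¹ ^ 3))).const_mul κ))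
  have eF' := eF.congr_coeff (a' := 0) (by ring) rfl rfl
  have := eF'.coeff_nonpos_of_eventually ?_
  · refine le_trans (le_of_eq ?_) this
    ring
  have hst := eS.tendsto.eventually (eventually_le_nhds (show (0 : ℝ) < 1 / 4 by norm_num))
  filter_upwards [hst] with t ht
  have hsym : (X t).IsSymm := by
    refine IsSymm.ext fun k l => ?_
    have hc : ∀ k l, X t k l = (∫ y, y k * y l ∂ν t) - (∫ y, y k ∂ν t) * (∫ y, y l ∂ν t) -
        if k = l then 1 else 0 := fun k l => by rw [← one_apply]; rfl
    rw [hc, hc]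
    simp only [mul_comm, eq_comm]
  obtain ⟨p1, p2, p3⟩ := perturbation_bounds hsym (s := s t) rfl ht
  have h1X : 1 + X t = lawCov (ν t) := add_sub_cancel _ _
  rw [h1X] at p1 p2 p3
  have hm := hmax t (ν t) rfl p2
  have hUt : ∑ k, (γ k + t ^ 2)⁻¹ * (lawCov (ν t))⁻¹ k k ≤ ∑ k, (γ k + t ^ 2)⁻¹ *
      (1 - X t k k + (∑ l, X t k l ^ 2) + 2 * (√(s t) * s t)) :=
    Finset.sum_le_sum fun k _ => mul_le_mul_of_nonneg_left (p3 k).2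
      (inv_nonneg.2 (add_nonneg (hγ k).le (sq_nonneg t)))
  have hUp : 0 < ∑ k, (γ k + t ^ 2)⁻¹ * (lawCov (ν t))⁻¹ k k :=
    Finset.sum_pos (fun k _ => mul_pos (inv_pos.2 (by have := hγ k; positivity)) (p3 k).1)
      ⟨i, Finset.mem_univ i⟩
  have htan := inv_sqrt_tangent hU0 hUp
  have hp3 : 0 ≤ 1 / 2 * (√U)⁻¹ ^ 3 := by positivity
  have h5 := mul_le_mul_of_nonneg_left hUt hp3
  have h6 : (-(1 / 2 * (√U)⁻¹ ^ 3)) * ((∑ k, (γ k + t ^ 2)⁻¹ *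
      (1 - X t k k + (∑ l, X t k l ^ 2) + 2 * (√(s t) * s t))) - U) ≤
      (√(∑ k, (γ k + t ^ 2)⁻¹ * (lawCov (ν t))⁻¹ k k))⁻¹ - (√U)⁻¹ := by linarith
  have h7 := mul_le_mul_of_nonneg_left h6 hκ
  have h8 := mul_le_mul_of_nonneg_left p1 hc₁
  linarith

end IsWhitened

end LocalInequality

end

section

open Filter Topology

section Maximizer

open Matrix

variable {n : ℕ} {K : Set (Fin n → ℝ)} {G : Matrix (Fin n) (Fin n) ℝ} {θ : Fin n → ℝ}

namespace IsWhitening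

variable {B S : Matrix (Fin n) (Fin n) ℝ} {γ z : Fin n → ℝ}

theorem tiltFunctional_shift (hK : IsBody K) (hG : G.PosDef) (h : IsWhitening K G θ B γ)
    (c₁ c₂ κ : ℝ) {s : ℝ} (hs : 0 ≤ s)
    (hdet : 0 < (lawCov (shiftLaw K G θ B (s • 1) z)).det) :
    tiltFunctional c₁ c₂ κ K (G + B⁻¹ᵀ * (s • (1 : Matrix (Fin n) (Fin n) ℝ)) * B⁻¹)
      (shiftθ K G θ B (s • 1) z) = tiltFunctional c₁ c₂ κ K G θ +
      (quadPot (diagonal γ) (Bᵀ *ᵥ (θ - G *ᵥ meanVec K G θ))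
          (lawMean (shiftLaw K G θ B (s • 1) z)) +
        quadPot (s • 1) z (lawMean (shiftLaw K G θ B (s • 1) z)) -
        Real.log (∫ y, Real.exp (quadPot (s • 1) z y) ∂(whitenedLaw K G θ B)) +
        c₁ * Real.log (lawCov (shiftLaw K G θ B (s • 1) z)).det +
        c₂ * ∑ k, Real.log (1 + s * (γ k)⁻¹) +
        κ * ((√(∑ k, (γ k + s)⁻¹ * (lawCov (shiftLaw K G θ B (s • 1) z))⁻¹ k k))⁻¹ -
          (√(∑ k, (γ k)⁻¹))⁻¹)) := by
  have hA : 0 < (covMat K G θ).det := (hK.covMat_posDef).det_pos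
  have hd : (covMat K (G + B⁻¹ᵀ * (s • (1 : Matrix (Fin n) (Fin n) ℝ)) * B⁻¹)
      (shiftθ K G θ B (s • 1) z)).det =
      (covMat K G θ).det * (lawCov (shiftLaw K G θ B (s • 1) z)).det := by
    rw [covMat_shift hK hG h (isSymm_one.smul s), ← h.mul_transpose]
    simp only [det_mul]; ring
  simp only [tiltFunctional]
  rw [hd, Real.log_mul hA.ne' hdet.ne', logDens_shift hK hG h (isSymm_one.smul s), h.det_shift hs,
    invTrace_shift hK hG h hs, h.invTrace_eq]
  ring

theorem local_max (hK : IsBody K) (hG : G.PosDef) (h : IsWhitening K G θ B γ) (hn : 1 ≤ n)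
    {c₁ c₂ κ : ℝ} (hc₁ : 0 ≤ c₁) (hκ : 0 ≤ κ)
    (hmax : ∀ G' θ', (G' - G).PosSemidef →
      tiltFunctional c₁ c₂ κ K G' θ' ≤ tiltFunctional c₁ c₂ κ K G θ) :
    n - 1 / 2 * (∑ i, γ i) -
      c₁ * (n + 1 / 2 * ∑ i, ∑ j, ∑ k, thirdSq (whitenedLaw K G θ B) i j k) +
      c₂ * (∑ i, (γ i)⁻¹) - κ * (1 / 2 * (√(∑ i, (γ i)⁻¹))⁻¹ ^ 3 * ((∑ i, (γ i)⁻¹) +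
        (∑ i, ∑ j, ∑ k, (γ i)⁻¹ * thirdSq (whitenedLaw K G θ B) i j k) -
        ∑ i, (γ i)⁻¹ ^ 2)) ≤ 0 := by
  have hw := h.isWhitened hK hG
  set μ := whitenedLaw K G θ B with hμ
  set β : ℝ := √n with hβd
  have hβ : β ^ 2 = n := Real.sq_sqrt (Nat.cast_nonneg n)
  set U := ∑ i, (γ i)⁻¹ with hU
  have hU0 : 0 < U := Finset.sum_pos (fun k _ => inv_pos.2 (h.pos k)) ⟨⟨0, hn⟩, Finset.mem_univ _⟩
  have key := fun i => hw.second_order i hβ (Bᵀ *ᵥ (θ - G *ᵥ meanVec K G θ)) (c₂ := c₂) hc₁ hκ hU hU0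
    (by
      rintro t ν rfl hdet
      have h1 := h.tiltFunctional_shift hK hG c₁ c₂ κ (sq_nonneg t) hdet
      have h2 := hmax (G + B⁻¹ᵀ * ((t ^ 2) • (1 : Matrix (Fin n) (Fin n) ℝ)) * B⁻¹)
        (shiftθ K G θ B ((t ^ 2) • 1) (Pi.single i (t * β))) (by
          rw [add_sub_cancel_left, Matrix.mul_smul, Matrix.mul_one, Matrix.smul_mul]
          refine PosSemidef.smul ?_ (sq_nonneg t)
          exact posSemidef_conjTranspose_mul_self B⁻¹)
      rw [h1] at h2
      exact (add_le_iff_nonpos_right _).1 h2)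
  have hsum := Finset.sum_nonpos fun i (_ : i ∈ Finset.univ) => key i
  have s1 : ∑ i, ∑ k, (Bᵀ *ᵥ (θ - G *ᵥ meanVec K G θ)) k * (tiltSecond μ i β fun y => y k) = 0 := by
    rw [Finset.sum_comm]
    refine Finset.sum_eq_zero fun k _ => ?_
    rw [← Finset.mul_sum, hw.sum_tiltSecond hβ (continuous_apply k), mul_zero]
  have s2' : ∀ k, ∑ i, (tiltSecond μ i β fun y => y k * y k) = 0 := fun k =>
    hw.sum_tiltSecond hβ (by fun_prop)
  have s2 : ∑ i, ∑ k, (tiltSecond μ i β fun y => y k * y k) = 0 := by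
    rw [Finset.sum_comm]
    exact Finset.sum_eq_zero fun k _ => s2' k
  have s3 : ∑ i, ∑ k, ((γ k)⁻¹ * (n * ∑ l, thirdSq μ i k l -
        ((tiltSecond μ i β fun y => y k * y k) - if i = k then (n : ℝ) else 0)) -
          (γ k)⁻¹ ^ 2) = n * (U + (∑ i, ∑ j, ∑ k, (γ i)⁻¹ * thirdSq μ i j k) -
        ∑ i, (γ i)⁻¹ ^ 2) := by
    rw [Finset.sum_comm, hU, ← Finset.sum_add_distrib, ← Finset.sum_sub_distrib, Finset.mul_sum]
    refine Finset.sum_congr rfl fun k _ => ?_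
    simp only [Finset.sum_sub_distrib, ← Finset.mul_sum]
    rw [s2']
    simp only [Finset.sum_ite_eq', Finset.mem_univ, if_true, Finset.sum_const,
      Finset.card_univ, Fintype.card_fin, nsmul_eq_mul]
    have : ∑ i, ∑ l, thirdSq μ i k l = ∑ i, ∑ l, thirdSq μ k i l := by
      refine Finset.sum_congr rfl fun i _ => Finset.sum_congr rfl fun l _ => ?_
      rw [thirdSq, thirdSq]; congr 2; ext y; ring
    rw [this]
    ring
  have hn' : (0 : ℝ) < n := by exact_mod_cast hn
  simp only [Finset.sum_add_distrib, Finset.sum_sub_distrib, ← Finset.mul_sum, Finset.sum_const,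
    Finset.card_univ, Fintype.card_fin, nsmul_eq_mul] at hsum
  simp only [Finset.sum_sub_distrib, ← Finset.mul_sum, Finset.sum_const,
    Finset.card_univ, Fintype.card_fin, nsmul_eq_mul] at s3
  rw [s1, s2, s3] at hsum
  refine nonpos_of_mul_nonpos_right (a := (n : ℝ)) ?_ hn'
  refine le_trans (le_of_eq ?_) hsum
  simp only [← Finset.mul_sum]
  ring

end IsWhitening

end Maximizer

end

section

open Filter Topology

section Phases

open Matrix

variable {n : ℕ} {μ : Measure (Fin n → ℝ)} {γ : Fin n → ℝ}

theorem quartic_contradiction {a b g : ℝ} (hb : 0 < b) (hab : 26 * b < a) (hg : a ^ 2 ≤ g * b)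
    (h : 8 * b ^ 3 * (g ^ 2 - a ^ 2 - 12 * a * g) ≤ 401 / 100 * a ^ 4 * b) : False := by
  have ha : 0 < a := by linarith
  have h1 : 8 * ((g * b) ^ 2 - a ^ 2 * b ^ 2 - 12 * (a * b) * (g * b)) ≤ 401 / 100 * a ^ 4 := by
    refine le_of_mul_le_mul_right ?_ hb
    linarith
  have h2 : (a ^ 2) ^ 2 - 12 * (a * b) * a ^ 2 ≤ (g * b) ^ 2 - 12 * (a * b) * (g * b) := by
    have : 0 ≤ (g * b - a ^ 2) * (g * b + a ^ 2 - 12 * (a * b)) := by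
      refine mul_nonneg (by linarith) ?_
      nlinarith
    linarith
  have h3 : a ^ 3 * b ≤ a ^ 4 / 26 := by nlinarith [pow_pos ha 3]
  have h4 : a ^ 2 * b ^ 2 ≤ a ^ 4 / 676 := by
    have : b ^ 2 ≤ a ^ 2 / 676 := by nlinarith
    nlinarith [pow_pos ha 2]
  have := pow_pos ha 4
  nlinarith

theorem IsWhitened.sum_inv_le (h : IsWhitened γ μ) (hn : 1 ≤ n) {η : ℝ} (hη0 : 0 ≤ η)
    (hη : η ≤ 1 / 6)
    (hmax : n - 1 / 2 * (∑ i, γ i) -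
      (1 / 2 + η) * (n + 1 / 2 * ∑ i, ∑ j, ∑ k, thirdSq μ i j k) +
      0 * (∑ i, (γ i)⁻¹) - (16 * √n ^ 3) * (1 / 2 * (√(∑ i, (γ i)⁻¹))⁻¹ ^ 3 * ((∑ i, (γ i)⁻¹) +
        (∑ i, ∑ j, ∑ k, (γ i)⁻¹ * thirdSq μ i j k) - ∑ i, (γ i)⁻¹ ^ 2)) ≤ 0) :
    ∑ i, (γ i)⁻¹ ≤ 676 * n := by
  have hγ := h.pos
  have hi : ∀ i, 0 < (γ i)⁻¹ := fun i => inv_pos.2 (hγ i)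
  have hn' : (0 : ℝ) < n := by exact_mod_cast hn
  have hP : ∑ i, γ i ≤ n := by
    refine (Finset.sum_le_sum fun i _ => h.le_one i).trans ?_
    simp
  have hX := h.sum_mul_thirdSq_le (fun _ => 1) (fun _ => zero_le_one) (fun _ _ _ => le_rfl)
  have hY := h.sum_mul_thirdSq_le (fun i => (γ i)⁻¹) (fun i => (hi i).le)
    (fun i j hij => inv_anti₀ (hγ i) hij)
  simp only [one_mul] at hX
  set U := ∑ i, (γ i)⁻¹ with hU
  set Q := ∑ i, (γ i)⁻¹ ^ 2 with hQ
  set X := ∑ i, ∑ j, ∑ k, thirdSq μ i j k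
  set Y := ∑ i, ∑ j, ∑ k, (γ i)⁻¹ * thirdSq μ i j k
  have hU0 : 0 < U := Finset.sum_pos (fun k _ => hi k) ⟨⟨0, hn⟩, Finset.mem_univ _⟩
  have hQ0 : 0 < Q := Finset.sum_pos (fun k _ => pow_pos (hi k) 2) ⟨⟨0, hn⟩, Finset.mem_univ _⟩
  have c1 : ∑ i, √(1 / γ i) ≤ √n * √U := by
    rw [← Real.sqrt_mul hn'.le]
    refine Real.le_sqrt_of_sq_le ?_
    have := Finset.sum_sq_le_sum_mul_sum_of_sq_le_mul Finset.univ
      (f := fun _ : Fin n => (1 : ℝ)) (g := fun i => (γ i)⁻¹) (r := fun i => √(1 / γ i))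
      (fun _ _ => zero_le_one) (fun i _ => (hi i).le) (fun i _ => by
        rw [Real.sq_sqrt (by have := hγ i; positivity), one_mul, one_div])
    simpa using this
  have c2 : ∑ i, (γ i)⁻¹ * √(1 / γ i) ≤ √U * √Q := by
    rw [← Real.sqrt_mul hU0.le]
    refine Real.le_sqrt_of_sq_le ?_
    exact Finset.sum_sq_le_sum_mul_sum_of_sq_le_mul Finset.univ
      (f := fun i => (γ i)⁻¹) (g := fun i => (γ i)⁻¹ ^ 2) (r := fun i => (γ i)⁻¹ * √(1 / γ i))
      (fun i _ => (hi i).le) (fun i _ => sq_nonneg _) (fun i _ => by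
        rw [mul_pow, Real.sq_sqrt (by have := hγ i; positivity), one_div]; exact le_of_eq (by ring))
  have c3 : U ^ 2 ≤ n * Q := by
    have := Finset.sum_sq_le_sum_mul_sum_of_sq_le_mul Finset.univ
      (f := fun _ : Fin n => (1 : ℝ)) (g := fun i => (γ i)⁻¹ ^ 2) (r := fun i => (γ i)⁻¹)
      (fun _ _ => zero_le_one) (fun i _ => sq_nonneg _) (fun i _ => by simp)
    simpa [hU, hQ] using this
  have ea := Real.sq_sqrt hU0.le
  have eb := Real.sq_sqrt hn'.le
  have eg := Real.sq_sqrt hQ0.le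
  have ha := Real.sqrt_pos.2 hU0
  have hb := Real.sqrt_pos.2 hn'
  have hg := Real.sqrt_pos.2 hQ0
  set a := √U
  set b := √(n : ℝ)
  set g := √Q
  by_contra hc
  push Not at hc
  rw [← ea, ← eb] at hc
  have hab : 26 * b < a := by
    refine lt_of_pow_lt_pow_left₀ 2 ha.le ?_
    linarith [mul_pow 26 b 2]
  refine quartic_contradiction (g := g) hb hab ?_ ?_
  · refine le_of_sq_le_sq ?_ (by positivity)
    rw [mul_pow, eg, eb, ea]; linarith
  · have h1 : 16 * b ^ 3 * (1 / 2 * a⁻¹ ^ 3 * (Q - U - Y)) ≤ η * n + (1 / 4 + η / 2) * X := by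
      linarith
    have h2 : 16 * b ^ 3 * (1 / 2 * a⁻¹ ^ 3 * (g ^ 2 - a ^ 2 - 12 * a * g)) ≤
        16 * b ^ 3 * (1 / 2 * a⁻¹ ^ 3 * (Q - U - Y)) := by
      have : g ^ 2 - a ^ 2 - 12 * a * g ≤ Q - U - Y := by linarith
      gcongr
    have hX0 : X ≤ 12 * (b * a) := by linarith
    have h3 : η * n + (1 / 4 + η / 2) * X ≤ 401 / 100 * (a * b) := by
      have e1 : η * n ≤ 1 / 6 * b ^ 2 := by rw [eb]; gcongr
      have e2 : (1 / 4 + η / 2) * X ≤ (1 / 4 + (1 / 6) / 2) * (12 * (b * a)) := by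
        refine (mul_le_mul_of_nonneg_left hX0 (by positivity)).trans ?_
        gcongr
      have e3 : 26 * b * b ≤ a * b := by gcongr
      nlinarith
    have h4 := h2.trans (h1.trans h3)
    have h5 : 16 * b ^ 3 * (1 / 2 * a⁻¹ ^ 3 * (g ^ 2 - a ^ 2 - 12 * a * g)) =
        8 * b ^ 3 * (g ^ 2 - a ^ 2 - 12 * a * g) / a ^ 3 := by field_simp; ring
    rw [h5, div_le_iff₀ (by positivity)] at h4
    linarith

theorem IsWhitened.sum_sq_div_le (h : IsWhitened γ μ) {η : ℝ} (hη0 : 0 ≤ η) (hη : η ≤ 1 / 12)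
    (hmax : n - 1 / 2 * (∑ i, γ i) -
      (1 / 2 + 5 + η) * (n + 1 / 2 * ∑ i, ∑ j, ∑ k, thirdSq μ i j k) +
      5 * (∑ i, (γ i)⁻¹) ≤ 0) :
    ∑ i, (1 - γ i) ^ 2 / γ i ≤ 6 * η * n := by
  have hγ := h.pos
  have hX := h.sum_thirdSq_le
  set X := ∑ i, ∑ j, ∑ k, thirdSq μ i j k
  have hP0 : 0 ≤ ∑ i, γ i := Finset.sum_nonneg fun i _ => (hγ i).le
  simp only [Finset.sum_sub_distrib, Finset.sum_const, Finset.card_univ, Fintype.card_fin,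
    nsmul_eq_mul, mul_one] at hX
  have hD : ∑ i, (1 - γ i) ^ 2 / γ i = (∑ i, (γ i)⁻¹) + (∑ i, γ i) - 2 * n := by
    rw [← Finset.sum_add_distrib, eq_sub_iff_add_eq]
    have : (2 * n : ℝ) = ∑ _i : Fin n, 2 := by simp; ring
    rw [this, ← Finset.sum_add_distrib]
    refine Finset.sum_congr rfl fun i _ => ?_
    have := (hγ i).ne'
    field_simp
    ring
  have hD0 : 0 ≤ ∑ i, (1 - γ i) ^ 2 / γ i :=
    Finset.sum_nonneg fun i _ => by have := hγ i; positivity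
  rw [hD] at hD0 ⊢
  set U := ∑ i, (γ i)⁻¹
  set P := ∑ i, γ i
  have h1 : 5 / 12 * (U + P - 2 * n) ≤ η * (n + 1 / 2 * X) := by linarith
  have h2 : n + 1 / 2 * X ≤ 2 * n + 5 / 6 * (U + P - 2 * n) := by linarith
  have h3 := mul_le_mul_of_nonneg_left h2 hη0
  have h4 := mul_le_mul_of_nonneg_right hη hD0
  have h5 : 0 ≤ η * n := by positivity
  linarith

end Phases

end

section

open Filter Topology

section Inradius

open Matrix

variable {n : ℕ} {K : Set (Fin n → ℝ)} {G : Matrix (Fin n) (Fin n) ℝ} {θ : Fin n → ℝ}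

theorem IsBody.nonempty (hK : IsBody K) : K.Nonempty :=
  hK.interior_nonempty.mono interior_subset

/-- Points outside of a body are separated from it by a unit normal. -/
theorem IsBody.exists_unit_normal (hK : IsBody K) {B : Matrix (Fin n) (Fin n) ℝ}
    (hB : IsUnit B.det) (a y₀ : Fin n → ℝ) (h0 : B *ᵥ y₀ + a ∉ K) :
    ∃ w : Fin n → ℝ, w ⬝ᵥ w = 1 ∧ ∀ x ∈ K, w ⬝ᵥ (B⁻¹ *ᵥ (x - a)) ≤ w ⬝ᵥ y₀ := by
  obtain ⟨f, u, hf, hu⟩ := geometric_hahn_banach_closed_point hK.convex hK.isCompact.isClosed h0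
  set v : Fin n → ℝ := fun i => f (Pi.single i 1) with hv
  have hfv : ∀ x, f x = v ⬝ᵥ x := fun x => by
    have := LinearMap.pi_apply_eq_sum_univ f.toLinearMap x
    simp only [ContinuousLinearMap.coe_coe] at this
    rw [this, dotProduct]
    refine Finset.sum_congr rfl fun i _ => ?_
    rw [smul_eq_mul, mul_comm, hv]
    congr 2
    ext j
    simp [Pi.single_apply, eq_comm]
  set w := Bᵀ *ᵥ v with hw
  have hwy : ∀ y, w ⬝ᵥ y = v ⬝ᵥ B *ᵥ y := fun y => by
    rw [hw, mulVec_transpose, ← dotProduct_mulVec]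
  have hlt : ∀ x ∈ K, w ⬝ᵥ (B⁻¹ *ᵥ (x - a)) < w ⬝ᵥ y₀ := fun x hx => by
    have h1 := (hf x hx).trans hu
    rw [hfv, hfv, dotProduct_add] at h1
    rw [hwy, hwy, mulVec_mulVec, mul_nonsing_inv _ hB, one_mulVec, dotProduct_sub]
    linarith
  have hw0 : 0 < w ⬝ᵥ w := by
    refine lt_of_le_of_ne (by
      simp only [dotProduct]; exact Finset.sum_nonneg fun i _ => mul_self_nonneg _) fun h => ?_
    have hz : w = 0 := dotProduct_self_eq_zero.1 h.symm
    obtain ⟨x, hx⟩ := hK.nonempty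
    have := hlt x hx
    rw [hz] at this
    simp at this
  have hs := Real.sqrt_pos.2 hw0
  refine ⟨(√(w ⬝ᵥ w))⁻¹ • w, ?_, fun x hx => ?_⟩
  · rw [smul_dotProduct, dotProduct_smul, smul_eq_mul, smul_eq_mul]
    nth_rw 3 [← Real.mul_self_sqrt hw0.le]
    field_simp
  · rw [smul_dotProduct, smul_dotProduct]
    exact smul_le_smul_of_nonneg_left (hlt x hx).le (inv_nonneg.2 hs.le)

theorem integral_cube_dotProduct (c : ℝ) (τ : Fin n → ℝ) :
    ∫ y in Set.pi Set.univ (fun _ : Fin n => Set.Icc (-c) c), τ ⬝ᵥ y = 0 := by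
  set Q : Set (Fin n → ℝ) := Set.pi Set.univ (fun _ : Fin n => Set.Icc (-c) c)
  have hQ : MeasurableSet Q := MeasurableSet.univ_pi fun _ => measurableSet_Icc
  rw [← integral_indicator hQ]
  set g : (Fin n → ℝ) → ℝ := Q.indicator fun y => τ ⬝ᵥ y
  have h1 := integral_neg_eq_self g volume
  have h2 : ∀ y, g (-y) = -g y := fun y => by
    have : -y ∈ Q ↔ y ∈ Q := by
      simp only [Q, Set.mem_univ_pi, Set.mem_Icc, Pi.neg_apply]
      constructor <;> intro h i <;> constructor <;> linarith [(h i).1, (h i).2]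
    by_cases hy : y ∈ Q
    · simp only [g, Set.indicator_of_mem hy, Set.indicator_of_mem (this.2 hy), dotProduct_neg]
    · simp only [g, Set.indicator_of_notMem hy, Set.indicator_of_notMem (mt this.1 hy), neg_zero]
  simp only [h2, integral_neg] at h1
  linarith

namespace IsWhitening

variable {B : Matrix (Fin n) (Fin n) ℝ} {γ : Fin n → ℝ}

/-- An upper bound for the normalized density at the barycenter in terms of an inscribed cube. -/
theorem logDens_add_le (hK : IsBody K) (hG : G.PosDef) (h : IsWhitening K G θ B γ) {c : ℝ}
    (hc : 0 < c)
    (hcube : ∀ y : Fin n → ℝ, (∀ k, |y k| ≤ c) → B *ᵥ y + meanVec K G θ ∈ K) :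
    logDens K G θ + 1 / 2 * Real.log (covMat K G θ).det ≤
      n * (1 / 2 * c ^ 2 - Real.log (2 * c)) := by
  have hw := h.isWhitened hK hG
  set a := meanVec K G θ with ha
  set Q : Set (Fin n → ℝ) := Set.pi Set.univ (fun _ : Fin n => Set.Icc (-c) c) with hQd
  have hQ : MeasurableSet Q := MeasurableSet.univ_pi fun _ => measurableSet_Icc
  have hQc : IsCompact Q := isCompact_univ_pi fun _ => isCompact_Icc
  have hmemQ : ∀ y ∈ Q, ∀ k, |y k| ≤ c := fun y hy k => abs_le.2 (hy k (Set.mem_univ k))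
  set L : (Fin n → ℝ) →L[ℝ] (Fin n → ℝ) := LinearMap.toContinuousLinearMap (toLin' B) with hL
  have hLdet : L.det = B.det := by
    rw [hL, LinearMap.det_toContinuousLinearMap, LinearMap.det_toLin']
  set F : (Fin n → ℝ) → (Fin n → ℝ) := fun y => B *ᵥ y + a with hF
  have hFd : ∀ y, HasFDerivAt F L y := fun y => by
    have : F = fun y => L y + a := by ext y; simp [hF, hL]
    rw [this]
    exact L.hasFDerivAt.add_const a
  have hinj : Function.Injective F := fun x y hxy => by
    have h1 : B *ᵥ x = B *ᵥ y := add_right_cancel hxy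
    have := congrArg (B⁻¹ *ᵥ ·) h1
    simpa [mulVec_mulVec, nonsing_inv_mul _ h.isUnit_det] using this
  set τ := Bᵀ *ᵥ (θ - G *ᵥ a) with hτ
  have hsub : F '' Q ⊆ K := by
    rintro _ ⟨y, hy, rfl⟩
    exact hcube y (hmemQ y hy)
  have h1 : ∫ x in F '' Q, Real.exp (quadPot G θ x) ≤ partFn K G θ :=
    setIntegral_mono_set hK.integrable_exp (.of_forall fun x => (Real.exp_pos _).le)
      (LE.le.eventuallyLE hsub)
  rw [integral_image_eq_integral_abs_det_fderiv_smul volume hQ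
    (fun y _ => (hFd y).hasFDerivWithinAt) hinj.injOn] at h1
  have hpot : ∀ y, quadPot G θ (F y) = quadPot (diagonal γ) τ y + quadPot G θ a := fun y => by
    rw [hF, quadPot_affine (isHermitian_iff_isSymm.1 hG.1), h.diag]
  have hcQ : Continuous fun y => |B.det| * (Real.exp (quadPot (diagonal γ) τ y) *
      Real.exp (quadPot G θ a)) := by fun_prop
  have hlow : |B.det| * Real.exp (quadPot G θ a) * Real.exp (-(n * (1 / 2 * c ^ 2))) * (2 * c) ^ n ≤
      ∫ y in Q, |L.det| • Real.exp (quadPot G θ (F y)) := by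
    have e1 : ∫ y in Q, (1 + τ ⬝ᵥ y) = (2 * c) ^ n := by
      have i1 : Integrable (fun y => τ ⬝ᵥ y) (volume.restrict Q) := by
        have : Continuous fun y : Fin n → ℝ => τ ⬝ᵥ y := by fun_prop
        exact this.continuousOn.integrableOn_compact hQc
      have i0 : Integrable (fun _ : Fin n → ℝ => (1 : ℝ)) (volume.restrict Q) :=
        continuous_const.continuousOn.integrableOn_compact hQc
      rw [integral_add i0 i1, integral_cube_dotProduct]
      simp only [integral_const, smul_eq_mul, mul_one, add_zero, measureReal_restrict_apply_univ]
      rw [measureReal_def, hQd, volume_pi_pi]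
      simp only [Real.volume_Icc, ENNReal.toReal_prod]
      rw [Finset.prod_const, Finset.card_univ, Fintype.card_fin,
        ENNReal.toReal_ofReal (by linarith)]
      ring
    rw [← e1, ← integral_const_mul]
    refine setIntegral_mono_on ?_ ?_ hQ fun y hy => ?_
    · have : Continuous fun y : Fin n → ℝ => |B.det| * Real.exp (quadPot G θ a) *
          Real.exp (-(n * (1 / 2 * c ^ 2))) * (1 + τ ⬝ᵥ y) := by fun_prop
      exact this.continuousOn.integrableOn_compact hQc
    · simp only [hpot, Real.exp_add, smul_eq_mul, hLdet]
      exact hcQ.continuousOn.integrableOn_compact hQc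
    · simp only [hpot, Real.exp_add, smul_eq_mul, hLdet]
      have e2 : Real.exp (-(n * (1 / 2 * c ^ 2))) * (1 + τ ⬝ᵥ y) ≤
          Real.exp (quadPot (diagonal γ) τ y) := by
        have e3 : τ ⬝ᵥ y - n * (1 / 2 * c ^ 2) ≤ quadPot (diagonal γ) τ y := by
          rw [quadPot]
          have : y ⬝ᵥ diagonal γ *ᵥ y ≤ n * c ^ 2 := by
            simp only [dotProduct, mulVec_diagonal]
            refine (Finset.sum_le_sum fun k _ => ?_ : _ ≤ ∑ _k : Fin n, c ^ 2).trans (by simp)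
            have h4 : y k ^ 2 ≤ c ^ 2 := sq_le_sq' (abs_le.1 (hmemQ y hy k)).1
              (abs_le.1 (hmemQ y hy k)).2
            have h5 := mul_le_mul_of_nonneg_right (hw.le_one k) (sq_nonneg (y k))
            linarith
          linarith
        refine le_trans ?_ (Real.exp_le_exp.2 e3)
        rw [sub_eq_add_neg, Real.exp_add, mul_comm]
        exact mul_le_mul_of_nonneg_right (by linarith [Real.add_one_le_exp (τ ⬝ᵥ y)])
          (Real.exp_pos _).le
      have e4 : 0 ≤ |B.det| * Real.exp (quadPot G θ a) := by positivity
      nlinarith [mul_le_mul_of_nonneg_left e2 e4]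
  have hBp : 0 < |B.det| := abs_pos.2 h.isUnit_det.ne_zero
  have h2 := Real.log_le_log (by positivity) (hlow.trans h1)
  rw [Real.log_mul (by positivity) (by positivity), Real.log_mul (by positivity) (by positivity),
    Real.log_mul (by positivity) (by positivity), Real.log_exp, Real.log_exp, Real.log_pow] at h2
  have h3 : Real.log (covMat K G θ).det = 2 * Real.log |B.det| := by
    rw [← h.mul_transpose, det_mul, det_transpose, Real.log_mul h.isUnit_det.ne_zero
      h.isUnit_det.ne_zero, Real.log_abs]
    ring
  rw [h3, logDens, ← ha]
  linarith

/-- The support function of the whitened body is bounded below. -/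
theorem le_of_dotProduct_le (hK : IsBody K) (hG : G.PosDef) (h : IsWhitening K G θ B γ) {r : ℝ}
    {w : Fin n → ℝ} (hw1 : w ⬝ᵥ w = 1)
    (hr : ∀ x ∈ K, w ⬝ᵥ (B⁻¹ *ᵥ (x - meanVec K G θ)) ≤ r) : 0 ≤ r ∧ 1 ≤ 7 * r ^ 2 := by
  have hw := h.isWhitened hK hG
  have hp := hw.isProbabilityMeasure
  set a := meanVec K G θ with ha
  set v : Fin n → ℝ := -(B⁻¹ᵀ *ᵥ w) with hv
  have hid : ∀ x, (r + w ⬝ᵥ (B⁻¹ *ᵥ a)) + v ⬝ᵥ x = r - w ⬝ᵥ (B⁻¹ *ᵥ (x - a)) := fun x => by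
    rw [hv, neg_dotProduct, mulVec_transpose, ← dotProduct_mulVec, mulVec_sub, dotProduct_sub]
    ring
  have key := hK.integral_sq_le_of_nonneg (θ := θ) hG.posSemidef (r + w ⬝ᵥ (B⁻¹ *ᵥ a)) v
    fun x hx => by rw [hid]; linarith [hr x hx]
  simp only [hid] at key
  rw [← integral_whitenedLaw (f := fun y => (r - w ⬝ᵥ y) ^ 2) (by fun_prop),
    ← integral_whitenedLaw (f := fun y => r - w ⬝ᵥ y) (by fun_prop)] at key
  have i1 : Integrable (fun y => w ⬝ᵥ y) (whitenedLaw K G θ B) := hw.integrable (by fun_prop)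
  have i2 : Integrable (fun y => (w ⬝ᵥ y) ^ 2) (whitenedLaw K G θ B) := hw.integrable (by fun_prop)
  have e1 : ∫ y, w ⬝ᵥ y ∂(whitenedLaw K G θ B) = 0 := by
    simp only [dotProduct]
    rw [integral_finsetSum _ fun k _ => hw.integrable (by fun_prop)]
    simp [integral_const_mul, hw.mean]
  have e2 : ∫ y, (w ⬝ᵥ y) ^ 2 ∂(whitenedLaw K G θ B) = 1 := by
    have : ∀ y : Fin n → ℝ, (w ⬝ᵥ y) ^ 2 = ∑ i, ∑ j, w i * w j * (y i * y j) := fun x => by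
      simp only [sq, dotProduct, Finset.sum_mul_sum]
      exact Finset.sum_congr rfl fun i _ => Finset.sum_congr rfl fun j _ => by ring
    simp only [this]
    rw [integral_finsetSum _ fun k _ => hw.integrable (by fun_prop)]
    rw [← hw1, dotProduct]
    refine Finset.sum_congr rfl fun i _ => ?_
    rw [integral_finsetSum _ fun k _ => hw.integrable (by fun_prop)]
    simp [integral_const_mul, hw.cov]
  have e3 : ∫ y, (r - w ⬝ᵥ y) ∂(whitenedLaw K G θ B) = r := by
    rw [integral_sub (integrable_const _) i1, e1]; simp
  have e4 : ∫ y, (r - w ⬝ᵥ y) ^ 2 ∂(whitenedLaw K G θ B) = r ^ 2 + 1 := by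
    have : ∀ y : Fin n → ℝ, (r - w ⬝ᵥ y) ^ 2 = (r ^ 2 - 2 * r * (w ⬝ᵥ y)) + (w ⬝ᵥ y) ^ 2 :=
      fun y => by ring
    simp only [this]
    have i3 : Integrable (fun y => r ^ 2 - 2 * r * (w ⬝ᵥ y)) (whitenedLaw K G θ B) :=
      hw.integrable (by fun_prop)
    rw [integral_add i3 i2, integral_sub (integrable_const _) (i1.const_mul _), integral_const_mul,
      e1, e2]
    simp
  rw [e3, e4] at key
  refine ⟨?_, by linarith⟩
  rw [← e3, integral_whitenedLaw (f := fun y => r - w ⬝ᵥ y) (by fun_prop)]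
  refine integral_nonneg_of_ae ?_
  filter_upwards [hK.ae_mem G θ] with x hx using sub_nonneg.2 (hr x hx)

theorem mem_of_abs_le (hK : IsBody K) (h : IsWhitening K G θ B γ) {c : ℝ}
    (hc : ∀ r : ℝ, ∀ w : Fin n → ℝ, w ⬝ᵥ w = 1 →
      (∀ x ∈ K, w ⬝ᵥ (B⁻¹ *ᵥ (x - meanVec K G θ)) ≤ r) → n * c ^ 2 < r ^ 2)
    (y : Fin n → ℝ) (hy : ∀ k, |y k| ≤ c) : B *ᵥ y + meanVec K G θ ∈ K := by
  by_contra h0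
  obtain ⟨w, hw1, hw⟩ := hK.exists_unit_normal h.isUnit_det _ y h0
  have h1 := hc _ w hw1 hw
  have h2 : (w ⬝ᵥ y) ^ 2 ≤ (w ⬝ᵥ w) * (y ⬝ᵥ y) := by
    simp only [dotProduct, ← sq]
    exact Finset.sum_mul_sq_le_sq_mul_sq _ _ _
  have h3 : y ⬝ᵥ y ≤ n * c ^ 2 := by
    simp only [dotProduct]
    refine (Finset.sum_le_sum fun k _ => ?_ : _ ≤ ∑ _k : Fin n, c ^ 2).trans (by simp)
    rw [← sq]
    exact sq_le_sq' (abs_le.1 (hy k)).1 (abs_le.1 (hy k)).2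
  rw [hw1, one_mul] at h2
  linarith

/-- A bound depending only on the dimension for the normalized density at the barycenter. -/
theorem logDens_add_le_dim (hK : IsBody K) (hG : G.PosDef) (h : IsWhitening K G θ B γ)
    (hn : 1 ≤ n) : logDens K G θ + 1 / 2 * Real.log (covMat K G θ).det ≤
      n * (1 / 2 * (1 / (3 * √n)) ^ 2 - Real.log (2 * (1 / (3 * √n)))) := by
  have hn' : (0 : ℝ) < n := by exact_mod_cast hn
  have hs := Real.sqrt_pos.2 hn'
  refine h.logDens_add_le hK hG (by positivity) (h.mem_of_abs_le hK fun r w hw1 hr => ?_)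
  have h1 := (h.le_of_dotProduct_le hK hG hw1 hr).2
  have h2 : n * (1 / (3 * √n)) ^ 2 = (1 / 9 : ℝ) := by
    rw [div_pow, mul_pow, Real.sq_sqrt hn'.le]; field_simp; norm_num
  rw [h2]; linarith

end IsWhitening

end Inradius

end

section Maximizer

open Matrix

variable {n : ℕ} {K : Set (Fin n → ℝ)} {G : Matrix (Fin n) (Fin n) ℝ} {θ : Fin n → ℝ}

namespace IsBody

theorem continuous_integral_exp (hK : IsBody K) {f : (Fin n → ℝ) → ℝ} (hf : Continuous f) :
    Continuous fun p : Matrix (Fin n) (Fin n) ℝ × (Fin n → ℝ) =>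
      ∫ x in K, Real.exp (quadPot p.1 p.2 x) * f x := by
  have : FirstCountableTopology (Matrix (Fin n) (Fin n) ℝ) :=
    inferInstanceAs (FirstCountableTopology (Fin n → Fin n → ℝ))
  have : LocallyCompactSpace (Matrix (Fin n) (Fin n) ℝ) :=
    inferInstanceAs (LocallyCompactSpace (Fin n → Fin n → ℝ))
  refine continuous_parametric_integral_of_continuous
    (f := fun (p : Matrix (Fin n) (Fin n) ℝ × (Fin n → ℝ)) x =>
      Real.exp (quadPot p.1 p.2 x) * f x) ?_ hK.isCompact
  have h1 : Continuous fun q : (Matrix (Fin n) (Fin n) ℝ × (Fin n → ℝ)) × (Fin n → ℝ) =>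
      quadPot q.1.1 q.1.2 q.2 := by fun_prop
  exact (Real.continuous_exp.comp h1).mul (hf.comp continuous_snd)

theorem continuous_partFn (hK : IsBody K) :
    Continuous fun p : Matrix (Fin n) (Fin n) ℝ × (Fin n → ℝ) => partFn K p.1 p.2 := by
  simpa [partFn] using hK.continuous_integral_exp (f := fun _ => 1) continuous_const

theorem integral_quadTilt (f : (Fin n → ℝ) → ℝ) :
    ∫ x, f x ∂(quadTilt K G θ) = (∫ x in K, Real.exp (quadPot G θ x) * f x) / partFn K G θ := by
  rw [quadTilt, integral_tilted, partFn, ← integral_div]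
  refine integral_congr_ae (.of_forall fun x => ?_)
  simp only [smul_eq_mul]
  ring

theorem continuous_integral_quadTilt (hK : IsBody K) {f : (Fin n → ℝ) → ℝ} (hf : Continuous f) :
    Continuous fun p : Matrix (Fin n) (Fin n) ℝ × (Fin n → ℝ) =>
      ∫ x, f x ∂(quadTilt K p.1 p.2) := by
  simp only [integral_quadTilt]
  exact (hK.continuous_integral_exp hf).div hK.continuous_partFn fun p => hK.partFn_pos.ne'

theorem continuous_meanVec (hK : IsBody K) :
    Continuous fun p : Matrix (Fin n) (Fin n) ℝ × (Fin n → ℝ) => meanVec K p.1 p.2 :=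
  continuous_pi fun i => hK.continuous_integral_quadTilt (continuous_apply i)

theorem continuous_covMat (hK : IsBody K) :
    Continuous fun p : Matrix (Fin n) (Fin n) ℝ × (Fin n → ℝ) => covMat K p.1 p.2 := by
  refine continuous_matrix fun i j => ?_
  simp only [covMat, of_apply]
  exact (hK.continuous_integral_quadTilt (f := fun x => x i * x j) (by fun_prop)).sub
    (((continuous_apply i).comp hK.continuous_meanVec).mul
      ((continuous_apply j).comp hK.continuous_meanVec))

theorem continuous_log_det_covMat (hK : IsBody K) :
    Continuous fun p : Matrix (Fin n) (Fin n) ℝ × (Fin n → ℝ) =>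
      Real.log (covMat K p.1 p.2).det :=
  hK.continuous_covMat.matrix_det.log fun _ => hK.covMat_posDef.det_pos.ne'

theorem continuous_logDens (hK : IsBody K) :
    Continuous fun p : Matrix (Fin n) (Fin n) ℝ × (Fin n → ℝ) => logDens K p.1 p.2 := by
  unfold logDens
  exact (continuous_quadPot continuous_fst continuous_snd hK.continuous_meanVec).sub
    (hK.continuous_partFn.log fun _ => hK.partFn_pos.ne')

theorem continuousOn_matrix_inv {S : Set (Matrix (Fin n) (Fin n) ℝ)} (hS : ∀ A ∈ S, A.det ≠ 0) :
    ContinuousOn (fun A : Matrix (Fin n) (Fin n) ℝ => A⁻¹) S := by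
  have : ∀ A : Matrix (Fin n) (Fin n) ℝ, A⁻¹ = A.det⁻¹ • A.adjugate := fun A => by
    rw [inv_def, Ring.inverse_eq_inv']
  simp only [this]
  exact (continuous_id.matrix_det.continuousOn.inv₀ hS).smul
    continuous_id.matrix_adjugate.continuousOn

theorem invTrace_pos (hK : IsBody K) (hG : G.PosDef) (hn : 1 ≤ n) : 0 < invTrace K G θ := by
  obtain ⟨B, γ, h⟩ := hK.exists_isWhitening (θ := θ) hG
  rw [h.invTrace_eq]
  exact Finset.sum_pos (fun k _ => inv_pos.2 (h.pos k)) ⟨⟨0, hn⟩, Finset.mem_univ _⟩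

theorem continuousOn_tiltFunctional (hK : IsBody K) (hn : 1 ≤ n) (c₁ c₂ κ : ℝ) :
    ContinuousOn (fun p : Matrix (Fin n) (Fin n) ℝ × (Fin n → ℝ) =>
      tiltFunctional c₁ c₂ κ K p.1 p.2) {p | p.1.PosDef} := by
  unfold tiltFunctional
  have h1 : ContinuousOn (fun p : Matrix (Fin n) (Fin n) ℝ × (Fin n → ℝ) => Real.log p.1.det)
      {p | p.1.PosDef} :=
    continuous_fst.matrix_det.continuousOn.log fun p hp => hp.det_pos.ne'
  have h2 : ContinuousOn (fun p : Matrix (Fin n) (Fin n) ℝ × (Fin n → ℝ) => invTrace K p.1 p.2)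
      {p | p.1.PosDef} := by
    unfold invTrace
    have i1 : ContinuousOn (fun p : Matrix (Fin n) (Fin n) ℝ × (Fin n → ℝ) => p.1⁻¹)
        {p | p.1.PosDef} :=
      (continuousOn_matrix_inv (S := {A | A.PosDef}) fun A hA => hA.det_pos.ne').comp
        continuous_fst.continuousOn fun p hp => hp
    have i2 : ContinuousOn (fun p : Matrix (Fin n) (Fin n) ℝ × (Fin n → ℝ) =>
        (covMat K p.1 p.2)⁻¹) {p | p.1.PosDef} :=
      (continuousOn_matrix_inv (S := {A | A.PosDef}) fun A hA => hA.det_pos.ne').comp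
        hK.continuous_covMat.continuousOn fun p _ => hK.covMat_posDef
    exact (continuous_id.matrix_trace (R := ℝ)).comp_continuousOn (i1.mul i2)
  refine ((hK.continuous_logDens.continuousOn.add
    (hK.continuous_log_det_covMat.continuousOn.const_smul c₁)).add
    (h1.const_smul c₂)).add ?_
  exact ((h2.sqrt).inv₀ fun p hp => (Real.sqrt_pos.2 (hK.invTrace_pos hp hn)).ne').const_smul κ

theorem isCompact_matrix_box (R : ℝ) :
    IsCompact {A : Matrix (Fin n) (Fin n) ℝ | ∀ i j, |A i j| ≤ R} := by
  have : IsCompact (Set.univ.pi fun _ : Fin n => Set.univ.pi fun _ : Fin n => Set.Icc (-R) R) :=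
    isCompact_univ_pi fun _ => isCompact_univ_pi fun _ => isCompact_Icc
  have e : {A : Fin n → Fin n → ℝ | ∀ i j, |A i j| ≤ R} =
      Set.univ.pi fun _ : Fin n => Set.univ.pi fun _ : Fin n => Set.Icc (-R) R := by
    ext A
    simp only [abs_le, Set.mem_ofPred_eq, Set.mem_univ_pi, Set.mem_Icc]
  rw [← e] at this
  exact this

theorem exists_abs_covMat_le (hK : IsBody K) :
    ∃ R : ℝ, ∀ G θ i j, |covMat K G θ i j| ≤ R := by
  have h1 : ∃ R : ℝ, ∀ x ∈ K, ∀ i, |x i| ≤ R := by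
    obtain ⟨R, hR⟩ := hK.isCompact.isBounded.exists_norm_le
    exact ⟨R, fun x hx i => (norm_le_pi_norm x i).trans (hR x hx)⟩
  obtain ⟨R, hR⟩ := h1
  have hR0 : ∀ G θ, ∀ i j, |∫ x, x i * x j ∂(quadTilt K G θ)| ≤ R ^ 2 := fun G θ i j => by
    have := hK.isProbabilityMeasure G θ
    have h := norm_integral_le_of_norm_le_const (μ := quadTilt K G θ) (f := fun x => x i * x j)
      (C := R ^ 2) (by
        filter_upwards [hK.ae_mem G θ] with x hx
        rw [Real.norm_eq_abs, abs_mul, sq]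
        exact mul_le_mul (hR x hx i) (hR x hx j) (abs_nonneg _)
          ((abs_nonneg _).trans (hR x hx i)))
    simpa using h
  have hR1 : ∀ G θ, ∀ i, |meanVec K G θ i| ≤ R := fun G θ i => by
    have := hK.isProbabilityMeasure G θ
    have h := norm_integral_le_of_norm_le_const (μ := quadTilt K G θ) (f := fun x => x i)
      (C := R) (by filter_upwards [hK.ae_mem G θ] with x hx using hR x hx i)
    simpa [meanVec] using h
  refine ⟨R ^ 2 + R * R, fun G θ i j => ?_⟩
  simp only [covMat, of_apply]
  refine (abs_sub _ _).trans (add_le_add (hR0 G θ i j) ?_)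
  rw [abs_mul]
  exact mul_le_mul (hR1 G θ i) (hR1 G θ j) (abs_nonneg _) ((abs_nonneg _).trans (hR1 G θ i))

theorem exists_log_det_covMat_le (hK : IsBody K) :
    ∃ C : ℝ, ∀ G θ, Real.log (covMat K G θ).det ≤ C := by
  obtain ⟨R, hR⟩ := hK.exists_abs_covMat_le
  obtain ⟨C, hC⟩ := (isCompact_matrix_box (n := n) R).exists_bound_of_continuousOn
    (f := fun A : Matrix (Fin n) (Fin n) ℝ => A.det) continuous_id.matrix_det.continuousOn
  refine ⟨C, fun G θ => ?_⟩
  have h1 := (abs_le.1 (hC _ (hR G θ))).2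
  have h2 := Real.log_le_sub_one_of_pos (hK.covMat_posDef (G := G) (θ := θ)).det_pos
  linarith

/-- A lower bound for the determinant of the covariance bounds the parameters of the tilt. -/
theorem exists_bound_of_le_det (hK : IsBody K) {δ : ℝ} (hδ : 0 < δ) :
    ∃ R : ℝ, ∀ G θ, G.PosDef → δ ≤ (covMat K G θ).det →
      (∀ i j, |G i j| ≤ R) ∧ ∀ i, |θ i| ≤ R := by
  obtain ⟨R, hR⟩ := hK.exists_abs_covMat_le
  obtain ⟨C₀, hC₀⟩ := (isCompact_matrix_box (n := n) R).exists_bound_of_continuousOn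
    (f := fun A : Matrix (Fin n) (Fin n) ℝ => (fun i j => A.adjugate i j : Fin n → Fin n → ℝ))
    (Continuous.continuousOn (by
      exact continuous_pi fun i => continuous_pi fun j =>
        continuous_id.matrix_adjugate.matrix_elem i j))
  set C := max C₀ 0 / δ with hCd
  have hC0 : 0 ≤ C := by positivity
  have hinv : ∀ G θ, δ ≤ (covMat K G θ).det → ∀ i, (covMat K G θ)⁻¹ i i ≤ C := fun G θ hd i => by
    have h1 : (covMat K G θ).adjugate i i ≤ C₀ :=
      (le_abs_self _).trans ((norm_le_pi_norm _ i).trans ((norm_le_pi_norm _ i).trans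
        (hC₀ _ (hR G θ))))
    rw [inv_def, Ring.inverse_eq_inv', Matrix.smul_apply, smul_eq_mul, hCd, inv_mul_eq_div]
    exact div_le_div₀ (le_max_right _ _) (h1.trans (le_max_left _ _)) hδ hd
  obtain ⟨M, hM⟩ := ((isCompact_matrix_box (n := n) C).prod hK.isCompact).exists_bound_of_continuousOn
    (f := fun p : Matrix (Fin n) (Fin n) ℝ × (Fin n → ℝ) => quadPot p.1 0 p.2)
    (Continuous.continuousOn (by fun_prop))
  refine ⟨max C (C * (2 * n + 2 * M ^ 2) + 1), fun G θ hG hd => ?_⟩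
  obtain ⟨B, γ, h⟩ := hK.exists_isWhitening (θ := θ) hG
  have hw := h.isWhitened hK hG
  have hAi : ∀ i, ∑ k, B⁻¹ k i ^ 2 ≤ C := fun i => by
    refine le_trans (le_of_eq ?_) (hinv G θ hd i)
    rw [← h.mul_transpose, Matrix.mul_inv_rev, ← transpose_nonsing_inv, mul_apply]
    exact Finset.sum_congr rfl fun k _ => by rw [transpose_apply, sq]
  have hGij : ∀ i j, G i j = ∑ k, γ k * (B⁻¹ k i * B⁻¹ k j) := fun i j => by
    conv_lhs => rw [h.G_eq]
    rw [mul_apply]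
    refine Finset.sum_congr rfl fun k _ => ?_
    rw [mul_diagonal, transpose_apply]
    ring
  have hGb : ∀ i j, |G i j| ≤ C := fun i j => by
    rw [hGij]
    calc |∑ k, γ k * (B⁻¹ k i * B⁻¹ k j)| ≤ ∑ k, |γ k * (B⁻¹ k i * B⁻¹ k j)| :=
          Finset.abs_sum_le_sum_abs _ _
      _ ≤ ∑ k, (B⁻¹ k i ^ 2 + B⁻¹ k j ^ 2) / 2 := Finset.sum_le_sum fun k _ => by
          rw [abs_mul, abs_of_pos (h.pos k)]
          have h1 : |B⁻¹ k i * B⁻¹ k j| ≤ (B⁻¹ k i ^ 2 + B⁻¹ k j ^ 2) / 2 := by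
            rw [abs_le]; constructor <;> nlinarith [sq_nonneg (B⁻¹ k i + B⁻¹ k j),
              sq_nonneg (B⁻¹ k i - B⁻¹ k j)]
          have := mul_le_mul (hw.le_one k) h1 (abs_nonneg _) zero_le_one
          linarith
      _ = (∑ k, B⁻¹ k i ^ 2 + ∑ k, B⁻¹ k j ^ 2) / 2 := by
          rw [← Finset.sum_add_distrib, Finset.sum_div]
      _ ≤ C := by linarith [hAi i, hAi j]
  have hvar : θ ⬝ᵥ covMat K G θ *ᵥ θ ≤ 2 * n + 2 * M ^ 2 := by
    have := hK.isProbabilityMeasure G θ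
    have hv := hK.variance_quadPot_le (θ := θ) hG.posSemidef
    set ν := quadTilt K G θ with hν
    have e0 := hK.integral_dotProduct_mul (G := G) (θ := θ) θ θ
    have e1 := hK.integral_dotProduct (G := G) (θ := θ) θ
    set P : (Fin n → ℝ) → ℝ := fun x => quadPot G θ x with hP
    set q : (Fin n → ℝ) → ℝ := fun x => quadPot G 0 x with hq
    have hPc : Continuous P := by fun_prop
    have hqc : Continuous q := by fun_prop
    have ex : ∀ x, θ ⬝ᵥ x = P x - q x := fun x => by simp [hP, hq, quadPot]
    simp only [ex] at e0 e1
    have iP : Integrable (fun x => P x) ν := hK.integrable hPc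
    have iq : Integrable (fun x => q x) ν := hK.integrable hqc
    have iP2 : Integrable (fun x => P x ^ 2) ν := hK.integrable (hPc.pow 2)
    have iq2 : Integrable (fun x => q x ^ 2) ν := hK.integrable (hqc.pow 2)
    have im : Integrable (fun x => (P x - q x) * (P x - q x)) ν :=
      hK.integrable ((hPc.sub hqc).mul (hPc.sub hqc))
    rw [integral_sub iP iq] at e1
    set a := ∫ x, P x ∂ν
    set b := ∫ x, q x ∂ν
    have hqM : ∫ x, q x ^ 2 ∂ν ≤ M ^ 2 := by
      have h1 : ∫ x, q x ^ 2 ∂ν ≤ ∫ _x, M ^ 2 ∂ν := integral_mono_ae iq2 (integrable_const _) (by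
        filter_upwards [hK.ae_mem G θ] with x hx
        exact sq_le_sq' (abs_le.1 (hM (G, x) ⟨hGb, hx⟩)).1 (abs_le.1 (hM (G, x) ⟨hGb, hx⟩)).2)
      simpa using h1
    have hmain : (∫ x, (P x - q x) * (P x - q x) ∂ν) - (a - b) ^ 2 ≤
        2 * ((∫ x, P x ^ 2 ∂ν) - a ^ 2) + 2 * ((∫ x, q x ^ 2 ∂ν) - b ^ 2) := by
      have h0 : 0 ≤ ∫ x, ((P x - a) + (q x - b)) ^ 2 ∂ν := integral_nonneg fun x => sq_nonneg _
      have e : ∀ x, ((P x - a) + (q x - b)) ^ 2 = 2 * P x ^ 2 + 2 * q x ^ 2 -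
          (P x - q x) * (P x - q x) - 2 * (a + b) * P x - 2 * (a + b) * q x + (a + b) ^ 2 :=
        fun x => by ring
      simp only [e] at h0
      have j1 : Integrable (fun x => 2 * P x ^ 2 + 2 * q x ^ 2) ν :=
        (iP2.const_mul 2).add (iq2.const_mul 2)
      have j2 : Integrable (fun x => 2 * P x ^ 2 + 2 * q x ^ 2 - (P x - q x) * (P x - q x)) ν :=
        j1.sub im
      have j3 : Integrable (fun x => 2 * P x ^ 2 + 2 * q x ^ 2 - (P x - q x) * (P x - q x) -
          2 * (a + b) * P x) ν := j2.sub (iP.const_mul _)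
      have j4 : Integrable (fun x => 2 * P x ^ 2 + 2 * q x ^ 2 - (P x - q x) * (P x - q x) -
          2 * (a + b) * P x - 2 * (a + b) * q x) ν := j3.sub (iq.const_mul _)
      rw [integral_add j4 (integrable_const _), integral_sub j3 (iq.const_mul _),
        integral_sub j2 (iP.const_mul _), integral_sub j1 im,
        integral_add (iP2.const_mul 2) (iq2.const_mul 2)] at h0
      simp only [integral_const_mul, integral_const, probReal_univ, one_smul] at h0
      nlinarith
    rw [e0, e1, ← ex] at hmain
    have hv' : (∫ x, P x ^ 2 ∂ν) - a ^ 2 ≤ n := hv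
    nlinarith [sq_nonneg b]
  refine ⟨fun i j => (hGb i j).trans (le_max_left _ _), fun i => le_trans ?_ (le_max_right _ _)⟩
  have hθ : θ i = ∑ k, B⁻¹ k i * (Bᵀ *ᵥ θ) k := by
    have h1 : B⁻¹ᵀ *ᵥ (Bᵀ *ᵥ θ) = θ := by
      rw [mulVec_mulVec, ← transpose_mul, mul_nonsing_inv _ h.isUnit_det, transpose_one,
        one_mulVec]
    conv_lhs => rw [← h1]
    rfl
  have hy : ∑ k, (Bᵀ *ᵥ θ) k ^ 2 = θ ⬝ᵥ covMat K G θ *ᵥ θ := by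
    rw [← h.mul_transpose, ← mulVec_mulVec, dotProduct_mulVec, ← mulVec_transpose]
    simp only [dotProduct, sq]
  have h2 : θ i ^ 2 ≤ C * (2 * n + 2 * M ^ 2) := by
    rw [hθ]
    refine (Finset.sum_mul_sq_le_sq_mul_sq _ _ _).trans ?_
    rw [hy]
    refine mul_le_mul (hAi i) hvar ?_ hC0
    rw [← hy]; positivity
  refine abs_le_of_sq_le_sq (h2.trans ?_) (by positivity)
  have : 0 ≤ C * (2 * n + 2 * M ^ 2) := by positivity
  nlinarith

end IsBody

theorem IsWhitening.log_det_add {B : Matrix (Fin n) (Fin n) ℝ} {γ : Fin n → ℝ}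
    (h : IsWhitening K G θ B γ) :
    Real.log (covMat K G θ).det + Real.log G.det = ∑ k, Real.log (γ k) := by
  have h1 : (covMat K G θ).det * G.det = ∏ k, γ k := by
    rw [← h.mul_transpose, ← det_diagonal, ← h.diag]
    simp only [det_mul]
    ring
  have h2 : ∏ k, γ k ≠ 0 := Finset.prod_ne_zero_iff.2 fun k _ => (h.pos k).ne'
  rw [← h1] at h2
  rw [← Real.log_mul (left_ne_zero_of_mul h2) (right_ne_zero_of_mul h2), h1,
    Real.log_prod fun k _ => (h.pos k).ne']

theorem posDef_of_sub_smul_one {ε : ℝ} (hε : 0 < ε)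
    (h : (G - ε • (1 : Matrix (Fin n) (Fin n) ℝ)).PosSemidef) : G.PosDef := by
  have := (PosDef.one.smul hε : (ε • (1 : Matrix (Fin n) (Fin n) ℝ)).PosDef).add_posSemidef h
  simpa using this

theorem isClosed_posSemidef_sub (ε : ℝ) : IsClosed {p : Matrix (Fin n) (Fin n) ℝ × (Fin n → ℝ) |
    (p.1 - ε • (1 : Matrix (Fin n) (Fin n) ℝ)).PosSemidef} := by
  have : {p : Matrix (Fin n) (Fin n) ℝ × (Fin n → ℝ) |
      (p.1 - ε • (1 : Matrix (Fin n) (Fin n) ℝ)).PosSemidef} =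
      {p | (p.1 - ε • (1 : Matrix (Fin n) (Fin n) ℝ))ᵀ = p.1 - ε • 1} ∩
        ⋂ x : Fin n → ℝ, {p | 0 ≤ x ⬝ᵥ (p.1 - ε • (1 : Matrix (Fin n) (Fin n) ℝ)) *ᵥ x} := by
    ext p
    simp only [Set.mem_ofPred_eq, Set.mem_inter_iff, Set.mem_iInter]
    constructor
    · exact fun h => ⟨isHermitian_iff_isSymm.1 h.1, fun x => by
        simpa using h.dotProduct_mulVec_nonneg x⟩
    · exact fun h => PosSemidef.of_dotProduct_mulVec_nonneg (isHermitian_iff_isSymm.2 h.1)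
        fun x => by simpa using h.2 x
  rw [this]
  have hc : Continuous fun p : Matrix (Fin n) (Fin n) ℝ × (Fin n → ℝ) =>
      p.1 - ε • (1 : Matrix (Fin n) (Fin n) ℝ) := continuous_fst.sub continuous_const
  refine (isClosed_eq hc.matrix_transpose hc).inter (isClosed_iInter fun x => ?_)
  exact isClosed_le continuous_const (continuous_const.dotProduct
    (hc.matrix_mulVec continuous_const))

/-- The functional attains its maximum over tilts with precision at least `ε`. -/
theorem IsBody.exists_max (hK : IsBody K) (hn : 1 ≤ n) {ε c₂ κ η : ℝ} (hε : 0 < ε) (hc₂ : 0 ≤ c₂)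
    (hκ : 0 ≤ κ) (hη : 0 < η) :
    ∃ G θ, (G - ε • (1 : Matrix (Fin n) (Fin n) ℝ)).PosSemidef ∧
      ∀ G' θ', (G' - ε • (1 : Matrix (Fin n) (Fin n) ℝ)).PosSemidef →
        tiltFunctional (1 / 2 + c₂ + η) c₂ κ K G' θ' ≤
          tiltFunctional (1 / 2 + c₂ + η) c₂ κ K G θ := by
  set v := tiltFunctional (1 / 2 + c₂ + η) c₂ κ K (ε • (1 : Matrix (Fin n) (Fin n) ℝ)) 0 with hv
  set E : ℝ := n * (1 / 2 * (1 / (3 * √n)) ^ 2 - Real.log (2 * (1 / (3 * √n)))) with hE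
  have key : ∀ G θ, (G - ε • (1 : Matrix (Fin n) (Fin n) ℝ)).PosSemidef →
      tiltFunctional (1 / 2 + c₂ + η) c₂ κ K G θ ≤
        E + η * Real.log (covMat K G θ).det + κ := fun G θ hp => by
    have hG := posDef_of_sub_smul_one hε hp
    obtain ⟨B, γ, h⟩ := hK.exists_isWhitening (θ := θ) hG
    have hw := h.isWhitened hK hG
    have h1 := h.logDens_add_le_dim hK hG hn
    have h2 : Real.log (covMat K G θ).det + Real.log G.det ≤ 0 := by
      rw [h.log_det_add]
      exact Finset.sum_nonpos fun k _ => Real.log_nonpos (h.pos k).le (hw.le_one k)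
    have h3 : (√(invTrace K G θ))⁻¹ ≤ 1 := by
      refine inv_le_one_of_one_le₀ (Real.one_le_sqrt.2 ?_)
      rw [h.invTrace_eq]
      have : ∑ _k : Fin n, (1 : ℝ) ≤ ∑ k, (γ k)⁻¹ :=
        Finset.sum_le_sum fun k _ => (one_le_inv₀ (h.pos k)).2 (hw.le_one k)
      have hn' : (1 : ℝ) ≤ n := by exact_mod_cast hn
      simp only [Finset.sum_const, Finset.card_univ, Fintype.card_fin, nsmul_eq_mul,
        mul_one] at this
      linarith
    have h4 := mul_le_mul_of_nonneg_left h3 hκ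
    have h5 := mul_le_mul_of_nonneg_left h2 hc₂
    unfold tiltFunctional
    linarith
  obtain ⟨R, hR⟩ := hK.exists_bound_of_le_det (Real.exp_pos ((v - E - κ) / η))
  have hbox : ∀ G θ, (G - ε • (1 : Matrix (Fin n) (Fin n) ℝ)).PosSemidef →
      v ≤ tiltFunctional (1 / 2 + c₂ + η) c₂ κ K G θ →
      (∀ i j, |G i j| ≤ R) ∧ ∀ i, |θ i| ≤ R := fun G θ hp hge => by
    refine hR G θ (posDef_of_sub_smul_one hε hp) ?_
    rw [← Real.le_log_iff_exp_le hK.covMat_posDef.det_pos, div_le_iff₀ hη]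
    linarith [key G θ hp]
  set S : Set (Matrix (Fin n) (Fin n) ℝ × (Fin n → ℝ)) :=
    ({A | ∀ i j, |A i j| ≤ R} ×ˢ Set.univ.pi fun _ => Set.Icc (-R) R) ∩
      {p | (p.1 - ε • (1 : Matrix (Fin n) (Fin n) ℝ)).PosSemidef} with hS
  have hSc : IsCompact S := ((isCompact_matrix_box R).prod
    (isCompact_univ_pi fun _ => isCompact_Icc)).inter_right (isClosed_posSemidef_sub ε)
  have hmem : ∀ G θ, (G - ε • (1 : Matrix (Fin n) (Fin n) ℝ)).PosSemidef →
      v ≤ tiltFunctional (1 / 2 + c₂ + η) c₂ κ K G θ → (G, θ) ∈ S := fun G θ hp hge =>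
    ⟨⟨(hbox G θ hp hge).1, fun i _ => abs_le.1 ((hbox G θ hp hge).2 i)⟩, hp⟩
  have h0 : (ε • (1 : Matrix (Fin n) (Fin n) ℝ) - ε • 1).PosSemidef := by
    rw [sub_self]; exact PosSemidef.zero
  obtain ⟨⟨G, θ⟩, hp, hmax⟩ := hSc.exists_isMaxOn ⟨_, hmem _ _ h0 hv.le⟩
    ((hK.continuousOn_tiltFunctional hn (1 / 2 + c₂ + η) c₂ κ).mono fun p hp =>
      posDef_of_sub_smul_one hε hp.2)
  rw [isMaxOn_iff] at hmax
  have hge0 := hmax _ (hmem _ _ h0 hv.le)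
  refine ⟨G, θ, hp.2, fun G' θ' hp' => ?_⟩
  by_cases hge : v ≤ tiltFunctional (1 / 2 + c₂ + η) c₂ κ K G' θ'
  · exact hmax _ (hmem G' θ' hp' hge)
  · exact (not_le.1 hge).le.trans hge0

end Maximizer

section Chain

open Matrix

variable {n : ℕ} {K : Set (Fin n → ℝ)} {G : Matrix (Fin n) (Fin n) ℝ} {θ : Fin n → ℝ}

theorem exists_small_mul_le (B c : ℝ) (hB : 0 < B) : ∃ η : ℝ, 0 < η ∧ η ≤ B ∧ η * c ≤ 1 := by
  refine ⟨min B (1 / (|c| + 1)), by positivity, min_le_left _ _, ?_⟩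
  have h1 : min B (1 / (|c| + 1)) * (|c| + 1) ≤ 1 := by
    rw [← le_div_iff₀ (by positivity)]; exact min_le_right _ _
  have h2 : 0 < min B (1 / (|c| + 1)) := by positivity
  nlinarith [le_abs_self c]

/-- A tilt whose normalized density at the barycenter is not much smaller than that of a given
one, and for which the whitened precision is bounded below on average. -/
theorem IsBody.exists_sum_inv_le (hK : IsBody K) (hn : 1 ≤ n) {ε : ℝ} (hε : 0 < ε)
    {G₀ : Matrix (Fin n) (Fin n) ℝ} {θ₀ : Fin n → ℝ}
    (h₀ : (G₀ - ε • (1 : Matrix (Fin n) (Fin n) ℝ)).PosSemidef) :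
    ∃ G θ B γ, (G - ε • (1 : Matrix (Fin n) (Fin n) ℝ)).PosSemidef ∧ IsWhitening K G θ B γ ∧
      ∑ i, (γ i)⁻¹ ≤ 676 * n ∧
      logDens K G₀ θ₀ + 1 / 2 * Real.log (covMat K G₀ θ₀).det ≤
        logDens K G θ + 1 / 2 * Real.log (covMat K G θ).det + (16 * n + 1) := by
  obtain ⟨C, hC⟩ := hK.exists_log_det_covMat_le
  obtain ⟨η, hη0, hη1, hη2⟩ := exists_small_mul_le (1 / 6)
    (C - Real.log (covMat K G₀ θ₀).det) (by norm_num)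
  obtain ⟨G, θ, hp, hmax⟩ := hK.exists_max hn hε (c₂ := 0) (κ := 16 * √n ^ 3) le_rfl
    (by positivity) hη0
  have hG := posDef_of_sub_smul_one hε hp
  obtain ⟨B, γ, h⟩ := hK.exists_isWhitening (θ := θ) hG
  have hw := h.isWhitened hK hG
  rw [add_zero] at hmax
  have hloc := h.local_max hK hG hn (c₁ := 1 / 2 + η) (by linarith) (by positivity)
    fun G' θ' hG' => hmax G' θ' (by simpa using hG'.add hp)
  refine ⟨G, θ, B, γ, hp, h, hw.sum_inv_le hn hη0.le hη1 hloc, ?_⟩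
  have h1 := hmax G₀ θ₀ h₀
  unfold tiltFunctional at h1
  have hn' : (1 : ℝ) ≤ n := by exact_mod_cast hn
  have hs : 0 < √(n : ℝ) := Real.sqrt_pos.2 (by linarith)
  have h2 : 16 * √(n : ℝ) ^ 3 * (√(invTrace K G θ))⁻¹ ≤ 16 * n := by
    have hU : (n : ℝ) ≤ invTrace K G θ := by
      rw [h.invTrace_eq]
      have : ∑ _k : Fin n, (1 : ℝ) ≤ ∑ k, (γ k)⁻¹ :=
        Finset.sum_le_sum fun k _ => (one_le_inv₀ (h.pos k)).2 (hw.le_one k)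
      simpa using this
    have h3 := inv_anti₀ hs (Real.sqrt_le_sqrt hU)
    calc 16 * √(n : ℝ) ^ 3 * (√(invTrace K G θ))⁻¹ ≤ 16 * √(n : ℝ) ^ 3 * (√(n : ℝ))⁻¹ :=
          mul_le_mul_of_nonneg_left h3 (by positivity)
      _ = 16 * √(n : ℝ) ^ 2 := by field_simp
      _ = 16 * n := by rw [Real.sq_sqrt (by linarith)]
  have h3 : 0 ≤ 16 * √(n : ℝ) ^ 3 * (√(invTrace K G₀ θ₀))⁻¹ := by positivity
  have h4 := mul_le_mul_of_nonneg_left (hC G θ) hη0.le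
  linarith

/-- A tilt whose normalized density at the barycenter is not much smaller than that of a given
one, and whose whitened precision is close to the identity. -/
theorem IsBody.exists_sum_sq_div_le (hK : IsBody K) (hn : 1 ≤ n) {ε δ : ℝ} (hε : 0 < ε) (hδ : 0 < δ)
    {B₀ : Matrix (Fin n) (Fin n) ℝ} {γ₀ : Fin n → ℝ}
    (hp₀ : (G - ε • (1 : Matrix (Fin n) (Fin n) ℝ)).PosSemidef) (h₀ : IsWhitening K G θ B₀ γ₀)
    (hγ₀ : ∑ i, (γ₀ i)⁻¹ ≤ 676 * n) :
    ∃ G' θ' B γ, (G' - ε • (1 : Matrix (Fin n) (Fin n) ℝ)).PosSemidef ∧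
      IsWhitening K G' θ' B γ ∧ ∑ i, (1 - γ i) ^ 2 / γ i ≤ δ ∧
      logDens K G θ + 1 / 2 * Real.log (covMat K G θ).det ≤
        logDens K G' θ' + 1 / 2 * Real.log (covMat K G' θ').det +
          (5 * (n * Real.log 676) + 1) := by
  obtain ⟨C, hC⟩ := hK.exists_log_det_covMat_le
  have hn' : (1 : ℝ) ≤ n := by exact_mod_cast hn
  obtain ⟨η, hη0, hη1, hη2⟩ := exists_small_mul_le (min (1 / 12) (δ / (6 * n)))
    (C - Real.log (covMat K G θ).det) (by positivity)
  obtain ⟨G', θ', hp, hmax⟩ := hK.exists_max hn hε (c₂ := 5) (κ := 0) (by norm_num) le_rfl hη0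
  have hG := posDef_of_sub_smul_one hε hp
  obtain ⟨B, γ, h⟩ := hK.exists_isWhitening (θ := θ') hG
  have hw := h.isWhitened hK hG
  have hloc := h.local_max hK hG hn (c₁ := 1 / 2 + 5 + η) (by linarith) le_rfl
    fun G'' θ'' hG' => hmax G'' θ'' (by simpa using hG'.add hp)
  rw [zero_mul, sub_zero] at hloc
  refine ⟨G', θ', B, γ, hp, h,
    (hw.sum_sq_div_le hη0.le (hη1.trans (min_le_left _ _)) hloc).trans ?_, ?_⟩
  · have := (le_div_iff₀ (by positivity)).1 (hη1.trans (min_le_right _ _))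
    linarith
  have h1 := hmax G θ hp₀
  simp only [tiltFunctional, zero_mul, add_zero] at h1
  have h2 : Real.log (covMat K G' θ').det + Real.log G'.det ≤ 0 := by
    rw [h.log_det_add]
    exact Finset.sum_nonpos fun k _ => Real.log_nonpos (h.pos k).le (hw.le_one k)
  have h3 : -(n * Real.log 676) ≤ Real.log (covMat K G θ).det + Real.log G.det := by
    rw [h₀.log_det_add]
    have : ∀ k, -Real.log 676 + 1 - (γ₀ k)⁻¹ / 676 ≤ Real.log (γ₀ k) := fun k => by
      have hk := inv_pos.2 (h₀.pos k)
      have := Real.log_le_sub_one_of_pos (x := (γ₀ k)⁻¹ / 676) (by positivity)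
      rw [Real.log_div hk.ne' (by norm_num), Real.log_inv] at this
      linarith
    have hs := Finset.sum_le_sum fun k (_ : k ∈ Finset.univ) => this k
    simp only [Finset.sum_sub_distrib, Finset.sum_const, Finset.card_univ, Fintype.card_fin,
      nsmul_eq_mul, ← Finset.sum_div] at hs
    linarith
  have h4 := mul_le_mul_of_nonneg_left (hC G' θ') hη0.le
  linarith

end Chain

section

open Filter Topology

section SupportFunction

open Matrix

/-- The Taylor polynomials of the exponential function. -/
noncomputable def expSum (N : ℕ) (x : ℝ) : ℝ := ∑ j ∈ Finset.range N, x ^ j / j.factorial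

@[fun_prop]
theorem continuous_expSum (N : ℕ) : Continuous (expSum N) := by
  unfold expSum
  fun_prop

theorem abs_expSum_le (N : ℕ) (x : ℝ) : |expSum N x| ≤ Real.exp |x| := by
  refine (Finset.abs_sum_le_sum_abs _ _).trans (le_trans (le_of_eq ?_)
    (Real.sum_le_exp_of_nonneg (abs_nonneg x) N))
  refine Finset.sum_congr rfl fun j _ => ?_
  rw [abs_div, abs_pow, Nat.abs_cast]

theorem tendsto_expSum (x : ℝ) : Tendsto (fun N => expSum N x) atTop (𝓝 (Real.exp x)) := by
  have := (NormedSpace.expSeries_div_hasSum_exp (𝔸 := ℝ) x).tendsto_sum_nat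
  rw [← Real.exp_eq_exp_ℝ] at this
  exact this

variable {n : ℕ} {γ : Fin n → ℝ} {μ : Measure (Fin n → ℝ)}

theorem tendsto_integral_of_abs_le [IsFiniteMeasure μ] {F : ℕ → (Fin n → ℝ) → ℝ}
    {f : (Fin n → ℝ) → ℝ} (hF : ∀ N, Continuous (F N)) {C : ℝ}
    (hb : ∀ N, ∀ᵐ y ∂μ, |F N y| ≤ C) (hl : ∀ y, Tendsto (fun N => F N y) atTop (𝓝 (f y))) :
    Tendsto (fun N => ∫ y, F N y ∂μ) atTop (𝓝 (∫ y, f y ∂μ)) :=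
  tendsto_integral_of_dominated_convergence (fun _ => C)
    (fun N => (hF N).aestronglyMeasurable) (integrable_const C) hb (.of_forall hl)

namespace IsWhitened

variable (h : IsWhitened γ μ)
include h

open Polynomial in
/-- The Brascamp–Lieb inequality for polynomials of one linear functional. -/
theorem brascampLieb_dotProduct (w : Fin n → ℝ) (P : ℝ[X]) :
    ∫ y, P.eval (w ⬝ᵥ y) ^ 2 ∂μ - (∫ y, P.eval (w ⬝ᵥ y) ∂μ) ^ 2 ≤
      (∑ k, (γ k)⁻¹ * w k ^ 2) * ∫ y, (derivative P).eval (w ⬝ᵥ y) ^ 2 ∂μ := by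
  set l : MvPolynomial (Fin n) ℝ := ∑ k, MvPolynomial.C (w k) * MvPolynomial.X k with hl
  have hle : ∀ y, MvPolynomial.eval y l = w ⬝ᵥ y := fun y => by
    simp [hl, dotProduct, map_sum]
  have he : ∀ (Q : ℝ[X]) y, MvPolynomial.eval y (aeval l Q) = Q.eval (w ⬝ᵥ y) := fun Q y => by
    rw [← hle y, ← MvPolynomial.coe_aeval_eq_eval, RingHom.coe_coe, ← Polynomial.aeval_algHom_apply,
      Polynomial.coe_aeval_eq_eval]
  have hd : ∀ k y, MvPolynomial.eval y (MvPolynomial.pderiv k (aeval l P)) =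
      w k * (derivative P).eval (w ⬝ᵥ y) := fun k y => by
    have hlk : MvPolynomial.pderiv k l = MvPolynomial.C (w k) := by
      rw [hl, map_sum, Finset.sum_eq_single k]
      · simp
      · intro i _ hi
        simp [MvPolynomial.pderiv_X_of_ne hi]
      · simp
    rw [Derivation.map_aeval, hlk, smul_eq_mul, map_mul, he, MvPolynomial.eval_C, mul_comm]
  have := h.brascampLieb (aeval l P)
  simp only [he, hd, mul_pow, integral_const_mul] at this
  rw [Finset.sum_mul]
  refine this.trans (le_of_eq (Finset.sum_congr rfl fun k _ => by ring))

theorem integral_dotProduct (w : Fin n → ℝ) : ∫ y, w ⬝ᵥ y ∂μ = 0 := by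
  simp only [dotProduct]
  rw [integral_finsetSum _ fun k _ => h.integrable (by fun_prop)]
  simp [integral_const_mul, h.mean]

theorem integral_dotProduct_sq (w : Fin n → ℝ) : ∫ y, (w ⬝ᵥ y) ^ 2 ∂μ = w ⬝ᵥ w := by
  have : ∀ y : Fin n → ℝ, (w ⬝ᵥ y) ^ 2 = ∑ i, ∑ j, w i * w j * (y i * y j) := fun x => by
    simp only [dotProduct, sq, Finset.sum_mul_sum]
    exact Finset.sum_congr rfl fun i _ => Finset.sum_congr rfl fun j _ => by ring
  simp only [this]
  rw [integral_finsetSum _ fun k _ => h.integrable (by fun_prop)]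
  simp only [dotProduct]
  refine Finset.sum_congr rfl fun i _ => ?_
  rw [integral_finsetSum _ fun k _ => h.integrable (by fun_prop)]
  simp [integral_const_mul, h.cov]

/-- The Brascamp–Lieb inequality for the function `s + a exp (t s)` of a linear functional `s`. -/
theorem brascampLieb_exp (w : Fin n → ℝ) (a t : ℝ) :
    ∫ y, (w ⬝ᵥ y + a * Real.exp (t * w ⬝ᵥ y)) ^ 2 ∂μ -
        (∫ y, (w ⬝ᵥ y + a * Real.exp (t * w ⬝ᵥ y)) ∂μ) ^ 2 ≤
      (∑ k, (γ k)⁻¹ * w k ^ 2) * ∫ y, (1 + a * t * Real.exp (t * w ⬝ᵥ y)) ^ 2 ∂μ := by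
  have := h.isProbabilityMeasure
  obtain ⟨R, hR⟩ := h.exists_ae_abs_le (f := fun y => w ⬝ᵥ y) (by fun_prop)
  have hpoly : ∀ N : ℕ, ∃ P : Polynomial ℝ, (∀ x, P.eval x = x + a * expSum (N + 1) (t * x)) ∧
      ∀ x, P.derivative.eval x = 1 + a * t * expSum N (t * x) := fun N => by
    refine ⟨Polynomial.X + Polynomial.C a * ∑ j ∈ Finset.range (N + 1),
      Polynomial.C (t ^ j / j.factorial) * Polynomial.X ^ j, fun x => ?_, fun x => ?_⟩
    · simp only [Polynomial.eval_add, Polynomial.eval_X, Polynomial.eval_mul, Polynomial.eval_C,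
        Polynomial.eval_finsetSum, Polynomial.eval_pow, expSum]
      congr 2
      exact Finset.sum_congr rfl fun j _ => by ring
    · simp only [map_add, Polynomial.derivative_X, Polynomial.derivative_C_mul, map_sum,
        Polynomial.derivative_X_pow, Polynomial.eval_add, Polynomial.eval_one,
        Polynomial.eval_mul, Polynomial.eval_C, Polynomial.eval_finsetSum, Polynomial.eval_pow,
        Polynomial.eval_X, expSum, mul_assoc a]
      rw [Finset.sum_range_succ']
      simp only [Nat.cast_zero, zero_mul, mul_zero, add_zero, Nat.add_sub_cancel]
      congr 2
      rw [Finset.mul_sum]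
      refine Finset.sum_congr rfl fun j _ => ?_
      rw [Nat.factorial_succ, Nat.cast_mul, pow_succ, mul_pow]
      have : (j.factorial : ℝ) ≠ 0 := by positivity
      have : ((j + 1 : ℕ) : ℝ) ≠ 0 := by positivity
      field_simp
  choose P hP hP' using hpoly
  have hb : ∀ N, ∀ᵐ y ∂μ, |expSum N (t * w ⬝ᵥ y)| ≤ Real.exp (|t| * R) := fun N => by
    filter_upwards [hR] with y hy
    refine (abs_expSum_le _ _).trans (Real.exp_le_exp.2 ?_)
    rw [abs_mul]
    exact mul_le_mul_of_nonneg_left hy (abs_nonneg t)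
  have hb1 : ∀ N, ∀ᵐ y ∂μ, |w ⬝ᵥ y + a * expSum (N + 1) (t * w ⬝ᵥ y)| ≤
      R + |a| * Real.exp (|t| * R) := fun N => by
    filter_upwards [hR, hb (N + 1)] with y h1 h2
    refine (abs_add_le _ _).trans (add_le_add h1 ?_)
    rw [abs_mul]
    exact mul_le_mul_of_nonneg_left h2 (abs_nonneg a)
  have hb2 : ∀ N, ∀ᵐ y ∂μ, |1 + a * t * expSum N (t * w ⬝ᵥ y)| ≤
      1 + |a * t| * Real.exp (|t| * R) := fun N => by
    filter_upwards [hb N] with y h2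
    refine (abs_add_le _ _).trans (add_le_add (by simp) ?_)
    rw [abs_mul]
    exact mul_le_mul_of_nonneg_left h2 (abs_nonneg _)
  have hl1 : ∀ y, Tendsto (fun N => w ⬝ᵥ y + a * expSum (N + 1) (t * w ⬝ᵥ y)) atTop
      (𝓝 (w ⬝ᵥ y + a * Real.exp (t * w ⬝ᵥ y))) := fun y =>
    (((tendsto_add_atTop_iff_nat 1).2 (tendsto_expSum _)).const_mul a).const_add _
  have hl2 : ∀ y, Tendsto (fun N => 1 + a * t * expSum N (t * w ⬝ᵥ y)) atTop
      (𝓝 (1 + a * t * Real.exp (t * w ⬝ᵥ y))) := fun y =>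
    ((tendsto_expSum _).const_mul _).const_add _
  have l1 := tendsto_integral_of_abs_le (μ := μ) (fun N => by fun_prop) hb1 hl1
  have l2 := tendsto_integral_of_abs_le (μ := μ)
    (F := fun N y => (w ⬝ᵥ y + a * expSum (N + 1) (t * w ⬝ᵥ y)) ^ 2) (fun N => by fun_prop)
    (C := (R + |a| * Real.exp (|t| * R)) ^ 2)
    (fun N => by
      filter_upwards [hb1 N] with y hy
      rw [abs_pow]
      exact pow_le_pow_left₀ (abs_nonneg _) hy 2) fun y => (hl1 y).pow 2
  have l3 := tendsto_integral_of_abs_le (μ := μ)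
    (F := fun N y => (1 + a * t * expSum N (t * w ⬝ᵥ y)) ^ 2) (fun N => by fun_prop)
    (C := (1 + |a * t| * Real.exp (|t| * R)) ^ 2)
    (fun N => by
      filter_upwards [hb2 N] with y hy
      rw [abs_pow]
      exact pow_le_pow_left₀ (abs_nonneg _) hy 2) fun y => (hl2 y).pow 2
  refine le_of_tendsto_of_tendsto' (l2.sub (l1.pow 2)) (l3.const_mul _) fun N => ?_
  have := h.brascampLieb_dotProduct w (P N)
  simpa only [hP, hP'] using this

/-- If the precision is close to the identity, the support of the measure is wide in every
direction. -/
theorem lt_sq_of_dotProduct_le {τ : ℝ} (hτ0 : 0 ≤ τ) (hτ1 : τ ≤ 1)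
    (hτ : τ * (2 * (√n + 1) ^ 2 * Real.exp (2 * (√n + 1) * √n)) < 1)
    (hγ : ∀ k, (γ k)⁻¹ ≤ 1 + τ) {w : Fin n → ℝ} (hw : w ⬝ᵥ w = 1) {r : ℝ}
    (hr : ∀ᵐ y ∂μ, w ⬝ᵥ y ≤ r) : n < r ^ 2 := by
  by_contra hcon
  have := h.isProbabilityMeasure
  have hrn : r ≤ √n := Real.le_sqrt_of_sq_le (not_lt.1 hcon)
  set q := √(n : ℝ) with hq
  have hq0 : 0 ≤ q := Real.sqrt_nonneg _
  set t := q + 1 with ht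
  have ht0 : 0 < t := by positivity
  set M := 2 * t ^ 2 * Real.exp (2 * t * q) with hM
  have hM0 : 0 < M := by positivity
  set b := M⁻¹ with hb
  have hb0 : 0 < b := inv_pos.2 hM0
  have hsum : ∑ k, (γ k)⁻¹ * w k ^ 2 ≤ 1 + τ := by
    calc ∑ k, (γ k)⁻¹ * w k ^ 2 ≤ ∑ k, (1 + τ) * w k ^ 2 := Finset.sum_le_sum fun k _ =>
          mul_le_mul_of_nonneg_right (hγ k) (sq_nonneg _)
      _ = 1 + τ := by
          rw [← Finset.mul_sum]
          simp only [dotProduct, ← sq] at hw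
          rw [hw, mul_one]
  have key := h.brascampLieb_exp w (-b) t
  have hkey2 := key.trans (mul_le_mul_of_nonneg_right hsum (integral_nonneg fun y => sq_nonneg _))
  set e : (Fin n → ℝ) → ℝ := fun y => Real.exp (t * w ⬝ᵥ y) with he
  set s : (Fin n → ℝ) → ℝ := fun y => w ⬝ᵥ y with hs
  have hec : Continuous e := by fun_prop
  have hsc : Continuous s := by fun_prop
  have ie : Integrable (fun y => e y) μ := h.integrable hec
  have is : Integrable (fun y => s y) μ := h.integrable hsc
  have ie2 : Integrable (fun y => e y ^ 2) μ := h.integrable (hec.pow 2)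
  have is2 : Integrable (fun y => s y ^ 2) μ := h.integrable (hsc.pow 2)
  have ise : Integrable (fun y => s y * e y) μ := h.integrable (hsc.mul hec)
  have es : ∫ y, s y ∂μ = 0 := h.integral_dotProduct w
  have es2 : ∫ y, s y ^ 2 ∂μ = 1 := (h.integral_dotProduct_sq w).trans hw
  have k1 : ∫ y, (s y + -b * e y) ^ 2 ∂μ =
      1 - 2 * b * (∫ y, s y * e y ∂μ) + b ^ 2 * ∫ y, e y ^ 2 ∂μ := by
    have : ∀ y, (s y + -b * e y) ^ 2 = s y ^ 2 - 2 * b * (s y * e y) + b ^ 2 * e y ^ 2 :=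
      fun y => by ring
    simp only [this]
    have i1 : Integrable (fun y => s y ^ 2 - 2 * b * (s y * e y)) μ := is2.sub (ise.const_mul _)
    rw [integral_add i1 (ie2.const_mul _), integral_sub is2 (ise.const_mul _), es2]
    simp only [integral_const_mul]
  have k2 : ∫ y, (s y + -b * e y) ∂μ = -b * ∫ y, e y ∂μ := by
    rw [integral_add is (ie.const_mul _), es, integral_const_mul, zero_add]
  have k3 : ∫ y, (1 + -b * t * e y) ^ 2 ∂μ =
      1 - 2 * b * t * (∫ y, e y ∂μ) + b ^ 2 * t ^ 2 * ∫ y, e y ^ 2 ∂μ := by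
    have : ∀ y, (1 + -b * t * e y) ^ 2 = 1 - 2 * b * t * e y + b ^ 2 * t ^ 2 * e y ^ 2 :=
      fun y => by ring
    simp only [this]
    have i1 : Integrable (fun y => 1 - 2 * b * t * e y) μ :=
      (integrable_const _).sub (ie.const_mul _)
    rw [integral_add i1 (ie2.const_mul _), integral_sub (integrable_const _) (ie.const_mul _)]
    simp only [integral_const_mul, integral_const, probReal_univ, one_smul]
  rw [k1, k2, k3] at hkey2
  have hvar : (∫ y, e y ∂μ) ^ 2 ≤ ∫ y, e y ^ 2 ∂μ := by
    have h0 : 0 ≤ ∫ y, (e y - ∫ z, e z ∂μ) ^ 2 ∂μ := integral_nonneg fun y => sq_nonneg _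
    set m := ∫ z, e z ∂μ with hm
    have : ∀ y, (e y - m) ^ 2 = e y ^ 2 - 2 * m * e y + m ^ 2 := fun y => by ring
    simp only [this] at h0
    have i1 : Integrable (fun y => e y ^ 2 - 2 * m * e y) μ := ie2.sub (ie.const_mul _)
    rw [integral_add i1 (integrable_const _), integral_sub ie2 (ie.const_mul _)] at h0
    simp only [integral_const_mul, integral_const, probReal_univ, one_smul] at h0
    nlinarith
  have hse : ∫ y, s y * e y ∂μ ≤ q * ∫ y, e y ∂μ := by
    rw [← integral_const_mul]
    refine integral_mono_ae ise (ie.const_mul _) ?_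
    filter_upwards [hr] with y hy
    exact mul_le_mul_of_nonneg_right (le_trans hy hrn) (Real.exp_pos _).le
  have he1 : 1 ≤ ∫ y, e y ∂μ := by
    have h1 : ∫ y, (t * s y + 1) ∂μ ≤ ∫ y, e y ∂μ :=
      integral_mono ((is.const_mul _).add (integrable_const _)) ie fun y => Real.add_one_le_exp _
    rw [integral_add (is.const_mul _) (integrable_const _), integral_const_mul, es] at h1
    simpa using h1
  have he2 : ∫ y, e y ^ 2 ∂μ ≤ Real.exp (2 * t * q) := by
    have h1 : ∫ y, e y ^ 2 ∂μ ≤ ∫ _y, Real.exp (2 * t * q) ∂μ := by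
      refine integral_mono_ae ie2 (integrable_const _) ?_
      filter_upwards [hr] with y hy
      simp only [he, ← Real.exp_nat_mul]
      refine Real.exp_le_exp.2 ?_
      push_cast
      nlinarith [mul_le_mul_of_nonneg_left (le_trans hy hrn) ht0.le]
    simpa using h1
  set m := ∫ y, e y ∂μ
  set E := ∫ y, e y ^ 2 ∂μ
  set S := ∫ y, s y * e y ∂μ
  have hbM : b * M = 1 := inv_mul_cancel₀ hM0.ne'
  have hE : (1 + τ) * (t ^ 2 * E) ≤ M := by
    have h1 : t ^ 2 * E ≤ t ^ 2 * Real.exp (2 * t * q) :=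
      mul_le_mul_of_nonneg_left he2 (sq_nonneg t)
    have h2 : (1 + τ) * (t ^ 2 * E) ≤ 2 * (t ^ 2 * Real.exp (2 * t * q)) :=
      mul_le_mul (by linarith) h1 (by positivity) (by norm_num)
    rw [hM]; linarith
  have f1 : 2 * b * (t * m - S) ≤ τ + b ^ 2 * M := by
    have := mul_le_mul_of_nonneg_left hE (sq_nonneg b)
    have h5 : 0 ≤ τ * (2 * b * t * m) := by positivity
    have h6 : 0 ≤ b ^ 2 * (E - m ^ 2) := mul_nonneg (sq_nonneg b) (by linarith)
    nlinarith
  have f2 : 1 ≤ t * m - S := by rw [ht]; linarith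
  have f3 : b ^ 2 * M = b := by rw [sq, mul_assoc, hbM, mul_one]
  have f4 : b ≤ τ := by
    have := mul_le_mul_of_nonneg_left f2 hb0.le
    linarith
  have f5 : 1 ≤ τ * M := by
    rw [← hbM]; exact mul_le_mul_of_nonneg_right f4 hM0.le
  linarith

end IsWhitened

end SupportFunction

end

section

open Filter Topology

section Slicing

open Matrix

variable {n : ℕ} {K : Set (Fin n → ℝ)} {G : Matrix (Fin n) (Fin n) ℝ} {θ : Fin n → ℝ}

/-- If the whitened precision is close enough to the identity, then the normalized density at the
barycenter is at most one. -/
theorem exists_logDens_add_nonpos (n : ℕ) : ∃ δ : ℝ, 0 < δ ∧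
    ∀ (K : Set (Fin n → ℝ)) (G : Matrix (Fin n) (Fin n) ℝ) (θ : Fin n → ℝ)
      (B : Matrix (Fin n) (Fin n) ℝ) (γ : Fin n → ℝ), IsBody K → G.PosDef →
      IsWhitening K G θ B γ → ∑ i, (1 - γ i) ^ 2 / γ i ≤ δ →
      logDens K G θ + 1 / 2 * Real.log (covMat K G θ).det ≤ 0 := by
  set M := 2 * (√(n : ℝ) + 1) ^ 2 * Real.exp (2 * (√n + 1) * √n) with hM
  have hM0 : 0 < M := by positivity
  set τ := min 1 (1 / (2 * M)) with hτ
  have hτ0 : 0 < τ := by positivity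
  have hτ1 : τ ≤ 1 := min_le_left _ _
  have hτM : τ * M < 1 := by
    have h1 : τ ≤ 1 / (2 * M) := min_le_right _ _
    rw [le_div_iff₀ (by positivity)] at h1
    linarith
  refine ⟨(τ / 2) ^ 2, by positivity, fun K G θ B γ hK hG h hδ => ?_⟩
  have hw := h.isWhitened hK hG
  have hγ : ∀ k, (γ k)⁻¹ ≤ 1 + τ := fun k => by
    have h0 := h.pos k
    have h1 := hw.le_one k
    have h2 : (1 - γ k) ^ 2 / γ k ≤ (τ / 2) ^ 2 :=
      (Finset.single_le_sum (f := fun i => (1 - γ i) ^ 2 / γ i)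
        (fun i _ => div_nonneg (sq_nonneg _) (h.pos i).le) (Finset.mem_univ k)).trans hδ
    rw [div_le_iff₀ h0] at h2
    have h3 : (1 - γ k) ^ 2 ≤ (τ / 2) ^ 2 := h2.trans (by nlinarith [sq_nonneg (τ / 2)])
    have h4 : 1 - γ k ≤ τ / 2 := le_of_sq_le_sq h3 (by positivity)
    rw [inv_le_comm₀ h0 (by positivity), inv_le_iff_one_le_mul₀ (by positivity)]
    nlinarith
  have hcube := h.logDens_add_le hK hG one_pos (h.mem_of_abs_le hK fun r w hw1 hr => by
    rw [one_pow, mul_one]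
    refine hw.lt_sq_of_dotProduct_le hτ0.le hτ1 hτM hγ hw1 ?_
    refine (ae_map_iff ?_ ?_).2 ?_
    · have : Continuous fun x : Fin n → ℝ => B⁻¹ *ᵥ (x - meanVec K G θ) := by fun_prop
      exact this.aemeasurable
    · exact measurableSet_le (by fun_prop) measurable_const
    · filter_upwards [hK.ae_mem G θ] with x hx using hr x hx)
  refine hcube.trans (mul_nonpos_of_nonneg_of_nonpos (Nat.cast_nonneg n) ?_)
  have := Real.log_two_gt_d9
  norm_num at this ⊢
  linarith

theorem IsBody.logDens_add_le_const (hK : IsBody K) (hn : 1 ≤ n) {ε : ℝ} (hε : 0 < ε)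
    (hG : (G - ε • (1 : Matrix (Fin n) (Fin n) ℝ)).PosSemidef) :
    logDens K G θ + 1 / 2 * Real.log (covMat K G θ).det ≤ (18 + 5 * Real.log 676) * n := by
  obtain ⟨δ, hδ, hδ'⟩ := exists_logDens_add_nonpos n
  obtain ⟨G₁, θ₁, B₁, γ₁, hp₁, h₁, hγ₁, hle₁⟩ := hK.exists_sum_inv_le hn hε (θ₀ := θ) hG
  obtain ⟨G₂, θ₂, B₂, γ₂, hp₂, h₂, hγ₂, hle₂⟩ := hK.exists_sum_sq_div_le hn hε hδ hp₁ h₁ hγ₁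
  have h3 := hδ' K G₂ θ₂ B₂ γ₂ hK (posDef_of_sub_smul_one hε hp₂) h₂ hγ₂
  have hn' : (1 : ℝ) ≤ n := by exact_mod_cast hn
  linarith

/-- The slicing inequality for centered bodies of unit volume. -/
theorem IsBody.log_det_covMat_le (hK : IsBody K) (hn : 1 ≤ n) (hvol : volume K = 1) :
    1 / 2 * Real.log (covMat K 0 0).det ≤ (18 + 5 * Real.log 676) * n := by
  have hc : Continuous fun ε : ℝ =>
      logDens K (ε • (1 : Matrix (Fin n) (Fin n) ℝ)) 0 +
        1 / 2 * Real.log (covMat K (ε • (1 : Matrix (Fin n) (Fin n) ℝ)) 0).det := by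
    have hp : Continuous fun ε : ℝ => ((ε • (1 : Matrix (Fin n) (Fin n) ℝ),
        (0 : Fin n → ℝ)) : Matrix (Fin n) (Fin n) ℝ × (Fin n → ℝ)) :=
      (continuous_id.smul continuous_const).prodMk continuous_const
    exact (hK.continuous_logDens.comp hp).add
      ((hK.continuous_log_det_covMat.comp hp).const_smul (1 / 2 : ℝ))
  have hlim := (hc.tendsto 0).mono_left (nhdsWithin_le_nhds (s := Set.Ioi 0))
  have hle := le_of_tendsto hlim (b := (18 + 5 * Real.log 676) * n) (by
    filter_upwards [self_mem_nhdsWithin] with ε hε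
    refine hK.logDens_add_le_const hn hε ?_
    rw [sub_self]; exact PosSemidef.zero)
  have h0 : logDens K 0 0 = 0 := by
    simp [logDens, quadPot, partFn, measureReal_def, hvol]
  rw [zero_smul, h0, zero_add] at hle
  exact hle

theorem IsBody.le_exp_of_isotropic (hK : IsBody K) (hn : 1 ≤ n) (hvol : volume K = 1) {L : ℝ}
    (hL : 0 < L) (hmean : ∀ i, ∫ x in K, x i = 0)
    (hcov : ∀ i j, ∫ x in K, x i * x j = if i = j then L ^ 2 else 0) :
    L ≤ Real.exp (18 + 5 * Real.log 676) := by
  have hA : covMat K 0 0 = L ^ 2 • (1 : Matrix (Fin n) (Fin n) ℝ) := by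
    have hp : partFn K (0 : Matrix (Fin n) (Fin n) ℝ) 0 = 1 := by
      simp [partFn, quadPot, measureReal_def, hvol]
    ext i j
    simp only [covMat, meanVec, of_apply, IsBody.integral_quadTilt, hp]
    simp [quadPot, hmean, hcov, one_apply]
  have h := hK.log_det_covMat_le hn hvol
  rw [hA, det_smul, det_one, mul_one, Fintype.card_fin, ← pow_mul, Real.log_pow] at h
  have hn' : (0 : ℝ) < n := by exact_mod_cast hn
  rw [← Real.log_le_iff_le_exp hL]
  push_cast at h
  nlinarith

theorem isBody_preimage_toLp {K : Set (EuclideanSpace ℝ (Fin n))} (hc : IsCompact K)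
    (hconv : Convex ℝ K) (hi : (interior K).Nonempty) :
    IsBody ((WithLp.toLp 2 : (Fin n → ℝ) → EuclideanSpace ℝ (Fin n)) ⁻¹' K) := by
  set e := (EuclideanSpace.equiv (Fin n) ℝ).symm with he
  have hpre : (WithLp.toLp 2 : (Fin n → ℝ) → EuclideanSpace ℝ (Fin n)) ⁻¹' K =
      e.toHomeomorph ⁻¹' K := rfl
  refine ⟨?_, ?_, ?_⟩
  · rw [hpre]; exact e.toHomeomorph.isCompact_preimage.2 hc
  · rw [hpre]; exact hconv.linear_preimage e.toLinearEquiv.toLinearMap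
  · rw [hpre, ← e.toHomeomorph.preimage_interior]
    exact hi.preimage e.toHomeomorph.surjective

end Slicing

end

/-- Bourgain's slicing conjecture (theorem of Klartag–Lehec): `sup_{n ≥ 1} Lₙ < +∞`,
i.e. there is a universal constant `C` bounding `L_K` for every `n ≥ 1` and every
convex body `K ⊂ ℝⁿ` in convex isotropic position. -/
theorem bourgain_slicing :
    ∃ C : ℝ, 0 < C ∧
      ∀ n : ℕ, 1 ≤ n → ∀ (K : Set (EuclideanSpace ℝ (Fin n))) (L : ℝ),
        IsConvexIsotropic K L → L ≤ C := by
  refine ⟨Real.exp (18 + 5 * Real.log 676), Real.exp_pos _, fun n hn K L hK => ?_⟩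
  obtain ⟨⟨hc, hconv, hi⟩, hvol, hL, hmean, hcov⟩ := hK
  have hmp := PiLp.volume_preserving_toLp (Fin n)
  have hemb : MeasurableEmbedding (WithLp.toLp 2 : (Fin n → ℝ) → EuclideanSpace ℝ (Fin n)) :=
    (MeasurableEquiv.toLp 2 (Fin n → ℝ)).measurableEmbedding
  refine (isBody_preimage_toLp hc hconv hi).le_exp_of_isotropic hn ?_ hL (fun i => ?_)
    fun i j => ?_
  · rw [hmp.measure_preimage hc.isClosed.measurableSet.nullMeasurableSet, hvol]
  · exact (hmp.setIntegral_preimage_emb hemb (fun x => x i) K).trans (hmean i)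
  · exact (hmp.setIntegral_preimage_emb hemb (fun x => x i * x j) K).trans (hcov i j)

end
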